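/- Let t = 2t' be an even positive integer. For any complex numbers y and z, the following identity of formal power series in x and y holds: Σ_{λ ∈ DD} δ_λ x^{|λ|/2} ∏_{h ∈ H_t(λ)} (y - ytz/(h ε_h)) = ∏_{k≥1} [(1-x^k)(1-x^{kt})^{t'-1}/(1-x^{kt'})] · [((1-y^{2k}x^{kt})^{zt'-1+t'})/(1-y^k x^{kt'})]^{z-1}, where the sum ranges over all doubled distinct partitions λ (whose weight |λ| is always even). -/

import Mathlib

/-!
Statement 1 (Theorem `generalisation`): for `t = 2t'` an even positive integer and
complex numbers `y`, `z`,
Σ_{λ ∈ DD} δ_λ x^{|λ|/2} ∏_{h ∈ H_t(λ)} (y - ytz/(h ε_h))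
  = ∏_{k≥1} [(1-x^k)(1-x^{kt})^{t'-1}/(1-x^{kt'})]
      · [((1-y^{2k}x^{kt})^{zt'-1+t'})/(1-y^k x^{kt'})]^{z-1},
where the sum ranges over doubled distinct partitions (which have even weight).
Complex powers are interpreted via the binomial series.
-/

noncomputable section

open PowerSeries

/-- Product (pi) topology on formal power series. -/
instance {R : Type*} [TopologicalSpace R] : TopologicalSpace (PowerSeries R) :=
  inferInstanceAs (TopologicalSpace ((Unit →₀ ℕ) → R))

/-- The hook length of the box `c = (i, j)` (0-indexed) of a Young diagram. -/
def hookLen (μ : YoungDiagram) (c : ℕ × ℕ) : ℕ :=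
  μ.rowLen c.1 + μ.colLen c.2 - c.1 - c.2 - 1

/-- The Durfee length: the number of diagonal cells. -/
def durfee (μ : YoungDiagram) : ℕ :=
  (μ.cells.filter fun c => c.1 = c.2).card

/-- `ε` of a box: `-1` if strictly above the principal diagonal, `1` otherwise. -/
def eps (c : ℕ × ℕ) : ℂ := if c.2 < c.1 then (-1 : ℂ) else 1

/-- A Young diagram is doubled distinct if, in Frobenius coordinates,
`a_i = b_i + 1` for every diagonal cell, i.e. each diagonal arm exceeds the
corresponding leg by exactly one. -/
def DDiagram (μ : YoungDiagram) : Prop :=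
  ∀ i : ℕ, (i, i) ∈ μ → μ.rowLen i = μ.colLen i + 1

/-- Generalized binomial coefficient `binom(z, k) = z(z-1)⋯(z-k+1)/k!`. -/
def cchoose (z : ℂ) (k : ℕ) : ℂ := (∏ i ∈ Finset.range k, (z - i)) / (k.factorial : ℂ)

/-- The complex power `f^z = Σ_k binom(z,k) (f-1)^k` of a power series with
constant coefficient `1`. -/
def cpow (f : PowerSeries ℂ) (z : ℂ) : PowerSeries ℂ :=
  ∑' k : ℕ, PowerSeries.C (cchoose z k) * (f - 1) ^ k


abbrev PS := PowerSeries ℂ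

instance ps_t2 : T2Space PS := inferInstanceAs (T2Space ((Unit →₀ ℕ) → ℂ))
instance ps_ring : IsTopologicalRing PS := PowerSeries.WithPiTopology.instIsTopologicalRing ℂ
instance ps_sring : IsTopologicalSemiring PS := inferInstance
instance ps_t3 : T3Space PS := inferInstanceAs (T3Space ((Unit →₀ ℕ) → ℂ))

theorem ps_hasSum_iff {ι : Type*} {a : ι → PS} {g : PS} :
    HasSum a g ↔ ∀ n, HasSum (fun i => coeff n (a i)) (coeff n g) :=
  PowerSeries.WithPiTopology.hasSum_iff_hasSum_coeff ℂ

theorem ps_tendsto_iff {ι : Type*} {a : ι → PS} {u : Filter ι} {g : PS} :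
    Filter.Tendsto a u (nhds g) ↔ ∀ n, Filter.Tendsto (fun i => coeff n (a i)) u (nhds (coeff n g)) :=
  PowerSeries.WithPiTopology.tendsto_iff_coeff_tendsto ℂ a u g

/-- formally summable families -/
def FS {ι : Type*} (a : ι → PS) : Prop := ∀ n, {i | coeff n (a i) ≠ 0}.Finite

theorem FS.hasSum {ι : Type*} {a : ι → PS} (h : FS a) :
    HasSum a (PowerSeries.mk fun n => ∑' i, coeff n (a i)) := by
  rw [ps_hasSum_iff]
  intro n
  rw [coeff_mk]
  exact (summable_of_hasFiniteSupport (h n)).hasSum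

theorem FS.summable {ι : Type*} {a : ι → PS} (h : FS a) : Summable a := h.hasSum.summable

theorem FS.coeff_tsum {ι : Type*} {a : ι → PS} (h : FS a) (n : ℕ) :
    coeff n (∑' i, a i) = ∑' i, coeff n (a i) := by
  rw [h.hasSum.tsum_eq, coeff_mk]

theorem FS.coeff_tsum_finset {ι : Type*} {a : ι → PS} (h : FS a) (n : ℕ) (s : Finset ι)
    (hs : ∀ i, i ∉ s → coeff n (a i) = 0) :
    coeff n (∑' i, a i) = ∑ i ∈ s, coeff n (a i) := by
  rw [h.coeff_tsum, tsum_eq_sum (fun i hi => hs i hi)]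

theorem FS.of_le {ι : Type*} {a : ι → PS} (h : ∀ n, {i | ¬ X ^ n ∣ a i}.Finite) : FS a := by
  intro n
  refine (h (n+1)).subset ?_
  intro i hi hd
  exact hi (X_pow_dvd_iff.1 hd n (Nat.lt_succ_self n))

theorem FS.fin_ndvd {ι : Type*} {a : ι → PS} (h : FS a) (n : ℕ) : {i | ¬ X ^ n ∣ a i}.Finite := by
  have : {i | ¬ X ^ n ∣ a i} ⊆ ⋃ m ∈ Finset.range n, {i | coeff m (a i) ≠ 0} := by
    intro i hi
    simp only [Set.mem_ofPred_eq, X_pow_dvd_iff, not_forall] at hi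
    obtain ⟨m, hm, h2⟩ := hi
    simp only [Set.mem_iUnion]
    exact ⟨m, Finset.mem_range.2 hm, h2⟩
  exact (Set.Finite.biUnion (Finset.finite_toSet _) (fun m _ => h m)).subset this

theorem FS.of_dvd {ι : Type*} {a b : ι → PS} (h : FS a) (hd : ∀ i, a i ∣ b i) : FS b :=
  FS.of_le fun n => (h.fin_ndvd n).subset fun i hi h2 => hi (h2.trans (hd i))

theorem FS.mul_left {ι : Type*} {a : ι → PS} (h : FS a) (c : ι → PS) : FS (fun i => c i * a i) :=
  h.of_dvd fun i => Dvd.intro_left _ rfl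

theorem FS.mul_right {ι : Type*} {a : ι → PS} (h : FS a) (c : ι → PS) : FS (fun i => a i * c i) :=
  h.of_dvd fun i => Dvd.intro _ rfl

theorem FS.mul {ι κ : Type*} {a : ι → PS} {b : κ → PS} (ha : FS a) (hb : FS b) :
    FS (fun p : ι × κ => a p.1 * b p.2) := by
  refine FS.of_le fun n => ?_
  refine ((ha.fin_ndvd n).prod (hb.fin_ndvd n)).subset ?_
  rintro ⟨i, j⟩ h
  exact ⟨fun h2 => h (Dvd.dvd.mul_right h2 _), fun h2 => h (Dvd.dvd.mul_left h2 _)⟩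

theorem FS.tsum_mul_tsum {ι κ : Type*} {a : ι → PS} {b : κ → PS} (ha : FS a) (hb : FS b) :
    (∑' i, a i) * (∑' j, b j) = ∑' p : ι × κ, a p.1 * b p.2 :=
  ha.summable.tsum_mul_tsum hb.summable (ha.mul hb).summable

theorem FS.comp_inj {ι κ : Type*} {a : ι → PS} (h : FS a) {f : κ → ι} (hf : Function.Injective f) :
    FS (fun k => a (f k)) := fun n => (h n).preimage hf.injOn

theorem FS.neg {ι : Type*} {a : ι → PS} (h : FS a) : FS (fun i => - a i) :=
  h.of_dvd fun i => (dvd_neg.2 dvd_rfl)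

theorem FS.add {ι : Type*} {a b : ι → PS} (h : FS a) (h' : FS b) : FS (fun i => a i + b i) := by
  intro n
  refine ((h n).union (h' n)).subset ?_
  intro i hi
  simp only [Set.mem_ofPred_eq, map_add] at hi
  by_contra h2
  simp only [Set.mem_union, Set.mem_ofPred_eq, not_or, not_not] at h2
  exact hi (by rw [h2.1, h2.2, add_zero])

theorem FS.finsum {ι κ : Type*} {a : κ → ι → PS} (s : Finset κ) (h : ∀ k ∈ s, FS (a k)) :
    FS (fun i => ∑ k ∈ s, a k i) := by
  classical
  induction s using Finset.induction_on with
  | empty => intro n; simp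
  | insert k s hk ih =>
    simp only [Finset.sum_insert hk]
    exact (h k (Finset.mem_insert_self _ _)).add (ih fun k hk => h k (Finset.mem_insert_of_mem hk))

theorem FS.of_exp {ι : Type*} (w : ι → PS) (e : ι → ℕ) (h : ∀ n, {i | e i < n}.Finite) :
    FS (fun i => w i * X ^ (e i)) := by
  refine FS.of_le fun n => (h n).subset ?_
  intro i hi
  by_contra h2
  simp only [Set.mem_ofPred_eq, not_lt] at h2
  exact hi (Dvd.dvd.mul_left (pow_dvd_pow _ h2) _)

theorem FS.prod_aux {κ : Type*} {ι : Type} [Finite ι] : ∀ [Fintype ι] (a : ι → κ → PS), (∀ i, FS (a i)) →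
    (FS (fun c : ι → κ => ∏ i, a i (c i)) ∧ ∏ i, ∑' k, a i k = ∑' c : ι → κ, ∏ i, a i (c i)) := by
  refine Finite.induction_empty_option (P := fun ι => ∀ [Fintype ι] (a : ι → κ → PS), (∀ i, FS (a i)) →
    (FS (fun c : ι → κ => ∏ i, a i (c i)) ∧ ∏ i, ∑' k, a i k = ∑' c : ι → κ, ∏ i, a i (c i)))
    ?_ ?_ ?_ ι
  · intro α β e ih _ a ha
    have : Fintype α := Fintype.ofEquiv β e.symm
    obtain ⟨h1, h2⟩ := ih (fun i => a (e i)) (fun i => ha _)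
    have key : ∀ c : β → κ, ∏ i, a i (c i) = ∏ i, a (e i) ((c ∘ e) i) := fun c =>
      (Fintype.prod_equiv e _ _ (fun _ => rfl)).symm
    have hinj : Function.Injective (fun c : β → κ => c ∘ e) := e.surjective.injective_comp_right
    constructor
    · simp only [key]
      exact h1.comp_inj hinj
    · rw [← Fintype.prod_equiv e (fun i => ∑' k, a (e i) k) _ (fun _ => rfl), h2]
      simp only [key]
      exact ((e.arrowCongr (Equiv.refl κ)).symm.tsum_eq (fun c : α → κ => ∏ i, a (e i) (c i))).symm
  · intro _ a _
    constructor
    · intro n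
      exact Set.toFinite _
    · simp
  · intro α hα ih inst a ha
    have : Fintype α := hα
    obtain ⟨h1, h2⟩ := ih (fun i => a (some i)) (fun i => ha _)
    have e : Fintype.card α = Fintype.card α := rfl
    have hp : ∀ f : Option α → PS, ∏ i, f i = f none * ∏ i, f (some i) := by
      intro f
      have := Fintype.prod_option f
      convert this
    let E : (Option α → κ) ≃ κ × (α → κ) := Equiv.piOptionEquivProd (β := fun _ => κ)
    have h3 := (ha none).mul h1
    constructor
    · have := h3.comp_inj E.injective
      simp only [hp]
      exact this
    · rw [hp, h2, (ha none).tsum_mul_tsum h1]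
      simp only [hp]
      exact (E.tsum_eq (fun p : κ × (α → κ) => a none p.1 * ∏ i, a (some i) (p.2 i))).symm

theorem FS.pi {κ : Type*} {ι : Type} [Fintype ι] {a : ι → κ → PS} (h : ∀ i, FS (a i)) :
    FS (fun c : ι → κ => ∏ i, a i (c i)) := (FS.prod_aux a h).1

theorem FS.prod_tsum {κ : Type*} {ι : Type} [Fintype ι] {a : ι → κ → PS} (h : ∀ i, FS (a i)) :
    ∏ i, ∑' k, a i k = ∑' c : ι → κ, ∏ i, a i (c i) := (FS.prod_aux a h).2

/-! Infinite products -/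

/-- nice product families -/
def NP (f : ℕ → PS) : Prop := ∀ k, X ^ (k + 1) ∣ f k - 1

theorem NP.multipliable {f : ℕ → PS} (h : NP f) : Multipliable f := by
  have : f = fun k => 1 + (f k - 1) := by funext k; ring
  rw [this]
  refine PowerSeries.WithPiTopology.multipliable_one_add_of_tendsto_order_atTop_nhds_top (R := ℂ) (ι := ℕ) ?_
  rw [ENat.tendsto_nhds_top_iff_natCast_lt]
  intro n
  filter_upwards [Filter.eventually_ge_atTop n] with k hk
  have := PowerSeries.nat_le_order (f k - 1) (k+1) (X_pow_dvd_iff.1 (h k))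
  refine lt_of_lt_of_le ?_ this
  exact_mod_cast Nat.lt_succ_of_le hk

theorem dvd_prod_sub_one {ι : Type*} (s : Finset ι) (f : ι → PS) (n : ℕ) (h : ∀ k ∈ s, X ^ n ∣ f k - 1) :
    X ^ n ∣ ∏ k ∈ s, f k - 1 := by
  classical
  induction s using Finset.induction_on with
  | empty => simp
  | insert k s hk ih =>
    rw [Finset.prod_insert hk]
    have e : f k * ∏ x ∈ s, f x - 1 = (f k - 1) * ∏ x ∈ s, f x + (∏ x ∈ s, f x - 1) := by ring
    rw [e]
    exact dvd_add (Dvd.dvd.mul_right (h k (Finset.mem_insert_self _ _)) _)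
      (ih fun k hk => h k (Finset.mem_insert_of_mem hk))

theorem NP.dvd {f : ℕ → PS} (h : NP f) (n m : ℕ) (hm : n ≤ m + 1) :
    X ^ n ∣ ∏' k, f k - ∏ k ∈ Finset.range m, f k := by
  rw [X_pow_dvd_iff]
  intro j hj
  have ht := h.multipliable.hasProd.tendsto_prod_nat
  rw [ps_tendsto_iff] at ht
  have h1 := ht j
  have h2 : ∀ᶠ N in Filter.atTop, coeff j (∏ k ∈ Finset.range N, f k) =
      coeff j (∏ k ∈ Finset.range m, f k) := by
    filter_upwards [Filter.eventually_ge_atTop m] with N hN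
    have : ∏ k ∈ Finset.range N, f k = (∏ k ∈ Finset.range m, f k) * ∏ k ∈ Finset.Ico m N, f k := by
      rw [Finset.range_eq_Ico, Finset.range_eq_Ico, Finset.prod_Ico_consecutive _ (Nat.zero_le _) hN]
    have hd : X ^ n ∣ ∏ k ∈ Finset.Ico m N, f k - 1 := by
      apply dvd_prod_sub_one
      intro k hk
      rw [Finset.mem_Ico] at hk
      exact (pow_dvd_pow _ (by omega)).trans (h k)
    have hd2 : X ^ n ∣ ∏ k ∈ Finset.range N, f k - ∏ k ∈ Finset.range m, f k := by
      rw [this]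
      have e : (∏ k ∈ Finset.range m, f k) * ∏ k ∈ Finset.Ico m N, f k - ∏ k ∈ Finset.range m, f k
        = (∏ k ∈ Finset.range m, f k) * (∏ k ∈ Finset.Ico m N, f k - 1) := by ring
      rw [e]
      exact Dvd.dvd.mul_left hd _
    have := X_pow_dvd_iff.1 hd2 j hj
    rwa [map_sub, sub_eq_zero] at this
  have h3 := tendsto_nhds_unique (h1.congr' h2) tendsto_const_nhds
  rw [map_sub, h3, sub_self]

theorem NP.mul {f g : ℕ → PS} (hf : NP f) (hg : NP g) : NP (fun k => f k * g k) := by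
  intro k
  have e : f k * g k - 1 = (f k - 1) * g k + (g k - 1) := by ring
  show _ ∣ f k * g k - 1
  rw [e]
  exact dvd_add (Dvd.dvd.mul_right (hf k) _) (hg k)

theorem NP.one : NP (fun _ => 1) := fun k => by simp

theorem NP.pow {f : ℕ → PS} (hf : NP f) (n : ℕ) : NP (fun k => f k ^ n) := by
  induction n with
  | zero => simpa using NP.one
  | succ n ih => simpa only [pow_succ] using ih.mul hf

theorem NP.const {f : ℕ → PS} (hf : NP f) (k : ℕ) : constantCoeff (f k) = 1 := by
  have := X_pow_dvd_iff.1 (hf k) 0 (Nat.succ_pos k)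
  rw [coeff_zero_eq_constantCoeff, map_sub, map_one, sub_eq_zero] at this
  exact this

theorem NP.inv {f : ℕ → PS} (hf : NP f) : NP (fun k => (f k)⁻¹) := by
  intro k
  have h1 : f k * (f k)⁻¹ = 1 := PowerSeries.mul_inv_cancel _ (by rw [hf.const]; exact one_ne_zero)
  have e : (f k)⁻¹ - 1 = (f k - 1) * (-(f k)⁻¹) := by linear_combination h1
  show _ ∣ (f k)⁻¹ - 1
  rw [e]
  exact Dvd.dvd.mul_right (hf k) _

theorem NP.tprod_mul {f g : ℕ → PS} (hf : NP f) (hg : NP g) :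
    ∏' k, (f k * g k) = (∏' k, f k) * ∏' k, g k := hf.multipliable.tprod_mul hg.multipliable

theorem NP.tprod_pow {f : ℕ → PS} (hf : NP f) (n : ℕ) :
    ∏' k, (f k ^ n) = (∏' k, f k) ^ n := by
  induction n with
  | zero => simp
  | succ n ih => simp only [pow_succ]; rw [(hf.pow n).tprod_mul hf, ih]

theorem NP.tprod_const {f : ℕ → PS} (hf : NP f) : constantCoeff (∏' k, f k) = 1 := by
  have := X_pow_dvd_iff.1 (hf.dvd 1 0 le_rfl) 0 one_pos
  rw [coeff_zero_eq_constantCoeff, map_sub, sub_eq_zero] at this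
  simpa using this

theorem NP.tprod_ne {f : ℕ → PS} (hf : NP f) : ∏' k, f k ≠ 0 := by
  intro h
  have := hf.tprod_const
  rw [h] at this
  simp at this

theorem NP.tprod_mul_inv {f : ℕ → PS} (hf : NP f) : (∏' k, f k) * ∏' k, (f k)⁻¹ = 1 := by
  rw [← hf.tprod_mul hf.inv]
  have : ∀ k, f k * (f k)⁻¹ = 1 := fun k =>
    PowerSeries.mul_inv_cancel _ (by rw [hf.const]; exact one_ne_zero)
  simp [this]

theorem NP.prod {ι : Type*} {f : ι → ℕ → PS} (s : Finset ι) (h : ∀ i ∈ s, NP (f i)) :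
    NP (fun k => ∏ i ∈ s, f i k) := fun k => dvd_prod_sub_one s _ _ (fun i hi => h i hi k)

theorem NP.tprod_prod {ι : Type*} {f : ι → ℕ → PS} (s : Finset ι) (h : ∀ i ∈ s, NP (f i)) :
    ∏' k, ∏ i ∈ s, f i k = ∏ i ∈ s, ∏' k, f i k := by
  classical
  induction s using Finset.induction_on with
  | empty => simp
  | insert j s hk ih =>
    simp only [Finset.prod_insert hk]
    have h2 : ∀ i ∈ s, NP (f i) := fun k hk => h k (Finset.mem_insert_of_mem hk)
    rw [(h j (Finset.mem_insert_self _ _)).tprod_mul (NP.prod s h2), ih h2]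

theorem NP.one_sub {g : ℕ → PS} (h : ∀ k, X ^ (k+1) ∣ g k) : NP (fun k => 1 - g k) := by
  intro k
  have : 1 - g k - 1 = - g k := by ring
  show _ ∣ 1 - g k - 1
  rw [this]
  exact dvd_neg.2 (h k)

theorem ps_ext_dvd {f g : PS} (h : ∀ n, X ^ n ∣ f - g) : f = g := by
  ext n
  have := X_pow_dvd_iff.1 (h (n+1)) n (Nat.lt_succ_self n)
  rwa [map_sub, sub_eq_zero] at this

theorem FS.tml {ι : Type*} {a : ι → PS} (h : FS a) (c : PS) : ∑' i, c * a i = c * ∑' i, a i :=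
  h.summable.tsum_mul_left c
theorem FS.tmr {ι : Type*} {a : ι → PS} (h : FS a) (c : PS) : ∑' i, a i * c = (∑' i, a i) * c :=
  h.summable.tsum_mul_right c


theorem FS.dvd_tsum {ι : Type*} {a : ι → PS} (h : FS a) (n : ℕ) (hd : ∀ i, X ^ n ∣ a i) :
    X ^ n ∣ ∑' i, a i := by
  rw [X_pow_dvd_iff]
  intro m hm
  rw [h.coeff_tsum]
  simp [fun i => X_pow_dvd_iff.1 (hd i) m hm]

/-- triangular numbers -/
def tri (j : ℤ) : ℤ := j * (j - 1) / 2

theorem two_tri (j : ℤ) : 2 * tri j = j * (j - 1) :=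
  Int.mul_ediv_cancel' (Int.even_mul_pred_self j).two_dvd

theorem tri_pred (j : ℤ) : tri (j - 1) = tri j - (j - 1) := by
  have h1 := two_tri j
  have h2 := two_tri (j-1)
  linarith

theorem tri_succ (j : ℤ) : tri (j + 1) = tri j + j := by
  have h1 := two_tri j
  have h2 := two_tri (j+1)
  linarith

theorem tri_nonneg (j : ℤ) : 0 ≤ tri j := by
  have h1 := two_tri j
  rcases lt_or_ge 0 j with h | h
  · nlinarith
  · nlinarith

/-- theta exponent -/
def ex (N i : ℕ) (j : ℤ) : ℕ := (N * tri j + i * j).toNat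

theorem ex_lower (N i : ℕ) (hi : i < N) (j : ℤ) : (|j| - 1 : ℤ) ≤ N * tri j + i * j := by
  have h1 := two_tri j
  have h0 := tri_nonneg j
  have hN : (i : ℤ) + 1 ≤ N := by exact_mod_cast hi
  have hi0 : (0 : ℤ) ≤ i := by positivity
  rcases lt_or_ge 0 j with h | h
  · rw [abs_of_pos h]
    have : j - 1 ≤ tri j := by nlinarith
    nlinarith [mul_nonneg hi0 h.le, mul_le_mul_of_nonneg_right hN h0]
  · rw [abs_of_nonpos h]
    have h3 : -j ≤ tri j := by nlinarith
    have h4 : ((i:ℤ)+1) * tri j ≤ N * tri j := mul_le_mul_of_nonneg_right hN h0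
    nlinarith [mul_le_mul_of_nonneg_left h3 hi0]

theorem ex_cast (N i : ℕ) (hi : i < N) (j : ℤ) : (ex N i j : ℤ) = N * tri j + i * j := by
  unfold ex
  apply Int.toNat_of_nonneg
  by_cases hj : j = 0
  · subst hj; simp [tri]
  · have := ex_lower N i hi j
    have : 1 ≤ |j| := Int.one_le_abs hj
    linarith

theorem ex_ge (N i : ℕ) (hi : i < N) (j : ℤ) : |j| ≤ ex N i j + 1 := by
  rw [ex_cast N i hi]; linarith [ex_lower N i hi j]

theorem abs_le_fin (n : ℤ) : {j : ℤ | |j| ≤ n}.Finite := by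
  refine (Set.finite_Icc (-n) n).subset ?_
  intro j hj
  exact abs_le.1 hj

theorem ex_fs (N i : ℕ) (hi : i < N) (w : ℤ → PS) : FS (fun j => w j * X ^ (ex N i j)) := by
  refine FS.of_exp w _ fun n => (abs_le_fin n).subset ?_
  intro j hj
  have := ex_ge N i hi j
  have h2 : ex N i j < n := hj
  show |j| ≤ n
  omega

/-- finite q-factorial -/
def qf (N m : ℕ) : PS := ∏ k ∈ Finset.range m, (1 - X ^ (N * (k + 1)))

theorem np_qf (N : ℕ) (hN : 0 < N) : NP (fun k => (1 - X ^ (N * (k + 1)) : PS)) :=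
  NP.one_sub fun k => pow_dvd_pow _ (Nat.le_mul_of_pos_left _ hN)

/-- Euler function -/
def EE (N : ℕ) : PS := ∏' k : ℕ, (1 - X ^ (N * (k + 1)))

theorem qf_const (N : ℕ) (hN : 0 < N) (m : ℕ) : constantCoeff (qf N m) = 1 := by
  unfold qf
  rw [map_prod]
  exact Finset.prod_eq_one fun k _ => (np_qf N hN).const k

def iqz (N : ℕ) (k : ℤ) : PS := if k < 0 then 0 else (qf N k.toNat)⁻¹

theorem qf_mul_inv (N : ℕ) (hN : 0 < N) (m : ℕ) : qf N m * (qf N m)⁻¹ = 1 :=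
  PowerSeries.mul_inv_cancel _ (by rw [qf_const N hN]; exact one_ne_zero)

theorem iqz_pred (N : ℕ) (hN : 0 < N) (k : ℤ) : iqz N (k - 1) = iqz N k * (1 - X ^ (N * k.toNat)) := by
  unfold iqz
  rcases lt_trichotomy k 0 with h | h | h
  · rw [if_pos (by omega), if_pos h]; simp
  · subst h; simp
  · obtain ⟨m, rfl⟩ : ∃ m : ℕ, k = m + 1 := ⟨(k-1).toNat, by omega⟩
    rw [if_neg (by omega), if_neg (by omega)]
    have e1 : ((m : ℤ) + 1 - 1).toNat = m := by omega
    have e2 : ((m : ℤ) + 1).toNat = m + 1 := by omega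
    rw [e1, e2]
    have h1 := qf_mul_inv N hN m
    have h2 := qf_mul_inv N hN (m+1)
    have h3 : qf N (m+1) = qf N m * (1 - X ^ (N * (m+1))) := Finset.prod_range_succ _ _
    rw [h3] at h2 ⊢
    linear_combination (-(qf N m)⁻¹) * h2 + ((qf N m * (1 - X ^ (N * (m+1))))⁻¹ * (1 - X ^ (N * (m+1)))) * h1

theorem qpascal (N : ℕ) (hN : 0 < N) (n : ℕ) (k l : ℤ) (h : k + l = n + 1) :
    qf N (n+1) * iqz N k * iqz N l = qf N n * iqz N (k-1) * iqz N l
      + X ^ (N * k.toNat) * (qf N n * iqz N k * iqz N (l-1)) := by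
  by_cases hk : k < 0
  · have e1 : iqz N k = 0 := if_pos hk
    have e2 : iqz N (k-1) = 0 := if_pos (by omega)
    rw [e1, e2]; ring
  by_cases hl : l < 0
  · have e1 : iqz N l = 0 := if_pos hl
    have e2 : iqz N (l-1) = 0 := if_pos (by omega)
    rw [e1, e2]; ring
  rw [iqz_pred N hN k, iqz_pred N hN l]
  have h3 : qf N (n+1) = qf N n * (1 - X ^ (N * (n+1))) := Finset.prod_range_succ _ _
  have h4 : N * (n + 1) = N * k.toNat + N * l.toNat := by
    rw [← mul_add]; congr 1; omega
  rw [h3, h4, pow_add]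
  ring

theorem tsum_shift (f : ℤ → PS) (m : ℤ) : ∑' j, f (j + m) = ∑' j, f j :=
  (Equiv.addRight m).tsum_eq f

theorem iqz_fs (N : ℕ) (w : ℤ → PS) (n : ℕ) (u v : ℤ) :
    FS (fun j : ℤ => w j * (qf N n * iqz N (u + j) * iqz N (v - j))) := by
  intro k
  refine (Set.finite_Icc (-u) v).subset ?_
  intro j hj
  by_contra h
  apply hj
  rw [Set.mem_Icc, not_and_or] at h
  have : iqz N (u+j) * iqz N (v-j) = 0 := by
    rcases h with h | h
    · rw [show iqz N (u+j) = 0 from if_pos (by omega)]; simp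
    · rw [show iqz N (v-j) = 0 from if_pos (by omega)]; simp
  show coeff k (w j * (qf N n * iqz N (u + j) * iqz N (v - j))) = 0
  rw [mul_assoc (qf N n), this]; simp

theorem jtp_fin (N i : ℕ) (hi : i < N) (a : ℂ) (ha : a ≠ 0) (m : ℕ) :
    ∏ k ∈ Finset.range m, ((1 - C a * X ^ (N * k + i)) * (1 - C a⁻¹ * X ^ (N * (k + 1) - i))) =
    ∑' j : ℤ, (C ((-a) ^ j) * X ^ (ex N i j)) * (qf N (2 * m) * iqz N (m + j) * iqz N (m - j)) := by
  have hN : 0 < N := by omega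
  have hna : -a ≠ 0 := neg_ne_zero.2 ha
  induction m with
  | zero =>
    rw [tsum_eq_single 0]
    · simp [ex, tri, iqz, qf]
    · intro j hj
      rcases lt_or_gt_of_ne hj with h | h
      · rw [show iqz N ((0:ℕ)+j) = 0 from if_pos (by simpa using h)]; simp
      · rw [show iqz N ((0:ℕ)-j) = 0 from if_pos (by simpa using h)]; simp
  | succ m ih =>
    rw [Finset.prod_range_succ, ih]
    -- first step
    have s1 : (∑' j : ℤ, (C ((-a) ^ j) * X ^ (ex N i j)) * (qf N (2 * m) * iqz N (m + j) * iqz N (m - j)))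
        * (1 - C a * X ^ (N * m + i)) =
        ∑' j : ℤ, (C ((-a) ^ j) * X ^ (ex N i j)) * (qf N (2 * m + 1) * iqz N (m + j) * iqz N (m + 1 - j)) := by
      have f1 := iqz_fs N (fun j => C ((-a) ^ j) * X ^ (ex N i j)) (2*m) m m
      have e : ∀ j : ℤ, (C ((-a) ^ j) * X ^ (ex N i j) : PS) * (qf N (2 * m + 1) * iqz N (m + j) * iqz N (m + 1 - j))
        = (C ((-a) ^ j) * X ^ (ex N i j)) * (qf N (2 * m) * iqz N (m + j) * iqz N (m - j))
        + (-(C a * X ^ (N * m + i))) * ((C ((-a) ^ (j + -1)) * X ^ (ex N i (j + -1))) * (qf N (2 * m) * iqz N (m + (j + -1)) * iqz N (m - (j + -1)))) := by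
        intro j
        have hp := qpascal N hN (2*m) (m + 1 - j) (m + j) (by push_cast; ring)
        rw [show (m:ℤ) + 1 - j - 1 = m - j by ring] at hp
        rw [show (m:ℤ) + (j + -1) = m + j - 1 by ring, show (m:ℤ) - (j + -1) = m + 1 - j by ring]
        by_cases hj : m + 1 - j < 0
        · have e1 : iqz N (m + 1 - j) = 0 := if_pos hj
          have e2 : iqz N (m - j) = 0 := if_pos (by omega)
          rw [e1, e2]; simp
        · have e3 : ex N i (j + -1) + (N * m + i) = ex N i j + N * (m + 1 - j).toNat := by
            zify
            rw [ex_cast N i hi, ex_cast N i hi, show j + -1 = j - 1 by ring, tri_pred, Int.toNat_of_nonneg (by omega)]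
            ring
          have e4 : (-a) ^ j = -(a * (-a) ^ (j + -1)) := by
            rw [zpow_add₀ hna, zpow_neg_one]; field_simp
          have e5 : (X : PS) ^ (ex N i (j + -1)) * X ^ (N * m + i) = X ^ (ex N i j) * X ^ (N * (m + 1 - j).toNat) := by
            rw [← pow_add, ← pow_add, e3]
          have e6 : (C ((-a) ^ j) : PS) = -(C a * C ((-a) ^ (j + -1))) := by
            rw [e4, map_neg, map_mul]
          rw [e6]
          linear_combination (-(C a * C ((-a) ^ (j + -1))) * X ^ (ex N i j)) * hp
            + (C a * C ((-a) ^ (j + -1)) * (qf N (2 * m) * iqz N (m + j - 1) * iqz N (m + 1 - j))) * e5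
      have f2 : FS (fun j : ℤ => (-(C a * X ^ (N * m + i))) * ((C ((-a) ^ (j + -1)) * X ^ (ex N i (j + -1))) * (qf N (2 * m) * iqz N (m + (j + -1)) * iqz N (m - (j + -1))))) :=
        (f1.comp_inj (f := fun j => j + -1) (add_left_injective _)).mul_left _
      simp only [e]
      rw [f1.summable.tsum_add f2.summable, (f1.comp_inj (f := fun j => j + -1) (add_left_injective _)).tml,
        tsum_shift (fun j => (C ((-a) ^ j) * X ^ (ex N i j)) * (qf N (2 * m) * iqz N (m + j) * iqz N (m - j))) (-1)]
      ring
    have s2 : (∑' j : ℤ, (C ((-a) ^ j) * X ^ (ex N i j)) * (qf N (2 * m + 1) * iqz N (m + j) * iqz N (m + 1 - j)))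
        * (1 - C a⁻¹ * X ^ (N * (m + 1) - i)) =
        ∑' j : ℤ, (C ((-a) ^ j) * X ^ (ex N i j)) * (qf N (2 * m + 1 + 1) * iqz N (m + 1 + j) * iqz N (m + 1 - j)) := by
      have f1 := iqz_fs N (fun j => C ((-a) ^ j) * X ^ (ex N i j)) (2*m+1) m (m+1)
      have e : ∀ j : ℤ, (C ((-a) ^ j) * X ^ (ex N i j) : PS) * (qf N (2 * m + 1 + 1) * iqz N (m + 1 + j) * iqz N (m + 1 - j))
        = (C ((-a) ^ j) * X ^ (ex N i j)) * (qf N (2 * m + 1) * iqz N (m + j) * iqz N (m + 1 - j))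
        + (-(C a⁻¹ * X ^ (N * (m + 1) - i))) * ((C ((-a) ^ (j + 1)) * X ^ (ex N i (j + 1))) * (qf N (2 * m + 1) * iqz N (m + (j + 1)) * iqz N (m + 1 - (j + 1)))) := by
        intro j
        have hp := qpascal N hN (2*m+1) (m + 1 + j) (m + 1 - j) (by push_cast; ring)
        rw [show (m:ℤ) + 1 + j - 1 = m + j by ring] at hp
        rw [show (m:ℤ) + (j + 1) = m + 1 + j by ring, show (m:ℤ) + 1 - (j + 1) = m + 1 - j - 1 by ring]
        by_cases hj : m + 1 + j < 0
        · have e1 : iqz N (m + 1 + j) = 0 := if_pos hj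
          have e2 : iqz N (m + j) = 0 := if_pos (by omega)
          rw [e1, e2]; simp
        · have hle : i ≤ N * (m + 1) := hi.le.trans (Nat.le_mul_of_pos_right _ (Nat.succ_pos m))
          have e3 : ex N i (j + 1) + (N * (m + 1) - i) = ex N i j + N * (m + 1 + j).toNat := by
            zify [hle]
            rw [ex_cast N i hi, ex_cast N i hi, tri_succ, Int.toNat_of_nonneg (by omega)]
            ring
          have e4 : (-a) ^ j = -(a⁻¹ * (-a) ^ (j + 1)) := by
            rw [zpow_add₀ hna, zpow_one]; field_simp
          have e5 : (X : PS) ^ (ex N i (j + 1)) * X ^ (N * (m + 1) - i) = X ^ (ex N i j) * X ^ (N * (m + 1 + j).toNat) := by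
            rw [← pow_add, ← pow_add, e3]
          have e6 : (C ((-a) ^ j) : PS) = -(C a⁻¹ * C ((-a) ^ (j + 1))) := by
            rw [e4, map_neg, map_mul]
          rw [e6]
          linear_combination (-(C a⁻¹ * C ((-a) ^ (j + 1))) * X ^ (ex N i j)) * hp
            + (C a⁻¹ * C ((-a) ^ (j + 1)) * (qf N (2 * m + 1) * iqz N (m + 1 + j) * iqz N (m + 1 - j - 1))) * e5
      have f2 : FS (fun j : ℤ => (-(C a⁻¹ * X ^ (N * (m + 1) - i))) * ((C ((-a) ^ (j + 1)) * X ^ (ex N i (j + 1))) * (qf N (2 * m + 1) * iqz N (m + (j + 1)) * iqz N (m + 1 - (j + 1))))) :=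
        (f1.comp_inj (f := fun j => j + 1) (add_left_injective _)).mul_left _
      simp only [e]
      rw [f1.summable.tsum_add f2.summable, (f1.comp_inj (f := fun j => j + 1) (add_left_injective _)).tml,
        tsum_shift (fun j => (C ((-a) ^ j) * X ^ (ex N i j)) * (qf N (2 * m + 1) * iqz N (m + j) * iqz N (m + 1 - j))) 1]
      ring
    rw [← mul_assoc, s1, s2]
    push_cast
    rfl

/-- theta series -/
def th (N i : ℕ) (a : ℂ) : PS := ∑' j : ℤ, C ((-a) ^ j) * X ^ (ex N i j)

theorem np_pow {e : ℕ → ℕ} (h : ∀ k, k + 1 ≤ e k) (a : ℕ → PS) :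
    NP (fun k => 1 - a k * X ^ (e k)) :=
  NP.one_sub fun k => Dvd.dvd.mul_left (pow_dvd_pow _ (h k)) _

theorem ps_dvd_mms {n : ℕ} {a b c d : PS} (h1 : X ^ n ∣ a - b) (h2 : X ^ n ∣ c - d) :
    X ^ n ∣ a * c - b * d := by
  have : a * c - b * d = (a - b) * c + b * (c - d) := by ring
  rw [this]
  exact dvd_add (Dvd.dvd.mul_right h1 _) (Dvd.dvd.mul_left h2 _)

theorem iqz_congr (N : ℕ) (hN : 0 < N) (n : ℕ) (k : ℤ) (hk : n ≤ k) : X ^ n ∣ EE N * iqz N k - 1 := by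
  obtain ⟨m, rfl⟩ : ∃ m : ℕ, k = m := ⟨k.toNat, by omega⟩
  have h1 : iqz N m = (qf N m)⁻¹ := by
    unfold iqz; rw [if_neg (by omega)]; simp
  have h2 := (np_qf N hN).dvd n m (by omega)
  have h3 := qf_mul_inv N hN m
  rw [h1, ← h3, ← sub_mul]
  exact Dvd.dvd.mul_right h2 _

theorem jtp (N i : ℕ) (hi : i < N) (a : ℂ) (ha : a ≠ 0) :
    th N i a = (1 - C a * X ^ i) * (EE N * (∏' k : ℕ, (1 - C a * X ^ (N * (k + 1) + i))) *
      ∏' k : ℕ, (1 - C a⁻¹ * X ^ (N * (k + 1) - i))) := by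
  have hN : 0 < N := by omega
  have h1 : NP (fun k : ℕ => (1 - C a * X ^ (N * (k + 1) + i) : PS)) :=
    np_pow (fun k => (Nat.le_mul_of_pos_left _ hN).trans (Nat.le_add_right _ _)) _
  have h2 : NP (fun k : ℕ => (1 - C a⁻¹ * X ^ (N * (k + 1) - i) : PS)) := by
    refine np_pow (fun k => ?_) _
    obtain ⟨d, rfl⟩ : ∃ d, N = i + 1 + d := ⟨N - (i+1), by omega⟩
    have : (i + 1 + d) * (k+1) = (i + (k + 1)) + (i * k + d * (k + 1)) := by ring
    omega
  refine ps_ext_dvd fun n => ?_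
  have hf := jtp_fin N i hi a ha (2 * n)
  have hEn : X ^ n ∣ EE N - qf N (4 * n) := (np_qf N hN).dvd n (4*n) (by omega)
  -- product side
  have p1 : X ^ n ∣ (1 - C a * X ^ i) * ((∏' k : ℕ, (1 - C a * X ^ (N * (k + 1) + i))) *
      ∏' k : ℕ, (1 - C a⁻¹ * X ^ (N * (k + 1) - i))) -
      ∏ k ∈ Finset.range (2*n), ((1 - C a * X ^ (N * k + i)) * (1 - C a⁻¹ * X ^ (N * (k + 1) - i))) := by
    rcases Nat.eq_zero_or_pos n with h0 | h0
    · subst h0; simp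
    rw [Finset.prod_mul_distrib]
    obtain ⟨M, hM⟩ : ∃ M, 2 * n = M + 1 := ⟨2*n-1, by omega⟩
    have e1 : ∏ k ∈ Finset.range (2*n), (1 - C a * X ^ (N * k + i) : PS) =
       (1 - C a * X ^ i) * ∏ k ∈ Finset.range M, (1 - C a * X ^ (N * (k + 1) + i)) := by
      rw [hM, Finset.prod_range_succ']; simp [mul_comm]
    rw [e1, mul_assoc, ← mul_sub]
    exact Dvd.dvd.mul_left (ps_dvd_mms (h1.dvd n M (by omega)) (h2.dvd n (2*n) (by omega))) _
  have p2 : X ^ n ∣ th N i a - EE N * ∑' j : ℤ, (C ((-a) ^ j) * X ^ (ex N i j)) * (qf N (2 * (2 * n)) * iqz N ((2 * n : ℕ) + j) * iqz N ((2 * n : ℕ) - j)) := by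
    unfold th
    have f1 := ex_fs N i hi (fun j => C ((-a) ^ j))
    have f2 := iqz_fs N (fun j => C ((-a) ^ j) * X ^ (ex N i j)) (2*(2*n)) (2*n:ℕ) (2*n:ℕ)
    have f3 := f2.mul_left (fun _ => EE N)
    rw [← f2.tml, ← f1.summable.tsum_sub f3.summable]
    have f4 := f1.add f3.neg
    simp only [← sub_eq_add_neg] at f4
    refine f4.dvd_tsum n fun j => ?_
    by_cases hj : |j| ≤ n
    · have hj' := abs_le.1 hj
      have c1 := iqz_congr N hN n ((2 * n : ℕ) + j) (by push_cast; omega)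
      have c2 := iqz_congr N hN n ((2 * n : ℕ) - j) (by push_cast; omega)
      have c3 := ps_dvd_mms c1 c2
      have c4 : X ^ n ∣ EE N * (qf N (2 * (2 * n)) * iqz N ((2 * n : ℕ) + j) * iqz N ((2 * n : ℕ) - j)) - 1 := by
        have e : EE N * (qf N (2 * (2 * n)) * iqz N ((2 * n : ℕ) + j) * iqz N ((2 * n : ℕ) - j)) - 1
          = (EE N * iqz N ((2 * n : ℕ) + j)  * (EE N * iqz N ((2 * n : ℕ) - j)) - 1 * 1)
            - (EE N - qf N (4 * n)) * (EE N * iqz N ((2 * n : ℕ) + j) * iqz N ((2 * n : ℕ) - j)) := by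
          rw [show 2 * (2 * n) = 4 * n by ring]; ring
        rw [e]
        exact dvd_sub c3 (Dvd.dvd.mul_right hEn _)
      have e : C ((-a) ^ j) * X ^ (ex N i j) - EE N * ((C ((-a) ^ j) * X ^ (ex N i j)) * (qf N (2 * (2 * n)) * iqz N ((2 * n : ℕ) + j) * iqz N ((2 * n : ℕ) - j)))
        = (-(C ((-a) ^ j) * X ^ (ex N i j))) * (EE N * (qf N (2 * (2 * n)) * iqz N ((2 * n : ℕ) + j) * iqz N ((2 * n : ℕ) - j)) - 1) := by ring
      rw [e]
      exact Dvd.dvd.mul_left c4 _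
    · have h5 := ex_ge N i hi j
      have h6 : X ^ n ∣ (X : PS) ^ (ex N i j) := pow_dvd_pow _ (by omega)
      exact dvd_sub (Dvd.dvd.mul_left h6 _) (Dvd.dvd.mul_left (Dvd.dvd.mul_right (Dvd.dvd.mul_left h6 _) _) _)
  rw [← hf] at p2
  have p3 := Dvd.dvd.mul_left p1 (EE N)
  have := dvd_sub p2 p3
  convert this using 1
  ring


theorem det_comp_perm {ι R : Type*} [Fintype ι] [DecidableEq ι] [CommRing R] {U : Type*} (φ : ι → U → R) (u : ι → U)
    (σ : Equiv.Perm ι) : (Matrix.of fun i j => φ i (u (σ j))).det =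
      ((Equiv.Perm.sign σ : ℤ) : R) * (Matrix.of fun i j => φ i (u j)).det :=
  Matrix.det_permute' σ (Matrix.of fun i j => φ i (u j))

theorem interp_zero {ι : Type*} [Fintype ι] [DecidableEq ι] {U : Type*} (D : (ι → U) → PS) (φ : ι → U → PS)
    (p : ι → U)
    (hspan : ∀ u k, ∃ a : ι → PS, ∀ x, D (Function.update u k x) = ∑ i, a i * φ i x)
    (hdet : (Matrix.of fun i j => φ i (p j)).det ≠ 0)
    (hz : ∀ k : ι → ι, D (fun i => p (k i)) = 0) : ∀ u, D u = 0 := by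
  have key : ∀ S : Finset ι, ∀ u : ι → U, (∀ j, j ∉ S → ∃ k, u j = p k) → D u = 0 := by
    intro S
    induction S using Finset.induction_on with
    | empty =>
      intro u hu
      choose k hk using fun j => hu j (Finset.notMem_empty j)
      have : u = fun i => p (k i) := funext hk
      rw [this]; exact hz k
    | insert a S ha ih =>
      intro u hu
      obtain ⟨c, hc⟩ := hspan u a
      have h0 : ∀ m, ∑ i, c i * φ i (p m) = 0 := by
        intro m
        rw [← hc]
        apply ih
        intro j hj
        by_cases hja : j = a
        · subst hja; exact ⟨m, by simp⟩
        · rw [Function.update_of_ne hja]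
          exact hu j (by simp [hja, hj])
      have h1 : c = 0 := by
        by_contra hne
        apply hdet
        exact Matrix.exists_vecMul_eq_zero_iff.1 ⟨c, hne, funext fun m => h0 m⟩
      have := hc (u a)
      rw [Function.update_eq_self] at this
      rw [this, h1]; simp
  intro u
  exact key Finset.univ u (fun j hj => absurd (Finset.mem_univ j) hj)

theorem interp {ι : Type*} [Fintype ι] [DecidableEq ι] {U : Type*} (P : (ι → U) → PS) (φ : ι → U → PS)
    (p : ι → U)
    (hspan : ∀ u k, ∃ a : ι → PS, ∀ x, P (Function.update u k x) = ∑ i, a i * φ i x)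
    (hperm : ∀ u (σ : Equiv.Perm ι), P (fun i => u (σ i)) = ((Equiv.Perm.sign σ : ℤ) : PS) * P u)
    (halt : ∀ u i j, i ≠ j → u i = u j → P u = 0)
    (hdet : (Matrix.of fun i j => φ i (p j)).det ≠ 0) (u : ι → U) :
    P u * (Matrix.of fun i j => φ i (p j)).det = P p * (Matrix.of fun i j => φ i (u j)).det := by
  rw [← sub_eq_zero]
  refine interp_zero (fun u => P u * (Matrix.of fun i j => φ i (p j)).det - P p * (Matrix.of fun i j => φ i (u j)).det)
    φ p ?_ hdet ?_ u
  · intro u k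
    obtain ⟨a, ha⟩ := hspan u k
    refine ⟨fun i => a i * (Matrix.of fun i j => φ i (p j)).det -
      P p * (Matrix.of fun i j => φ i (u j)).adjugate k i, fun x => ?_⟩
    simp only
    rw [ha]
    have h1 : (Matrix.of fun i j => φ i (Function.update u k x j)).det =
        ∑ i, (Matrix.of fun i j => φ i (u j)).adjugate k i * φ i x := by
      have : (Matrix.of fun i j => φ i (Function.update u k x j)) =
          (Matrix.of fun i j => φ i (u j)).updateCol k (fun i => φ i x) := by
        ext i j
        by_cases h : j = k
        · subst h; simp
        · simp [h]
      rw [this, ← Matrix.cramer_apply, Matrix.cramer_eq_adjugate_mulVec]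
      rfl
    rw [h1, Finset.sum_mul, Finset.mul_sum, ← Finset.sum_sub_distrib]
    refine Finset.sum_congr rfl fun i _ => ?_
    ring
  · intro k
    simp only
    by_cases hk : Function.Injective k
    · let σ : Equiv.Perm ι := Equiv.ofBijective k (Finite.injective_iff_bijective.1 hk)
      have h1 := hperm p σ
      have h2 := det_comp_perm φ p σ
      have e : ∀ i, σ i = k i := fun _ => rfl
      simp only [e] at h1 h2
      rw [h1, h2]; ring
    · rw [Function.Injective] at hk
      push Not at hk
      obtain ⟨i, j, hij, hne⟩ := hk
      rw [halt _ i j hne (by simp [hij])]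
      have h0 : (Matrix.of fun i j => φ i (p (k j))).det = 0 :=
        Matrix.det_zero_of_column_eq hne (by intro m; simp [hij])
      rw [h0]
      ring

theorem det_expand {ι : Type} [Fintype ι] [DecidableEq ι]
    (φ : ι → ℂˣ → PS) (A : ι → ℤ → ℂˣ → ℂ) (e : ι → ℤ → ℕ)
    (hφ : ∀ i u, φ i u = ∑' c, C (A i c u) * X ^ (e i c))
    (hFS : ∀ (i : ι) (w : ℤ → PS), FS (fun c => w c * X ^ (e i c))) : ∀ u : ι → ℂˣ, (Matrix.of fun i j => φ i (u j)).det =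
      ∑' c : ι → ℤ, C (Matrix.of fun i j => A i (c i) (u j)).det * X ^ (∑ i, e i (c i)) := by
  intro u
  have h1 : ∀ σ : Equiv.Perm ι, ∏ i, φ i (u (σ i)) =
      ∑' c : ι → ℤ, ∏ i, (C (A i (c i) (u (σ i))) * X ^ (e i (c i))) := by
    intro σ
    have e1 : ∀ i, φ i (u (σ i)) = ∑' c, C (A i c (u (σ i))) * X ^ (e i c) := fun i => hφ i _
    rw [Finset.prod_congr rfl fun i _ => e1 i]
    exact FS.prod_tsum (a := fun i c => C (A i c (u (σ i))) * X ^ (e i c)) (fun i => hFS i (fun c => C (A i c (u (σ i)))))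
  rw [← Matrix.det_transpose, Matrix.det_apply]
  have h2 : ∀ σ : Equiv.Perm ι, ∏ i, (Matrix.of fun i j => φ i (u j)).transpose (σ i) i
      = ∏ i, φ i (u (σ i)) := fun σ => rfl
  simp only [h2, h1]
  have h3 : ∀ c : ι → ℤ, C (Matrix.of fun i j => A i (c i) (u j)).det * X ^ (∑ i, e i (c i))
     = ∑ σ : Equiv.Perm ι, Equiv.Perm.sign σ • ∏ i, (C (A i (c i) (u (σ i))) * X ^ (e i (c i)) : PS) := by
    intro c
    rw [← Matrix.det_transpose, Matrix.det_apply, map_sum, Finset.sum_mul]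
    refine Finset.sum_congr rfl fun σ _ => ?_
    rw [Finset.prod_mul_distrib, Finset.prod_pow_eq_pow_sum, ← map_prod]
    simp only [Units.smul_def, zsmul_eq_mul, map_mul, map_intCast]
    rw [mul_assoc]; rfl
  simp only [h3]
  have hpi : ∀ σ : Equiv.Perm ι, FS (fun c : ι → ℤ => ∏ i, (C (A i (c i) (u (σ i))) * X ^ (e i (c i)) : PS)) := fun σ =>
    FS.pi (a := fun i c => C (A i c (u (σ i))) * X ^ (e i c)) (fun i => hFS i (fun c => C (A i c (u (σ i)))))
  have h4 : ∀ σ : Equiv.Perm ι, FS (fun c : ι → ℤ => Equiv.Perm.sign σ • ∏ i, (C (A i (c i) (u (σ i))) * X ^ (e i (c i)) : PS)) := by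
    intro σ
    simp only [Units.smul_def, zsmul_eq_mul]
    exact (hpi σ).mul_left _
  rw [Summable.tsum_finsetSum (fun σ _ => (h4 σ).summable)]
  refine Finset.sum_congr rfl fun σ _ => ?_
  simp only [Units.smul_def, zsmul_eq_mul]
  rw [(hpi σ).tml]

theorem engine {ι : Type} [Fintype ι] [DecidableEq ι]
    (φ : ι → ℂˣ → PS) (A : ι → ℤ → ℂˣ → ℂ) (e : ι → ℤ → ℕ) (p : ι → ℂˣ)
    (τ : ι → PS) (R : (ι → ℂˣ) → PS)
    (hspan : ∀ u k, ∃ a : ι → PS, ∀ x, C (Matrix.of fun i j => A i 0 ((Function.update u k x) j)).det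
      * R (Function.update u k x) = ∑ i, a i * φ i x)
    (hsym : ∀ u (σ : Equiv.Perm ι), R (fun i => u (σ i)) = R u)
    (hφ : ∀ i u, φ i u = ∑' c, C (A i c u) * X ^ (e i c))
    (he : ∀ i n, {c | e i c < n}.Finite)
    (hp : ∀ i j, φ i (p j) = τ i * C (A i 0 (p j)))
    (hD0 : (Matrix.of fun i j => A i 0 (p j)).det ≠ 0)
    (hτ : ∀ i, τ i ≠ 0)
    {α : Type*} {l : Filter α} [l.NeBot] (u : α → ι → ℂˣ)
    (hu : ∀ᶠ a in l, (Matrix.of fun i j => A i 0 (u a j)).det ≠ 0)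
    (R1 : PS) (hR : Filter.Tendsto (fun a => R (u a)) l (nhds R1))
    (ψ : (ι → ℤ) → ℂ)
    (hψ : ∀ c : ι → ℤ, Filter.Tendsto (fun a => (Matrix.of fun i j => A i (c i) (u a j)).det /
      (Matrix.of fun i j => A i 0 (u a j)).det) l (nhds (ψ c))) :
    R1 * ∏ i, τ i = R p * ∑' c : ι → ℤ, C (ψ c) * X ^ (∑ i, e i (c i)) := by
  have hCm : ∀ (B : ι → ι → ℂ), (Matrix.of fun i j => (C (B i j) : PS)).det = C (Matrix.of B).det := by
    intro B
    rw [RingHom.map_det]; rfl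
  have hdet1 : (Matrix.of fun i j => φ i (p j)).det = (∏ i, τ i) * C (Matrix.of fun i j => A i 0 (p j)).det := by
    simp only [hp]
    have := Matrix.det_mul_column τ (Matrix.of fun i j => (C (A i 0 (p j)) : PS))
    rw [← hCm, ← this]; rfl
  have hdet : (Matrix.of fun i j => φ i (p j)).det ≠ 0 := by
    rw [hdet1]
    refine mul_ne_zero (Finset.prod_ne_zero_iff.2 fun i _ => hτ i) ?_
    intro h
    exact hD0 ((map_eq_zero_iff _ PowerSeries.C_injective).1 h)
  have h_interp := interp (fun u => C (Matrix.of fun i j => A i 0 (u j)).det * R u) φ p hspan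
    (by
      intro u σ
      simp only [hsym]
      rw [det_comp_perm (fun i => A i 0) u σ, map_mul, mul_assoc]
      congr 1
      simp)
    (by
      intro u i j hne hij
      have h0 : (Matrix.of fun i j => A i 0 (u j)).det = 0 :=
        Matrix.det_zero_of_column_eq hne (by intro m; simp [hij])
      rw [h0]
      simp) hdet
  have hFS : ∀ (i : ι) (w : ℤ → PS), FS (fun c => w c * X ^ (e i c)) := fun i w => FS.of_exp w _ (he i)
  have hFS2 : ∀ (w : (ι → ℤ) → PS), FS (fun c => w c * X ^ (∑ i, e i (c i))) := by
    intro w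
    have := FS.pi (fun i => hFS i (fun _ => 1))
    simp only [one_mul, Finset.prod_pow_eq_pow_sum] at this
    exact this.mul_left w
  have hdetφ := det_expand φ A e hφ hFS
  have hmain : ∀ u : ι → ℂˣ, (Matrix.of fun i j => A i 0 (u j)).det ≠ 0 →
      R u * ∏ i, τ i = R p * ∑' c : ι → ℤ, C ((Matrix.of fun i j => A i (c i) (u j)).det /
        (Matrix.of fun i j => A i 0 (u j)).det) * X ^ (∑ i, e i (c i)) := by
    intro u hu
    have h := h_interp u
    rw [hdet1, hdetφ] at h
    have hC0 : (C (Matrix.of fun i j => A i 0 (p j)).det : PS) ≠ 0 := by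
      intro h
      exact hD0 ((map_eq_zero_iff _ PowerSeries.C_injective).1 h)
    have hC1 : (C (Matrix.of fun i j => A i 0 (u j)).det : PS) ≠ 0 := by
      intro h
      exact hu ((map_eq_zero_iff _ PowerSeries.C_injective).1 h)
    apply mul_left_cancel₀ hC0
    apply mul_left_cancel₀ hC1
    have h5 : C (Matrix.of fun i j => A i 0 (u j)).det * ∑' c : ι → ℤ, C ((Matrix.of fun i j => A i (c i) (u j)).det /
        (Matrix.of fun i j => A i 0 (u j)).det) * X ^ (∑ i, e i (c i)) =
        ∑' c : ι → ℤ, C (Matrix.of fun i j => A i (c i) (u j)).det * X ^ (∑ i, e i (c i)) := by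
      rw [← (hFS2 _).tml]
      refine tsum_congr fun c => ?_
      rw [← mul_assoc, ← map_mul, mul_div_cancel₀ _ hu]
    rw [← h5] at h
    linear_combination h
  have hlim : Filter.Tendsto (fun a => R p * ∑' c : ι → ℤ, C ((Matrix.of fun i j => A i (c i) (u a j)).det /
        (Matrix.of fun i j => A i 0 (u a j)).det) * X ^ (∑ i, e i (c i))) l
        (nhds (R p * ∑' c : ι → ℤ, C (ψ c) * X ^ (∑ i, e i (c i)))) := by
    refine Filter.Tendsto.const_mul _ ?_
    rw [ps_tendsto_iff]
    intro n
    have hfin := (hFS2 (fun _ => 1)).fin_ndvd (n+1)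
    have hz : ∀ (w : ℂ) (c : ι → ℤ), c ∉ hfin.toFinset → coeff n (C w * X ^ (∑ i, e i (c i)) : PS) = 0 := by
      intro w c hc
      simp only [Set.Finite.mem_toFinset, Set.mem_ofPred_eq, not_not, one_mul] at hc
      exact X_pow_dvd_iff.1 (Dvd.dvd.mul_left hc (C w)) n (Nat.lt_succ_self n)
    rw [(hFS2 _).coeff_tsum_finset n hfin.toFinset (fun c hc => hz _ c hc)]
    have : ∀ a, coeff n (∑' c : ι → ℤ, C ((Matrix.of fun i j => A i (c i) (u a j)).det /
        (Matrix.of fun i j => A i 0 (u a j)).det) * X ^ (∑ i, e i (c i)) : PS) =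
        ∑ c ∈ hfin.toFinset, coeff n (C ((Matrix.of fun i j => A i (c i) (u a j)).det /
        (Matrix.of fun i j => A i 0 (u a j)).det) * X ^ (∑ i, e i (c i)) : PS) := fun a =>
      (hFS2 _).coeff_tsum_finset n hfin.toFinset (fun c hc => hz _ c hc)
    simp only [this]
    refine tendsto_finsetSum _ fun c _ => ?_
    simp only [coeff_C_mul]
    exact (hψ c).mul_const _
  have hlim2 : Filter.Tendsto (fun a => R (u a) * ∏ i, τ i) l (nhds (R1 * ∏ i, τ i)) := hR.mul_const _
  refine tendsto_nhds_unique hlim2 (hlim.congr' ?_)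
  filter_upwards [hu] with a ha
  exact (hmain (u a) ha).symm


def QP (g N : ℕ) (d : ℤ) (κ : ℂ) (c : ℤ → PS) : Prop :=
  ∀ (s : ℤ) (m n : ℕ), (m : ℤ) - n = g * s + d → X ^ n * c (s + N) = C κ * X ^ m * c s

theorem QP.of {g N : ℕ} {d : ℤ} {κ : ℂ} {c : ℤ → PS}
    (h : ∀ s : ℤ, ∃ m n : ℕ, (m : ℤ) - n = g * s + d ∧ X ^ n * c (s + N) = C κ * X ^ m * c s) : QP g N d κ c := by
  intro s m n hmn
  obtain ⟨m', n', h1, h2⟩ := h s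
  have e : n + m' = m + n' := by omega
  have hX : (X ^ n' : PS) ≠ 0 := pow_ne_zero _ X_ne_zero
  apply mul_left_cancel₀ hX
  have e2 : (X ^ n * X ^ m' : PS) = X ^ m * X ^ n' := by rw [← pow_add, ← pow_add, e]
  linear_combination X ^ n * h2 + C κ * c s * e2

theorem exists_mn (k : ℤ) : ∃ m n : ℕ, (m : ℤ) - n = k := ⟨k.toNat, (-k).toNat, by omega⟩

def IsTh (g N : ℕ) (d : ℤ) (κ : ℂ) (f : ℂˣ → PS) : Prop :=
  ∃ c, FS c ∧ QP g N d κ c ∧ ∀ u : ℂˣ, f u = ∑' s, c s * C ((u : ℂ) ^ s)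

theorem FS.tsum_prod {ι κ : Type*} {F : ι × κ → PS} (h : FS F) :
    FS (fun i => ∑' k, F (i, k)) ∧ ∑' p, F p = ∑' i, ∑' k, F (i, k) := by
  have hf : ∀ i, FS (fun k => F (i, k)) := fun i => h.comp_inj (f := fun k => (i, k)) (by
    intro a b hab; exact (Prod.mk.inj hab).2)
  refine ⟨?_, h.summable.tsum_prod' fun i => (hf i).summable⟩
  intro n
  refine ((h n).image Prod.fst).subset ?_
  intro i hi
  by_contra hc
  apply hi
  rw [(hf i).coeff_tsum]
  have : ∀ k, coeff n (F (i, k)) = 0 := by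
    intro k
    by_contra h2
    exact hc ⟨(i, k), h2, rfl⟩
  simp [this]

theorem FS.conv {c1 c2 : ℤ → PS} (h1 : FS c1) (h2 : FS c2) (w1 w2 w : ℤ → PS) (hw : ∀ a b, w1 a * w2 b = w (a + b)) :
    FS (fun s => ∑' a, c1 a * c2 (s - a)) ∧
    (∑' s, c1 s * w1 s) * (∑' s, c2 s * w2 s) = ∑' s, (∑' a, c1 a * c2 (s - a)) * w s := by
  let e : ℤ × ℤ ≃ ℤ × ℤ := ⟨fun p => (p.2, p.1 - p.2), fun p => (p.1 + p.2, p.1), fun p => by ext <;> simp,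
    fun p => by ext <;> simp⟩
  have h3 : FS (fun p : ℤ × ℤ => c1 p.2 * c2 (p.1 - p.2)) := (h1.mul h2).comp_inj (f := e) e.injective
  have h4 := h3.mul_right (fun p => w p.1)
  refine ⟨h3.tsum_prod.1, ?_⟩
  rw [(h1.mul_right w1).tsum_mul_tsum (h2.mul_right w2), ← e.tsum_eq]
  have : ∀ p : ℤ × ℤ, c1 (e p).1 * w1 (e p).1 * (c2 (e p).2 * w2 (e p).2) = c1 p.2 * c2 (p.1 - p.2) * w p.1 := by
    intro p
    have := hw p.2 (p.1 - p.2)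
    rw [add_sub_cancel] at this
    rw [← this]
    show c1 p.2 * w1 p.2 * (c2 (p.1 - p.2) * w2 (p.1 - p.2)) = _
    ring
  simp only [this]
  rw [h4.tsum_prod.2]
  refine tsum_congr fun s => ?_
  have h5 : FS (fun a => c1 a * c2 (s - a)) := h3.comp_inj (f := fun k => (s, k)) (by
    intro a b hab; exact (Prod.mk.inj hab).2)
  exact h5.tmr (w s)

theorem IsTh.mul {g N1 N2 : ℕ} {d1 d2 : ℤ} {κ1 κ2 : ℂ} {f1 f2 : ℂˣ → PS} (h1 : IsTh g N1 d1 κ1 f1)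
    (h2 : IsTh g N2 d2 κ2 f2) : IsTh g (N1 + N2) (d1 + d2) (κ1 * κ2) (fun u => f1 u * f2 u) := by
  obtain ⟨c1, hc1, q1, e1⟩ := h1
  obtain ⟨c2, hc2, q2, e2⟩ := h2
  refine ⟨fun s => ∑' a, c1 a * c2 (s - a), (hc1.conv hc2 1 1 1 (by simp)).1, ?_, ?_⟩
  · apply QP.of
    intro s
    obtain ⟨m, n, hmn⟩ := exists_mn (g * s + (d1 + d2))
    refine ⟨m, n, hmn, ?_⟩
    have hfs : ∀ s : ℤ, FS (fun a => c1 a * c2 (s - a)) := fun s =>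
      (hc1.mul hc2).comp_inj (f := fun a => (a, s - a)) (by
        intro a b hab; exact (Prod.mk.inj hab).1)
    rw [← tsum_shift _ (N1 : ℤ), ← (((hfs _).comp_inj (f := fun a => a + (N1:ℤ)) (add_left_injective _))).tml,
      ← (hfs s).tml]
    refine tsum_congr fun a => ?_
    obtain ⟨m1, n1, hmn1⟩ := exists_mn (g * a + d1)
    obtain ⟨m2, n2, hmn2⟩ := exists_mn (g * (s - a) + d2)
    have r1 := q1 a m1 n1 hmn1
    have r2 := q2 (s - a) m2 n2 hmn2
    have e3 : s + ((N1 + N2 : ℕ) : ℤ) - (a + N1) = s - a + N2 := by push_cast; ring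
    rw [e3]
    have e : n + (m1 + m2) = m + (n1 + n2) := by
      have : (n : ℤ) + (m1 + m2) = m + (n1 + n2) := by linarith
      exact_mod_cast this
    have hX : (X ^ (n1 + n2) : PS) ≠ 0 := pow_ne_zero _ X_ne_zero
    apply mul_left_cancel₀ hX
    have e2 : (X ^ n * (X ^ m1 * X ^ m2) : PS) = X ^ m * (X ^ n1 * X ^ n2) := by
      rw [← pow_add, ← pow_add, ← pow_add, ← pow_add, e]
    rw [pow_add, map_mul]
    linear_combination X ^ n * (X ^ n2 * c2 (s - a + N2)) * r1 + X ^ n * (C κ1 * X ^ m1 * c1 a) * r2 +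
      C κ1 * C κ2 * c1 a * c2 (s - a) * e2
  · intro u
    simp only
    rw [e1, e2]
    exact (hc1.conv hc2 _ _ (fun s => C ((u:ℂ) ^ s)) (by
      intro a b
      rw [← map_mul, zpow_add₀ u.ne_zero])).2

theorem IsTh.congr {g N N' : ℕ} {d d' : ℤ} {κ κ' : ℂ} {f f' : ℂˣ → PS} (h : IsTh g N d κ f) (hN : N' = N) (hd : d' = d)
    (hκ : κ' = κ) (hf : ∀ u, f' u = f u) : IsTh g N' d' κ' f' := by
  subst hN hd hκ
  have : f' = f := funext hf
  rwa [this]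

theorem IsTh.const (g : ℕ) (c : PS) : IsTh g 0 0 1 (fun _ => c) := by
  refine ⟨fun s => if s = 0 then c else 0, ?_, ?_, ?_⟩
  · intro n
    refine (Set.finite_singleton (0:ℤ)).subset ?_
    intro s hs
    by_contra h
    apply hs
    have : s ≠ 0 := h
    simp [this]
  · intro s m n h
    simp only [Nat.cast_zero, add_zero, map_one, one_mul] at h ⊢
    by_cases hs : s = 0
    · subst hs
      have : m = n := by
        have : (m:ℤ) = n := by linarith
        exact_mod_cast this
      rw [this]
    · simp [hs]
  · intro u
    rw [tsum_eq_single 0]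
    · simp
    · intro b hb; simp [hb]

theorem IsTh.cmul {g N : ℕ} {d : ℤ} {κ : ℂ} {f : ℂˣ → PS} (h : IsTh g N d κ f) (c : PS) :
    IsTh g N d κ (fun u => c * f u) :=
  ((IsTh.const g c).mul h).congr (by simp) (by simp) (by simp) (fun u => rfl)

theorem IsTh.prod {ι : Type*} (s : Finset ι) {g : ℕ} {N : ι → ℕ} {d : ι → ℤ} {κ : ι → ℂ} {f : ι → ℂˣ → PS}
    (h : ∀ i ∈ s, IsTh g (N i) (d i) (κ i) (f i)) :
    IsTh g (∑ i ∈ s, N i) (∑ i ∈ s, d i) (∏ i ∈ s, κ i) (fun u => ∏ i ∈ s, f i u) := by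
  classical
  induction s using Finset.induction_on with
  | empty => simpa using IsTh.const g 1
  | insert a s ha ih =>
    simp only [Finset.sum_insert ha, Finset.prod_insert ha]
    exact (h a (by simp)).mul (ih fun i hi => h i (by simp [hi]))

/-- multiplication by `u⁻¹` -/
theorem IsTh.inv {g N : ℕ} {d : ℤ} {κ : ℂ} {f : ℂˣ → PS} (h : IsTh g N d κ f) :
    IsTh g N (d + g) κ (fun u => C ((u:ℂ)⁻¹) * f u) := by
  obtain ⟨c, hc, q, e⟩ := h
  refine ⟨fun s => c (s + 1), hc.comp_inj (add_left_injective 1), ?_, ?_⟩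
  · intro s m n hmn
    have := q (s + 1) m n (by rw [hmn]; ring)
    rw [← this]
    congr 2; ring_nf
  · intro u
    simp only
    rw [e, ← (hc.mul_right _).tml, ← tsum_shift _ 1]
    refine tsum_congr fun s => ?_
    have : (C ((u:ℂ)^s) : PS) = C ((u:ℂ)⁻¹) * C ((u:ℂ)^(s+1)) := by
      rw [← map_mul, zpow_add_one₀ u.ne_zero]
      congr 1
      have := u.ne_zero
      field_simp
    rw [this]; ring

theorem IsTh.th (g : ℕ) (hg : 0 < g) (a : ℂˣ) : IsTh g 1 0 (-a) (fun u => _root_.th g 0 (a * u)) := by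
  refine ⟨fun s => C ((-a:ℂ) ^ s) * X ^ (ex g 0 s), ex_fs g 0 hg _, ?_, ?_⟩
  · apply QP.of
    intro s
    refine ⟨ex g 0 (s + 1), ex g 0 s, ?_, ?_⟩
    · rw [ex_cast _ _ hg, ex_cast _ _ hg, tri_succ]; push_cast; ring
    · have : (-a:ℂ) ≠ 0 := neg_ne_zero.2 a.ne_zero
      simp only [Nat.cast_one]
      rw [zpow_add_one₀ this, map_mul]; ring
  · intro u
    unfold _root_.th
    refine tsum_congr fun s => ?_
    rw [← neg_mul, mul_zpow, map_mul]; ring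

theorem IsTh.th_sq : IsTh 1 4 1 1 (fun u => _root_.th 1 0 (u ^ 2)) := by
  let c : ℤ → PS := fun s => if 2 ∣ s then C ((-1:ℂ) ^ (s / 2)) * X ^ (ex 1 0 (s / 2)) else 0
  have inj : Function.Injective (fun j : ℤ => 2 * j) := by intro a b h; simpa using h
  refine ⟨c, ?_, ?_, ?_⟩
  · intro n
    refine ((ex_fs 1 0 one_pos (fun s => C ((-1:ℂ) ^ s)) n).image (fun j => 2 * j)).subset ?_
    intro s hs
    by_cases h : 2 ∣ s
    · refine ⟨s / 2, ?_, by simp only; omega⟩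
      simpa [c, h] using hs
    · exact absurd (by simp [c, h]) hs
  · apply QP.of
    intro s
    by_cases h : 2 ∣ s
    · obtain ⟨j, rfl⟩ := h
      refine ⟨ex 1 0 (j + 2), ex 1 0 j, ?_, ?_⟩
      · rw [ex_cast _ _ one_pos, ex_cast _ _ one_pos]
        have h1 := two_tri j
        have h2 := two_tri (j+2)
        push_cast
        linarith
      · have e1 : c (2 * j + (4 : ℕ)) = C ((-1:ℂ) ^ (j+2)) * X ^ (ex 1 0 (j + 2)) := by
          have e0 : (2 * j + (4:ℕ)) / 2 = j + 2 := by push_cast; omega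
          simp only [c]; rw [if_pos (by push_cast; omega), e0]
        have e2 : c (2 * j) = C ((-1:ℂ) ^ j) * X ^ (ex 1 0 j) := by
          have e0 : (2 * j) / 2 = j := by omega
          simp only [c]; rw [if_pos (by omega), e0]
        rw [e1, e2, zpow_add₀ (by norm_num)]
        norm_num
        ring
    · obtain ⟨m, n, hmn⟩ := exists_mn ((1:ℕ) * s + 1)
      refine ⟨m, n, hmn, ?_⟩
      have e1 : c (s + (4:ℕ)) = 0 := by simp only [c]; rw [if_neg (by push_cast; omega)]
      have e2 : c s = 0 := by simp only [c]; rw [if_neg h]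
      rw [e1, e2]; simp
  · intro u
    unfold _root_.th
    have : Function.support (fun s => c s * C ((u:ℂ) ^ s)) ⊆ Set.range (fun j : ℤ => 2 * j) := by
      intro s hs
      by_cases h : 2 ∣ s
      · exact ⟨s / 2, by simp only; omega⟩
      · exact absurd (by simp [c, h]) hs
    rw [← inj.tsum_eq this]
    refine tsum_congr fun j => ?_
    have e0 : (2 * j) / 2 = j := by omega
    simp only [c]
    have e3 : (-(u:ℂ)^2) ^ j = (-1) ^ j * (u:ℂ) ^ (2 * j) := by
      rw [zpow_mul, ← mul_zpow]; congr 1; simp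
    rw [if_pos (by omega), e0, e3]
    rw [map_mul]; ring

/-- the exponent of the basis theta functions -/
def fe (g N : ℕ) (d i : ℤ) (j : ℤ) : ℕ := ex (g * N) (g * i + d).toNat j

theorem QP.step {g N : ℕ} {d : ℤ} {c : ℤ → PS} (h : QP g N d 1 c) (i : ℤ)
    (hi0 : 0 ≤ g * i + d) (hi1 : g * i + d < g * N) (j : ℤ) : c (i + N * j) = X ^ (fe g N d i j) * c i := by
  have hlt : (g * i + d).toNat < g * N := by zify; rw [Int.toNat_of_nonneg hi0]; exact hi1
  have hc : ∀ j, ((fe g N d i j : ℕ) : ℤ) = (g * N : ℕ) * tri j + (g * i + d) * j := by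
    intro j; unfold fe; rw [ex_cast _ _ hlt, Int.toNat_of_nonneg hi0]
  have hstep : ∀ j, X ^ (fe g N d i j) * c (i + N * (j + 1)) = X ^ (fe g N d i (j + 1)) * c (i + N * j) := by
    intro j
    have := h (i + N * j) (fe g N d i (j + 1)) (fe g N d i j) (by
      rw [hc, hc, tri_succ]; push_cast; ring)
    rw [map_one, one_mul] at this
    rw [← this]; congr 2; ring
  have hX : ∀ n : ℕ, (X ^ n : PS) ≠ 0 := fun n => pow_ne_zero _ X_ne_zero
  induction j using Int.induction_on with
  | zero =>
    have : fe g N d i 0 = 0 := by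
      have := hc 0
      simp [tri] at this; exact this
    rw [this]; simp
  | succ j ih =>
    apply mul_left_cancel₀ (hX (fe g N d i j))
    rw [hstep, ih]; ring
  | pred j ih =>
    have := hstep (-j - 1)
    rw [sub_add_cancel, ih] at this
    apply mul_left_cancel₀ (hX (fe g N d i (-j)))
    rw [← this]; ring

def resEquiv (N : ℕ) [NeZero N] (lo : ℤ) : Fin N × ℤ ≃ ℤ where
  toFun p := lo + p.1 + N * p.2
  invFun s := (⟨((s - lo) % N).toNat, by
    have hN : (0:ℤ) < N := by exact_mod_cast Nat.pos_of_ne_zero (NeZero.ne N)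
    have := Int.emod_lt_of_pos (s - lo) hN
    have := Int.emod_nonneg (s - lo) hN.ne'
    omega⟩, (s - lo) / N)
  left_inv p := by
    have hN : (0:ℤ) < N := by exact_mod_cast Nat.pos_of_ne_zero (NeZero.ne N)
    obtain ⟨⟨i, hi⟩, j⟩ := p
    have e : lo + (i:ℤ) + N * j - lo = i + N * j := by ring
    have h1 : ((i:ℤ) + N * j) % N = i := by
      rw [Int.add_mul_emod_self_left]; exact Int.emod_eq_of_lt (by positivity) (by exact_mod_cast hi)
    have h2 : ((i:ℤ) + N * j) / N = j := by
      rw [Int.add_mul_ediv_left _ _ hN.ne', Int.ediv_eq_zero_of_lt (by positivity) (by exact_mod_cast hi)]; ring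
    simp only [e]
    ext
    · simp [h1]
    · simp [h2]
  right_inv s := by
    have hN : (0:ℤ) < N := by exact_mod_cast Nat.pos_of_ne_zero (NeZero.ne N)
    have := Int.emod_nonneg (s - lo) hN.ne'
    simp only [Int.toNat_of_nonneg this]
    have := Int.emod_add_mul_ediv (s - lo) N
    linarith

theorem QP.decomp {g N : ℕ} [NeZero N] {d : ℤ} {c : ℤ → PS} (h : QP g N d 1 c) (hc : FS c) (lo : ℤ)
    (h0 : 0 ≤ g * lo + d) (h1 : g * lo + d < g) (w : ℤ → PS) :
    ∑' s, c s * w s = ∑ k : Fin N, c (lo + k) * ∑' j : ℤ, w (lo + k + N * j) * X ^ (fe g N d (lo + k) j) := by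
  have hF := hc.mul_right w
  have hF2 := hF.comp_inj (resEquiv N lo).injective
  rw [← (resEquiv N lo).tsum_eq, hF2.tsum_prod.2, tsum_fintype]
  refine Finset.sum_congr rfl fun k _ => ?_
  have hk : (k:ℤ) + 1 ≤ N := by exact_mod_cast k.2
  have hk0 : (0:ℤ) ≤ k := by positivity
  have g0 : (0:ℤ) ≤ g := by positivity
  have b0 : 0 ≤ g * (lo + k) + d := by nlinarith
  have b1 : g * (lo + k) + d < g * N := by nlinarith
  have hlt : (g * (lo + k) + d).toNat < g * N := by zify; rw [Int.toNat_of_nonneg b0]; exact b1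
  simp only [fe]
  rw [← (ex_fs _ _ hlt _).tml]
  refine tsum_congr fun j => ?_
  show c (lo + k + N * j) * w (lo + k + N * j) = _
  rw [h.step (lo + k) b0 b1 j]
  unfold fe
  ring


theorem th_inv (g : ℕ) (hg : 0 < g) (a : ℂ) (ha : a ≠ 0) : th g 0 a⁻¹ = - C a⁻¹ * th g 0 a := by
  unfold th
  rw [← (ex_fs g 0 hg _).tml, ← (Equiv.subLeft (1:ℤ)).tsum_eq]
  refine tsum_congr fun j => ?_
  have e1 : ex g 0 (1 - j) = ex g 0 j := by
    unfold ex
    have h1 := two_tri j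
    have h2 := two_tri (1 - j)
    have : tri (1 - j) = tri j := by linarith
    rw [this]; simp
  have e2 : (-a⁻¹) ^ (1 - j) = - a⁻¹ * (-a) ^ j := by
    have h0 : -a ≠ 0 := neg_ne_zero.2 ha
    have : -a⁻¹ = (-a)⁻¹ := by rw [inv_neg]
    rw [this, inv_zpow, ← zpow_neg, neg_sub, zpow_sub_one₀ h0]; ring
  simp only [Equiv.subLeft_apply, e1, e2]
  rw [map_mul, map_neg]; ring

/-- the nonvanishing part of the theta function -/
def GG (g : ℕ) (a : ℂ) : PS :=
  EE g * (∏' k : ℕ, (1 - C a * X ^ (g * (k + 1)))) * ∏' k : ℕ, (1 - C a⁻¹ * X ^ (g * (k + 1)))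

theorem GG_inv (g : ℕ) (a : ℂ) : GG g a⁻¹ = GG g a := by
  unfold GG; rw [inv_inv]; ring

theorem th_GG (g : ℕ) (hg : 0 < g) (a : ℂ) (ha : a ≠ 0) : th g 0 a = (1 - C a) * GG g a := by
  rw [jtp g 0 hg a ha]; simp [GG]

theorem tprod_continuous {α : Type*} [TopologicalSpace α] (f : α → ℕ → PS) (h : ∀ a, NP (f a))
    (hc : ∀ k, Continuous fun a => f a k) : Continuous fun a => ∏' k, f a k := by
  rw [continuous_iff_continuousAt]
  intro a0
  unfold ContinuousAt
  rw [ps_tendsto_iff]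
  intro n
  have e : ∀ a, coeff n (∏' k, f a k) = coeff n (∏ k ∈ Finset.range n, f a k) := by
    intro a
    have := X_pow_dvd_iff.1 ((h a).dvd (n+1) n le_rfl) n (Nat.lt_succ_self n)
    rwa [map_sub, sub_eq_zero] at this
  simp only [e]
  have : Filter.Tendsto (fun a => ∏ k ∈ Finset.range n, f a k) (nhds a0) (nhds (∏ k ∈ Finset.range n, f a0 k)) :=
    (continuous_finsetProd _ fun k _ => hc k).tendsto a0
  exact ps_tendsto_iff.1 this n

theorem ps_continuous_C : Continuous (fun a : ℂ => (C a : PS)) := by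
  rw [continuous_iff_continuousAt]
  intro a0
  unfold ContinuousAt
  rw [ps_tendsto_iff]
  intro n
  simp only [coeff_C]
  split_ifs
  · exact continuous_id.tendsto a0
  · exact tendsto_const_nhds

theorem GG_continuous (g : ℕ) (hg : 0 < g) : Continuous (fun a : ℂˣ => GG g (a : ℂ)) := by
  unfold GG
  have hk : ∀ k : ℕ, k + 1 ≤ g * (k + 1) := fun k => Nat.le_mul_of_pos_left _ hg
  refine (continuous_const.mul ?_).mul ?_
  · refine tprod_continuous _ (fun a => np_pow hk _) fun k => ?_
    exact continuous_const.sub ((ps_continuous_C.comp Units.continuous_val).mul continuous_const)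
  · refine tprod_continuous _ (fun a => np_pow hk _) fun k => ?_
    refine continuous_const.sub (Continuous.mul ?_ continuous_const)
    have : (fun a : ℂˣ => (C ((a:ℂ)⁻¹) : PS)) = fun a => C ((a⁻¹ : ℂˣ) : ℂ) := by funext a; simp
    rw [this]
    exact ps_continuous_C.comp (Units.continuous_val.comp continuous_inv)

/-- general span lemma -/
theorem span_gen {ι : Type} [Fintype ι] {g N : ℕ} [NeZero N] {d : ℤ} {f : ℂˣ → PS} (h : IsTh g N d 1 f) (lo : ℤ)
    (h0 : 0 ≤ g * lo + d) (h1 : g * lo + d < g) (B : ℤ → ℂˣ → ℂ) (φ : ι → ℂˣ → PS) (r : ℂ) (hr : r ≠ 0)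
    (hB : ∀ c : ℤ → PS, FS c → (∀ u, f u = ∑' s, c s * C ((u : ℂ) ^ s)) → ∀ u, C r * f u = ∑' s, c s * C (B s u))
    (hφ : ∀ i : ℤ, lo ≤ i → i < lo + N → (fun u => ∑' j : ℤ, (C (B (i + N * j) u) : PS) * X ^ (fe g N d i j)) ∈
      Submodule.span PS (Set.range φ)) : ∃ a : ι → PS, ∀ x, f x = ∑ i, a i * φ i x := by
  obtain ⟨c, hc, q, e⟩ := h
  have h2 := hB c hc e
  have hmem : f ∈ Submodule.span PS (Set.range φ) := by
    have : f = (C r⁻¹ : PS) • ∑ k : Fin N, c (lo + k) • (fun u => ∑' j : ℤ, (C (B (lo + k + N * j) u) : PS) * X ^ (fe g N d (lo + k) j)) := by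
      funext u
      simp only [Pi.smul_apply, Finset.sum_apply, smul_eq_mul]
      rw [← q.decomp hc lo h0 h1 (fun s => C (B s u)), ← h2, ← mul_assoc, ← map_mul, inv_mul_cancel₀ hr]; simp
    rw [this]
    refine Submodule.smul_mem _ _ (Submodule.sum_mem _ fun k _ => Submodule.smul_mem _ _ (hφ _ (by omega) (by omega)))
  rw [Submodule.mem_span_range_iff_exists_fun] at hmem
  obtain ⟨a, ha⟩ := hmem
  refine ⟨a, fun x => ?_⟩
  rw [← ha]
  simp

theorem fe_reflect (g N : ℕ) (d i i' j j' : ℤ) (b0 : 0 ≤ g * i + d) (b0' : 0 ≤ g * i' + d)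
    (h : (g * N : ℤ) * tri j + (g * i + d) * j = (g * N : ℤ) * tri j' + (g * i' + d) * j') :
    fe g N d i j = fe g N d i' j' := by
  unfold fe ex
  rw [Int.toNat_of_nonneg b0, Int.toNat_of_nonneg b0']
  push_cast
  rw [h]


/-- three-term recurrence polynomials -/
def cheb (b : ℂ) : ℕ → Polynomial ℂ
  | 0 => 1
  | 1 => Polynomial.X - Polynomial.C b
  | (k+2) => Polynomial.X * cheb b (k+1) - cheb b k

theorem cheb_deg (b : ℂ) : ∀ k, (cheb b k).natDegree = k ∧ (cheb b k).Monic
  | 0 => by simp [cheb]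
  | 1 => by simp [cheb, Polynomial.monic_X_sub_C]
  | (k+2) => by
    obtain ⟨h1, h2⟩ := cheb_deg b (k+1)
    obtain ⟨h3, h4⟩ := cheb_deg b k
    have hm : (Polynomial.X * cheb b (k+1)).Monic := Polynomial.monic_X.mul h2
    have hd : (Polynomial.X * cheb b (k+1)).natDegree = k + 2 := by
      rw [Polynomial.natDegree_X_mul h2.ne_zero, h1]
    have hlt : (cheb b k).degree < (Polynomial.X * cheb b (k+1)).degree := by
      rw [Polynomial.degree_eq_natDegree h4.ne_zero, Polynomial.degree_eq_natDegree hm.ne_zero, h3, hd]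
      exact_mod_cast (by omega : k < k + 2)
    constructor
    · show (Polynomial.X * cheb b (k+1) - cheb b k).natDegree = _
      rw [Polynomial.natDegree_sub_eq_left_of_natDegree_lt (by rw [h3, hd]; omega), hd]
    · exact hm.sub_of_left hlt

theorem cheb_eval {U : Type*} (b : ℂ) (a : ℕ → U → ℂ) (w : U → ℂ) (h0 : ∀ u, a 0 u = b * a 1 u)
    (h : ∀ k u, a (k+2) u = w u * a (k+1) u - a k u) (u : U) : ∀ k, a (k+1) u = a 1 u * (cheb b k).eval (w u)
  | 0 => by simp [cheb]
  | 1 => by rw [h, h0]; simp [cheb]; ring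
  | (k+2) => by
    rw [h, cheb_eval b a w h0 h u (k+1), cheb_eval b a w h0 h u k]
    simp [cheb]; ring

theorem weyl_det {U : Type*} (n : ℕ) (b : ℂ) (a : ℕ → U → ℂ) (w : U → ℂ) (h0 : ∀ u, a 0 u = b * a 1 u)
    (h : ∀ k u, a (k+2) u = w u * a (k+1) u - a k u) (u : Fin n → U) :
    (Matrix.of fun i j : Fin n => a (i+1) (u j)).det =
      (∏ j, a 1 (u j)) * ∏ i : Fin n, ∏ j ∈ Finset.Ioi i, (w (u j) - w (u i)) := by
  rw [← Matrix.det_vandermonde (fun j => w (u j)),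
    Matrix.det_eval_matrixOfPolynomials_eq_det_vandermonde (fun j => w (u j)) (fun k => cheb b k)
      (fun i => (cheb_deg b i).1) (fun i => (cheb_deg b i).2), ← Matrix.det_mul_column, ← Matrix.det_transpose]
  congr 1
  ext i j
  exact cheb_eval b a w h0 h (u _) _

/-- slot decomposition of a product over pairs -/
theorem pair_slot {n : ℕ} {M : Type*} [CommMonoid M] (F : Fin n → Fin n → M) (k : Fin n) :
    ∏ i : Fin n, ∏ j ∈ Finset.Ioi i, F i j =
      (∏ i ∈ Finset.univ.erase k, ∏ j ∈ (Finset.Ioi i).erase k, F i j) *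
        ∏ j ∈ Finset.univ.erase k, (if k < j then F k j else F j k) := by
  classical
  rw [← Finset.mul_prod_erase Finset.univ _ (Finset.mem_univ k)]
  have h1 : ∏ j ∈ Finset.Ioi k, F k j = ∏ j ∈ Finset.univ.erase k, (if k < j then F k j else 1) := by
    rw [← Finset.prod_filter]
    refine Finset.prod_congr ?_ fun _ _ => rfl
    ext j; simp; intro h; exact h.ne'
  have h2 : ∀ i ∈ Finset.univ.erase k, ∏ j ∈ Finset.Ioi i, F i j =
      (if k < i then 1 else F i k) * ∏ j ∈ (Finset.Ioi i).erase k, F i j := by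
    intro i hi
    have hik : i ≠ k := Finset.ne_of_mem_erase hi
    by_cases h : k < i
    · rw [if_pos h, one_mul, Finset.erase_eq_of_notMem]
      simp [h.le]
    · rw [if_neg h, Finset.mul_prod_erase]
      simp; exact lt_of_le_of_ne (not_lt.1 h) hik
  rw [h1, Finset.prod_congr rfl h2, Finset.prod_mul_distrib, ← mul_assoc, ← Finset.prod_mul_distrib, mul_comm]
  congr 1
  refine Finset.prod_congr rfl fun j _ => ?_
  split_ifs <;> simp

theorem pair_perm {n : ℕ} {M : Type*} [CommMonoid M] (F : Fin n → Fin n → M) (hF : ∀ i j, F i j = F j i)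
    (σ : Equiv.Perm (Fin n)) :
    ∏ i : Fin n, ∏ j ∈ Finset.Ioi i, F (σ i) (σ j) = ∏ i : Fin n, ∏ j ∈ Finset.Ioi i, F i j := by
  rw [Finset.prod_sigma', Finset.prod_sigma']
  let f : (Equiv.Perm (Fin n)) → (Σ _ : Fin n, Fin n) → (Σ _ : Fin n, Fin n) := fun σ p => ⟨min (σ p.1) (σ p.2), max (σ p.1) (σ p.2)⟩
  have hf : ∀ σ : Equiv.Perm (Fin n), ∀ p ∈ (Finset.univ : Finset (Fin n)).sigma (fun i => Finset.Ioi i), f σ p ∈ (Finset.univ : Finset (Fin n)).sigma (fun i => Finset.Ioi i) := by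
    rintro σ ⟨i, j⟩ h
    simp only [f, Finset.mem_sigma, Finset.mem_univ, Finset.mem_Ioi, true_and] at h ⊢
    simp only [min_lt_max]
    exact fun e => h.ne (σ.injective e)
  have hinv : ∀ σ : Equiv.Perm (Fin n), ∀ p ∈ (Finset.univ : Finset (Fin n)).sigma (fun i => Finset.Ioi i), f σ.symm (f σ p) = p := by
    rintro σ ⟨i, j⟩ h
    simp only [Finset.mem_sigma, Finset.mem_univ, Finset.mem_Ioi, true_and] at h
    simp only [f]
    rcases le_total (σ i) (σ j) with h2 | h2
    · simp [h2, h.le]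
    · simp [h2, h.le]
  refine Finset.prod_nbij' (f σ) (f σ.symm) (hf σ) (hf σ.symm) (hinv σ) (fun p hp => by simpa using hinv σ.symm p hp) ?_
  rintro ⟨i, j⟩ h
  simp only [f]
  rcases le_total (σ i) (σ j) with h2 | h2
  · simp [h2]
  · simp [h2, hF (σ i)]


def expU (x : ℂ) : ℂˣ := Units.mk0 (Complex.exp x) (Complex.exp_ne_zero x)

theorem expU_val (x : ℂ) : (expU x : ℂ) = Complex.exp x := rfl

theorem expU_continuous : Continuous expU := by
  rw [Units.continuous_iff]
  refine ⟨Complex.continuous_exp, ?_⟩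
  have : (fun x => ((expU x)⁻¹ : ℂˣ).val) = fun x => Complex.exp (-x) := by
    funext x; simp [expU, Complex.exp_neg]
  show Continuous fun x => ((expU x)⁻¹ : ℂˣ).val
  rw [this]; fun_prop

def Sh (e : ℂ) (m : ℤ) : ℂ := Complex.exp (e * m) - Complex.exp (-(e * m))

theorem Sh_slope (m : ℤ) : Filter.Tendsto (fun e : ℂ => Sh e m / e) (nhdsWithin 0 {0}ᶜ) (nhds (2 * m)) := by
  have h : HasDerivAt (fun e : ℂ => Sh e m) (2 * m) 0 := by
    unfold Sh
    have h1 : HasDerivAt (fun e : ℂ => e * (m:ℂ)) (m:ℂ) 0 := by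
      simpa using (hasDerivAt_id (0:ℂ)).mul_const (m:ℂ)
    have := h1.cexp.sub h1.neg.cexp
    refine HasDerivAt.congr_deriv this ?_
    simp; ring
  have := hasDerivAt_iff_tendsto_slope.1 h
  refine this.congr fun e => ?_
  simp [slope_def_field, Sh]

theorem Sh_ne (a : ℤ) (ha : a ≠ 0) : ∀ᶠ e : ℂ in nhdsWithin 0 {0}ᶜ, Sh e a ≠ 0 := by
  have h := (Sh_slope a).eventually_ne (b₂ := (0:ℂ)) (by simpa using ha)
  filter_upwards [h] with e he h0
  exact he (by rw [h0]; simp)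

theorem Sh_lim (m a : ℤ) (ha : a ≠ 0) : Filter.Tendsto (fun e : ℂ => Sh e m / Sh e a) (nhdsWithin 0 {0}ᶜ)
    (nhds (m / a : ℂ)) := by
  have h := (Sh_slope m).div (Sh_slope a) (by simpa using ha)
  have e1 : (2 * m / (2 * a) : ℂ) = m / a := by
    rw [mul_div_mul_left _ _ two_ne_zero]
  rw [e1] at h
  refine h.congr' ?_
  filter_upwards [self_mem_nhdsWithin] with e he
  have : e ≠ 0 := he
  simp only [Pi.div_apply]
  rw [div_div_div_cancel_right₀ this]

def ww (u : ℂˣ) : ℂ := (u : ℂ) + (u : ℂ)⁻¹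

theorem ww_exp (e : ℂ) (a b : ℤ) : ww (expU (2 * e * a)) - ww (expU (2 * e * b)) = Sh e (a + b) * Sh e (a - b) := by
  unfold ww Sh
  simp only [expU_val, ← Complex.exp_neg]
  have h : ∀ x y : ℂ, Complex.exp x * Complex.exp y = Complex.exp (x + y) := fun x y => (Complex.exp_add x y).symm
  rw [sub_mul, mul_sub, mul_sub]
  simp only [h]
  push_cast
  have e1 : e * (a + b) + e * (a - b) = 2 * e * a := by ring
  have e2 : e * (a + b) + -(e * (a - b)) = 2 * e * b := by ring
  have e3 : -(e * (a + b)) + e * (a - b) = -(2 * e * b) := by ring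
  have e4 : -(e * (a + b)) + -(e * (a - b)) = -(2 * e * a) := by ring
  rw [e1, e2, e3, e4]; ring

/-- pair factor -/
def Fp (g : ℕ) (x w : ℂˣ) : PS := C ((x:ℂ)⁻¹) * (th g 0 (w * x : ℂˣ) * th g 0 (w⁻¹ * x : ℂˣ))

def G2 (g : ℕ) (x w : ℂˣ) : PS := GG g (x * w : ℂˣ) * GG g (x / w : ℂˣ)

theorem G2_symm (g : ℕ) (x w : ℂˣ) : G2 g x w = G2 g w x := by
  unfold G2
  rw [mul_comm x w]
  congr 1
  rw [← GG_inv]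
  congr 1
  simp

theorem Fp_eq (g : ℕ) (hg : 0 < g) (x w : ℂˣ) : Fp g x w = C (ww x - ww w) * G2 g x w := by
  unfold Fp G2
  rw [th_GG g hg _ (Units.ne_zero _), th_GG g hg _ (Units.ne_zero _)]
  have e1 : w * x = x * w := mul_comm _ _
  have e2 : w⁻¹ * x = x / w := by rw [mul_comm]; rfl
  rw [e1, e2]
  have : (C (ww x - ww w) : PS) = C ((x:ℂ)⁻¹) * (1 - C ((x * w : ℂˣ) : ℂ)) * (1 - C ((x / w : ℂˣ):ℂ)) := by
    rw [← map_one C, ← map_sub, ← map_sub, ← map_mul, ← map_mul]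
    congr 1
    have hx := x.ne_zero
    have hw := w.ne_zero
    unfold ww
    push_cast
    field_simp
    ring
  rw [this]; ring

theorem Fp_th (g : ℕ) (hg : 0 < g) (w : ℂˣ) : IsTh g 2 g 1 (fun x => Fp g x w) := by
  have := ((IsTh.th g hg w).mul (IsTh.th g hg w⁻¹)).inv
  refine this.congr rfl (by ring) ?_ (fun u => ?_)
  · simp
  · simp [Fp]

theorem Fp_inv (g : ℕ) (hg : 0 < g) (x w : ℂˣ) : Fp g x⁻¹ w = Fp g x w := by
  rw [Fp_eq g hg, Fp_eq g hg]
  have e1 : ww x⁻¹ = ww x := by unfold ww; push_cast; rw [inv_inv]; ring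
  have e2 : G2 g x⁻¹ w = G2 g x w := by
    unfold G2
    rw [← GG_inv g ((x⁻¹ * w : ℂˣ) : ℂ), ← GG_inv g ((x⁻¹ / w : ℂˣ) : ℂ), ← Units.val_inv_eq_inv_val, ← Units.val_inv_eq_inv_val]
    have e3 : (x⁻¹ * w)⁻¹ = x / w := by rw [mul_inv, inv_inv]; rfl
    have e4 : (x⁻¹ / w)⁻¹ = x * w := by simp [mul_comm]
    rw [e3, e4, mul_comm]
  rw [e1, e2]

def RR {n : ℕ} (g : ℕ) (H : ℂˣ → PS) (u : Fin n → ℂˣ) : PS :=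
  (∏ i, H (u i)) * ∏ i : Fin n, ∏ j ∈ Finset.Ioi i, G2 g (u i) (u j)

theorem RR_slot {n : ℕ} (g : ℕ) (hg : 0 < g) (B : ℤ → ℂˣ → ℂ) (b : ℂ) (H : ℂˣ → PS)
    (hB0 : ∀ u, B 0 u = b * B 1 u) (hBrec : ∀ s u, B (s + 2) u = ww u * B (s + 1) u - B s u)
    (u : Fin n → ℂˣ) (k : Fin n) : ∃ K : PS, ∀ x,
      C (Matrix.of fun i j : Fin n => B (i + 1) ((Function.update u k x) j)).det * RR g H (Function.update u k x) =
        K * ((C (B 1 x) * H x) * ∏ j ∈ Finset.univ.erase k, Fp g x (u j)) := by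
  refine ⟨(∏ j ∈ Finset.univ.erase k, C (B 1 (u j)) * H (u j)) *
    ((∏ i ∈ Finset.univ.erase k, ∏ j ∈ (Finset.Ioi i).erase k, (C (ww (u j) - ww (u i)) * G2 g (u i) (u j))) *
      ∏ j ∈ Finset.univ.erase k, (if k < j then -1 else 1)), fun x => ?_⟩
  have hw := weyl_det n b (fun k u => B (k:ℤ) u) ww (by simpa using hB0) (by
    intro k u; have := hBrec k u; push_cast at this ⊢; exact this) (Function.update u k x)
  have hw2 : (Matrix.of fun i j : Fin n => B (i + 1) ((Function.update u k x) j)).det = _ :=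
    Eq.trans (by congr 1) hw
  rw [hw2]
  unfold RR
  rw [map_mul, map_prod, map_prod]
  simp only [map_prod]
  have e1 : ∀ a b c d : PS, a * b * (c * d) = (a * c) * (b * d) := by intros; ring
  have d2 : ∀ v : Fin n → ℂˣ, (∏ i : Fin n, ∏ j ∈ Finset.Ioi i, (C (ww (v j) - ww (v i)) : PS)) *
      (∏ i : Fin n, ∏ j ∈ Finset.Ioi i, G2 g (v i) (v j)) =
      ∏ i : Fin n, ∏ j ∈ Finset.Ioi i, (C (ww (v j) - ww (v i)) * G2 g (v i) (v j)) := by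
    intro v
    simp only [Finset.prod_mul_distrib]
  rw [e1, ← Finset.prod_mul_distrib, d2]
  rw [pair_slot _ k, ← Finset.mul_prod_erase Finset.univ _ (Finset.mem_univ k)]
  have e2 : ∀ j ∈ Finset.univ.erase k, Function.update u k x j = u j := fun j hj =>
    Function.update_of_ne (Finset.ne_of_mem_erase hj) _ _
  have e3 : ∏ j ∈ Finset.univ.erase k, (C (B ((1:ℕ):ℤ) (Function.update u k x j)) * H (Function.update u k x j)) =
      ∏ j ∈ Finset.univ.erase k, C (B 1 (u j)) * H (u j) :=
    Finset.prod_congr rfl fun j hj => by rw [e2 j hj]; simp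
  have e4 : ∏ i ∈ Finset.univ.erase k, ∏ j ∈ (Finset.Ioi i).erase k,
      (C (ww (Function.update u k x j) - ww (Function.update u k x i)) *
        G2 g (Function.update u k x i) (Function.update u k x j)) =
      ∏ i ∈ Finset.univ.erase k, ∏ j ∈ (Finset.Ioi i).erase k, (C (ww (u j) - ww (u i)) * G2 g (u i) (u j)) :=
    Finset.prod_congr rfl fun i hi => Finset.prod_congr rfl fun j hj => by
      rw [e2 i hi, e2 j (by simp; exact Finset.ne_of_mem_erase hj)]
  have e5 : ∏ j ∈ Finset.univ.erase k, (if k < j then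
      (C (ww (Function.update u k x j) - ww (Function.update u k x k)) *
        G2 g (Function.update u k x k) (Function.update u k x j)) else
        (C (ww (Function.update u k x k) - ww (Function.update u k x j)) *
        G2 g (Function.update u k x j) (Function.update u k x k))) =
      ∏ j ∈ Finset.univ.erase k, ((if k < j then -1 else 1) * Fp g x (u j)) :=
    Finset.prod_congr rfl fun j hj => by
      rw [e2 j hj, Function.update_self, Fp_eq g hg]
      split_ifs
      · have : ww (u j) - ww x = -(ww x - ww (u j)) := by ring
        rw [this, map_neg]; ring
      · rw [G2_symm g (u j)]; ring
  rw [Finset.prod_mul_distrib] at e5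
  rw [e3, e4, e5, Function.update_self]
  simp only [Nat.cast_one]
  ring


theorem RR_continuous {n : ℕ} (g : ℕ) (hg : 0 < g) (H : ℂˣ → PS) (hH : Continuous H) :
    Continuous (fun u : Fin n → ℂˣ => RR g H u) := by
  unfold RR
  refine Continuous.mul (continuous_finsetProd _ fun i _ => hH.comp (continuous_apply i)) ?_
  refine continuous_finsetProd _ fun i _ => continuous_finsetProd _ fun j _ => ?_
  unfold G2
  have hG := GG_continuous g hg
  refine Continuous.mul ?_ ?_
  · exact hG.comp ((continuous_apply i).mul (continuous_apply j))
  · exact hG.comp ((continuous_apply i).div' (continuous_apply j))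

theorem RR_perm {n : ℕ} (g : ℕ) (H : ℂˣ → PS) (u : Fin n → ℂˣ) (σ : Equiv.Perm (Fin n)) :
    RR g H (fun i => u (σ i)) = RR g H u := by
  unfold RR
  rw [pair_perm (fun i j => G2 g (u i) (u j)) (fun i j => G2_symm g _ _) σ, Equiv.prod_comp σ (fun i => H (u i))]

theorem bc_engine (n g N N0 : ℕ) [NeZero N] (hg : 0 < g) (d d0 : ℤ) (B : ℤ → ℂˣ → ℂ) (b : ℂ) (H : ℂˣ → PS)
    (hB0 : ∀ u, B 0 u = b * B 1 u) (hBrec : ∀ s u, B (s + 2) u = ww u * B (s + 1) u - B s u)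
    (ownTh : IsTh g N0 d0 1 (fun u => C (B 1 u) * H u)) (hN : (N : ℤ) = N0 + 2 * (n - 1)) (hd : d = d0 + g * (n - 1))
    (sg : ℂˣ → ℂ) (hsg : ∀ u, C (B 1 u⁻¹) * H u⁻¹ = C (sg u) * (C (B 1 u) * H u))
    (hb : ∀ i : Fin n, 0 ≤ (g : ℤ) * (i + 1) + d ∧ (g : ℤ) * (i + 1) + d < g * N)
    (hspan : ∀ f : ℂˣ → PS, IsTh g N d 1 f → (∀ u, f u⁻¹ = C (sg u) * f u) → ∃ a : Fin n → PS, ∀ x,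
      f x = ∑ i : Fin n, a i * ∑' c : ℤ, C (B (i + 1 + N * c) x) * X ^ (fe g N d (i + 1) c))
    (p : Fin n → ℂˣ) (hp : ∀ (i j : Fin n) (c : ℤ), B (i + 1 + N * c) (p j) = B (i + 1) (p j))
    (hp1 : ∀ j, B 1 (p j) ≠ 0) (hp2 : ∀ i j : Fin n, i < j → ww (p j) ≠ ww (p i))
    (hτ : ∀ i : Fin n, ∑' c : ℤ, (X ^ (fe g N d (i + 1) c) : PS) ≠ 0)
    (hH : Continuous H)
    (hv : ℤ → ℤ) (ρ : ℂ → ℤ → ℂ) (hρ0 : ∀ e v, ρ e v ≠ 0) (hρ : ∀ v, Filter.Tendsto (fun e => ρ e v) (nhdsWithin 0 {0}ᶜ) (nhds 1))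
    (hsw : ∀ e v x, B v (expU (2 * e * hv x)) = ρ e x * (ρ e v)⁻¹ * B x (expU (2 * e * hv v)))
    (ℓ : ℤ → ℂ) (hℓ : ∀ (i : Fin n) v, Filter.Tendsto (fun e => B 1 (expU (2 * e * hv v)) / B 1 (expU (2 * e * hv (i + 1))))
      (nhdsWithin 0 {0}ᶜ) (nhds (ℓ v / ℓ (i + 1))))
    (hℓ0 : ∀ i : Fin n, ∀ᶠ e in nhdsWithin 0 {0}ᶜ, B 1 (expU (2 * e * hv (i + 1))) ≠ 0)
    (hvd : ∀ i j : Fin n, i < j → hv (j + 1) + hv (i + 1) ≠ 0 ∧ hv (j + 1) - hv (i + 1) ≠ 0) :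
    RR g H (fun _ : Fin n => 1) * ∏ i : Fin n, ∑' c : ℤ, (X ^ (fe g N d (i + 1) c) : PS) =
      RR g H p * ∑' c : Fin n → ℤ, C ((∏ i : Fin n, ℓ (i + 1 + N * c i) / ℓ (i + 1)) *
        ∏ i : Fin n, ∏ j ∈ Finset.Ioi i, ((((hv (j + 1 + N * c j) + hv (i + 1 + N * c i) : ℤ) : ℂ) / ((hv (j + 1) + hv (i + 1) : ℤ) : ℂ)) *
          (((hv (j + 1 + N * c j) - hv (i + 1 + N * c i) : ℤ) : ℂ) / ((hv (j + 1) - hv (i + 1) : ℤ) : ℂ)))) *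
        X ^ (∑ i : Fin n, fe g N d (i + 1) (c i)) := by
  have hlt : ∀ i : Fin n, ((g:ℤ) * (i + 1) + d).toNat < g * N := by
    intro i; zify; rw [Int.toNat_of_nonneg (hb i).1]; exact (hb i).2
  have hw := fun u : Fin n → ℂˣ => weyl_det n b (fun k u => B (k:ℤ) u) ww (by simpa using hB0) (by
    intro k u; have := hBrec k u; push_cast at this ⊢; exact this) u
  have hw : ∀ u : Fin n → ℂˣ, (Matrix.of fun i j : Fin n => B (i + 1) (u j)).det =
      (∏ j, B 1 (u j)) * ∏ i : Fin n, ∏ j ∈ Finset.Ioi i, (ww (u j) - ww (u i)) := fun u => by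
    have := hw u
    simpa using this
  have hfeF : ∀ (i : Fin n) (m : ℕ), {c : ℤ | fe g N d (i + 1) c < m}.Finite := by
    intro i m
    refine (abs_le_fin m).subset ?_
    intro j hj
    have h1 := ex_ge _ _ (hlt i) j
    have h2 : ex (g * N) ((g:ℤ) * (i + 1) + d).toNat j < m := hj
    simp only [Set.mem_ofPred_eq]
    omega
  -- determinant with swapped roles
  have hdet : ∀ (e : ℂ) (v : Fin n → ℤ), (Matrix.of fun i j : Fin n => B (v i) (expU (2 * e * hv (j + 1)))).det =
      (∏ j : Fin n, ρ e (j + 1)) * (∏ i, (ρ e (v i))⁻¹) * ((∏ i, B 1 (expU (2 * e * hv (v i)))) *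
        ∏ i : Fin n, ∏ j ∈ Finset.Ioi i, (Sh e (hv (v j) + hv (v i)) * Sh e (hv (v j) - hv (v i)))) := by
    intro e v
    have h1 := hw (fun i => expU (2 * e * hv (v i)))
    simp only [ww_exp] at h1
    rw [← h1, ← Matrix.det_transpose (Matrix.of fun i j : Fin n => B (i + 1) (expU (2 * e * hv (v j)))), mul_assoc,
      ← Matrix.det_mul_column, ← Matrix.det_mul_row]
    congr 1
    ext i j
    simp only [Matrix.of_apply, Matrix.transpose_apply]
    rw [hsw e (v i) (j+1)]
    ring
  have hR1 : Filter.Tendsto (fun e : ℂ => RR g H (fun j : Fin n => expU (2 * e * hv (j + 1)))) (nhdsWithin 0 {0}ᶜ)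
      (nhds (RR g H (fun _ : Fin n => 1))) := by
    have hc : Continuous (fun e : ℂ => (fun j : Fin n => expU (2 * e * hv (j + 1)))) := by
      refine continuous_pi fun j => expU_continuous.comp (by fun_prop)
    have := ((RR_continuous g hg H hH).comp hc).tendsto 0
    have e0 : (fun j : Fin n => expU (2 * 0 * hv (j + 1))) = fun _ => 1 := by
      funext j; ext; simp [expU]
    simp only [Function.comp_def, e0] at this
    exact this.mono_left nhdsWithin_le_nhds
  have hSne : ∀ᶠ e : ℂ in nhdsWithin 0 {0}ᶜ, ∀ i j : Fin n, i < j →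
      Sh e (hv (j+1) + hv (i+1)) ≠ 0 ∧ Sh e (hv (j+1) - hv (i+1)) ≠ 0 := by
    rw [Filter.eventually_all]; intro i
    rw [Filter.eventually_all]; intro j
    by_cases h : i < j
    · filter_upwards [Sh_ne _ (hvd i j h).1, Sh_ne _ (hvd i j h).2] with e h1 h2 _ using ⟨h1, h2⟩
    · exact Filter.Eventually.of_forall fun e h' => absurd h' h
  have hBne : ∀ᶠ e : ℂ in nhdsWithin 0 {0}ᶜ, ∀ i : Fin n, B 1 (expU (2 * e * hv (i + 1))) ≠ 0 := by
    rw [Filter.eventually_all]; exact hℓ0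
  refine engine (fun (i : Fin n) x => ∑' c : ℤ, C (B (i + 1 + N * c) x) * X ^ (fe g N d (i + 1) c))
    (fun i c u => B (i + 1 + N * c) u) (fun i c => fe g N d (i + 1) c) p _ (RR g H) ?_ (RR_perm g H) (fun i u => rfl) hfeF
    ?_ ?_ hτ (l := nhdsWithin (0:ℂ) {0}ᶜ) (fun e j => expU (2 * e * hv (j + 1))) ?_ _ hR1 _ ?_
  · intro u k
    obtain ⟨K, hK⟩ := RR_slot g hg B b H hB0 hBrec u k
    simp only [mul_zero, add_zero]
    have hcard : ((Finset.univ.erase k).card : ℤ) = n - 1 := by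
      rw [Finset.card_erase_of_mem (Finset.mem_univ k), Finset.card_univ, Fintype.card_fin]
      have := k.pos
      omega
    refine hspan _ ?_ ?_
    · refine ((ownTh.mul (IsTh.prod (Finset.univ.erase k) (fun j _ => Fp_th g hg (u j)))).cmul K).congr ?_ ?_ ?_ hK
      · zify
        rw [Finset.sum_const, hN]
        push_cast
        rw [nsmul_eq_mul, hcard]; ring
      · rw [Finset.sum_const, hd, nsmul_eq_mul, hcard]; ring
      · simp
    · intro x
      simp only [hK]
      rw [hsg]
      simp only [Fp_inv g hg]
      ring
  · intro i j
    simp only [hp, mul_zero, add_zero]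
    have := (ex_fs _ _ (hlt i) (fun _ => 1)).tml (C (B (i + 1) (p j)))
    simp only [one_mul] at this
    rw [mul_comm]
    exact this
  · simp only [mul_zero, add_zero]
    rw [hw]
    refine mul_ne_zero (Finset.prod_ne_zero_iff.2 fun j _ => hp1 j) ?_
    refine Finset.prod_ne_zero_iff.2 fun i _ => Finset.prod_ne_zero_iff.2 fun j hj => ?_
    exact sub_ne_zero.2 (hp2 i j (Finset.mem_Ioi.1 hj))
  · filter_upwards [hSne, hBne] with e h1 h2
    simp only [mul_zero, add_zero]
    rw [hdet e (fun i => i + 1)]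
    refine mul_ne_zero (mul_ne_zero ?_ ?_) (mul_ne_zero ?_ ?_)
    · exact Finset.prod_ne_zero_iff.2 fun j _ => hρ0 _ _
    · exact Finset.prod_ne_zero_iff.2 fun j _ => inv_ne_zero (hρ0 _ _)
    · exact Finset.prod_ne_zero_iff.2 fun j _ => h2 j
    · refine Finset.prod_ne_zero_iff.2 fun i _ => Finset.prod_ne_zero_iff.2 fun j hj => ?_
      exact mul_ne_zero (h1 i j (Finset.mem_Ioi.1 hj)).1 (h1 i j (Finset.mem_Ioi.1 hj)).2
  · intro c
    simp only [mul_zero, add_zero]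
    have hl1 : Filter.Tendsto (fun e => (∏ i : Fin n, ((ρ e (i + 1 + N * c i))⁻¹ / (ρ e (i + 1))⁻¹)) *
        ((∏ i : Fin n, (B 1 (expU (2 * e * hv (i + 1 + N * c i))) / B 1 (expU (2 * e * hv (i + 1))))) *
        ∏ i : Fin n, ∏ j ∈ Finset.Ioi i, ((Sh e (hv (j + 1 + N * c j) + hv (i + 1 + N * c i)) / Sh e (hv (j + 1) + hv (i + 1))) *
          (Sh e (hv (j + 1 + N * c j) - hv (i + 1 + N * c i)) / Sh e (hv (j + 1) - hv (i + 1))))))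
        (nhdsWithin 0 {0}ᶜ) (nhds (1 * ((∏ i : Fin n, ℓ (i + 1 + N * c i) / ℓ (i + 1)) *
        ∏ i : Fin n, ∏ j ∈ Finset.Ioi i, ((((hv (j + 1 + N * c j) + hv (i + 1 + N * c i) : ℤ) : ℂ) / ((hv (j + 1) + hv (i + 1) : ℤ) : ℂ)) *
          (((hv (j + 1 + N * c j) - hv (i + 1 + N * c i) : ℤ) : ℂ) / ((hv (j + 1) - hv (i + 1) : ℤ) : ℂ)))))) := by
      refine Filter.Tendsto.mul ?_ (Filter.Tendsto.mul ?_ ?_)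
      · have := tendsto_finsetProd (Finset.univ : Finset (Fin n)) (fun i _ => (((hρ (i + 1 + N * c i)).inv₀ one_ne_zero).div
          ((hρ (i + 1)).inv₀ one_ne_zero) (by simp)))
        simpa using this
      · exact tendsto_finsetProd _ fun i _ => hℓ i _
      · refine tendsto_finsetProd _ fun i _ => tendsto_finsetProd _ fun j hj => ?_
        have h := hvd i j (Finset.mem_Ioi.1 hj)
        exact (Sh_lim _ _ h.1).mul (Sh_lim _ _ h.2)
    rw [one_mul] at hl1
    refine hl1.congr fun e => ?_
    rw [hdet e (fun i => i + 1 + N * c i), hdet e (fun i => i + 1)]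
    have hr : (∏ j : Fin n, ρ e (j + 1)) ≠ 0 := Finset.prod_ne_zero_iff.2 fun j _ => hρ0 _ _
    rw [mul_assoc, mul_assoc, mul_div_mul_left _ _ hr, mul_div_mul_comm, mul_div_mul_comm]
    simp only [← Finset.prod_div_distrib, mul_div_mul_comm]


theorem tsum_refl (f f' : ℤ → PS) (k : ℤ) (h : ∀ j, f j = f' (k - j)) : ∑' j, f j = ∑' j, f' j := by
  rw [← (Equiv.subLeft k).tsum_eq f']
  exact tsum_congr h

theorem ps_add_self {f : PS} (h : f = -f) : f = 0 := by
  ext n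
  have := congrArg (coeff n) h
  simp only [map_neg] at this
  rw [map_zero]
  exact self_eq_neg.1 this

theorem zpow_prim {N : ℕ} (w : ℂˣ) (hw : w ^ N = 1) (k s c : ℤ) : ((w ^ k : ℂˣ) : ℂ) ^ (s + N * c) = ((w ^ k : ℂˣ) : ℂ) ^ s := by
  have : (w ^ k) ^ (s + N * c) = (w ^ k) ^ s := by
    rw [zpow_add, ← zpow_mul w k (N * c)]
    have : k * (N * c) = N * (k * c) := by ring
    rw [this, zpow_mul w N, zpow_natCast, hw]; simp
  rw [← Units.val_zpow_eq_zpow_val, this, Units.val_zpow_eq_zpow_val]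

theorem prim_zpow_ne {N : ℕ} {w : ℂˣ} (hw : IsPrimitiveRoot w N) (k : ℤ) (h : ¬ (N:ℤ) ∣ k) : w ^ k ≠ 1 := by
  rw [Ne, hw.zpow_eq_one_iff_dvd]; exact h

theorem ww_ne {x y : ℂˣ} (h1 : x * y ≠ 1) (h2 : x * y⁻¹ ≠ 1) : ww x ≠ ww y := by
  intro h
  unfold ww at h
  have hx := x.ne_zero
  have hy := y.ne_zero
  have : ((x:ℂ) * y - 1) * (x - y) = 0 := by
    field_simp at h
    linear_combination h
  rcases mul_eq_zero.1 this with h | h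
  · apply h1; ext; push_cast; linear_combination h
  · apply h2; ext; push_cast
    have : (x:ℂ) = y := by linear_combination h
    rw [this]; exact mul_inv_cancel₀ hy

theorem expU_zpow (x : ℂ) (v : ℤ) : ((expU x : ℂˣ) : ℂ) ^ v = Complex.exp (v * x) := by
  rw [expU_val, Complex.exp_int_mul]

/-- the τ sums -/
theorem tau_th (N i : ℕ) : ∑' c : ℤ, (X ^ (ex N i c) : PS) = th N i (-1) := by
  unfold th; simp

theorem tau_ne (N i : ℕ) (h0 : 0 < i) (hi : i < N) : th N i (-1) ≠ 0 := by
  intro h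
  have h2 := congrArg constantCoeff h
  rw [jtp N i hi (-1) (by norm_num)] at h2
  have n1 : NP (fun k : ℕ => (1 - C (-1:ℂ) * X ^ (N * (k + 1) + i) : PS)) := np_pow (fun k => by
    have : k + 1 ≤ N * (k+1) := Nat.le_mul_of_pos_left _ (by omega)
    omega) _
  have n2 : NP (fun k : ℕ => (1 - C (-1:ℂ)⁻¹ * X ^ (N * (k + 1) - i) : PS)) := np_pow (fun k => by
    have : (N - i) * (k+1) ≤ N * (k + 1) - i := by
      rw [Nat.sub_mul]
      have : i * 1 ≤ i * (k + 1) := Nat.mul_le_mul_left _ (by omega)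
      omega
    have : k + 1 ≤ (N-i) * (k+1) := Nat.le_mul_of_pos_left _ (by omega)
    omega) _
  have n3 := (np_qf N (by omega)).tprod_const
  simp only [map_mul, map_sub, map_one, n1.tprod_const, n2.tprod_const, map_pow, constantCoeff_X, map_zero] at h2
  rw [show constantCoeff (EE N) = 1 from n3] at h2
  simp [h0.ne'] at h2

def BC (s : ℤ) (u : ℂˣ) : ℂ := (u:ℂ) ^ s - (u:ℂ) ^ (-s)

theorem BC_neg (s u) : BC (-s) u = - BC s u := by unfold BC; rw [neg_neg]; ring

theorem C_span (n : ℕ) (f : ℂˣ → PS) (hf : IsTh 1 (2 * n + 2) (n + 1) 1 f) (hs : ∀ u, f u⁻¹ = C (-1) * f u) :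
    ∃ a : Fin n → PS, ∀ x,
      f x = ∑ i : Fin n, a i * ∑' c : ℤ, C (BC (i + 1 + (2 * n + 2 : ℕ) * c) x) * X ^ (fe 1 (2 * n + 2) (n + 1) (i + 1) c) := by
  refine span_gen hf (-(n+1)) (by push_cast; omega) (by push_cast; omega) BC _ 2 two_ne_zero ?_ ?_
  · intro c hc e u
    have h1 := e u
    have h2 := e u⁻¹
    rw [hs] at h2
    have h3 : C 2 * f u = f u - C (-1) * f u := by rw [← one_add_one_eq_two]; simp; ring
    rw [h3, h2]
    nth_rw 1 [h1]
    rw [← (hc.mul_right _).summable.tsum_sub (hc.mul_right _).summable]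
    refine tsum_congr fun s => ?_
    unfold BC
    rw [← mul_sub, ← map_sub]
    simp
  · intro i h1 h2
    have key : ∀ (i' k : ℤ), -(n+1 : ℤ) ≤ i' → (∀ j, i' + (2*n+2:ℕ) * (k - j) = -(i + (2*n+2:ℕ) * j)) →
      (∀ j, ((1:ℕ) * (2*n+2:ℕ) : ℤ) * tri j + ((1:ℕ) * i + (n+1)) * j = ((1:ℕ) * (2*n+2:ℕ) : ℤ) * tri (k-j) + ((1:ℕ) * i' + (n+1)) * (k-j)) →
        (fun u => ∑' j : ℤ, (C (BC (i + (2*n+2:ℕ) * j) u) : PS) * X ^ (fe 1 (2*n+2) (n+1) i j)) =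
         - (fun u => ∑' j : ℤ, (C (BC (i' + (2*n+2:ℕ) * j) u) : PS) * X ^ (fe 1 (2*n+2) (n+1) i' j)) := by
      intro i' k hi' hk1 hk2
      funext u
      simp only [Pi.neg_apply]
      rw [← tsum_neg]
      refine tsum_refl _ _ k fun j => ?_
      rw [hk1, BC_neg, fe_reflect 1 (2*n+2) (n+1) i i' j (k-j) (by push_cast; omega) (by push_cast; omega) (hk2 j)]
      simp
    have tn : ∀ j, tri (0 - j) = tri j + j := fun j => by
      have e1 := two_tri (0-j); have e2 := two_tri j; nlinarith
    have t1 : ∀ j, tri (1 - j) = tri j := fun j => by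
      have e1 := two_tri (1-j); have e2 := two_tri j; nlinarith
    rcases lt_trichotomy i 0 with h | h | h
    · by_cases h3 : i = -(n+1)
      · have h4 := key i 1 (by omega) (fun j => by rw [h3]; push_cast; ring) (fun j => by rw [t1, h3]; push_cast; ring)
        have h5 : (fun u => ∑' j : ℤ, (C (BC (i + (2*n+2:ℕ) * j) u) : PS) * X ^ (fe 1 (2*n+2) (n+1) i j)) = 0 := by
          funext u; exact ps_add_self (congrFun h4 u)
        rw [h5]; exact Submodule.zero_mem _
      · rw [key (-i) 0 (by omega) (fun j => by ring) (fun j => by rw [tn]; push_cast; ring)]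
        refine Submodule.neg_mem _ (Submodule.subset_span ⟨⟨(-i-1).toNat, by omega⟩, ?_⟩)
        have : (((-i-1).toNat : ℕ) : ℤ) + 1 = -i := by omega
        simp only [this]
    · have h4 := key i 0 (by omega) (fun j => by rw [h]; push_cast; ring) (fun j => by rw [tn, h]; push_cast; ring)
      have h5 : (fun u => ∑' j : ℤ, (C (BC (i + (2*n+2:ℕ) * j) u) : PS) * X ^ (fe 1 (2*n+2) (n+1) i j)) = 0 := by
        funext u; exact ps_add_self (congrFun h4 u)
      rw [h5]; exact Submodule.zero_mem _
    · refine Submodule.subset_span ⟨⟨(i-1).toNat, by push_cast at h2; omega⟩, ?_⟩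
      have : (((i-1).toNat : ℕ) : ℤ) + 1 = i := by omega
      simp only [this]

theorem C_raw (n : ℕ) (w : ℂˣ) (hw : IsPrimitiveRoot w (2 * n + 2)) :
    RR 1 (fun u => GG 1 (u ^ 2 : ℂˣ)) (fun _ : Fin n => 1) * ∏ i : Fin n, th (2 * n + 2) (n + 2 + i) (-1) =
      RR 1 (fun u => GG 1 (u ^ 2 : ℂˣ)) (fun j : Fin n => w ^ ((j:ℤ) + 1)) * ∑' c : Fin n → ℤ,
        C ((∏ i : Fin n, ((i + 1 + (2 * n + 2 : ℕ) * c i : ℤ) : ℂ) / ((i + 1 : ℤ) : ℂ)) *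
        ∏ i : Fin n, ∏ j ∈ Finset.Ioi i, ((((j + 1 + (2 * n + 2 : ℕ) * c j) + (i + 1 + (2 * n + 2 : ℕ) * c i) : ℤ) : ℂ) / (((j + 1) + (i + 1) : ℤ) : ℂ)) *
          ((((j + 1 + (2 * n + 2 : ℕ) * c j) - (i + 1 + (2 * n + 2 : ℕ) * c i) : ℤ) : ℂ) / (((j + 1) - (i + 1) : ℤ) : ℂ))) *
        X ^ (∑ i : Fin n, ex (2 * n + 2) (n + 2 + i) (c i)) := by
  have hfe : ∀ (i : Fin n) c, fe 1 (2 * n + 2) (n + 1) (i + 1) c = ex (2 * n + 2) (n + 2 + i) c := by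
    intro i c; unfold fe; congr 1
    · ring
    · push_cast; omega
  have hτ : ∀ i : Fin n, ∑' c : ℤ, (X ^ (fe 1 (2 * n + 2) (n + 1) (i + 1) c) : PS) = th (2 * n + 2) (n + 2 + i) (-1) := by
    intro i; simp only [hfe]; exact tau_th _ _
  have hown : ∀ u : ℂˣ, C (BC 1 u) * GG 1 (u ^ 2 : ℂˣ) = C (-1) * (C ((u:ℂ)⁻¹) * th 1 0 ((u:ℂ) ^ 2)) := by
    intro u
    rw [th_GG 1 one_pos _ (pow_ne_zero _ u.ne_zero)]
    have : (C (BC 1 u) : PS) = C (-1) * (C ((u:ℂ)⁻¹) * (1 - C ((u:ℂ)^2))) := by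
      rw [← map_one C, ← map_sub, ← map_mul, ← map_mul]
      congr 1
      unfold BC
      have := u.ne_zero
      simp; field_simp; ring
    rw [this, Units.val_pow_eq_pow_val]; ring
  have := bc_engine n 1 (2 * n + 2) 4 one_pos (n + 1) 2 BC 0 (fun u => GG 1 (u ^ 2 : ℂˣ)) (fun u => by simp [BC])
    (fun s u => by
      unfold BC ww
      have h := u.ne_zero
      rw [neg_add, neg_add, zpow_add₀ h, zpow_add₀ h, zpow_add₀ h, zpow_add₀ h]
      simp; field_simp; ring)
    ((IsTh.th_sq.inv.cmul (C (-1))).congr rfl (by norm_num) rfl hown)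
    (by push_cast; ring) (by push_cast; ring) (fun _ => -1)
    (fun u => by
      have h1 : BC 1 u⁻¹ = - BC 1 u := by simp [BC]
      have h2 : GG 1 ((u⁻¹ ^ 2 : ℂˣ) : ℂ) = GG 1 ((u ^ 2 : ℂˣ) : ℂ) := by
        rw [← GG_inv]; congr 1; simp
      rw [h1, h2]; simp)
    (fun i => by have := i.2; push_cast; omega) (C_span n) (fun j => w ^ ((j:ℤ) + 1))
    (fun i j c => by
      unfold BC
      have := zpow_prim w hw.pow_eq_one ((j:ℤ)+1)
      rw [this (i+1) c, show -((i:ℤ)+1+(2*n+2:ℕ)*c) = -(i+1) + (2*n+2:ℕ)*(-c) by ring, this (-(i+1)) (-c)])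
    (fun j => by
      have h := prim_zpow_ne hw (2 * ((j:ℤ)+1)) (by
        intro hd; have := Int.le_of_dvd (by omega) hd; have := j.2; push_cast at this; omega)
      intro h0
      apply h
      unfold BC at h0
      have h1 : ((w ^ ((j:ℤ)+1) : ℂˣ)) = (w ^ ((j:ℤ)+1) : ℂˣ)⁻¹ := by
        ext; simp at h0 ⊢; linear_combination h0
      rw [two_mul, zpow_add]; nth_rw 1 [h1]; simp)
    (fun i j hij => by
      have := i.2; have := j.2; have : (i:ℕ) < j := hij
      apply ww_ne
      · rw [← zpow_add]; apply prim_zpow_ne hw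
        intro hd; have := Int.le_of_dvd (by omega) hd; push_cast at this; omega
      · rw [← zpow_neg, ← zpow_add]; apply prim_zpow_ne hw
        intro hd; have := Int.le_of_dvd (by omega) hd; push_cast at this; omega)
    (fun i => by rw [hτ]; exact tau_ne _ _ (by omega) (by have := i.2; omega))
    ((GG_continuous 1 one_pos).comp (continuous_pow 2))
    (fun v => v) (fun _ _ => 1) (fun _ _ => one_ne_zero) (fun _ => tendsto_const_nhds)
    (fun e v x => by
      unfold BC
      simp only [expU_zpow]
      push_cast
      have e1 : (v:ℂ) * (2 * e * x) = x * (2 * e * v) := by ring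
      have e2 : -(v:ℂ) * (2 * e * x) = -x * (2 * e * v) := by ring
      rw [e1, e2]; simp)
    (fun v => v)
    (fun i v => by
      have h := Sh_lim (2 * v) (2 * (i + 1)) (by omega)
      push_cast at h
      rw [mul_div_mul_left _ _ two_ne_zero] at h
      push_cast
      refine h.congr fun e => ?_
      unfold BC Sh
      simp only [expU_zpow]
      push_cast
      have e1 : ∀ a : ℂ, (1:ℂ) * (2 * e * a) = e * (2 * a) := fun a => by ring
      have e2 : ∀ a : ℂ, (-1:ℂ) * (2 * e * a) = -(e * (2 * a)) := fun a => by ring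
      simp only [e1, e2])
    (fun i => by
      have h := Sh_ne (2 * (i + 1)) (by omega)
      filter_upwards [h] with e he
      unfold Sh at he
      unfold BC
      simp only [expU_zpow]
      push_cast at he ⊢
      have e1 : ∀ a : ℂ, (1:ℂ) * (2 * e * a) = e * (2 * a) := fun a => by ring
      have e2 : ∀ a : ℂ, (-1:ℂ) * (2 * e * a) = -(e * (2 * a)) := fun a => by ring
      simp only [e1, e2]
      exact he)
    (fun i j hij => by have : (i:ℕ) < j := hij; constructor <;> omega)
  simp only [hτ] at this
  simp only [hfe] at this
  exact this


def BF (s : ℤ) (u : ℂˣ) : ℂ := (u:ℂ) ^ s + (u:ℂ) ^ (1 - s)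

theorem BF_refl (s u) : BF (1 - s) u = BF s u := by unfold BF; rw [sub_sub_cancel]; ring

theorem IsTh.th_own : IsTh 2 2 1 1 (fun u => _root_.th 1 0 (-u)) := by
  refine ⟨fun s => X ^ (ex 1 0 s), ?_, ?_, ?_⟩
  · simpa using ex_fs 1 0 one_pos (fun _ => 1)
  · apply QP.of
    intro s
    refine ⟨ex 1 0 (s + 2), ex 1 0 s, ?_, ?_⟩
    · rw [ex_cast _ _ one_pos, ex_cast _ _ one_pos]
      have e1 := two_tri (s+2); have e2 := two_tri s
      push_cast
      nlinarith
    · push_cast; simp [mul_comm]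
  · intro u
    unfold _root_.th
    refine tsum_congr fun s => ?_
    rw [neg_neg, mul_comm]

theorem F_span (n : ℕ) (hn : 0 < n) (f : ℂˣ → PS) (hf : IsTh 2 (2 * n) (2 * n - 1) 1 f) (hs : ∀ u, f u⁻¹ = C ((u:ℂ)⁻¹) * f u) :
    ∃ a : Fin n → PS, ∀ x,
      f x = ∑ i : Fin n, a i * ∑' c : ℤ, C (BF (i + 1 + (2 * n : ℕ) * c) x) * X ^ (fe 2 (2 * n) (2 * n - 1) (i + 1) c) := by
  have : NeZero (2 * n) := ⟨by omega⟩
  refine span_gen hf (1 - n) (by push_cast; omega) (by push_cast; omega) BF _ 2 two_ne_zero ?_ ?_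
  · intro c hc e u
    have h1 := e u
    have h2 := e u⁻¹
    rw [hs] at h2
    have h3 : C 2 * f u = f u + C (u:ℂ) * (C ((u:ℂ)⁻¹) * f u) := by
      rw [← mul_assoc, ← map_mul, mul_inv_cancel₀ u.ne_zero, ← one_add_one_eq_two]; simp; ring
    rw [h3, h2]
    nth_rw 1 [h1]
    rw [← (hc.mul_right _).tml, ← (hc.mul_right _).summable.tsum_add (((hc.mul_right _).mul_left (fun _ => C (u:ℂ))).summable)]
    refine tsum_congr fun s => ?_
    unfold BF
    rw [sub_eq_add_neg, zpow_add₀ u.ne_zero]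
    simp
    ring
  · intro i h1 h2
    have tn : ∀ j, tri (0 - j) = tri j + j := fun j => by
      have e1 := two_tri (0-j); have e2 := two_tri j; nlinarith
    push_cast at h2
    by_cases h : 0 < i
    · refine Submodule.subset_span ⟨⟨(i-1).toNat, by omega⟩, ?_⟩
      have : (((i-1).toNat : ℕ) : ℤ) + 1 = i := by omega
      simp only [this]
    · have : (fun u => ∑' j : ℤ, (C (BF (i + (2*n:ℕ) * j) u) : PS) * X ^ (fe 2 (2*n) (2*n-1) i j)) =
         (fun u => ∑' j : ℤ, (C (BF ((1 - i) + (2*n:ℕ) * j) u) : PS) * X ^ (fe 2 (2*n) (2*n-1) (1-i) j)) := by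
        funext u
        refine tsum_refl _ _ 0 fun j => ?_
        rw [show (1 - i) + (2*n:ℕ) * (0 - j) = 1 - (i + (2*n:ℕ) * j) by ring, BF_refl,
          fe_reflect 2 (2*n) (2*n-1) i (1-i) j (0-j) (by push_cast; omega) (by push_cast; omega) (by rw [tn]; push_cast; ring)]
      rw [this]
      refine Submodule.subset_span ⟨⟨(-i).toNat, by omega⟩, ?_⟩
      have : (((-i).toNat : ℕ) : ℤ) + 1 = 1 - i := by omega
      simp only [this]

theorem F_raw (n : ℕ) (hn : 0 < n) (w : ℂˣ) (hw : IsPrimitiveRoot w (2 * n)) :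
    RR 2 (fun u => GG 1 (-u : ℂˣ)) (fun _ : Fin n => 1) * ∏ i : Fin n, th (2 * (2 * n)) (2 * n + 1 + 2 * i) (-1) =
      RR 2 (fun u => GG 1 (-u : ℂˣ)) (fun j : Fin n => w ^ (j:ℤ)) * ∑' c : Fin n → ℤ,
        C (∏ i : Fin n, ∏ j ∈ Finset.Ioi i, ((((2 * (j + 1 + (2 * n : ℕ) * c j) - 1) + (2 * (i + 1 + (2 * n : ℕ) * c i) - 1) : ℤ) : ℂ) / (((2 * (j + 1) - 1) + (2 * (i + 1) - 1) : ℤ) : ℂ)) *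
          ((((2 * (j + 1 + (2 * n : ℕ) * c j) - 1) - (2 * (i + 1 + (2 * n : ℕ) * c i) - 1) : ℤ) : ℂ) / (((2 * (j + 1) - 1) - (2 * (i + 1) - 1) : ℤ) : ℂ))) *
        X ^ (∑ i : Fin n, ex (2 * (2 * n)) (2 * n + 1 + 2 * i) (c i)) := by
  have : NeZero (2 * n) := ⟨by omega⟩
  have hfe : ∀ (i : Fin n) c, fe 2 (2 * n) (2 * n - 1) (i + 1) c = ex (2 * (2 * n)) (2 * n + 1 + 2 * i) c := by
    intro i c; unfold fe; congr 1
    push_cast; omega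
  have hτ : ∀ i : Fin n, ∑' c : ℤ, (X ^ (fe 2 (2 * n) (2 * n - 1) (i + 1) c) : PS) = th (2 * (2 * n)) (2 * n + 1 + 2 * i) (-1) := by
    intro i; simp only [hfe]; exact tau_th _ _
  have hown : ∀ u : ℂˣ, C (BF 1 u) * GG 1 (-u : ℂˣ) = th 1 0 (-(u:ℂ)) := by
    intro u
    rw [th_GG 1 one_pos _ (neg_ne_zero.2 u.ne_zero)]
    simp [BF, add_comm]
  have := bc_engine n 2 (2 * n) 2 two_pos (2 * n - 1) 1 BF 1 (fun u => GG 1 (-u : ℂˣ)) (fun u => by simp [BF, add_comm])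
    (fun s u => by
      unfold BF ww
      have h := u.ne_zero
      rw [show 1 - (s+2) = - s + (-1) by ring, show 1 - (s + 1) = -s by ring, sub_eq_add_neg 1 s, zpow_add₀ h, zpow_add₀ h, zpow_add₀ h, zpow_add₀ h]
      simp; field_simp; ring)
    (IsTh.th_own.congr rfl rfl rfl hown)
    (by push_cast; ring) (by push_cast; ring) (fun u => (u:ℂ)⁻¹)
    (fun u => by
      rw [hown, hown]
      have := th_inv 1 one_pos (-(u:ℂ)) (neg_ne_zero.2 u.ne_zero)
      rw [inv_neg] at this
      rw [Units.val_inv_eq_inv_val, this]; simp)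
    (fun i => by have := i.2; push_cast; omega) (F_span n hn) (fun j => w ^ (j:ℤ))
    (fun i j c => by
      unfold BF
      have := zpow_prim w hw.pow_eq_one (j:ℤ)
      rw [this (i+1) c, show 1-((i:ℤ)+1+(2*n:ℕ)*c) = (1-(i+1)) + (2*n:ℕ)*(-c) by ring, this (1-(i+1)) (-c)])
    (fun j => by
      have hj := j.2
      have h := prim_zpow_ne hw (2 * (j:ℤ))
      have h' := prim_zpow_ne hw ((j:ℤ))
      intro h0
      unfold BF at h0
      simp at h0
      have h1 : ((w ^ (j:ℤ) : ℂˣ)) = -1 := by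
        ext; simp at h0 ⊢; linear_combination h0
      have h3 : w ^ (2 * (j:ℤ)) = 1 := by rw [two_mul, zpow_add, h1]; simp
      rw [hw.zpow_eq_one_iff_dvd] at h3
      have h4 : (j:ℤ) = 0 := by
        by_contra hne
        have := Int.le_of_dvd (by omega) h3; push_cast at this; omega
      rw [h4, zpow_zero] at h1
      have := congrArg Units.val h1
      norm_num at this)
    (fun i j hij => by
      have := i.2; have := j.2; have : (i:ℕ) < j := hij
      apply ww_ne
      · rw [← zpow_add]; apply prim_zpow_ne hw
        intro hd; have := Int.le_of_dvd (by omega) hd; push_cast at this; omega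
      · rw [← zpow_neg, ← zpow_add]; apply prim_zpow_ne hw
        intro hd; have := Int.le_of_dvd (by omega) hd; push_cast at this; omega)
    (fun i => by rw [hτ]; exact tau_ne _ _ (by omega) (by have := i.2; omega))
    ((GG_continuous 1 one_pos).comp (by
      have : (Neg.neg : ℂˣ → ℂˣ) = fun u => (-1) * u := by funext u; simp
      rw [this]; exact continuous_const.mul continuous_id))
    (fun v => 2 * v - 1) (fun e v => Complex.exp (e * (2 * v - 1))) (fun _ _ => Complex.exp_ne_zero _)
    (fun v => by
      have : Continuous (fun e : ℂ => Complex.exp (e * (2 * v - 1))) := by fun_prop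
      have := this.tendsto 0
      simp only [zero_mul, Complex.exp_zero] at this
      exact this.mono_left nhdsWithin_le_nhds)
    (fun e v x => by
      unfold BF
      simp only [expU_zpow]
      rw [← Complex.exp_neg, ← Complex.exp_add, mul_add, ← Complex.exp_add, ← Complex.exp_add]
      push_cast
      rw [show (v:ℂ) * (2 * e * (2 * x - 1)) = e * (2 * x - 1) + -(e * (2 * v - 1)) + x * (2 * e * (2 * v - 1)) by ring,
        show (1 - v:ℂ) * (2 * e * (2 * x - 1)) = e * (2 * x - 1) + -(e * (2 * v - 1)) + (1 - x) * (2 * e * (2 * v - 1)) by ring])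
    (fun v => 1)
    (fun i v => by
      have hc : ∀ v : ℤ, Filter.Tendsto (fun e : ℂ => BF 1 (expU (2 * e * ((2 * v - 1 : ℤ)))) ) (nhdsWithin 0 {0}ᶜ) (nhds 2) := by
        intro v
        unfold BF
        simp only [expU_zpow]
        have : Continuous (fun e : ℂ => Complex.exp ((1:ℤ) * (2 * e * ((2 * v - 1 : ℤ)))) + Complex.exp ((1 - 1:ℤ) * (2 * e * ((2 * v - 1 : ℤ))))) := by fun_prop
        have := this.tendsto 0
        simp at this
        norm_num at this
        refine Filter.Tendsto.mono_left ?_ nhdsWithin_le_nhds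
        simpa using this
      have := (hc v).div (hc (i+1)) two_ne_zero
      simpa [Pi.div_def] using this)
    (fun i => by
      have hc : Filter.Tendsto (fun e : ℂ => BF 1 (expU (2 * e * ((2 * (i+1) - 1 : ℤ)))) ) (nhdsWithin 0 {0}ᶜ) (nhds 2) := by
        unfold BF
        simp only [expU_zpow]
        have : Continuous (fun e : ℂ => Complex.exp ((1:ℤ) * (2 * e * ((2 * (i+1) - 1 : ℤ)))) + Complex.exp ((1 - 1:ℤ) * (2 * e * ((2 * (i+1) - 1 : ℤ))))) := by fun_prop
        have := this.tendsto 0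
        simp at this
        norm_num at this
        refine Filter.Tendsto.mono_left ?_ nhdsWithin_le_nhds
        simpa using this
      exact hc.eventually_ne two_ne_zero)
    (fun i j hij => by have : (i:ℕ) < j := hij; constructor <;> omega)
  simp only [hτ] at this
  simp only [hfe, div_one, Finset.prod_const_one, one_mul] at this
  exact this


theorem tau_ne0 (N : ℕ) (hN : 0 < N) (i : ℕ) (hi : i < N) : th N i (-1) ≠ 0 := by
  rcases Nat.eq_zero_or_pos i with h | h
  · subst h
    rw [th_GG N hN _ (by norm_num)]
    intro h
    have h2 := congrArg constantCoeff h
    have n1 : ∀ a : ℂ, NP (fun k : ℕ => (1 - C a * X ^ (N * (k + 1)) : PS)) := fun a => np_pow (fun k => Nat.le_mul_of_pos_left _ hN) _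
    have n3 := (np_qf N hN).tprod_const
    unfold GG at h2
    simp only [map_mul, map_sub, map_one, (n1 _).tprod_const, map_zero] at h2
    rw [show constantCoeff (EE N) = 1 from n3] at h2
    norm_num at h2
  · exact tau_ne N i h hi

def RA {n : ℕ} (u : Fin n → ℂˣ) : PS :=
  (∏ i : Fin n, ∏ j ∈ Finset.Ioi i, GG 1 ((u i / u j : ℂˣ) : ℂ)) * th 1 0 ((∏ i, u i : ℂˣ) : ℂ)

theorem GG_div_symm (g : ℕ) (x w : ℂˣ) : GG g ((x / w : ℂˣ) : ℂ) = GG g ((w / x : ℂˣ) : ℂ) := by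
  rw [← GG_inv]; congr 1; simp

theorem RA_perm {n : ℕ} (u : Fin n → ℂˣ) (σ : Equiv.Perm (Fin n)) : RA (fun i => u (σ i)) = RA u := by
  unfold RA
  rw [pair_perm (fun i j => GG 1 ((u i / u j : ℂˣ) : ℂ)) (fun i j => GG_div_symm 1 _ _) σ, Equiv.prod_comp σ (fun i => u i)]

theorem RA_slot {n : ℕ} (u : Fin n → ℂˣ) (k : Fin n) : ∃ K : PS, ∀ x,
    C (∏ i : Fin n, ∏ j ∈ Finset.Ioi i, (((Function.update u k x) j : ℂ) - ((Function.update u k x) i : ℂ))) * RA (Function.update u k x) =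
        K * ((∏ j ∈ Finset.univ.erase k, th 1 0 ((((u j)⁻¹ : ℂˣ) : ℂ) * x)) * th 1 0 (((∏ j ∈ Finset.univ.erase k, u j : ℂˣ) : ℂ) * x)) := by
  refine ⟨(∏ i ∈ Finset.univ.erase k, ∏ j ∈ (Finset.Ioi i).erase k, (C ((u j : ℂ) - (u i : ℂ)) * GG 1 ((u i / u j : ℂˣ) : ℂ))) *
      ∏ j ∈ Finset.univ.erase k, (if k < j then C (u j : ℂ) else - C (u j : ℂ)), fun x => ?_⟩
  have h1 : ∏ i, Function.update u k x i = (∏ j ∈ Finset.univ.erase k, u j) * x := by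
    rw [← Finset.mul_prod_erase Finset.univ _ (Finset.mem_univ k), mul_comm]
    simp only [Function.update_self]
    congr 1
    exact Finset.prod_congr rfl fun j hj => by rw [Function.update_of_ne (Finset.ne_of_mem_erase hj)]
  unfold RA
  rw [h1, map_prod]
  simp only [map_prod]
  have d2 : ∀ v : Fin n → ℂˣ, (∏ i : Fin n, ∏ j ∈ Finset.Ioi i, (C ((v j : ℂ) - v i) : PS)) *
      (∏ i : Fin n, ∏ j ∈ Finset.Ioi i, GG 1 ((v i / v j : ℂˣ) : ℂ)) =
      ∏ i : Fin n, ∏ j ∈ Finset.Ioi i, (C ((v j : ℂ) - v i) * GG 1 ((v i / v j : ℂˣ) : ℂ)) := by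
    intro v
    simp only [Finset.prod_mul_distrib]
  rw [← mul_assoc, d2]
  rw [pair_slot _ k]
  have e2 : ∀ j ∈ Finset.univ.erase k, Function.update u k x j = u j := fun j hj =>
    Function.update_of_ne (Finset.ne_of_mem_erase hj) _ _
  have e4 : ∏ i ∈ Finset.univ.erase k, ∏ j ∈ (Finset.Ioi i).erase k,
      (C ((Function.update u k x j : ℂ) - (Function.update u k x i : ℂ)) *
        GG 1 ((Function.update u k x i / Function.update u k x j : ℂˣ) : ℂ)) =
      ∏ i ∈ Finset.univ.erase k, ∏ j ∈ (Finset.Ioi i).erase k, (C ((u j : ℂ) - (u i : ℂ)) * GG 1 ((u i / u j : ℂˣ) : ℂ)) :=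
    Finset.prod_congr rfl fun i hi => Finset.prod_congr rfl fun j hj => by
      rw [e2 i hi, e2 j (by simp; exact Finset.ne_of_mem_erase hj)]
  have hth : ∀ j, C (u j : ℂ) * th 1 0 ((((u j)⁻¹ : ℂˣ) : ℂ) * x) = C ((u j : ℂ) - x) * GG 1 ((x / u j : ℂˣ) : ℂ) := by
    intro j
    rw [← Units.val_mul, th_GG 1 one_pos _ (Units.ne_zero _), mul_comm (u j)⁻¹ x, ← div_eq_mul_inv, ← mul_assoc]
    congr 1
    rw [← map_one C, ← map_sub, ← map_mul]
    congr 1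
    have := (u j).ne_zero
    push_cast
    field_simp
  have e5 : ∏ j ∈ Finset.univ.erase k, (if k < j then
      (C ((Function.update u k x j : ℂ) - (Function.update u k x k : ℂ)) *
        GG 1 ((Function.update u k x k / Function.update u k x j : ℂˣ) : ℂ)) else
        (C ((Function.update u k x k : ℂ) - (Function.update u k x j : ℂ)) *
        GG 1 ((Function.update u k x j / Function.update u k x k : ℂˣ) : ℂ))) =
      ∏ j ∈ Finset.univ.erase k, ((if k < j then C (u j : ℂ) else - C (u j : ℂ)) * th 1 0 ((((u j)⁻¹ : ℂˣ) : ℂ) * x)) :=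
    Finset.prod_congr rfl fun j hj => by
      rw [e2 j hj, Function.update_self]
      split_ifs
      · rw [hth]
      · rw [neg_mul, hth, GG_div_symm, ← neg_sub, map_neg]; ring
  rw [e4, e5, Finset.prod_mul_distrib, Units.val_mul]
  ring

theorem vand_zpow (N : ℕ) (u : Fin N → ℂˣ) : (Matrix.of fun i j : Fin N => (u j : ℂ) ^ ((i:ℤ) + N * 0)).det =
    ∏ i : Fin N, ∏ j ∈ Finset.Ioi i, ((u j : ℂ) - (u i : ℂ)) := by
  rw [← Matrix.det_vandermonde (fun j => (u j : ℂ)), ← Matrix.det_transpose]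
  congr 1

theorem th_continuous (g : ℕ) (hg : 0 < g) : Continuous (fun a : ℂˣ => th g 0 (a : ℂ)) := by
  have : (fun a : ℂˣ => th g 0 (a : ℂ)) = fun a : ℂˣ => (1 - C (a:ℂ)) * GG g a := by
    funext a; exact th_GG g hg _ a.ne_zero
  rw [this]
  exact (continuous_const.sub (ps_continuous_C.comp Units.continuous_val)).mul (GG_continuous g hg)

theorem exp_slope (a b : ℤ) : Filter.Tendsto (fun e : ℂ => (Complex.exp (e * a) - Complex.exp (e * b)) / e) (nhdsWithin 0 {0}ᶜ)
    (nhds ((a - b : ℤ) : ℂ)) := by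
  have h : HasDerivAt (fun e : ℂ => Complex.exp (e * a) - Complex.exp (e * b)) ((a - b : ℤ) : ℂ) 0 := by
    have h1 : ∀ m : ℤ, HasDerivAt (fun e : ℂ => e * (m:ℂ)) (m:ℂ) 0 := fun m => by
      simpa using (hasDerivAt_id (0:ℂ)).mul_const (m:ℂ)
    have := (h1 a).cexp.sub (h1 b).cexp
    refine HasDerivAt.congr_deriv this ?_
    simp
  have := hasDerivAt_iff_tendsto_slope.1 h
  refine this.congr fun e => ?_
  simp [slope_def_field]

theorem A_raw (N : ℕ) (hN : 0 < N) (hev : Even N) (w : ℂˣ) (hw : IsPrimitiveRoot w N) (ζ : ℂˣ) :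
    RA (fun _ : Fin N => ζ) * ∏ i : Fin N, th N i (-1) =
      RA (fun j : Fin N => w ^ (j:ℤ)) * ∑' c : Fin N → ℤ,
        C (((ζ:ℂ) ^ (N * ∑ i, c i)) * ∏ i : Fin N, ∏ j ∈ Finset.Ioi i,
          (((((j + N * c j) - (i + N * c i) : ℤ) : ℂ) / ((j - i : ℤ) : ℂ)))) *
        X ^ (∑ i : Fin N, ex N i (c i)) := by
  have : NeZero N := ⟨by omega⟩
  have hdet : ∀ (e : ℂ) (v : Fin N → ℤ), (Matrix.of fun i j : Fin N => ((ζ * expU (e * (j:ℤ)) : ℂˣ) : ℂ) ^ (v i)).det =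
      (∏ i, (ζ:ℂ) ^ (v i)) * ∏ i : Fin N, ∏ j ∈ Finset.Ioi i, (Complex.exp (e * v j) - Complex.exp (e * v i)) := by
    intro e v
    rw [← Matrix.det_vandermonde (fun j => Complex.exp (e * v j)), ← Matrix.det_mul_column]
    congr 1
    ext i j
    simp only [Matrix.of_apply, Matrix.vandermonde]
    push_cast
    rw [mul_zpow, expU_zpow, ← Complex.exp_nat_mul]
    push_cast
    congr 2
    ring
  have hne : ∀ i j : Fin N, i < j → ∀ᶠ e : ℂ in nhdsWithin 0 {0}ᶜ, Complex.exp (e * (j:ℤ)) - Complex.exp (e * (i:ℤ)) ≠ 0 := by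
    intro i j hij
    have h0 : (i:ℕ) < j := hij
    have h := (exp_slope j i).eventually_ne (b₂ := (0:ℂ)) (by rw [Int.cast_ne_zero]; omega)
    filter_upwards [h] with e he h0
    exact he (by rw [h0]; simp)
  have hne2 : ∀ᶠ e : ℂ in nhdsWithin 0 {0}ᶜ, ∀ i j : Fin N, i < j → Complex.exp (e * (j:ℤ)) - Complex.exp (e * (i:ℤ)) ≠ 0 := by
    rw [Filter.eventually_all]; intro i
    rw [Filter.eventually_all]; intro j
    by_cases h : i < j
    · filter_upwards [hne i j h] with e h1 _ using h1
    · exact Filter.Eventually.of_forall fun e h' => absurd h' h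
  have hτf : ∀ i : Fin N, FS (fun c => (X ^ (ex N i c) : PS)) := fun i => by
    simpa using ex_fs N i i.2 (fun _ => 1)
  refine engine (fun (i : Fin N) x => ∑' c : ℤ, C ((x:ℂ) ^ ((i:ℤ) + N * c)) * X ^ (ex N i c))
    (fun i c u => (u:ℂ) ^ ((i:ℤ) + N * c)) (fun i c => ex N i c) (fun j => w ^ (j:ℤ)) _ RA ?_ RA_perm (fun i u => rfl) ?_
    ?_ ?_ (fun i => tau_ne0 N hN i i.2) (l := nhdsWithin (0:ℂ) {0}ᶜ) (fun e j => ζ * expU (e * (j:ℤ))) ?_ _ ?_ _ ?_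
  · intro u k
    obtain ⟨K, hK⟩ := RA_slot u k
    simp only [vand_zpow, hK]
    have hcard : (Finset.univ.erase k).card = N - 1 := by
      rw [Finset.card_erase_of_mem (Finset.mem_univ k), Finset.card_univ, Fintype.card_fin]
    have hth : IsTh 1 N 0 1 (fun x => K * ((∏ j ∈ Finset.univ.erase k, th 1 0 ((((u j)⁻¹ : ℂˣ) : ℂ) * x)) * th 1 0 (((∏ j ∈ Finset.univ.erase k, u j : ℂˣ) : ℂ) * x))) := by
      refine (((IsTh.prod (Finset.univ.erase k) (fun j _ => IsTh.th 1 one_pos (u j)⁻¹)).mul (IsTh.th 1 one_pos (∏ j ∈ Finset.univ.erase k, u j))).cmul K).congr ?_ ?_ ?_ (fun u => rfl)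
      · simp; omega
      · simp
      · rw [Finset.prod_neg, hcard]
        push_cast
        rw [Finset.prod_inv_distrib]
        have hq : ∏ j ∈ Finset.univ.erase k, (u j : ℂ) ≠ 0 := Finset.prod_ne_zero_iff.2 fun j _ => (u j).ne_zero
        have : Odd (N - 1) := by
          rcases hev with ⟨m, hm⟩; exact ⟨m - 1, by omega⟩
        rw [this.neg_one_pow]
        field_simp
    refine span_gen hth 0 (by simp) (by simp) (fun s u => (u:ℂ)^s) _ 1 one_ne_zero ?_ ?_
    · intro c _ e u
      rw [map_one, one_mul]; exact e u
    · intro i h1 h2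
      refine Submodule.subset_span ⟨⟨i.toNat, by omega⟩, ?_⟩
      funext u
      have : ((i.toNat : ℕ) : ℤ) = i := by omega
      simp only [this, fe, Nat.cast_one, one_mul, add_zero]
  · intro i m
    refine (abs_le_fin m).subset ?_
    intro j hj
    have h1 := ex_ge _ _ i.2 j
    have h2 : ex N i j < m := hj
    simp only [Set.mem_ofPred_eq]
    omega
  · intro i j
    simp only [zpow_prim w hw.pow_eq_one (j:ℤ)]
    have := (hτf i).tml (C (((w ^ (j:ℤ) : ℂˣ) : ℂ) ^ (i:ℤ)))
    rw [this, tau_th, mul_comm]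
  · rw [vand_zpow]
    refine Finset.prod_ne_zero_iff.2 fun i _ => Finset.prod_ne_zero_iff.2 fun j hj => ?_
    have hij : i < j := Finset.mem_Ioi.1 hj
    have hij : (i:ℕ) < j := hij
    rw [sub_ne_zero]
    intro h
    have h2 := prim_zpow_ne hw ((j:ℤ) - i) (by
      intro hd; have := Int.le_of_dvd (by omega) hd; have := j.2; omega)
    apply h2
    rw [zpow_sub, Units.ext h]; simp
  · filter_upwards [hne2] with e h1
    rw [hdet e (fun i => (i:ℤ) + N * 0)]
    refine mul_ne_zero (Finset.prod_ne_zero_iff.2 fun j _ => zpow_ne_zero _ ζ.ne_zero) ?_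
    refine Finset.prod_ne_zero_iff.2 fun i _ => Finset.prod_ne_zero_iff.2 fun j hj => ?_
    simpa using h1 i j (Finset.mem_Ioi.1 hj)
  · have hc : ∀ j : Fin N, Continuous (fun e : ℂ => (ζ * expU (e * (j:ℤ)))) := by
      intro j
      exact continuous_const.mul (expU_continuous.comp (by fun_prop))
    have : Continuous (fun e : ℂ => RA (fun j : Fin N => (ζ * expU (e * (j:ℤ))))) := by
      unfold RA
      refine Continuous.mul (continuous_finsetProd _ fun i _ => continuous_finsetProd _ fun j _ => ?_) ?_
      · exact (GG_continuous 1 one_pos).comp ((hc i).div' (hc j))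
      · exact (th_continuous 1 one_pos).comp (continuous_finsetProd _ fun i _ => hc i)
    have := this.tendsto 0
    have e0 : (fun j : Fin N => (ζ * expU (0 * (j:ℤ)))) = fun _ => ζ := by
      funext j; ext; simp [expU]
    rw [e0] at this
    exact this.mono_left nhdsWithin_le_nhds
  · intro c
    have hl1 : Filter.Tendsto (fun e : ℂ => ((ζ:ℂ) ^ (N * ∑ i, c i)) * ∏ i : Fin N, ∏ j ∈ Finset.Ioi i,
        (((Complex.exp (e * ((j + N * c j : ℤ) : ℂ)) - Complex.exp (e * ((i + N * c i : ℤ) : ℂ))) / e) / ((Complex.exp (e * ((j : ℤ) : ℂ)) - Complex.exp (e * ((i: ℤ) : ℂ))) / e)))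
        (nhdsWithin 0 {0}ᶜ) (nhds (((ζ:ℂ) ^ (N * ∑ i, c i)) * ∏ i : Fin N, ∏ j ∈ Finset.Ioi i,
          (((((j + N * c j) - (i + N * c i) : ℤ) : ℂ) / ((j - i : ℤ) : ℂ))))) := by
      refine Filter.Tendsto.mul tendsto_const_nhds ?_
      refine tendsto_finsetProd _ fun i _ => tendsto_finsetProd _ fun j hj => ?_
      have hij : i < j := Finset.mem_Ioi.1 hj
      have hij : (i:ℕ) < j := hij
      exact (exp_slope _ _).div (exp_slope _ _) (by push_cast; rw [sub_ne_zero]; norm_cast; omega)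
    refine hl1.congr' ?_
    filter_upwards [self_mem_nhdsWithin] with e he
    have he : e ≠ 0 := he
    rw [hdet e (fun i => i + N * c i), hdet e (fun i => i + N * 0), mul_div_mul_comm, ← Finset.prod_div_distrib]
    congr 1
    · simp only [mul_zero, add_zero, zpow_add₀ ζ.ne_zero, mul_div_cancel_left₀ _ (zpow_ne_zero _ ζ.ne_zero)]
      rw [Finset.mul_sum]
      induction (Finset.univ : Finset (Fin N)) using Finset.induction_on with
      | empty => simp
      | insert a s ha ih => rw [Finset.sum_insert ha, Finset.prod_insert ha, zpow_add₀ ζ.ne_zero, ih]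
    · simp only [mul_zero, add_zero, ← Finset.prod_div_distrib]
      refine Finset.prod_congr rfl fun i _ => Finset.prod_congr rfl fun j _ => ?_
      rw [div_div_div_cancel_right₀ he]


def qq (w : ℂˣ) (y : PS) (a : ℤ) : PS := 1 - C ((w ^ a : ℂˣ) : ℂ) * y

theorem qq_per {N : ℕ} {w : ℂˣ} (hw : w ^ N = 1) (y : PS) (a : ℤ) : qq w y (a + N) = qq w y a := by
  unfold qq; rw [zpow_add, zpow_natCast, hw, mul_one]

theorem qq_range {N : ℕ} (hN : 0 < N) {w : ℂˣ} (hw : IsPrimitiveRoot w N) (y : PS) :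
    ∏ r ∈ Finset.range N, qq w y r = 1 - y ^ N := by
  classical
  have h1 : IsPrimitiveRoot ((w:ℂˣ):ℂ) N := IsPrimitiveRoot.coe_units_iff.2 hw
  have h2 : IsPrimitiveRoot (C ((w:ℂˣ):ℂ) : PS) N := h1.map_of_injective (PowerSeries.C_injective)
  have h3 := h2.pow_sub_pow_eq_prod_sub_mul 1 y hN
  rw [one_pow] at h3
  rw [h3]
  have : Polynomial.nthRootsFinset N (1:PS) = (Finset.range N).image (fun i => (C ((w:ℂˣ):ℂ) : PS) ^ i) := by
    symm
    apply Finset.eq_of_subset_of_card_le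
    · intro x hx
      obtain ⟨i, _, rfl⟩ := Finset.mem_image.1 hx
      rw [Polynomial.mem_nthRootsFinset hN, ← pow_mul, mul_comm, pow_mul, h2.pow_eq_one, one_pow]
    · rw [h2.card_nthRootsFinset, Finset.card_image_of_injOn, Finset.card_range]
      intro i hi j hj hij
      exact h2.pow_inj (Finset.mem_range.1 hi) (Finset.mem_range.1 hj) hij
  rw [this, Finset.prod_image]
  · refine Finset.prod_congr rfl fun i _ => ?_
    unfold qq; simp
  · intro i hi j hj hij
    exact h2.pow_inj (Finset.mem_range.1 hi) (Finset.mem_range.1 hj) hij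

theorem qq_shift {N : ℕ} (hN : 0 < N) {w : ℂˣ} (hw : IsPrimitiveRoot w N) (y : PS) (a : ℤ) :
    ∏ r ∈ Finset.range N, qq w y (a + r) = 1 - y ^ N := by
  have key : ∀ a : ℤ, ∏ r ∈ Finset.range N, qq w y (a + 1 + r) = ∏ r ∈ Finset.range N, qq w y (a + r) := by
    intro a
    have h1 := Finset.prod_range_succ (fun r : ℕ => qq w y (a + r)) N
    have h2 := Finset.prod_range_succ' (fun r : ℕ => qq w y (a + r)) N
    rw [qq_per hw.pow_eq_one] at h1
    rw [h1] at h2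
    by_cases h0 : qq w y a = 0
    · -- both vanish
      obtain ⟨M, rfl⟩ : ∃ M, N = M + 1 := ⟨N - 1, by omega⟩
      rw [Finset.prod_range_succ, Finset.prod_range_succ']
      have : a + 1 + (M:ℤ) = a + ((M+1:ℕ):ℤ) := by push_cast; ring
      rw [this, qq_per hw.pow_eq_one]
      simp [h0]
    · have h3 : (a + ((0:ℕ):ℤ)) = a := by simp
      rw [h3] at h2
      have := mul_right_cancel₀ h0 h2
      rw [this]
      refine Finset.prod_congr rfl fun r _ => ?_
      congr 1; push_cast; ring
  induction a using Int.induction_on with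
  | zero => simpa using qq_range hN hw y
  | succ i ih => rw [key]; exact ih
  | pred i ih => rw [← ih, ← key]; simp

theorem pair_sq {n : ℕ} {M : Type*} [CommMonoid M] (f : Fin n → Fin n → M) (hf : ∀ i j, f i j = f j i) :
    (∏ i : Fin n, ∏ j ∈ Finset.Ioi i, f i j) ^ 2 * ∏ i, f i i = ∏ i, ∏ j, f i j := by
  have h1 : ∀ i, ∏ j, f i j = (∏ j ∈ Finset.Iio i, f i j) * (f i i * ∏ j ∈ Finset.Ioi i, f i j) := by
    intro i
    rw [← Finset.prod_filter_mul_prod_filter_not Finset.univ (fun j => j < i)]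
    congr 1
    · refine Finset.prod_congr ?_ fun _ _ => rfl
      ext j; simp
    · rw [← Finset.prod_insert (by simp)]
      refine Finset.prod_congr ?_ fun _ _ => rfl
      ext j; simp [le_iff_eq_or_lt, eq_comm]
  simp only [h1, Finset.prod_mul_distrib]
  have h2 : ∏ i, ∏ j ∈ Finset.Iio i, f i j = ∏ i : Fin n, ∏ j ∈ Finset.Ioi i, f i j := by
    rw [Finset.prod_sigma', Finset.prod_sigma']
    refine Finset.prod_nbij' (fun p => ⟨p.2, p.1⟩) (fun p => ⟨p.2, p.1⟩) ?_ ?_ ?_ ?_ ?_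
    · rintro ⟨i, j⟩ h; simpa using h
    · rintro ⟨i, j⟩ h; simpa using h
    · rintro ⟨i, j⟩ h; rfl
    · rintro ⟨i, j⟩ h; rfl
    · rintro ⟨i, j⟩ h; exact hf _ _
  rw [h2, sq, mul_comm (∏ i, f i i), mul_assoc]

theorem ps_sq_eq {A B : PS} (h : A ^ 2 = B ^ 2) (hA : constantCoeff A = 1) (hB : constantCoeff B = 1) : A = B := by
  rcases sq_eq_sq_iff_eq_or_eq_neg.1 h with h | h
  · exact h
  · have := congrArg constantCoeff h
    rw [map_neg, hA, hB] at this
    norm_num at this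

theorem qq_const (w : ℂˣ) (y : PS) (hy : constantCoeff y = 0) (a : ℤ) : constantCoeff (qq w y a) = 1 := by
  unfold qq; simp [hy]

/-- `∏_{j=1}^n q(a+j) q(a-j) q(a) q(a+n+1)` -/
theorem qq_sym (n : ℕ) {w : ℂˣ} (hw : IsPrimitiveRoot w (2 * n + 2)) (y : PS) (a : ℤ) :
    (∏ j : Fin n, (qq w y (a + (j + 1)) * qq w y (a - (j + 1)))) * (qq w y a * qq w y (a + (n + 1))) = 1 - y ^ (2 * n + 2) := by
  rw [← qq_shift (by omega) hw y (a - n), show 2 * n + 2 = n + (1 + (n + 1)) by ring, Finset.prod_range_add,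
    Finset.prod_range_add, Finset.prod_range_succ (n := n), Finset.prod_mul_distrib]
  have h1 : ∏ j : Fin n, qq w y (a - (j + 1)) = ∏ x ∈ Finset.range n, qq w y (a - n + x) := by
    rw [← Finset.prod_range_reflect, Finset.prod_range]
    refine Finset.prod_congr rfl fun j _ => ?_
    congr 1
    have := j.2
    omega
  have h2 : ∏ j : Fin n, qq w y (a + (j + 1)) = ∏ x ∈ Finset.range n, qq w y (a - n + ((n + (1 + x) : ℕ))) := by
    rw [Finset.prod_range]
    refine Finset.prod_congr rfl fun j _ => ?_
    congr 1; push_cast; ring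
  rw [h1, h2]
  simp only [Finset.prod_range_one, add_zero]
  have e1 : a - n + (n:ℤ) = a := by ring
  have e2 : a - n + ((n + (1 + n) : ℕ) : ℤ) = a + (n+1) := by push_cast; ring
  rw [e1, e2]; ring

theorem qq_sym' (n : ℕ) (hn : 0 < n) {w : ℂˣ} (hw : IsPrimitiveRoot w (2 * n)) (y : PS) (a : ℤ) :
    (∏ j : Fin n, (qq w y (a + j) * qq w y (a - j))) * qq w y (a + n) = (1 - y ^ (2 * n)) * qq w y a := by
  obtain ⟨m, rfl⟩ : ∃ m, n = m + 1 := ⟨n - 1, by omega⟩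
  have := qq_sym m hw y a
  rw [Fin.prod_univ_succ]
  rw [show 2 * (m + 1) = 2 * m + 2 by ring, ← this]
  simp
  ring

theorem qq_neg_half {n : ℕ} {w : ℂˣ} (hw : IsPrimitiveRoot w (2 * n)) (hn : 0 < n) (y : PS) (a : ℤ) :
    qq w y (a + n) = 1 + C ((w ^ a : ℂˣ) : ℂ) * y := by
  have h1 : (w ^ n) ^ 2 = 1 := by rw [← pow_mul, mul_comm, hw.pow_eq_one]
  have h2 : ((w ^ n : ℂˣ) : ℂ) = -1 := by
    have h3 : (((w ^ n : ℂˣ) : ℂ)) ^ 2 = 1 := by rw [← Units.val_pow_eq_pow_val, h1]; rfl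
    rcases (mul_self_eq_one_iff.1 ((sq _).symm.trans h3)) with h | h
    · exact absurd (Units.ext h) (hw.pow_ne_one_of_pos_of_lt hn.ne' (by omega))
    · exact h
  unfold qq
  rw [zpow_add, zpow_natCast, Units.val_mul, h2]
  simp

theorem qq_sq {n : ℕ} {w : ℂˣ} (hw : IsPrimitiveRoot w (2 * n)) (hn : 0 < n) (y : PS) (a : ℤ) :
    qq w y a * qq w y (a + n) = qq (w ^ 2) (y ^ 2) a := by
  rw [qq_neg_half hw hn]
  unfold qq
  have : (((w ^ 2) ^ a : ℂˣ) : ℂ) = ((w ^ a : ℂˣ) : ℂ) ^ 2 := by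
    rw [← Units.val_pow_eq_pow_val]; congr 1
    rw [← zpow_natCast, ← zpow_natCast, ← zpow_mul, ← zpow_mul, mul_comm]
  rw [this, map_pow]; ring


theorem tprod_split (f : ℕ → PS) (hf : NP f) (N : ℕ) (hN : 0 < N) :
    ∏' k, f k = ∏ r ∈ Finset.range N, ∏' k, f (N * k + r) := by
  have h1 : ∀ r ∈ Finset.range N, NP (fun k => f (N * k + r)) := fun r _ k =>
    (pow_dvd_pow _ (by nlinarith [Nat.le_mul_of_pos_left k hN])).trans (hf (N * k + r))
  rw [← NP.tprod_prod _ h1]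
  refine ps_ext_dvd fun n => ?_
  have h2 := hf.dvd n (N * n) (by nlinarith [Nat.le_mul_of_pos_left n hN])
  have h3 := (NP.prod _ h1).dvd n n (by omega)
  have h4 : ∀ n, ∏ k ∈ Finset.range n, ∏ r ∈ Finset.range N, f (N * k + r) = ∏ k ∈ Finset.range (N * n), f k := by
    intro n
    induction n with
    | zero => simp
    | succ n ih => rw [Finset.prod_range_succ, ih, mul_add, mul_one, Finset.prod_range_add]
  rw [h4] at h3
  have := dvd_sub h2 h3
  rwa [sub_sub_sub_cancel_right] at this

/-- `∏ (1 + X^(N k + r))` -/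
def PPr (N r : ℕ) : PS := ∏' k : ℕ, (1 + X ^ (N * k + r))

theorem np_ppr (N r : ℕ) (hN : 0 < N) (hr : 0 < r) : NP (fun k => (1 + X ^ (N * k + r) : PS)) := by
  intro k
  rw [add_sub_cancel_left]
  exact pow_dvd_pow _ (by nlinarith [Nat.le_mul_of_pos_left k hN])

theorem ppr_prod (g N : ℕ) (hg : 0 < g) (hN : 0 < N) (s : ℕ) (hs : 0 < s) :
    ∏ r ∈ Finset.range N, PPr (g * N) (g * r + s) = PPr g s := by
  unfold PPr
  rw [tprod_split _ (np_ppr g s hg hs) N hN]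
  refine Finset.prod_congr rfl fun r _ => ?_
  refine tprod_congr fun k => ?_
  congr 2; ring

theorem ee_np_const (N : ℕ) (hN : 0 < N) : constantCoeff (EE N) = 1 := (np_qf N hN).tprod_const
theorem ee_ne (N : ℕ) (hN : 0 < N) : EE N ≠ 0 := (np_qf N hN).tprod_ne

theorem pp_ee (m : ℕ) (hm : 0 < m) : PPr m m * EE m = EE (2 * m) := by
  unfold PPr EE
  rw [← (np_ppr m m hm hm).tprod_mul (np_qf m hm)]
  refine tprod_congr fun k => ?_
  ring

theorem th_ppr (N i : ℕ) (hi : i < N) (h0 : 0 < i) : th N i (-1) = EE N * PPr N i * PPr N (N - i) := by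
  rw [jtp N i hi (-1) (by norm_num)]
  have h1 : PPr N i = (1 + X ^ i) * ∏' k : ℕ, (1 + X ^ (N * (k + 1) + i)) := by
    unfold PPr
    have hnp := np_ppr N i (by omega) h0
    have hnp' : NP (fun k => (1 + X ^ (N * (k + 1) + i) : PS)) := by
      intro k
      rw [add_sub_cancel_left]
      exact pow_dvd_pow _ (by nlinarith [Nat.le_mul_of_pos_left k (show 0 < N by omega)])
    refine ps_ext_dvd fun n => ?_
    have h2 := hnp.dvd n (n + 1) (by omega)
    have h3 := hnp'.dvd n n (by omega)
    rw [Finset.prod_range_succ'] at h2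
    have h4 := Dvd.dvd.mul_left h3 (1 + X ^ i : PS)
    have := dvd_sub h2 h4
    convert this using 1
    simp only [mul_zero, zero_add]
    ring
  have h2 : PPr N (N - i) = ∏' k : ℕ, (1 + X ^ (N * (k + 1) - i)) := by
    unfold PPr
    refine tprod_congr fun k => ?_
    congr 2
    rw [mul_add]; omega
  rw [h1, h2]
  simp
  ring

theorem th_ppr0 (N : ℕ) (hN : 0 < N) : th N 0 (-1) = 2 * EE N * PPr N N ^ 2 := by
  rw [jtp N 0 hN (-1) (by norm_num)]
  unfold PPr
  have : (-1 : ℂ)⁻¹ = -1 := by norm_num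
  simp [this, mul_add]
  ring

def QQ (w : ℂˣ) (g : ℕ) (a : ℤ) : PS := ∏' k : ℕ, qq w (X ^ (g * (k + 1))) a

theorem np_qq (w : ℂˣ) (g : ℕ) (hg : 0 < g) (a : ℤ) : NP (fun k => qq w (X ^ (g * (k + 1))) a) := by
  unfold qq
  exact np_pow (fun k => Nat.le_mul_of_pos_left _ hg) _

theorem QQ_zero (w : ℂˣ) (g : ℕ) : QQ w g 0 = EE g := by
  unfold QQ EE qq; simp

theorem QQ_const (w : ℂˣ) (g : ℕ) (hg : 0 < g) (a : ℤ) : constantCoeff (QQ w g a) = 1 := (np_qq w g hg a).tprod_const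

theorem QQ_per {N : ℕ} {w : ℂˣ} (hw : w ^ N = 1) (g : ℕ) (a : ℤ) : QQ w g (a + N) = QQ w g a := by
  unfold QQ; simp only [qq_per hw]

theorem QQ_shift {N : ℕ} (hN : 0 < N) {w : ℂˣ} (hw : IsPrimitiveRoot w N) (g : ℕ) (hg : 0 < g) (a : ℤ) :
    ∏ r ∈ Finset.range N, QQ w g (a + r) = EE (g * N) := by
  unfold QQ
  rw [← NP.tprod_prod _ (fun r _ => np_qq w g hg _)]
  unfold EE
  refine tprod_congr fun k => ?_
  rw [qq_shift hN hw]; ring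

theorem QQ_sym (n : ℕ) {w : ℂˣ} (hw : IsPrimitiveRoot w (2 * n + 2)) (g : ℕ) (hg : 0 < g) (a : ℤ) :
    (∏ j : Fin n, (QQ w g (a + (j + 1)) * QQ w g (a - (j + 1)))) * (QQ w g a * QQ w g (a + (n + 1))) = EE (g * (2 * n + 2)) := by
  unfold QQ EE
  have h1 : ∀ a b, NP (fun k => qq w (X ^ (g * (k + 1))) a * qq w (X ^ (g * (k + 1))) b) := fun a b =>
    (np_qq w g hg a).mul (np_qq w g hg b)
  simp only [← (np_qq w g hg _).tprod_mul (np_qq w g hg _)]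
  rw [← NP.tprod_prod _ (fun r _ => h1 _ _), ← (NP.prod _ (fun r _ => h1 _ _)).tprod_mul (h1 _ _)]
  refine tprod_congr fun k => ?_
  rw [qq_sym n hw]; ring

theorem QQ_sym' (n : ℕ) (hn : 0 < n) {w : ℂˣ} (hw : IsPrimitiveRoot w (2 * n)) (g : ℕ) (hg : 0 < g) (a : ℤ) :
    (∏ j : Fin n, (QQ w g (a + j) * QQ w g (a - j))) * QQ w g (a + n) = EE (g * (2 * n)) * QQ w g a := by
  unfold QQ EE
  have h1 : ∀ a b, NP (fun k => qq w (X ^ (g * (k + 1))) a * qq w (X ^ (g * (k + 1))) b) := fun a b =>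
    (np_qq w g hg a).mul (np_qq w g hg b)
  simp only [← (np_qq w g hg _).tprod_mul (np_qq w g hg _)]
  rw [← NP.tprod_prod _ (fun r _ => h1 _ _), ← (NP.prod _ (fun r _ => h1 _ _)).tprod_mul (np_qq w g hg _),
    ← (np_qf _ (by positivity)).tprod_mul (np_qq w g hg _)]
  refine tprod_congr fun k => ?_
  rw [qq_sym' n hn hw]; ring

theorem QQ_half {n : ℕ} {w : ℂˣ} (hw : IsPrimitiveRoot w (2 * n)) (hn : 0 < n) (g : ℕ) :
    QQ w g n = PPr g g := by
  unfold QQ PPr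
  refine tprod_congr fun k => ?_
  have := qq_neg_half hw hn (X ^ (g * (k + 1))) 0
  rw [zero_add] at this
  rw [this]; simp; ring

theorem QQ_sq {n : ℕ} {w : ℂˣ} (hw : IsPrimitiveRoot w (2 * n)) (hn : 0 < n) (g : ℕ) (hg : 0 < g) (a : ℤ) :
    QQ w g a * QQ w g (a + n) = QQ (w ^ 2) (2 * g) a := by
  unfold QQ
  rw [← (np_qq w g hg _).tprod_mul (np_qq w g hg _)]
  refine tprod_congr fun k => ?_
  rw [qq_sq hw hn]; congr 1; ring

theorem QQ_two (w : ℂˣ) (g : ℕ) (a : ℤ) : QQ w g (2 * a) = QQ (w ^ 2) g a := by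
  unfold QQ qq
  refine tprod_congr fun k => ?_
  rw [zpow_mul]; norm_cast

theorem GG_QQ (w : ℂˣ) (g : ℕ) (a : ℤ) : GG g ((w ^ a : ℂˣ) : ℂ) = EE g * (QQ w g a * QQ w g (-a)) := by
  unfold GG QQ qq
  rw [mul_assoc]
  simp

theorem pair_const (n : ℕ) (c : PS) (hc : constantCoeff c = 1) :
    (∏ i : Fin n, ∏ j ∈ Finset.Ioi i, c ^ 2) * c ^ n = c ^ n ^ 2 := by
  apply ps_sq_eq
  · have := pair_sq (n := n) (fun _ _ => c ^ 2) (fun _ _ => rfl)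
    rw [mul_pow, ← pow_mul]
    simp only [Finset.prod_const, Finset.card_univ, Fintype.card_fin] at this ⊢
    rw [← pow_mul c, ← pow_mul c] at this
    rw [mul_comm n 2, this]; ring
  · simp [hc]
  · simp [hc]


theorem pair_mul {n : ℕ} (a b : Fin n → Fin n → PS) :
    ∏ i : Fin n, ∏ j ∈ Finset.Ioi i, (a i j * b i j) = (∏ i : Fin n, ∏ j ∈ Finset.Ioi i, a i j) * ∏ i : Fin n, ∏ j ∈ Finset.Ioi i, b i j := by
  simp only [Finset.prod_mul_distrib]

theorem GG_one (g : ℕ) : GG g ((1:ℂˣ):ℂ) = EE g ^ 3 := by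
  have := GG_QQ 1 g 0
  rw [zpow_zero, neg_zero, QQ_zero] at this
  rw [this]; ring

theorem G2_QQ (w : ℂˣ) (g : ℕ) (a b : ℤ) : G2 g (w ^ a) (w ^ b) =
    EE g ^ 2 * ((QQ w g (a + b) * QQ w g (-a - b)) * (QQ w g (a - b) * QQ w g (b - a))) := by
  unfold G2
  rw [← zpow_add, div_eq_mul_inv, ← zpow_sub, GG_QQ, GG_QQ, show -(a+b) = -a-b by ring, show -(a-b) = b-a by ring]
  ring

theorem QQ_shift1 (n : ℕ) {w : ℂˣ} (hw : IsPrimitiveRoot w (n + 1)) (g : ℕ) (hg : 0 < g) :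
    (∏ j : Fin n, QQ w g (j + 1)) * EE g = EE (g * (n + 1)) ∧
    (∏ j : Fin n, QQ w g (-(j + 1))) * EE g = EE (g * (n + 1)) := by
  constructor
  · rw [← QQ_shift (by omega) hw g hg 0, Finset.prod_range_succ', Finset.prod_range]
    simp [QQ_zero]
  · rw [← QQ_shift (by omega) hw g hg (-n), Finset.prod_range_succ, ← Finset.prod_range_reflect, Finset.prod_range]
    simp only [neg_add_cancel, QQ_zero]
    congr 1
    refine Finset.prod_congr rfl fun j _ => ?_
    congr 1
    have := j.2; omega

theorem PiC (n : ℕ) {w : ℂˣ} (hw : IsPrimitiveRoot w (2 * n + 2)) :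
    RR 1 (fun u => GG 1 (u ^ 2 : ℂˣ)) (fun j : Fin n => w ^ ((j:ℤ) + 1)) * (EE 1 ^ (n + 1) * EE (2 * n + 2)) =
      EE 1 ^ n ^ 2 * (EE (n + 1) * EE (2 * n + 2) ^ n * EE 2) := by
  set p : Fin n → ℤ := fun j => (j:ℤ) + 1 with hp
  set f : Fin n → Fin n → PS := fun i j => (QQ w 1 (p i + p j) * QQ w 1 (-p i - p j)) * (QQ w 1 (p i - p j) * QQ w 1 (p j - p i)) with hf
  have hw2 : IsPrimitiveRoot (w ^ 2) (n + 1) := hw.pow (by omega) (by ring)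
  have hw' : IsPrimitiveRoot w (2 * (n + 1)) := by convert hw using 1; ring
  set U := ∏ i, (QQ w 1 (2 * p i) * QQ w 1 (2 * (-p i))) with hU
  set F := ∏ i : Fin n, ∏ j ∈ Finset.Ioi i, f i j with hF
  have hRR : RR 1 (fun u => GG 1 (u ^ 2 : ℂˣ)) (fun j : Fin n => w ^ (p j)) = EE 1 ^ n ^ 2 * (U * F) := by
    unfold RR
    have h1 : ∀ i, GG 1 (((w ^ (p i)) ^ 2 : ℂˣ) : ℂ) = EE 1 * (QQ w 1 (2 * p i) * QQ w 1 (2 * (-p i))) := by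
      intro i
      rw [← zpow_natCast, ← zpow_mul, GG_QQ, mul_comm (p i)]
      simp [mul_comm]
    simp only [h1, G2_QQ]
    rw [pair_mul, Finset.prod_mul_distrib]
    rw [← pair_const n (EE 1) (ee_np_const 1 one_pos)]
    rw [Finset.prod_const, Finset.card_univ, Fintype.card_fin]
    simp only [hU, hF, hf]
    ring
  have hU1 : U * EE 1 ^ 2 = EE (n + 1) ^ 2 := by
    have := QQ_shift1 n hw2 1 one_pos
    rw [one_mul] at this
    simp only [hU, QQ_two, Finset.prod_mul_distrib]
    linear_combination (∏ x, QQ (w^2) 1 (-p x)) * EE 1 * this.1 + EE (n+1) * this.2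
  set V := ∏ i, (QQ (w ^ 2) 2 (p i) * QQ (w ^ 2) 2 (-p i)) with hV
  have hV1 : V * EE 2 ^ 2 = EE (2 * n + 2) ^ 2 := by
    have := QQ_shift1 n hw2 2 two_pos
    rw [show 2 * (n + 1) = 2 * n + 2 by ring] at this
    simp only [hV, Finset.prod_mul_distrib]
    linear_combination (∏ x, QQ (w^2) 2 (-p x)) * EE 2 * this.1 + EE (2 * n+2) * this.2
  have hrow : ∀ i, (∏ j, f i j) * (QQ (w ^ 2) 2 (p i) * QQ (w ^ 2) 2 (-p i)) = EE (2 * n + 2) ^ 2 := by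
    intro i
    have h1 := QQ_sym n hw 1 one_pos (p i)
    have h2 := QQ_sym n hw 1 one_pos (-p i)
    have e1 := QQ_sq hw' (by omega) 1 one_pos (p i)
    have e2 := QQ_sq hw' (by omega) 1 one_pos (-p i)
    push_cast at e1 e2
    rw [e1, one_mul] at h1
    rw [e2, one_mul] at h2
    rw [sq (EE _)]
    nth_rewrite 1 [← h1]; rw [← h2]
    have : ∏ j, f i j = (∏ j : Fin n, (QQ w 1 (p i + (j + 1)) * QQ w 1 (p i - (j + 1)))) * (∏ j : Fin n, (QQ w 1 (-p i + (j + 1)) * QQ w 1 (-p i - (j + 1)))) := by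
      rw [← Finset.prod_mul_distrib]
      refine Finset.prod_congr rfl fun j _ => ?_
      simp only [hf]
      rw [show p j - p i = -p i + (j + 1) by simp only [hp]; ring]
      simp only [hp]
      ring
    rw [this]; ring
  have hsym : ∀ i j, f i j = f j i := by
    intro i j; simp only [hf]
    rw [add_comm (p i), show -p i - p j = -p j - p i by ring]; ring
  have hps := pair_sq f hsym
  have hall : (∏ i, ∏ j, f i j) * V = EE (2 * n + 2) ^ (2 * n) := by
    rw [hV, ← Finset.prod_mul_distrib, Finset.prod_congr rfl (fun i _ => hrow i)]
    simp [pow_mul]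
  have hdiag : ∏ i, f i i = U * EE 1 ^ (2 * n) := by
    simp only [hf, sub_self, QQ_zero, Finset.prod_mul_distrib, hU]
    simp only [Finset.prod_const, Finset.card_univ, Fintype.card_fin, two_mul, neg_add, pow_add]
    simp only [sub_eq_add_neg]
  rw [hRR, mul_assoc]
  congr 1
  have hc : ∀ a, constantCoeff (QQ w 1 a) = 1 := fun a => QQ_const w 1 one_pos a
  apply ps_sq_eq
  · rw [hdiag] at hps
    rw [← hps] at hall
    linear_combination U * F ^ 2 * EE 1 ^ (2 * n) * EE (2 * n + 2) ^ 2 * hU1 - U * F ^ 2 * EE 1 ^ (2 * n) * EE (n + 1) ^ 2 * hV1 + EE (n + 1) ^ 2 * EE 2 ^ 2 * hall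
  · simp [hU, hF, hf, hc, ee_np_const, map_prod]
  · simp [ee_np_const]


theorem ppr_symm_prod (n : ℕ) (f : ℕ → PS) :
    (∏ i : Fin n, f (n - 1 - i)) = ∏ i : Fin n, f i := by
  rw [← Finset.prod_range (fun i => f i), ← Finset.prod_range (fun i => f (n - 1 - i))]
  exact Finset.prod_range_reflect f n

theorem tauC (n : ℕ) : (∏ i : Fin n, th (2 * n + 2) (n + 2 + i) (-1)) * (EE (2 * n + 2) * EE 1) =
    EE (2 * n + 2) ^ n * EE 2 * EE (n + 1) := by
  have h1 : ∀ i : Fin n, th (2 * n + 2) (n + 2 + i) (-1) =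
      EE (2 * n + 2) * PPr (2 * n + 2) (n + 2 + i) * PPr (2 * n + 2) ((n - 1 - i : ℕ) + 1) := by
    intro i
    have := i.2
    rw [th_ppr _ _ (by omega) (by omega)]
    congr 2; omega
  simp only [h1, Finset.prod_mul_distrib, Finset.prod_const, Finset.card_univ, Fintype.card_fin]
  rw [ppr_symm_prod n (fun i => PPr (2 * n + 2) (i + 1))]
  have h2 := ppr_prod 1 (2 * n + 2) one_pos (by omega) 1 one_pos
  have h3 := ppr_prod (n + 1) 2 (by omega) two_pos (n + 1) (by omega)
  have e1 := pp_ee 1 one_pos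
  have e2 := pp_ee (n + 1) (by omega)
  rw [show 2 * n + 2 = n + (1 + (n + 1)) by ring, Finset.prod_range_add, Finset.prod_range_add, Finset.prod_range_succ (n := n),
    Finset.prod_range, Finset.prod_range (n := n), show n + (1 + (n + 1)) = 2 * n + 2 by ring] at h2
  simp only [one_mul, Finset.prod_range_one, add_zero] at h2
  rw [Finset.prod_range_succ, Finset.prod_range_one, mul_zero, zero_add, mul_one, show (n + 1) * 2 = 2 * n + 2 by ring, show n + 1 + (n + 1) = 2 * n + 2 by ring] at h3
  have h4 : (∏ i : Fin n, PPr (2 * n + 2) (n + 2 + i)) = ∏ i : Fin n, PPr (2 * n + 2) (n + (1 + i) + 1) := by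
    refine Finset.prod_congr rfl fun i _ => ?_
    congr 1; ring
  rw [h4]
  rw [show n + (1 + n) + 1 = 2 * n + 2 by ring] at h2
  rw [show 2 * (n+1) = 2 * n + 2 by ring] at e2
  rw [mul_one] at e1
  rw [← e1, ← h2]
  set A := ∏ i : Fin n, PPr (2 * n + 2) (n + (1 + i) + 1)
  set B := ∏ i : Fin n, PPr (2 * n + 2) (i + 1)
  linear_combination EE (2*n+2)^n * A * B * EE 1 * (-e2 - EE (n+1) * h3)

theorem RRC1 (n : ℕ) : RR 1 (fun u => GG 1 (u ^ 2 : ℂˣ)) (fun _ : Fin n => 1) = EE 1 ^ (3 * n ^ 2) := by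
  unfold RR G2
  simp only [one_pow, mul_one, div_one, GG_one]
  have h := pair_const n (EE 1 ^ 3) (by simp [ee_np_const])
  simp only [← pow_add, ← pow_mul] at h ⊢
  rw [← h, Finset.prod_const, Finset.card_univ, Fintype.card_fin]
  ring

theorem C_final (n : ℕ) : ∑' c : Fin n → ℤ,
        C ((∏ i : Fin n, ((i + 1 + (2 * n + 2 : ℕ) * c i : ℤ) : ℂ) / ((i + 1 : ℤ) : ℂ)) *
        ∏ i : Fin n, ∏ j ∈ Finset.Ioi i, ((((j + 1 + (2 * n + 2 : ℕ) * c j) + (i + 1 + (2 * n + 2 : ℕ) * c i) : ℤ) : ℂ) / (((j + 1) + (i + 1) : ℤ) : ℂ)) *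
          ((((j + 1 + (2 * n + 2 : ℕ) * c j) - (i + 1 + (2 * n + 2 : ℕ) * c i) : ℤ) : ℂ) / (((j + 1) - (i + 1) : ℤ) : ℂ))) *
        X ^ (∑ i : Fin n, ex (2 * n + 2) (n + 2 + i) (c i)) = EE 1 ^ (2 * n ^ 2 + n) := by
  obtain ⟨w, hw⟩ : ∃ w : ℂˣ, IsPrimitiveRoot w (2 * n + 2) := by
    have h := Complex.isPrimitiveRoot_exp (2 * n + 2) (by omega)
    exact ⟨(h.isUnit (by omega)).unit, IsPrimitiveRoot.coe_units_iff.1 (by simpa using h)⟩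
  have h := C_raw n w hw
  have h1 := PiC n hw
  have h2 := tauC n
  rw [RRC1] at h
  refine (fun (key : ∀ S : PS, _ = _ * S → S = EE 1 ^ (2 * n ^ 2 + n)) => key _ h) ?_
  clear h
  intro S h
  set R := RR 1 (fun u => GG 1 (u ^ 2 : ℂˣ)) (fun j : Fin n => w ^ ((j:ℤ) + 1))
  set τ := ∏ i : Fin n, th (2 * n + 2) (n + 2 + i) (-1)
  have hne : EE 1 ^ n ^ 2 * (EE (n + 1) * EE (2 * n + 2) ^ n * EE 2) ≠ 0 := by
    have := ee_ne 1 one_pos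
    have := ee_ne 2 two_pos
    have := ee_ne (n+1) (by omega)
    have := ee_ne (2*n+2) (by omega)
    simp [*]
  apply mul_left_cancel₀ hne
  have e : EE 1 ^ (2 * n ^ 2 + n) * EE 1 ^ n ^ 2 = EE 1 ^ (3 * n ^ 2) * EE 1 ^ n := by ring
  linear_combination -S * h1 + EE 1 ^ (3 * n ^2) * EE 1 ^ n * h2 - EE 1 ^ (n + 1) * EE (2 * n + 2) * h - EE (n + 1) * EE (2 * n + 2) ^ n * EE 2 * e


theorem neg_half_unit {n : ℕ} {w : ℂˣ} (hw : IsPrimitiveRoot w (2 * n)) (hn : 0 < n) : w ^ n = -1 := by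
  have h1 : (w ^ n) ^ 2 = 1 := by rw [← pow_mul, mul_comm, hw.pow_eq_one]
  have h3 : (((w ^ n : ℂˣ) : ℂ)) ^ 2 = 1 := by rw [← Units.val_pow_eq_pow_val, h1]; rfl
  rcases mul_self_eq_one_iff.1 ((sq _).symm.trans h3) with h | h
  · exact absurd (Units.ext h) (hw.pow_ne_one_of_pos_of_lt hn.ne' (by omega))
  · exact Units.ext h

theorem PiF (n : ℕ) (hn : 0 < n) {w : ℂˣ} (hw : IsPrimitiveRoot w (2 * n)) :
    RR 2 (fun u => GG 1 (-u : ℂˣ)) (fun j : Fin n => w ^ (j:ℤ)) * (EE 1 ^ 2 * EE 2 ^ (2 * n) * EE (2 * n) * EE 4) =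
      EE 1 ^ n * EE 2 ^ n ^ 2 * (EE (2 * n) * EE 2 ^ 3 * EE (4 * n) ^ n) := by
  set f : Fin n → Fin n → PS := fun i j => (QQ w 2 (i + j) * QQ w 2 (-i - j)) * (QQ w 2 (i - j) * QQ w 2 (j - i)) with hf
  have hw2 : IsPrimitiveRoot (w ^ 2) n := hw.pow (by omega) (by ring)
  set Lf := ∏ i : Fin n, (QQ w 1 (n + i) * QQ w 1 (n - i)) with hL
  set F := ∏ i : Fin n, ∏ j ∈ Finset.Ioi i, f i j with hF
  have hRR : RR 2 (fun u => GG 1 (-u : ℂˣ)) (fun j : Fin n => w ^ (j:ℤ)) * EE 2 ^ n = EE 1 ^ n * EE 2 ^ n ^ 2 * (Lf * F) := by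
    unfold RR
    have h1 : ∀ i : Fin n, GG 1 ((-(w ^ (i:ℤ)) : ℂˣ) : ℂ) = EE 1 * (QQ w 1 (n + i) * QQ w 1 (n - i)) := by
      intro i
      rw [neg_eq_neg_one_mul, ← neg_half_unit hw hn, ← zpow_natCast, ← zpow_add, GG_QQ]
      have := QQ_per hw.pow_eq_one 1 (-(n + i : ℤ))
      rw [← this]
      congr 3; push_cast; ring
    simp only [h1, G2_QQ]
    rw [pair_mul, Finset.prod_mul_distrib, ← pair_const n (EE 2) (ee_np_const 2 two_pos),
      Finset.prod_const, Finset.card_univ, Fintype.card_fin]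
    simp only [hL, hF, hf]
    ring
  have ep1 := pp_ee 1 one_pos
  have ep2 := pp_ee 2 two_pos
  have hL1 : Lf * EE 1 ^ 2 = EE (2 * n) * EE 2 := by
    have h1 := QQ_sym' n hn hw 1 one_pos n
    have h2 := QQ_per hw.pow_eq_one 1 0
    rw [QQ_zero, show ((0:ℤ) + (2 * n : ℕ)) = n + n by push_cast; ring] at h2
    rw [h2, QQ_half hw hn, one_mul] at h1
    simp only [hL]
    linear_combination EE 1 * h1 + EE (2 * n) * ep1
  have hU : (∏ i : Fin n, (QQ w 2 (2 * i) * QQ w 2 (2 * (-i)))) = EE (2 * n) ^ 2 := by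
    simp only [QQ_two, Finset.prod_mul_distrib]
    have h1 := QQ_shift hn hw2 2 two_pos 0
    have h2 := QQ_shift hn hw2 2 two_pos (-(n-1:ℕ))
    rw [← Finset.prod_range_reflect, Finset.prod_range] at h2
    rw [Finset.prod_range] at h1
    rw [sq (EE _)]; nth_rewrite 1 [← h1]; rw [← h2]
    congr 1
    · simp
    · refine Finset.prod_congr rfl fun i _ => ?_
      have := i.2
      congr 1; omega
  set A := ∏ i : Fin n, (QQ w 2 (n + i) * QQ w 2 (n - i)) with hA
  have hA1 : A * EE 2 ^ 2 = EE (4 * n) * EE 4 := by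
    have h1 := QQ_sym' n hn hw 2 two_pos n
    have h2 := QQ_per hw.pow_eq_one 2 0
    rw [QQ_zero, show ((0:ℤ) + (2 * n : ℕ)) = n + n by push_cast; ring] at h2
    rw [h2, QQ_half hw hn, show 2 * (2 * n) = 4 * n by ring] at h1
    simp only [hA]
    linear_combination EE 2 * h1 + EE (4 * n) * ep2
  set B := ∏ i : Fin n, (QQ w 2 i * QQ w 2 (-i)) with hB
  have hB1 : B * EE 4 = EE (4 * n) * EE 2 ^ 2 := by
    have h1 := QQ_sym' n hn hw 2 two_pos 0
    rw [QQ_zero, zero_add, QQ_half hw hn, show 2 * (2 * n) = 4 * n by ring] at h1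
    simp only [zero_add, zero_sub] at h1
    simp only [hB]
    linear_combination EE 2 * h1 - (∏ i : Fin n, (QQ w 2 i * QQ w 2 (-i))) * ep2
  have hrow : ∀ i : Fin n, (∏ j, f i j) * (QQ w 2 (n + i) * QQ w 2 (n - i)) = EE (4 * n) ^ 2 * (QQ w 2 i * QQ w 2 (-i)) := by
    intro i
    have h1 := QQ_sym' n hn hw 2 two_pos i
    have h2 := QQ_sym' n hn hw 2 two_pos (-i)
    have : ∏ j, f i j = (∏ j : Fin n, (QQ w 2 (i + j) * QQ w 2 (i - j))) * (∏ j : Fin n, (QQ w 2 (-i + j) * QQ w 2 (-i - j))) := by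
      rw [← Finset.prod_mul_distrib]
      refine Finset.prod_congr rfl fun j _ => ?_
      simp only [hf]
      rw [show (j - i : ℤ) = -i + j by ring]
      ring
    rw [this, show (n + i : ℤ) = i + n by ring, show (n - i : ℤ) = -i + n by ring]
    rw [show 2 * (2 * n) = 4 * n by ring] at h1 h2
    linear_combination (∏ j : Fin n, (QQ w 2 (-i + j) * QQ w 2 (-i - j))) * QQ w 2 (-i + n) * h1 + EE (4 * n) * QQ w 2 i * h2
  have hsym : ∀ i j, f i j = f j i := by
    intro i j; simp only [hf]
    rw [add_comm (i:ℤ), show (-i - j : ℤ) = -j - i by ring]; ring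
  have hps := pair_sq f hsym
  have hall : (∏ i, ∏ j, f i j) * A = EE (4 * n) ^ (2 * n) * B := by
    rw [hA, ← Finset.prod_mul_distrib, Finset.prod_congr rfl (fun i _ => hrow i), Finset.prod_mul_distrib]
    simp [pow_mul, hB]
  have hdiag : ∏ i, f i i = EE (2 * n) ^ 2 * EE 2 ^ (2 * n) := by
    rw [← hU]
    simp only [hf, sub_self, QQ_zero, Finset.prod_mul_distrib]
    simp only [Finset.prod_const, Finset.card_univ, Fintype.card_fin, two_mul, pow_add]
    simp only [sub_eq_add_neg]
  have hc : ∀ a, constantCoeff (QQ w 2 a) = 1 := fun a => QQ_const w 2 two_pos a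
  have hFF : F * (EE (2 * n) * EE 2 ^ n * EE 4) = EE (4 * n) ^ n * EE 2 ^ 2 := by
    apply ps_sq_eq
    · rw [hdiag] at hps
      rw [← hps] at hall
      have hne : EE (4 * n) ≠ 0 := ee_ne _ (by omega)
      apply mul_left_cancel₀ hne
      linear_combination EE 2 ^ 2 * EE 4 * hall - F ^ 2 * EE (2 * n) ^ 2 * EE 2 ^ (2 * n) * EE 4 * hA1 + EE (4 * n) ^ (2 * n) * EE 2 ^ 2 * hB1
    · simp [hF, hf, hc, ee_np_const, map_prod, hn]
    · simp [ee_np_const, hn]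
  linear_combination EE 1 ^ 2 * EE 2 ^ n * EE (2 * n) * EE 4 * hRR + EE 1 ^ n * EE 2 ^ n ^ 2 * Lf * EE 1 ^ 2 * hFF +
    EE 1 ^ n * EE 2 ^ n ^ 2 * EE (4 * n) ^ n * EE 2 ^ 2 * hL1

theorem tauF (n : ℕ) (hn : 0 < n) : (∏ i : Fin n, th (2 * (2 * n)) (2 * n + 1 + 2 * i) (-1)) * (EE 4 * EE 1) =
    EE (4 * n) ^ n * EE 2 ^ 2 := by
  have h1 : ∀ i : Fin n, th (2 * (2 * n)) (2 * n + 1 + 2 * i) (-1) =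
      EE (4 * n) * PPr (2 * (2 * n)) (2 * n + 1 + 2 * i) * PPr (2 * (2 * n)) (2 * (n - 1 - i : ℕ) + 1) := by
    intro i
    have := i.2
    rw [th_ppr _ _ (by omega) (by omega), show 4 * n = 2 * (2 * n) by ring]
    congr 2; omega
  simp only [h1, Finset.prod_mul_distrib, Finset.prod_const, Finset.card_univ, Fintype.card_fin]
  rw [ppr_symm_prod n (fun i => PPr (2 * (2 * n)) (2 * i + 1))]
  have h2 := ppr_prod 2 (2 * n) two_pos (by omega) 1 one_pos
  have h3 := ppr_prod 1 2 one_pos two_pos 1 one_pos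
  have e1 := pp_ee 1 one_pos
  have e2 := pp_ee 2 two_pos
  rw [two_mul n, Finset.prod_range_add, Finset.prod_range, Finset.prod_range (n := n), ← two_mul n] at h2
  have h4 : (∏ i : Fin n, PPr (2 * (2 * n)) (2 * n + 1 + 2 * i)) = ∏ i : Fin n, PPr (2 * (2 * n)) (2 * (n + i) + 1) := by
    refine Finset.prod_congr rfl fun i _ => ?_
    congr 1; ring
  rw [h4]
  rw [Finset.prod_range_succ, Finset.prod_range_one] at h3
  norm_num at h3 e1 e2
  set A := ∏ i : Fin n, PPr (2 * (2 * n)) (2 * (n + i) + 1)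
  set B := ∏ i : Fin n, PPr (2 * (2 * n)) (2 * i + 1)
  linear_combination EE (4 * n) ^ n * EE 4 * EE 1 * h2 - EE (4*n) ^ n * PPr 2 1 * EE 1 * e2 + EE (4 * n) ^ n * EE 1 * EE 2 * h3 + EE (4 * n) ^ n * EE 2 * e1

theorem GG_neg_one : GG 1 (-1) * EE 1 = EE 2 ^ 2 := by
  have h := th_GG 1 one_pos (-1) (by norm_num)
  have h1 := th_ppr0 1 one_pos
  have e1 := pp_ee 1 one_pos
  rw [h] at h1
  have h2 : (2 : PS) ≠ 0 := by
    intro h; have := congrArg constantCoeff h; rw [map_ofNat, map_zero] at this; norm_num at this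
  have h3 : GG 1 (-1) = EE 1 * PPr 1 1 ^ 2 := by
    apply mul_left_cancel₀ h2
    rw [← mul_assoc, ← h1]
    congr 1
    simp; norm_num
  rw [h3]
  norm_num at e1
  linear_combination (PPr 1 1 * EE 1 + EE 2) * e1

theorem RRF1 (n : ℕ) : RR 2 (fun u => GG 1 (-u : ℂˣ)) (fun _ : Fin n => 1) * (EE 1 ^ n * EE 2 ^ (3 * n)) =
    EE 2 ^ (2 * n + 3 * n ^ 2) := by
  unfold RR G2
  simp only [mul_one, div_one, GG_one]
  have h := pair_const n (EE 2 ^ 3) (by simp [ee_np_const])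
  simp only [← pow_add, ← pow_mul] at h
  simp only [← pow_add]
  rw [pow_add (EE 2) (2 * n), ← h, Finset.prod_const, Finset.card_univ, Fintype.card_fin, pow_mul (EE 2) 2, ← GG_neg_one]
  simp
  ring

theorem F_final (n : ℕ) (hn : 0 < n) : (∑' c : Fin n → ℤ,
        C (∏ i : Fin n, ∏ j ∈ Finset.Ioi i, ((((2 * (j + 1 + (2 * n : ℕ) * c j) - 1) + (2 * (i + 1 + (2 * n : ℕ) * c i) - 1) : ℤ) : ℂ) / (((2 * (j + 1) - 1) + (2 * (i + 1) - 1) : ℤ) : ℂ)) *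
          ((((2 * (j + 1 + (2 * n : ℕ) * c j) - 1) - (2 * (i + 1 + (2 * n : ℕ) * c i) - 1) : ℤ) : ℂ) / (((2 * (j + 1) - 1) - (2 * (i + 1) - 1) : ℤ) : ℂ))) *
        X ^ (∑ i : Fin n, ex (2 * (2 * n)) (2 * n + 1 + 2 * i) (c i))) * EE 1 ^ (2 * n - 1) = EE 2 ^ (2 * n ^ 2 + n - 1) := by
  obtain ⟨w, hw⟩ : ∃ w : ℂˣ, IsPrimitiveRoot w (2 * n) := by
    have h := Complex.isPrimitiveRoot_exp (2 * n) (by omega)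
    exact ⟨(h.isUnit (by omega)).unit, IsPrimitiveRoot.coe_units_iff.1 (by simpa using h)⟩
  have h := F_raw n hn w hw
  have h1 := PiF n hn hw
  have h2 := tauF n hn
  have h3 := RRF1 n
  refine (fun (key : ∀ S : PS, _ = _ * S → S * EE 1 ^ (2 * n - 1) = EE 2 ^ (2 * n ^ 2 + n - 1)) => key _ h) ?_
  clear h
  intro S h
  obtain ⟨m, rfl⟩ : ∃ m, n = m + 1 := ⟨n - 1, by omega⟩
  rw [show 2 * (m + 1) - 1 = 2 * m + 1 by omega, show 2 * (m+1)^2 + (m+1) - 1 = 2 * (m+1)^2 + m by omega]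
  set n := m + 1 with hnm
  set R1 := RR 2 (fun u => GG 1 (-u : ℂˣ)) (fun _ : Fin n => 1)
  set R := RR 2 (fun u => GG 1 (-u : ℂˣ)) (fun j : Fin n => w ^ (j:ℤ))
  set τ := ∏ i : Fin n, th (2 * (2 * n)) (2 * n + 1 + 2 * i) (-1)
  have n1 := ee_ne 1 one_pos
  have n2 := ee_ne 2 two_pos
  have n3 := ee_ne 4 (by norm_num)
  have n4 := ee_ne (2*n) (by omega)
  have n5 := ee_ne (4*n) (by omega)
  have hne : EE 1 * EE (2 * n) * EE (4 * n) ^ n * EE 2 ^ (n ^ 2 + n + 3) ≠ 0 := by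
    exact mul_ne_zero (mul_ne_zero (mul_ne_zero n1 n4) (pow_ne_zero _ n5)) (pow_ne_zero _ n2)
  apply mul_left_cancel₀ hne
  have e : EE 1 * EE 1 ^ (2 * m + 1) = EE 1 ^ n * EE 1 ^ n := by rw [hnm]; ring
  have e2 : EE 2 ^ (n ^ 2 + n + 3) * EE 2 ^ (2 * n ^ 2 + m) = EE 2 ^ (2 * n + 3 * n ^ 2) * EE 2 ^ 2 := by rw [hnm]; ring
  have e3 : EE 2 ^ (n ^ 2 + n + 3) = EE 2 ^ n ^ 2 * EE 2 ^ n * EE 2 ^ 3 := by ring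
  linear_combination EE (2 * n) * EE (4 * n) ^ n * EE 2 ^ (n ^ 2 + n + 3) * S * e
    - EE 1 * EE (2 * n) * EE (4 * n) ^ n * e2
    + EE (2 * n) * EE (4 * n) ^ n * S * EE 1 ^ n * EE 1 ^ n * e3
    - S * EE 1 ^ n * EE 2 ^ n * h1
    - EE 1 ^ n * EE 2 ^ (3 * n) * EE 4 * EE 1 ^ 2 * EE (2 * n) * h
    + τ * EE 4 * EE 1 ^ 2 * EE (2 * n) * h3
    + EE 2 ^ (2 * n + 3 * n ^ 2) * EE 1 * EE (2 * n) * h2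


theorem tauA (N : ℕ) (hN : 0 < N) : (∏ i : Fin N, th N i (-1)) * EE 1 = EE N ^ N * th 1 0 (-1) := by
  obtain ⟨m, rfl⟩ : ∃ m, N = m + 1 := ⟨N - 1, by omega⟩
  rw [Fin.prod_univ_succ, th_ppr0 1 one_pos]
  simp only [Fin.val_zero, th_ppr0 _ hN]
  have h1 : ∀ i : Fin m, th (m + 1) (i.succ) (-1) =
      EE (m + 1) * PPr (m + 1) (i + 1) * PPr (m + 1) ((m - 1 - i : ℕ) + 1) := by
    intro i
    have := i.2
    rw [Fin.val_succ, th_ppr _ _ (by omega) (by omega)]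
    congr 2; omega
  simp only [h1, Finset.prod_mul_distrib, Finset.prod_const, Finset.card_univ, Fintype.card_fin]
  rw [ppr_symm_prod m (fun i => PPr (m + 1) (i + 1))]
  have h2 := ppr_prod 1 (m + 1) one_pos (by omega) 1 one_pos
  rw [Finset.prod_range_succ, Finset.prod_range] at h2
  simp only [one_mul] at h2
  rw [← h2]; ring

theorem A_final (N : ℕ) (hN : 0 < N) (hev : Even N) (ζ : ℂˣ) :
      ∑' c : Fin N → ℤ,
        C (((ζ:ℂ) ^ (N * ∑ i, c i)) * ∏ i : Fin N, ∏ j ∈ Finset.Ioi i,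
          (((((j + N * c j) - (i + N * c i) : ℤ) : ℂ) / ((j - i : ℤ) : ℂ)))) *
        X ^ (∑ i : Fin N, ex N i (c i)) = EE 1 ^ (N ^ 2 - 1) * th 1 0 ((ζ:ℂ) ^ N) := by
  obtain ⟨w, hw⟩ : ∃ w : ℂˣ, IsPrimitiveRoot w N := by
    have h := Complex.isPrimitiveRoot_exp N (by omega)
    exact ⟨(h.isUnit (by omega)).unit, IsPrimitiveRoot.coe_units_iff.1 (by simpa using h)⟩
  have h := A_raw N hN hev w hw ζ
  have h2 := tauA N hN
  refine (fun (key : ∀ S : PS, _ = _ * S → S = _) => key _ h) ?_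
  clear h
  intro S h
  have hw1 : (∏ i : Fin N, w ^ (i:ℤ)) = -1 := by
    obtain ⟨m, rfl⟩ := hev
    rw [← two_mul] at *
    simp only [zpow_natCast]
    rw [Finset.prod_pow_eq_pow_sum, ← Finset.sum_range (fun i => i), Finset.sum_range_id]
    rw [show 2 * m * (2 * m - 1) / 2 = m * (2 * m - 1) by rw [mul_assoc, Nat.mul_div_cancel_left _ two_pos], pow_mul, neg_half_unit hw (by omega)]
    apply Odd.neg_one_pow
    exact ⟨m - 1, by omega⟩
  set f : Fin N → Fin N → PS := fun i j => QQ w 1 (i - j) * QQ w 1 (j - i) with hf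
  set F := ∏ i : Fin N, ∏ j ∈ Finset.Ioi i, f i j with hF
  set P := ∏ i : Fin N, ∏ j ∈ Finset.Ioi i, EE 1 with hP
  have r1 : RA (fun _ : Fin N => ζ) = P ^ 3 * th 1 0 ((ζ:ℂ) ^ N) := by
    unfold RA
    simp only [div_self', GG_one]
    rw [hP]
    simp only [Finset.prod_pow]
    simp
  have r2 : RA (fun j : Fin N => w ^ (j:ℤ)) = P * F * th 1 0 (-1) := by
    unfold RA
    rw [hw1]
    have : ∀ i j : Fin N, GG 1 ((w ^ (i:ℤ) / w ^ (j:ℤ) : ℂˣ) : ℂ) = EE 1 * f i j := by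
      intro i j
      rw [div_eq_mul_inv, ← zpow_sub, GG_QQ]
      simp [hf]
    simp only [this]
    rw [pair_mul]; simp [hP, hF]
  have hPc : P ^ 2 * EE 1 ^ N = EE 1 ^ N ^ 2 := by
    have := pair_const N (EE 1) (ee_np_const 1 one_pos)
    rw [← this, hP]; simp only [Finset.prod_pow]
  have hsym : ∀ i j, f i j = f j i := fun i j => by simp only [hf]; ring
  have hps := pair_sq f hsym
  have hrow : ∀ i : Fin N, ∏ j, f i j = EE N ^ 2 := by
    intro i
    have h1 := QQ_shift hN hw 1 one_pos (-i)
    have h3 := QQ_shift hN hw 1 one_pos (i - (N - 1 : ℕ))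
    rw [← Finset.prod_range_reflect] at h3
    rw [Finset.prod_range, one_mul] at h1 h3
    rw [sq (EE _)]; nth_rewrite 1 [← h3]; rw [← h1]
    rw [← Finset.prod_mul_distrib]
    refine Finset.prod_congr rfl fun j _ => ?_
    have := j.2
    simp only [hf]
    congr 2
    · omega
    · ring
  have hc : ∀ a, constantCoeff (QQ w 1 a) = 1 := fun a => QQ_const w 1 one_pos a
  have hFF : F * EE 1 ^ N = EE N ^ N := by
    apply ps_sq_eq
    · rw [Finset.prod_congr rfl (fun i _ => hrow i)] at hps
      simp only [hf, sub_self, QQ_zero, Finset.prod_const, Finset.card_univ, Fintype.card_fin] at hps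
      rw [← pow_mul, mul_comm 2 N, pow_mul] at hps
      rw [← hps]; simp only [hF, hf]; ring
    · simp [hF, hf, hc, ee_np_const, map_prod]
    · simp [ee_np_const, hN]
  rw [r1, r2] at h
  have n0 : th 1 0 (-1) ≠ 0 := by
    have := th_ppr0 1 one_pos
    rw [this]
    have h2 : (2 : PS) ≠ 0 := by
      intro h; have := congrArg constantCoeff h; rw [map_ofNat, map_zero] at this; norm_num at this
    exact mul_ne_zero (mul_ne_zero h2 (ee_ne 1 one_pos)) (pow_ne_zero _ (np_ppr 1 1 one_pos one_pos).tprod_ne)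
  have n1 := ee_ne 1 one_pos
  have n2 := ee_ne N hN
  have n3 : P ≠ 0 := by
    rw [hP]; simp [Finset.prod_ne_zero_iff, n1]
  apply mul_left_cancel₀ (mul_ne_zero (mul_ne_zero (mul_ne_zero n0 n1) (pow_ne_zero N n2)) n3)
  have e : EE 1 * EE 1 ^ (N ^ 2 - 1) = EE 1 ^ N ^ 2 := by
    rw [← pow_succ']; congr 1
    have : 0 < N ^ 2 := by positivity
    omega
  set Z := th 1 0 ((ζ:ℂ) ^ N)
  set τ := ∏ i : Fin N, th N i (-1)
  linear_combination -th 1 0 (-1) * EE N ^ N * P * Z * e - th 1 0 (-1) * EE 1 * P * S * hFF - EE 1 * EE 1 ^ N * h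
    + P ^ 3 * Z * EE 1 ^ N * h2 + P * Z * EE N ^ N * th 1 0 (-1) * hPc


theorem tele1 (d T : ℂ) (h : ∀ k : ℤ, d - k * T ≠ 0) (K : ℕ) :
    ∏ k ∈ Finset.range K, (1 - T ^ 2 / (d - k * T) ^ 2) = ((d + T) / d) * ((d - K * T) / (d - K * T + T)) := by
  have h0 : d ≠ 0 := by simpa using h 0
  induction K with
  | zero =>
    have h1 : d + T ≠ 0 := by have := h (-1); push_cast at this; convert this using 1; ring
    simp; field_simp
  | succ K ih =>
    rw [Finset.prod_range_succ, ih]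
    have h1 : d - K * T ≠ 0 := by have := h K; push_cast at this; exact this
    have h2 : d - K * T + T ≠ 0 := by have := h (K - 1); push_cast at this; convert this using 1; ring
    have h3 : d - (K + 1 : ℕ) * T = d - K * T - T := by push_cast; ring
    rw [h3]
    generalize d - K * T = e at *
    rw [sub_add_cancel]
    field_simp
    ring

theorem runner (T : ℤ) (hT : 0 < T) (s q0 : ℤ) (hnd : ¬ T ∣ s - q0) (lo : -s < q0) (hi : q0 < s + T) :
    ∏ q ∈ (Finset.Ioo (-s) s).filter (fun q => T ∣ q - q0 ∧ q0 ≤ q), (1 - (T:ℂ) ^ 2 / ((s - q : ℤ) : ℂ) ^ 2) =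
      (((s - q0 + T : ℤ) : ℂ) / ((s - q0 : ℤ) : ℂ)) * (-(((q0 - s) % T : ℤ) : ℂ) / ((T - (q0 - s) % T : ℤ) : ℂ)) := by
  set δ := (q0 - s) % T with hδ
  have d0 : 0 ≤ δ := Int.emod_nonneg _ hT.ne'
  have d1 : δ < T := Int.emod_lt_of_pos _ hT
  have d2 : δ ≠ 0 := by
    intro h; apply hnd
    have := Int.dvd_of_emod_eq_zero h
    rwa [← Int.dvd_neg, neg_sub] at this
  have hdiv := Int.mul_ediv_add_emod (q0 - s) T
  rw [← hδ] at hdiv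
  set κ := (q0 - s) / T with hκ
  have k0 : κ ≤ 0 := by
    by_contra hc
    have : T * 1 ≤ T * κ := by apply mul_le_mul_of_nonneg_left <;> omega
    omega
  obtain ⟨K, hK⟩ : ∃ K : ℕ, κ = -(K:ℤ) := ⟨(-κ).toNat, by omega⟩
  have key : (Finset.Ioo (-s) s).filter (fun q => T ∣ q - q0 ∧ q0 ≤ q) = (Finset.range K).image (fun k : ℕ => q0 + k * T) := by
    ext q
    simp only [Finset.mem_filter, Finset.mem_Ioo, Finset.mem_image, Finset.mem_range]
    constructor
    · rintro ⟨⟨h1, h2⟩, ⟨j, hj⟩, h3⟩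
      have hj0 : 0 ≤ j := by
        by_contra hc
        have : T * j ≤ T * (-1) := by apply mul_le_mul_of_nonneg_left <;> omega
        omega
      refine ⟨j.toNat, ?_, ?_⟩
      · by_contra hc
        have : T * K ≤ T * j := by apply mul_le_mul_of_nonneg_left <;> omega
        rw [hK] at hdiv
        have : T * -(K:ℤ) = - (T * K) := by ring
        omega
      · have : ((j.toNat : ℕ) : ℤ) = j := by omega
        rw [this, mul_comm]; omega
    · rintro ⟨k, hk, rfl⟩
      have h1 : 0 ≤ (k:ℤ) * T := by positivity
      have h2 : T * (k + 1) ≤ T * K := by apply mul_le_mul_of_nonneg_left <;> omega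
      rw [hK] at hdiv
      have e1 : T * -(K:ℤ) = - (T * K) := by ring
      have e2 : T * ((k:ℤ) + 1) = k * T + T := by ring
      refine ⟨⟨by omega, by omega⟩, ⟨k, by ring⟩, by omega⟩
  rw [key, Finset.prod_image]
  · have hne : ∀ k : ℤ, ((s - q0 : ℤ) : ℂ) - k * (T:ℂ) ≠ 0 := by
      intro k hk
      apply hnd
      have : s - q0 - k * T = 0 := by exact_mod_cast hk
      exact ⟨k, by linarith⟩
    have := tele1 _ _ hne K
    have hd : s - q0 - K * T = - δ := by rw [hK] at hdiv; linarith
    have hd' : ((s - q0 : ℤ) : ℂ) - K * (T:ℂ) = -(δ:ℂ) := by exact_mod_cast hd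
    rw [hd'] at this
    convert this using 1
    · refine Finset.prod_congr rfl fun k _ => ?_
      push_cast; ring
    · push_cast; ring
  · intro k _ k' _ h
    have h : q0 + k * T = q0 + k' * T := h
    have : (k:ℤ) * T = k' * T := by linarith
    have := mul_right_cancel₀ hT.ne' this
    exact_mod_cast this

theorem end_prod (t N : ℕ) (ht : 0 < t) (hN : 0 < N) :
    ∏ e ∈ Finset.Ioo 0 N, (-((t * e : ℕ) : ℂ) / ((t * N - t * e : ℤ) : ℂ)) = (-1) ^ (N - 1) := by
  obtain ⟨n, rfl⟩ : ∃ n, N = n + 1 := ⟨N - 1, by omega⟩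
  have : Finset.Ioo 0 (n + 1) = (Finset.range n).image (fun e => e + 1) := by
    ext x; simp only [Finset.mem_Ioo, Finset.mem_image, Finset.mem_range]
    constructor
    · intro h; exact ⟨x - 1, by omega, by omega⟩
    · rintro ⟨e, h, rfl⟩; omega
  rw [this, Finset.prod_image (by intro a _ b _ h; simpa using h)]
  have h1 : ∀ e ∈ Finset.range n, (-((t * (e + 1) : ℕ) : ℂ) / ((t * (n + 1 : ℕ) - t * (e + 1 : ℕ) : ℤ) : ℂ)) =
      (-1) * (((e + 1 : ℕ) : ℂ) / ((n - 1 - e + 1 : ℕ) : ℂ)) := by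
    intro e he
    have he := Finset.mem_range.1 he
    have h2 : (((n - 1 - e + 1 : ℕ) : ℂ)) = n - e := by
      rw [show n - 1 - e + 1 = n - e by omega, Nat.cast_sub he.le]
    rw [h2]
    have h3 : ((n:ℂ) - e) ≠ 0 := by
      rw [sub_ne_zero]; exact_mod_cast he.ne'
    have h4 : (t:ℂ) ≠ 0 := by exact_mod_cast ht.ne'
    have h5 : (((t * (n + 1 : ℕ) - t * (e + 1 : ℕ) : ℤ) : ℂ)) = t * (n - e) := by push_cast; ring
    rw [h5]
    push_cast
    field_simp
  rw [Finset.prod_congr rfl h1, Finset.prod_mul_distrib, Finset.prod_div_distrib,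
    Finset.prod_range_reflect (fun e => ((e + 1 : ℕ) : ℂ)), div_self]
  · simp
  · rw [Finset.prod_ne_zero_iff]; intro e _; exact_mod_cast Nat.succ_ne_zero e

theorem tele_all (t N : ℕ) (ht : 0 < t) (hN : 0 < N) (hev : Even N) (s : ℤ) (Q : ℤ → ℤ)
    (hper : ∀ u v, ((t * N : ℕ) : ℤ) ∣ u - v → Q u = Q v) (hQ : ∀ u, ((t * N : ℕ) : ℤ) ∣ Q u - u)
    (lo : ∀ u, - s < Q u) (hi : ∀ u, Q u < s + (t * N : ℕ)) (hs : Q s = s) :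
    ∏ q ∈ (Finset.Ioo (-s) s).filter (fun q => (t:ℤ) ∣ s - q ∧ Q q ≤ q),
        (1 - ((t * N : ℕ) : ℂ) ^ 2 / ((s - q : ℤ) : ℂ) ^ 2) =
      - ∏ e ∈ Finset.Ioo 0 N, (((s - Q (s + t * e) + (t * N : ℕ) : ℤ) : ℂ) / ((s - Q (s + t * e) : ℤ) : ℂ)) := by
  set T : ℤ := ((t * N : ℕ) : ℤ) with hT
  have hTt : T = t * N := by rw [hT]; push_cast; ring
  have T0 : 0 < T := by rw [hT]; exact_mod_cast Nat.mul_pos ht hN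
  have t0 : (0:ℤ) < t := by exact_mod_cast ht
  rw [← Finset.prod_fiberwise_of_maps_to (t := Finset.range N) (g := fun q => (((q - s) % T) / t).toNat)]
  · have hsplit : Finset.range N = insert 0 (Finset.Ioo 0 N) := by
      ext x; simp only [Finset.mem_range, Finset.mem_insert, Finset.mem_Ioo]; omega
    rw [hsplit, Finset.prod_insert (by simp)]
    have hfib : ∀ e ∈ Finset.range N, ((Finset.Ioo (-s) s).filter (fun q => (t:ℤ) ∣ s - q ∧ Q q ≤ q)).filter
        (fun q => (((q - s) % T) / t).toNat = e) =
        (Finset.Ioo (-s) s).filter (fun q => T ∣ q - Q (s + t * e) ∧ Q (s + t * e) ≤ q) := by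
      intro e he
      have he := Finset.mem_range.1 he
      ext q
      simp only [Finset.mem_filter, and_assoc]
      refine and_congr_right fun _ => ?_
      have hd : ((t:ℤ) ∣ s - q ∧ (((q - s) % T) / t).toNat = e) ↔ T ∣ q - (s + t * e) := by
        have m0 := Int.emod_nonneg (q - s) T0.ne'
        have m1 := Int.emod_lt_of_pos (q - s) T0
        have m2 := Int.mul_ediv_add_emod (q - s) T
        constructor
        · rintro ⟨h1, h2⟩
          have h3 : (t:ℤ) ∣ (q - s) % T := by
            rw [show (q - s) % T = -(s - q) - t * (N * ((q-s)/T)) by rw [hTt] at m2 ⊢; linarith]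
            exact dvd_sub (h1.neg_right) (dvd_mul_right _ _)
          obtain ⟨f, hf⟩ := h3
          rw [hf, Int.mul_ediv_cancel_left _ t0.ne'] at h2
          have f0 : 0 ≤ f := by
            by_contra hc
            have : (t:ℤ) * f ≤ t * (-1) := by apply mul_le_mul_of_nonneg_left <;> omega
            omega
          have : f = e := by omega
          rw [this] at hf
          exact ⟨(q - s) / T, by linarith⟩
        · rintro ⟨k, hk⟩
          have h1 : q - s = t * e + T * k := by linarith
          have h2 : (q - s) % T = t * e := by
            rw [h1, Int.add_mul_emod_self_left]
            apply Int.emod_eq_of_lt (by positivity)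
            rw [hTt]; apply mul_lt_mul_of_pos_left _ t0; exact_mod_cast he
          rw [h2, Int.mul_ediv_cancel_left _ t0.ne']
          refine ⟨⟨-(e + N * k), ?_⟩, by simp⟩
          rw [hTt] at h1; linarith
      constructor
      · rintro ⟨h1, h2, h3⟩
        have h4 := hd.1 ⟨h1, h3⟩
        have h5 := hper _ _ h4
        rw [← h5]
        refine ⟨?_, h2⟩
        have := hQ q
        rwa [← Int.dvd_neg, neg_sub] at this
      · rintro ⟨h1, h2⟩
        have h4 : T ∣ q - (s + t * e) := by
          have := dvd_add h1 (hQ (s + t * e))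
          rw [show q - (s + t * e : ℤ) = q - Q (s + t * e) + (Q (s + t * e) - (s + t * e)) by ring]
          exact this
        have h5 := hper _ _ h4
        have := hd.2 h4
        exact ⟨this.1, by rw [h5]; exact h2, this.2⟩
    have hz : ∏ q ∈ ((Finset.Ioo (-s) s).filter (fun q => (t:ℤ) ∣ s - q ∧ Q q ≤ q)).filter
        (fun q => (((q - s) % T) / t).toNat = 0), (1 - ((t * N : ℕ) : ℂ) ^ 2 / ((s - q : ℤ) : ℂ) ^ 2) = 1 := by
      rw [hfib 0 (Finset.mem_range.2 hN)]
      apply Finset.prod_eq_one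
      intro q hq
      simp only [Finset.mem_filter, Finset.mem_Ioo, Nat.cast_zero, mul_zero, add_zero, hs] at hq
      omega
    rw [hz, one_mul]
    have hrun : ∀ e ∈ Finset.Ioo 0 N, ∏ q ∈ ((Finset.Ioo (-s) s).filter (fun q => (t:ℤ) ∣ s - q ∧ Q q ≤ q)).filter
        (fun q => (((q - s) % T) / t).toNat = e), (1 - ((t * N : ℕ) : ℂ) ^ 2 / ((s - q : ℤ) : ℂ) ^ 2) =
        (((s - Q (s + t * e) + T : ℤ) : ℂ) / ((s - Q (s + t * e) : ℤ) : ℂ)) *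
          (-((t * e : ℕ) : ℂ) / ((t * N - t * e : ℤ) : ℂ)) := by
      intro e he
      have he := Finset.mem_Ioo.1 he
      have he1 : (t:ℤ) * e < T := by
        rw [hTt]; apply mul_lt_mul_of_pos_left _ t0; exact_mod_cast he.2
      have he2 : (0:ℤ) < t * e := by apply mul_pos t0; exact_mod_cast he.1
      rw [hfib e (Finset.mem_range.2 he.2)]
      have hm : (Q (s + t * e) - s) % T = t * e := by
        obtain ⟨k, hk⟩ := hQ (s + t * e)
        rw [show Q (s + t * e) - s = t * e + T * k by linarith, Int.add_mul_emod_self_left]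
        exact Int.emod_eq_of_lt he2.le he1
      have := runner T T0 s (Q (s + t * e)) ?_ (lo _) (hi _)
      · rw [hm] at this
        have e1 : ((t * N : ℕ) : ℂ) = ((T : ℤ) : ℂ) := by rw [hT]; push_cast; ring
        have e2 : ((t * e : ℕ) : ℂ) = ((t * e : ℤ) : ℂ) := by push_cast; ring
        rw [e1, e2, ← hTt]
        exact this
      · intro hd
        rw [← Int.dvd_neg, neg_sub] at hd
        have := Int.emod_eq_zero_of_dvd hd
        omega
    rw [Finset.prod_congr rfl hrun, Finset.prod_mul_distrib, end_prod t N ht hN]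
    rw [Odd.neg_one_pow (by obtain ⟨m, hm⟩ := hev; exact ⟨m - 1, by omega⟩)]
    ring
  · intro q hq
    simp only [Finset.mem_range]
    have m0 := Int.emod_nonneg (q - s) T0.ne'
    have m1 := Int.emod_lt_of_pos (q - s) T0
    have : ((q - s) % T) / t < N := by
      apply Int.ediv_lt_of_lt_mul t0
      rw [mul_comm, ← hTt]; exact m1
    omega


/-- Residue system data. -/
structure RS (t M : ℕ) (T H : ℤ) {ι : Type} [Fintype ι] (a : ι → ℤ) : Prop where
  t0 : 0 < t
  M0 : 0 < M
  hT : T = ((t * (2 * M) : ℕ) : ℤ)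
  hH : H = t * M
  pos : ∀ i, 0 < a i
  lt : ∀ i, a i < T
  inj : Function.Injective a
  sum_ne : ∀ i j, a i + a j ≠ T
  card : 2 * (Fintype.card ι : ℤ) + 2 = T

def dv (T u : ℤ) : ℤ := if T ∣ u then 1 else 0

def ch {ι : Type} [Fintype ι] (T : ℤ) (a : ι → ℤ) (c : ι → ℤ) (u : ℤ) : ℤ :=
  ∑ i, c i * (dv T (u - a i) - dv T (u + a i))

def Qh {ι : Type} [Fintype ι] (T : ℤ) (a : ι → ℤ) (c : ι → ℤ) (u : ℤ) : ℤ :=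
  (u - 1) % T + 1 + T * ch T a c u

theorem dv_congr {T u v : ℤ} (h : T ∣ u - v) : dv T u = dv T v := by
  unfold dv
  have : T ∣ u ↔ T ∣ v := by
    constructor
    · intro h1; have := dvd_sub h1 h; simpa using this
    · intro h1; have := dvd_add h1 h; simpa using this
  simp only [this]

theorem dv_neg (T u : ℤ) : dv T (-u) = dv T u := by unfold dv; simp only [Int.dvd_neg]

section
variable {t M : ℕ} {T H : ℤ} {ι : Type} [Fintype ι] {a : ι → ℤ}

theorem RS.T0 (h : RS t M T H a) : 0 < T := by
  rw [h.hT]; exact_mod_cast Nat.mul_pos h.t0 (Nat.mul_pos two_pos h.M0)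

theorem RS.TH (h : RS t M T H a) : T = 2 * H := by
  rw [h.hT, h.hH]; push_cast; ring

theorem RS.ndvd_sub (h : RS t M T H a) {i j : ι} (hij : i ≠ j) : ¬ T ∣ a i - a j := by
  rintro ⟨k, hk⟩
  have h1 := h.pos i; have h2 := h.lt i; have h3 := h.pos j; have h4 := h.lt j
  have : k = 0 := by
    have T0 := h.T0
    by_contra hc
    rcases lt_or_gt_of_ne hc with hc | hc
    · have : T * k ≤ T * (-1) := by apply mul_le_mul_of_nonneg_left <;> omega
      omega
    · have : T * 1 ≤ T * k := by apply mul_le_mul_of_nonneg_left <;> omega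
      omega
  rw [this] at hk
  exact hij (h.inj (by omega))

theorem RS.ndvd_add (h : RS t M T H a) (i j : ι) : ¬ T ∣ a i + a j := by
  rintro ⟨k, hk⟩
  have h1 := h.pos i; have h2 := h.lt i; have h3 := h.pos j; have h4 := h.lt j
  have T0 := h.T0
  have : k = 1 := by
    by_contra hc
    rcases lt_or_gt_of_ne hc with hc | hc
    · have : T * k ≤ T * 0 := by apply mul_le_mul_of_nonneg_left <;> omega
      omega
    · have : T * 2 ≤ T * k := by apply mul_le_mul_of_nonneg_left <;> omega
      omega
  rw [this] at hk
  exact h.sum_ne i j (by omega)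

theorem RS.ndvd (h : RS t M T H a) (i : ι) : ¬ T ∣ a i := by
  intro hd
  exact h.ndvd_add i i (dvd_add hd hd)

theorem RS.ndvdH (h : RS t M T H a) (i : ι) : ¬ T ∣ a i - H := by
  intro hd
  apply h.ndvd_add i i
  have := dvd_add (dvd_add hd hd) (dvd_refl T)
  rw [show a i + a i = a i - H + (a i - H) + T by rw [h.TH]; ring]
  exact this

theorem RS.ndvdH' (h : RS t M T H a) (i : ι) : ¬ T ∣ a i + H := by
  intro hd
  apply h.ndvdH i
  rw [show a i - H = a i + H - T by rw [h.TH]; ring]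
  exact dvd_sub hd (dvd_refl T)

theorem ch_congr (c : ι → ℤ) {u v : ℤ} (h : T ∣ u - v) : ch T a c u = ch T a c v := by
  unfold ch
  refine Finset.sum_congr rfl fun i _ => ?_
  rw [dv_congr (u := u - a i) (v := v - a i) (by simpa using h),
    dv_congr (u := u + a i) (v := v + a i) (by simpa using h)]

theorem ch_neg (c : ι → ℤ) (u : ℤ) : ch T a c (-u) = - ch T a c u := by
  unfold ch
  rw [← Finset.sum_neg_distrib]
  refine Finset.sum_congr rfl fun i _ => ?_
  rw [show -u - a i = -(u + a i) by ring, show -u + a i = -(u - a i) by ring, dv_neg, dv_neg]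
  ring

theorem ch_a (h : RS t M T H a) (c : ι → ℤ) (i : ι) : ch T a c (a i) = c i := by
  classical
  unfold ch
  rw [Finset.sum_eq_single i]
  · simp [dv, h.ndvd_add i i]
  · intro j _ hj
    simp [dv, h.ndvd_add i j, h.ndvd_sub hj.symm]
  · simp

theorem ch_zero (h : RS t M T H a) (c : ι → ℤ) {u : ℤ} (hu : T ∣ u) : ch T a c u = 0 := by
  have h1 := ch_neg (T := T) (a := a) c u
  have h2 : ch T a c (-u) = ch T a c u := ch_congr c (by
    rw [show -u - u = u * (-2) by ring]; exact dvd_mul_of_dvd_left hu _)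
  omega

theorem ch_H (h : RS t M T H a) (c : ι → ℤ) {u : ℤ} (hu : T ∣ u - H) : ch T a c u = 0 := by
  have h1 := ch_neg (T := T) (a := a) c u
  have h2 : ch T a c (-u) = ch T a c u := ch_congr c (by
    rw [show -u - u = (u - H) * (-2) - T by rw [h.TH]; ring]
    exact dvd_sub (dvd_mul_of_dvd_left hu _) (dvd_refl T))
  omega

theorem ch_add (c d : ι → ℤ) (u : ℤ) : ch T a (c + d) u = ch T a c u + ch T a d u := by
  unfold ch
  rw [← Finset.sum_add_distrib]
  refine Finset.sum_congr rfl fun i _ => ?_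
  simp only [Pi.add_apply]; ring

theorem ch_single [DecidableEq ι] (i : ι) (σ u : ℤ) :
    ch T a (Pi.single i σ) u = σ * (dv T (u - a i) - dv T (u + a i)) := by
  unfold ch
  rw [Finset.sum_eq_single i]
  · simp
  · intro j _ hj; simp [Pi.single_eq_of_ne hj]
  · simp

theorem res_congr {u v : ℤ} (h : T ∣ u - v) : (u - 1) % T = (v - 1) % T := by
  have : v - 1 ≡ u - 1 [ZMOD T] := Int.modEq_iff_dvd.2 (by simpa using h)
  exact this.symm

theorem Qh_congr (c : ι → ℤ) {u v : ℤ} (h : T ∣ u - v) : Qh T a c u = Qh T a c v := by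
  unfold Qh; rw [ch_congr c h, res_congr h]

theorem Qh_dvd (c : ι → ℤ) (u : ℤ) : T ∣ Qh T a c u - u := by
  have := Int.mul_ediv_add_emod (u - 1) T
  refine ⟨ch T a c u - (u - 1) / T, ?_⟩
  unfold Qh
  linarith

theorem Qh_idem (c : ι → ℤ) (u : ℤ) : Qh T a c (Qh T a c u) = Qh T a c u := Qh_congr c (Qh_dvd c u)

theorem Qh_zero (h : RS t M T H a) (c : ι → ℤ) {u : ℤ} (hu : T ∣ u) : Qh T a c u = T := by
  have T0 := h.T0
  rw [Qh_congr (v := 0) c (by simpa using hu)]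
  unfold Qh
  rw [ch_zero h c (dvd_zero T)]
  have : ((0:ℤ) - 1) % T = T - 1 := by
    rw [show (0:ℤ) - 1 = (T - 1) + T * (-1) by ring, Int.add_mul_emod_self_left]
    exact Int.emod_eq_of_lt (by omega) (by omega)
  omega

theorem Qh_of (h : RS t M T H a) (c : ι → ℤ) {u : ℤ} (h1 : 0 < u) (h2 : u < T) : Qh T a c u = u + T * ch T a c u := by
  unfold Qh
  rw [Int.emod_eq_of_lt (by omega) (by omega)]; ring

theorem Qh_a (h : RS t M T H a) (c : ι → ℤ) (i : ι) : Qh T a c (a i) = a i + T * c i := by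
  rw [Qh_of h c (h.pos i) (h.lt i), ch_a h]

theorem Qh_H (h : RS t M T H a) (c : ι → ℤ) {u : ℤ} (hu : T ∣ u - H) : Qh T a c u = H := by
  have T0 := h.T0
  have TH := h.TH
  rw [Qh_congr (v := H) c hu, Qh_of h c (by omega) (by omega), ch_H h c (by simp)]; ring

theorem Qh_neg (h : RS t M T H a) (c : ι → ℤ) {u : ℤ} (hu : ¬ T ∣ u) : Qh T a c (-u) = T - Qh T a c u := by
  have T0 := h.T0
  have m0 := Int.emod_nonneg u T0.ne'
  have m1 := Int.emod_lt_of_pos u T0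
  have m2 : u % T ≠ 0 := fun h => hu (Int.dvd_of_emod_eq_zero h)
  have hd : T ∣ u - u % T := Int.dvd_self_sub_emod
  rw [Qh_congr c hd, Qh_of h c (by omega) m1,
    Qh_congr (v := T - u % T) c (by
      rw [show -u - (T - u % T) = -(u - u % T) - T by ring]; exact dvd_sub (hd.neg_right) (dvd_refl T)),
    Qh_of h c (by omega) (by omega),
    ch_congr (v := -(u % T)) c (by rw [show T - u % T - -(u%T) = T by ring]), ch_neg]
  ring

theorem Qh_na (h : RS t M T H a) (c : ι → ℤ) (i : ι) : Qh T a c (- a i) = T - a i - T * c i := by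
  rw [Qh_neg h c (h.ndvd i), Qh_a h]; ring

theorem Qh_upd [DecidableEq ι] (c : ι → ℤ) (i : ι) (σ u : ℤ) :
    Qh T a (c + Pi.single i σ) u = Qh T a c u + T * (σ * (dv T (u - a i) - dv T (u + a i))) := by
  unfold Qh
  rw [ch_add, ch_single]; ring

/-- hole symmetry -/
theorem hole_symm (h : RS t M T H a) (c : ι → ℤ) {q : ℤ} (hq : q < 0) :
    Qh T a c q ≤ q ↔ -q < Qh T a c (-q) := by
  have T0 := h.T0
  by_cases hd : T ∣ q
  · rw [Qh_zero h c hd, Qh_zero h c (hd.neg_right)]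
    have : ¬ (-q < T) := by
      intro hc
      have := Int.eq_zero_of_dvd_of_nonneg_of_lt (by omega) hc (hd.neg_right)
      omega
    constructor <;> intro <;> omega
  · rw [Qh_neg h c hd]
    obtain ⟨k, hk⟩ := Qh_dvd (T := T) (a := a) c q
    have hk' : Qh T a c q = q + T * k := by omega
    rw [hk']
    constructor
    · intro h1; omega
    · intro h1
      by_contra hc
      have : 0 < k := by
        by_contra hc2
        have : T * k ≤ T * 0 := by apply mul_le_mul_of_nonneg_left <;> omega
        omega
      have : T * 1 ≤ T * k := by apply mul_le_mul_of_nonneg_left <;> omega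
      omega

def Sc (T : ℤ) (a : ι → ℤ) (c : ι → ℤ) : Finset ℕ :=
  (Finset.range (T * (1 + 2 * ∑ i, |c i|)).toNat).filter (fun m => 0 < m ∧ (m:ℤ) < Qh T a c m)

theorem mem_Sc (h : RS t M T H a) (c : ι → ℤ) (m : ℕ) : m ∈ Sc T a c ↔ 0 < m ∧ (m:ℤ) < Qh T a c m := by
  unfold Sc
  rw [Finset.mem_filter, Finset.mem_range]
  refine and_iff_right_of_imp ?_
  rintro ⟨_, h2⟩
  have T0 := h.T0
  have m1 := Int.emod_lt_of_pos ((m:ℤ) - 1) T0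
  have h3 : ch T a c m ≤ 2 * ∑ i, |c i| := by
    unfold ch
    rw [Finset.mul_sum]
    apply Finset.sum_le_sum
    intro i _
    have h4 : |dv T (m - a i) - dv T (m + a i)| ≤ 2 := by
      unfold dv; split_ifs <;> simp
    have := abs_mul (c i) (dv T (m - a i) - dv T (m + a i))
    have h5 := le_abs_self (c i * (dv T (m - a i) - dv T (m + a i)))
    have h6 : |c i| * |dv T (m - a i) - dv T (m + a i)| ≤ |c i| * 2 := by gcongr
    linarith
  have h4 : T * ch T a c m ≤ T * (2 * ∑ i, |c i|) := by gcongr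
  unfold Qh at h2
  have : (m:ℤ) < T * (1 + 2 * ∑ i, |c i|) := by linarith
  omega

theorem Sc_inj (h : RS t M T H a) : Function.Injective (Sc T a) := by
  have key : ∀ c d : ι → ℤ, Sc T a c = Sc T a d → ∀ q, Qh T a c q ≤ q → Qh T a d q ≤ q := by
    intro c d e q hq
    have T0 := h.T0
    rcases lt_trichotomy q 0 with h0 | h0 | h0
    · rw [hole_symm h d h0]
      rw [hole_symm h c h0] at hq
      have := (mem_Sc h c q.natAbs).2 ⟨by omega, by
        rw [show ((q.natAbs : ℕ) : ℤ) = -q by omega]; exact hq⟩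
      rw [e] at this
      have := ((mem_Sc h d _).1 this).2
      rwa [show ((q.natAbs : ℕ) : ℤ) = -q by omega] at this
    · rw [h0, Qh_zero h c (dvd_zero T)] at hq; omega
    · by_contra hc
      have := (mem_Sc h d q.natAbs).2 ⟨by omega, by
        rw [show ((q.natAbs : ℕ) : ℤ) = q by omega]; omega⟩
      rw [← e] at this
      have := ((mem_Sc h c _).1 this).2
      rw [show ((q.natAbs : ℕ) : ℤ) = q by omega] at this
      omega
  intro c d e
  have h1 : ∀ q, Qh T a d q ≤ Qh T a c q := by
    intro q
    have := key c d e (Qh T a c q) (by rw [Qh_idem])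
    rwa [Qh_congr d (Qh_dvd c q)] at this
  have h2 : ∀ q, Qh T a c q ≤ Qh T a d q := by
    intro q
    have := key d c e.symm (Qh T a d q) (by rw [Qh_idem])
    rwa [Qh_congr c (Qh_dvd d q)] at this
  ext i
  have := le_antisymm (h1 (a i)) (h2 (a i))
  rw [Qh_a h, Qh_a h] at this
  have : T * d i = T * c i := by omega
  exact (mul_left_cancel₀ h.T0.ne' this).symm

theorem Sc_zero (h : RS t M T H a) : Sc T a 0 = ∅ := by
  ext m
  rw [mem_Sc h]
  simp only [Finset.notMem_empty, iff_false, not_and, not_lt]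
  intro hm
  have T0 := h.T0
  unfold Qh
  have : ch T a 0 (m:ℤ) = 0 := by simp [ch]
  rw [this]
  have h1 := Int.mul_ediv_add_emod ((m:ℤ) - 1) T
  have h2 : 0 ≤ ((m:ℤ) - 1) / T := Int.ediv_nonneg (by omega) T0.le
  have h3 : 0 ≤ T * (((m:ℤ) - 1) / T) := by positivity
  omega

theorem Sc_add [DecidableEq ι] (h : RS t M T H a) (c : ι → ℤ) (i : ι) (σ : ℤ) (hσ : σ = 1 ∨ σ = -1) (s : ℕ) (hs : 0 < s)
    (hd : T ∣ s - σ * a i) (hQ : Qh T a c s = s) : Sc T a (c + Pi.single i σ) = insert s (Sc T a c) := by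
  have T0 := h.T0
  have hns : ¬ T ∣ (s:ℤ) := by
    intro h1
    have : T ∣ σ * a i := by have := dvd_sub h1 hd; simpa using this
    rcases hσ with rfl | rfl
    · exact h.ndvd i (by simpa using this)
    · exact h.ndvd i (by simpa using this)
  have hn2s : ¬ T ∣ (s:ℤ) + s := by
    intro h1
    apply h.ndvd_add i i
    rcases hσ with rfl | rfl
    · rw [show a i + a i = s + s - ((s - 1 * a i) + (s - 1 * a i)) by ring]
      exact dvd_sub h1 (dvd_add hd hd)
    · rw [show a i + a i = ((s - -1 * a i) + (s - -1 * a i)) - (s + s) by ring]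
      exact dvd_sub (dvd_add hd hd) h1
  have hupd : ∀ u, Qh T a (c + Pi.single i σ) u = Qh T a c u + T * (dv T (u - s) - dv T (u + s)) := by
    intro u
    rw [Qh_upd]
    congr 2
    rcases hσ with rfl | rfl
    · rw [one_mul, dv_congr (u := u - a i) (v := u - s) (by rw [show u - a i - (u - s) = s - 1 * a i by ring]; exact hd),
        dv_congr (u := u + a i) (v := u + s) (by rw [show u + a i - (u + s) = -(s - 1 * a i) by ring]; exact hd.neg_right)]
    · rw [dv_congr (u := u - a i) (v := u + s) (by rw [show u - a i - (u + s) = -(s - -1 * a i) by ring]; exact hd.neg_right),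
        dv_congr (u := u + a i) (v := u - s) (by rw [show u + a i - (u - s) = (s - -1 * a i) by ring]; exact hd)]
      ring
  ext m
  rw [Finset.mem_insert, mem_Sc h, mem_Sc h, hupd]
  by_cases h1 : T ∣ (m:ℤ) - s
  · have h2 : ¬ T ∣ (m:ℤ) + s := by
      intro h2; apply hn2s
      rw [show (s:ℤ) + s = m + s - (m - s) by ring]; exact dvd_sub h2 h1
    rw [Qh_congr c h1, hQ]
    simp only [dv, h1, h2, if_true, if_false]
    obtain ⟨k, hk⟩ := h1
    constructor
    · rintro ⟨h3, h4⟩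
      by_cases h5 : (m:ℤ) < s
      · right; exact ⟨h3, h5⟩
      · left
        have : k = 0 := by
          by_contra hc
          rcases lt_or_gt_of_ne hc with hc | hc
          · have : T * k ≤ T * (-1) := by apply mul_le_mul_of_nonneg_left <;> omega
            omega
          · have : T * 1 ≤ T * k := by apply mul_le_mul_of_nonneg_left <;> omega
            omega
        rw [this] at hk; omega
    · rintro (rfl | ⟨h3, h4⟩)
      · exact ⟨hs, by omega⟩
      · exact ⟨h3, by omega⟩
  · have hms : m ≠ s := by rintro rfl; simp at h1
    by_cases h2 : T ∣ (m:ℤ) + s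
    · have h3 : Qh T a c m = T - s := by
        rw [Qh_congr (v := -(s:ℤ)) c (by simpa using h2), Qh_neg h c hns, hQ]
      rw [h3]
      simp only [dv, h1, h2, if_true, if_false, hms, false_or]
      obtain ⟨k, hk⟩ := h2
      constructor
      · rintro ⟨h4, h5⟩; omega
      · rintro ⟨h4, h5⟩
        exfalso
        have : 1 ≤ k := by
          by_contra hc
          have : T * k ≤ T * 0 := by apply mul_le_mul_of_nonneg_left <;> omega
          omega
        have : T * 1 ≤ T * k := by apply mul_le_mul_of_nonneg_left <;> omega
        omega
    · simp [dv, h1, h2, hms]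

end


section
variable {t M : ℕ} {T H : ℤ} {ι : Type} [Fintype ι] {a : ι → ℤ}

def rmap (T H : ℤ) (a : ι → ℤ) : Bool ⊕ ι ⊕ ι → ℤ
  | .inl true => 0
  | .inl false => H
  | .inr (.inl i) => a i
  | .inr (.inr i) => T - a i

theorem rmap_inj (h : RS t M T H a) : Function.Injective (rmap T H a) := by
  have T0 := h.T0
  have TH := h.TH
  intro x y hxy
  rcases x with (_ | _) | i | i <;> rcases y with (_ | _) | j | j <;> simp only [rmap] at hxy <;>
    first
    | rfl
    | (exfalso
       first
       | omega
       | (have := h.pos i; have := h.lt i; omega)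
       | (have := h.pos j; have := h.lt j; omega)
       | (have := h.sum_ne i i; omega)
       | (have := h.sum_ne j j; omega)
       | (have := h.sum_ne i j; omega))
    | (have := h.inj hxy; rw [this])
    | (have := h.inj (show a i = a j by omega); rw [this])

theorem rmap_image (h : RS t M T H a) : Finset.univ.image (rmap T H a) = Finset.Ico 0 T := by
  have T0 := h.T0
  have TH := h.TH
  apply Finset.eq_of_subset_of_card_le
  · intro x hx
    obtain ⟨y, _, rfl⟩ := Finset.mem_image.1 hx
    rw [Finset.mem_Ico]
    rcases y with (_ | _) | i | i <;> simp only [rmap]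
    · omega
    · omega
    · have := h.pos i; have := h.lt i; omega
    · have := h.pos i; have := h.lt i; omega
  · rw [Finset.card_image_of_injective _ (rmap_inj h), Int.card_Ico]
    simp only [Finset.card_univ, Fintype.card_sum, Fintype.card_bool]
    have := h.card
    omega

theorem rs_prod (h : RS t M T H a) (G : ℤ → ℂ) (hG : ∀ u v, T ∣ u - v → G u = G v) :
    ∏ ρ ∈ Finset.Ico 0 T, G ρ = G 0 * G H * ∏ i, (G (a i) * G (-a i)) := by
  rw [← rmap_image h, Finset.prod_image (fun x _ y _ e => rmap_inj h e), Fintype.prod_sum_type, Fintype.prod_sum_type]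
  simp only [Fintype.prod_bool, rmap, Finset.prod_mul_distrib]
  congr 2
  refine Finset.prod_congr rfl fun i _ => hG _ _ (by simp)

theorem rs_cases (h : RS t M T H a) (u : ℤ) :
    T ∣ u ∨ T ∣ u - H ∨ ∃ i, ∃ σ : ℤ, (σ = 1 ∨ σ = -1) ∧ T ∣ u - σ * a i := by
  have T0 := h.T0
  have m0 := Int.emod_nonneg u T0.ne'
  have m1 := Int.emod_lt_of_pos u T0
  have hd : T ∣ u - u % T := Int.dvd_self_sub_emod
  have : u % T ∈ Finset.univ.image (rmap T H a) := by
    rw [rmap_image h, Finset.mem_Ico]; exact ⟨m0, m1⟩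
  obtain ⟨y, _, hy⟩ := Finset.mem_image.1 this
  rcases y with (_ | _) | i | i <;> simp only [rmap] at hy <;> rw [← hy] at hd
  · right; left; exact hd
  · left; simpa using hd
  · right; right; exact ⟨i, 1, Or.inl rfl, by simpa using hd⟩
  · right; right
    refine ⟨i, -1, Or.inr rfl, ?_⟩
    rw [show u - -1 * a i = u - (T - a i) + T by ring]
    exact dvd_add hd (dvd_refl T)

theorem Sc_down [DecidableEq ι] (h : RS t M T H a) (c : ι → ℤ) (s : ℕ) (hs : s ∈ Sc T a c) (hm : ∀ m ∈ Sc T a c, m ≤ s) :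
    ∃ c' : ι → ℤ, ∃ i, ∃ σ : ℤ, (σ = 1 ∨ σ = -1) ∧ T ∣ s - σ * a i ∧ Qh T a c' s = s ∧ c = c' + Pi.single i σ ∧
      Sc T a c = insert s (Sc T a c') ∧ s ∉ Sc T a c' := by
  have T0 := h.T0
  have hs' := (mem_Sc h c s).1 hs
  have hQ : Qh T a c s = s + T := by
    obtain ⟨k, hk⟩ := Qh_dvd (T := T) (a := a) c s
    have k1 : 1 ≤ k := by
      by_contra hc
      have : T * k ≤ T * 0 := by apply mul_le_mul_of_nonneg_left <;> omega
      omega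
    rcases eq_or_lt_of_le k1 with k1 | k1
    · rw [← k1] at hk; omega
    · exfalso
      have h2 : T * 2 ≤ T * k := by apply mul_le_mul_of_nonneg_left <;> omega
      have : s + T.toNat ∈ Sc T a c := by
        rw [mem_Sc h]
        refine ⟨by omega, ?_⟩
        rw [Qh_congr (v := (s:ℤ)) c (by
          rw [show (((s + T.toNat : ℕ) : ℤ)) - s = T by omega])]
        push_cast
        omega
      have := hm _ this
      omega
  rcases rs_cases h s with h1 | h1 | ⟨i, σ, hσ, hd⟩
  · exfalso
    have h2 := Qh_zero h c h1
    have := hs'.1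
    omega
  · exfalso
    have h2 := Qh_H h c h1
    have := h.TH
    omega
  · have hQ' : Qh T a (c + Pi.single i (-σ)) s = s := by
      rw [Qh_upd, hQ]
      have h3 : (-σ * (dv T (s - a i) - dv T (s + a i))) = -1 := by
        rcases hσ with rfl | rfl
        · rw [one_mul] at hd
          have : ¬ T ∣ (s:ℤ) + a i := by
            intro h4; apply h.ndvd_add i i
            rw [show a i + a i = s + a i - (s - a i) by ring]; exact dvd_sub h4 hd
          simp [dv, hd, this]
        · rw [show (s:ℤ) - -1 * a i = s + a i by ring] at hd
          have : ¬ T ∣ (s:ℤ) - a i := by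
            intro h4; apply h.ndvd_add i i
            rw [show a i + a i = s + a i - (s - a i) by ring]; exact dvd_sub hd h4
          simp [dv, hd, this]
      rw [h3]; ring
    have hc : c = (c + Pi.single i (-σ)) + Pi.single i σ := by
      ext j
      by_cases hj : j = i
      · subst hj; simp
      · simp [Pi.single_eq_of_ne hj]
    generalize (c + Pi.single i (-σ)) = c' at hQ' hc
    refine ⟨c', i, σ, hσ, hd, hQ', hc, ?_, ?_⟩
    · exact (congrArg (Sc T a) hc).trans (Sc_add h _ i σ hσ s hs'.1 hd hQ')
    · rw [mem_Sc h, hQ']; simp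

theorem c_ind [DecidableEq ι] (h : RS t M T H a) {P : (ι → ℤ) → Prop} (h0 : P 0)
    (step : ∀ (c : ι → ℤ) (i : ι) (σ : ℤ) (s : ℕ), (σ = 1 ∨ σ = -1) → 0 < s → T ∣ s - σ * a i → Qh T a c s = s →
      (∀ m ∈ Sc T a c, m < s) → Sc T a (c + Pi.single i σ) = insert s (Sc T a c) → P c → P (c + Pi.single i σ)) :
    ∀ c, P c := by
  suffices ∀ n, ∀ c, (Sc T a c).card = n → P c from fun c => this _ c rfl
  intro n
  induction n with
  | zero =>
    intro c hc
    rw [Finset.card_eq_zero, ← Sc_zero h] at hc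
    rw [Sc_inj h hc]; exact h0
  | succ n ih =>
    intro c hc
    have hne : (Sc T a c).Nonempty := by rw [← Finset.card_pos]; omega
    obtain ⟨s, hs, hm⟩ := (Sc T a c).exists_max_image id hne
    simp only [id] at hm
    obtain ⟨c', i, σ, hσ, hd, hQ, hcc, hS, hns⟩ := Sc_down h c s hs hm
    rw [hcc]
    apply step c' i σ s hσ ((mem_Sc h c s).1 hs).1 hd hQ
    · intro m hm'
      have := hm m (by rw [hS]; exact Finset.mem_insert_of_mem hm')
      rcases eq_or_lt_of_le this with h1 | h1
      · rw [h1] at hm'; exact absurd hm' hns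
      · exact h1
    · rw [← hcc]; exact hS
    · apply ih
      rw [hS, Finset.card_insert_of_notMem hns] at hc
      omega

/-- weights -/
def Dz (t : ℕ) (y z : ℂ) (d : ℕ) : ℂ := if t ∣ d then (y - y * t * z / d) * (y + y * t * z / d) else 1

def wt (t : ℕ) (y z : ℂ) (s : ℕ) (S : Finset ℕ) : ℂ :=
  if s = 0 then 0 else (if t ∣ s then y - y * t * z / s else 1) * (if t ∣ 2 * s then y - y * t * z / (2 * s : ℕ) else 1) *
    ∏ m ∈ Finset.Ioo 0 s, Dz t y z (if m ∈ S then s + m else s - m)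

def WW (t : ℕ) (y z : ℂ) (S : Finset ℕ) : ℂ := ∏ s ∈ S, wt t y z s S

theorem wt_congr (t : ℕ) (y z : ℂ) (s : ℕ) (S S' : Finset ℕ) (h : ∀ m, 0 < m → m < s → (m ∈ S ↔ m ∈ S')) :
    wt t y z s S = wt t y z s S' := by
  unfold wt
  split_ifs <;> first | rfl | skip
  all_goals
    congr 1
    refine Finset.prod_congr rfl fun m hm => ?_
    rw [Finset.mem_Ioo] at hm
    simp only [h m hm.1 hm.2]

theorem WW_insert (t : ℕ) (y z : ℂ) (s : ℕ) (S : Finset ℕ) (h : ∀ m ∈ S, m < s) :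
    WW t y z (insert s S) = wt t y z s S * WW t y z S := by
  unfold WW
  rw [Finset.prod_insert (fun hs => lt_irrefl _ (h s hs))]
  congr 1
  · apply wt_congr
    intro m _ hm
    simp [hm.ne]
  · refine Finset.prod_congr rfl fun m hm => ?_
    apply wt_congr
    intro m' _ hm'
    have := h m hm
    simp [(hm'.trans this).ne]

theorem WW_empty (t : ℕ) (y z : ℂ) : WW t y z ∅ = 1 := by simp [WW]

theorem wt_zero_aux (h : RS t M T H a) (S : Finset ℕ) (s m : ℕ) (h1 : 0 < m) (h2 : m < s)
    (hd : (((if m ∈ S then s + m else s - m : ℕ)) : ℤ) = T) : wt t 1 ((2 * M : ℕ) : ℂ) s S = 0 := by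
  unfold wt
  rw [if_neg (by omega)]
  apply mul_eq_zero_of_right
  apply Finset.prod_eq_zero (Finset.mem_Ioo.2 ⟨h1, h2⟩)
  have hd' : (if m ∈ S then s + m else s - m : ℕ) = t * (2 * M) := by
    rw [h.hT] at hd; exact_mod_cast hd
  rw [hd']
  unfold Dz
  rw [if_pos (dvd_mul_right _ _)]
  have : (1 * (t:ℂ) * ((2 * M : ℕ) : ℂ) / ((t * (2 * M) : ℕ) : ℂ)) = 1 := by
    rw [one_mul, ← Nat.cast_mul, div_self]
    have := h.t0; have := h.M0
    exact_mod_cast (by positivity)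
  rw [this]; simp

theorem wt_zero_T (h : RS t M T H a) (S : Finset ℕ) (s : ℕ) (hs : (s:ℤ) = T) : wt t 1 ((2 * M : ℕ) : ℂ) s S = 0 := by
  have hd' : s = t * (2 * M) := by
    rw [h.hT] at hs; exact_mod_cast hs
  have := h.t0; have := h.M0
  unfold wt
  rw [if_neg (by rw [hd']; positivity)]
  apply mul_eq_zero_of_left
  apply mul_eq_zero_of_left
  rw [hd', if_pos (dvd_mul_right _ _)]
  rw [one_mul, ← Nat.cast_mul, div_self, sub_self]
  exact_mod_cast (by positivity)

theorem wt_zero_H (h : RS t M T H a) (S : Finset ℕ) (s : ℕ) (hs : (s:ℤ) = H) : wt t 1 ((2 * M : ℕ) : ℂ) s S = 0 := by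
  have hd' : s = t * M := by
    rw [h.hH] at hs; exact_mod_cast hs
  have := h.t0; have := h.M0
  have h2 : 2 * s = t * (2 * M) := by rw [hd']; ring
  unfold wt
  rw [if_neg (by rw [hd']; positivity)]
  apply mul_eq_zero_of_left
  apply mul_eq_zero_of_right
  rw [h2, if_pos (dvd_mul_right _ _)]
  rw [one_mul, ← Nat.cast_mul, div_self, sub_self]
  exact_mod_cast (by positivity)

theorem wt_zero (h : RS t M T H a) (c : ι → ℤ) (s : ℕ) (hm : ∀ m ∈ Sc T a c, m < s)
    (hz : ¬ (0 < s ∧ ¬ T ∣ (s:ℤ) ∧ ¬ T ∣ s - H ∧ Qh T a c s = s)) : wt t 1 ((2 * M : ℕ) : ℂ) s (Sc T a c) = 0 := by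
  have T0 := h.T0
  have TH := h.TH
  by_cases hs0 : s = 0
  · unfold wt; rw [if_pos hs0]
  by_cases hsT : (s:ℤ) = T
  · exact wt_zero_T h _ s hsT
  by_cases hsH : (s:ℤ) = H
  · exact wt_zero_H h _ s hsH
  have hns : s ∉ Sc T a c := fun hs => lt_irrefl _ (hm s hs)
  have hle : Qh T a c s ≤ s := by
    by_contra hc
    exact hns ((mem_Sc h c s).2 ⟨by omega, by omega⟩)
  have hne : Qh T a c s ≠ s := by
    intro he
    apply hz
    refine ⟨by omega, ?_, ?_, he⟩
    · intro hd; rw [Qh_zero h c hd] at he; omega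
    · intro hd; rw [Qh_H h c hd] at he; omega
  have hle2 : Qh T a c s ≤ s - T := by
    obtain ⟨k, hk⟩ := Qh_dvd (T := T) (a := a) c s
    have k1 : k ≤ -1 := by
      by_contra hc
      have : T * 0 ≤ T * k := by apply mul_le_mul_of_nonneg_left <;> omega
      omega
    have : T * k ≤ T * (-1) := by apply mul_le_mul_of_nonneg_left <;> omega
    omega
  have hQ2 : Qh T a c (s - T) ≤ s - T := by
    rw [Qh_congr (v := (s:ℤ)) c (by simp)]; exact hle2
  rcases lt_trichotomy ((s:ℤ) - T) 0 with h1 | h1 | h1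
  · rw [hole_symm h c h1] at hQ2
    have hmem : (T - s).toNat ∈ Sc T a c := by
      rw [mem_Sc h]
      refine ⟨by omega, ?_⟩
      rw [show (((T - s).toNat : ℕ) : ℤ) = -(s - T) by omega]; exact hQ2
    apply wt_zero_aux h _ s (T - s).toNat (by omega) (hm _ hmem)
    rw [if_pos hmem]; omega
  · omega
  · have hmem : ((s:ℤ) - T).toNat ∉ Sc T a c := by
      rw [mem_Sc h]
      rintro ⟨_, h2⟩
      rw [show ((((s:ℤ) - T).toNat : ℕ) : ℤ) = s - T by omega] at h2
      omega
    apply wt_zero_aux h _ s ((s:ℤ) - T).toNat (by omega) (by omega)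
    rw [if_neg hmem]; omega

theorem WW_range [DecidableEq ι] (h : RS t M T H a) (S : Finset ℕ) :
    WW t 1 ((2 * M : ℕ) : ℂ) S ≠ 0 → ∃ c, S = Sc T a c := by
  induction S using Finset.induction_on_max with
  | empty => intro _; exact ⟨0, (Sc_zero h).symm⟩
  | insert s S hS ih =>
    rw [WW_insert _ _ _ _ _ hS]
    intro hne
    obtain ⟨c, rfl⟩ := ih (right_ne_zero_of_mul hne)
    have hw := left_ne_zero_of_mul hne
    have : (0 < s ∧ ¬ T ∣ (s:ℤ) ∧ ¬ T ∣ s - H ∧ Qh T a c s = s) := by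
      by_contra hc
      exact hw (wt_zero h c s hS hc)
    obtain ⟨h1, h2, h3, h4⟩ := this
    rcases rs_cases h s with h5 | h5 | ⟨i, σ, hσ, hd⟩
    · exact absurd h5 h2
    · exact absurd h5 h3
    · exact ⟨_, (Sc_add h c i σ hσ s h1 hd h4).symm⟩

end


section
variable {t M : ℕ} {T H : ℤ} {ι : Type} [Fintype ι] {a : ι → ℤ}

theorem Dz_one (t M d : ℕ) : Dz t 1 ((2 * M : ℕ) : ℂ) d =
    if t ∣ d then 1 - ((t * (2 * M) : ℕ) : ℂ) ^ 2 / (d:ℂ) ^ 2 else 1 := by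
  unfold Dz
  split_ifs
  · push_cast; ring
  · rfl

theorem hole_prod (h : RS t M T H a) (c : ι → ℤ) (s : ℕ) :
    ∏ m ∈ Finset.Ioo 0 s, Dz t 1 ((2 * M : ℕ) : ℂ) (if m ∈ Sc T a c then s + m else s - m) =
    ∏ q ∈ (Finset.Ioo (-(s:ℤ)) s).filter (fun q => (t:ℤ) ∣ s - q ∧ Qh T a c q ≤ q),
        (1 - ((t * (2 * M) : ℕ) : ℂ) ^ 2 / ((s - q : ℤ) : ℂ) ^ 2) := by
  have e1 : (Finset.Ioo (-(s:ℤ)) s).filter (fun q => (t:ℤ) ∣ s - q ∧ Qh T a c q ≤ q) =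
      ((Finset.Ioo (-(s:ℤ)) s).filter (fun q => Qh T a c q ≤ q)).filter (fun q => (t:ℤ) ∣ s - q) := by
    rw [Finset.filter_filter]; congr 1; ext q; exact and_comm
  have e2 : (Finset.Ioo (-(s:ℤ)) s).filter (fun q => Qh T a c q ≤ q) =
      (Finset.Ioo 0 s).image (fun m : ℕ => if m ∈ Sc T a c then -(m:ℤ) else m) := by
    ext q
    simp only [Finset.mem_filter, Finset.mem_Ioo, Finset.mem_image]
    have T0 := h.T0
    constructor
    · rintro ⟨⟨h1, h2⟩, h3⟩
      have hq0 : q ≠ 0 := by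
        rintro rfl; rw [Qh_zero h c (dvd_zero T)] at h3; omega
      refine ⟨q.natAbs, by omega, ?_⟩
      rcases lt_or_gt_of_ne hq0 with h4 | h4
      · rw [hole_symm h c h4] at h3
        rw [if_pos]
        · omega
        · rw [mem_Sc h, show ((q.natAbs : ℕ) : ℤ) = -q by omega]; exact ⟨by omega, h3⟩
      · rw [if_neg]
        · omega
        · rw [mem_Sc h, show ((q.natAbs : ℕ) : ℤ) = q by omega]
          rintro ⟨_, h5⟩; omega
    · rintro ⟨m, ⟨h1, h2⟩, rfl⟩
      split_ifs with hm
      · refine ⟨⟨by omega, by omega⟩, ?_⟩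
        rw [hole_symm h c (by omega), neg_neg]
        exact ((mem_Sc h c m).1 hm).2
      · refine ⟨⟨by omega, by omega⟩, ?_⟩
        by_contra hc
        exact hm ((mem_Sc h c m).2 ⟨h1, by omega⟩)
  rw [e1, Finset.prod_filter, e2, Finset.prod_image]
  · refine Finset.prod_congr rfl fun m hm => ?_
    have hm := Finset.mem_Ioo.1 hm
    rw [Dz_one]
    split_ifs with h1 h2 h3 h3 h2 h3 h3
    · congr 2; push_cast; ring
    · exfalso; apply h3; rw [show (s:ℤ) - -m = ((s + m : ℕ) : ℤ) by push_cast; ring]; exact_mod_cast h2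
    · exfalso; apply h2; rw [show (s:ℤ) - -m = ((s + m : ℕ) : ℤ) by push_cast; ring] at h3; exact_mod_cast h3
    · rfl
    · congr 2; push_cast [Nat.cast_sub hm.2.le]; ring
    · exfalso; apply h3; rw [show (s:ℤ) - m = ((s - m : ℕ) : ℤ) by push_cast [Nat.cast_sub hm.2.le]; ring]; exact_mod_cast h2
    · exfalso; apply h2; rw [show (s:ℤ) - m = ((s - m : ℕ) : ℤ) by push_cast [Nat.cast_sub hm.2.le]; ring] at h3; exact_mod_cast h3
    · rfl
  · intro m hm m' hm' e
    have hm := Finset.mem_Ioo.1 hm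
    have hm' := Finset.mem_Ioo.1 hm'
    simp only at e
    split_ifs at e <;> omega

theorem cyc_prod (h : RS t M T H a) (s : ℤ) (g : ℤ → ℂ) (hg : ∀ u v, T ∣ u - v → g u = g v) :
    ∏ e ∈ Finset.range (2 * M), g (s + t * e) = ∏ ρ ∈ Finset.Ico 0 T, (if (t:ℤ) ∣ s - ρ then g ρ else 1) := by
  have T0 := h.T0
  have t0 : (0:ℤ) < t := by exact_mod_cast h.t0
  have hT : T = t * (2 * M : ℕ) := by rw [h.hT]; push_cast; ring
  have htT : (t:ℤ) ∣ T := ⟨_, hT⟩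
  rw [← Finset.prod_filter]
  apply Finset.prod_bij (fun (e : ℕ) _ => (s + t * e : ℤ) % T)
  · intro e he
    rw [Finset.mem_filter, Finset.mem_Ico]
    refine ⟨⟨Int.emod_nonneg _ T0.ne', Int.emod_lt_of_pos _ T0⟩, ?_⟩
    have h1 : (t:ℤ) ∣ (s + t * e) - (s + t * e : ℤ) % T := htT.trans Int.dvd_self_sub_emod
    have := dvd_sub h1 (dvd_mul_right (t:ℤ) e)
    rwa [show (s + t * e) - (s + t * e : ℤ) % T - t * e = s - (s + t * e : ℤ) % T by ring] at this
  · intro e he e' he' hee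
    have he := Finset.mem_range.1 he
    have he' := Finset.mem_range.1 he'
    have h1 : T ∣ (s + t * e' : ℤ) - (s + t * e) := Int.modEq_iff_dvd.1 hee
    rw [hT, show (s + t * e' : ℤ) - (s + t * e) = t * (e' - e) by ring] at h1
    have h2 := Int.dvd_of_mul_dvd_mul_left t0.ne' h1
    have h3 : ((e':ℤ) - e) = 0 := by
      apply Int.eq_zero_of_abs_lt_dvd h2
      rw [abs_lt]; omega
    omega
  · intro ρ hρ
    rw [Finset.mem_filter, Finset.mem_Ico] at hρ
    obtain ⟨⟨h1, h2⟩, h3⟩ := hρ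
    have m0 := Int.emod_nonneg (ρ - s) T0.ne'
    have m1 := Int.emod_lt_of_pos (ρ - s) T0
    have h4 : (t:ℤ) ∣ (ρ - s) % T := by
      have h5 : (t:ℤ) ∣ (ρ - s) - (ρ - s) % T := htT.trans Int.dvd_self_sub_emod
      have := dvd_sub (h3.neg_right) h5
      rwa [show -(s - ρ) - ((ρ - s) - (ρ - s) % T) = (ρ - s) % T by ring] at this
    obtain ⟨f, hf⟩ := h4
    have f0 : 0 ≤ f := by
      by_contra hc
      have : (t:ℤ) * f ≤ t * (-1) := by apply mul_le_mul_of_nonneg_left <;> omega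
      omega
    have f1 : f < (2 * M : ℕ) := by
      rw [hf] at m1
      by_contra hc
      have : (t:ℤ) * (2 * M : ℕ) ≤ t * f := by apply mul_le_mul_of_nonneg_left <;> omega
      omega
    refine ⟨f.toNat, Finset.mem_range.2 (by omega), ?_⟩
    rw [show ((f.toNat : ℕ) : ℤ) = f by omega, ← hf]
    have : ρ ≡ (s + (ρ - s) % T) [ZMOD T] := by
      apply Int.modEq_iff_dvd.2
      rw [show s + (ρ - s) % T - ρ = -((ρ - s) - (ρ - s) % T) by ring]
      exact Int.dvd_self_sub_emod.neg_right
    rw [← this]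
    exact Int.emod_eq_of_lt h1 h2
  · intro e he
    apply hg
    exact Int.dvd_self_sub_emod

end


section
variable {t M : ℕ} {T H : ℤ} {ι : Type} [Fintype ι] {a : ι → ℤ}

def vv (T H : ℤ) (a : ι → ℤ) (c : ι → ℤ) (i : ι) : ℤ := a i - H + T * c i

theorem dvd_congr' {t u v : ℤ} (h : t ∣ u - v) : t ∣ u ↔ t ∣ v := by
  constructor
  · intro h1; have := dvd_sub h1 h; simpa using this
  · intro h1; have := dvd_add h1 h; simpa using this

theorem ite_eq' {p q : Prop} [Decidable p] [Decidable q] {x y : ℂ} (h : p ↔ q) (h2 : q → x = y) :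
    (if p then x else 1) = (if q then y else 1) := by
  by_cases hq : q
  · rw [if_pos hq, if_pos (h.2 hq), h2 hq]
  · rw [if_neg hq, if_neg (fun hp => hq (h.1 hp))]

theorem Q_bounds (h : RS t M T H a) (c : ι → ℤ) (s : ℕ) (hs : 0 < s) (hm : ∀ m ∈ Sc T a c, m < s) :
    (∀ u, -(s:ℤ) < Qh T a c u) ∧ (∀ u, Qh T a c u < s + T) := by
  have T0 := h.T0
  have hi : ∀ u, Qh T a c u < s + T := by
    intro u
    by_contra hc
    have : (Qh T a c u - T).toNat ∈ Sc T a c := by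
      rw [mem_Sc h, show (((Qh T a c u - T).toNat : ℕ) : ℤ) = Qh T a c u - T by omega]
      refine ⟨by omega, ?_⟩
      rw [Qh_congr (u := Qh T a c u - T) (v := u) c]
      · omega
      · rw [show Qh T a c u - T - u = (Qh T a c u - u) - T by ring]
        exact dvd_sub (Qh_dvd c u) (dvd_refl T)
    have := hm _ this
    omega
  refine ⟨fun u => ?_, hi⟩
  by_cases hd : T ∣ u
  · rw [Qh_zero h c hd]; omega
  · have := hi (-u)
    rw [Qh_neg h c hd] at this
    omega

theorem wt_formula [DecidableEq ι] (h : RS t M T H a) (c : ι → ℤ) (i : ι) (σ : ℤ) (s : ℕ) (hσ : σ = 1 ∨ σ = -1)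
    (hs : 0 < s) (hd : T ∣ s - σ * a i) (hQ : Qh T a c s = s) (hm : ∀ m ∈ Sc T a c, m < s) :
    wt t 1 ((2 * M : ℕ) : ℂ) s (Sc T a c) =
      -((if (t:ℤ) ∣ a i then ((vv T H a c i + σ * T : ℤ) : ℂ) / ((vv T H a c i : ℤ) : ℂ) else 1) *
        ∏ j ∈ Finset.univ.erase i,
          ((if (t:ℤ) ∣ a i - a j then ((vv T H a c i + σ * T - vv T H a c j : ℤ) : ℂ) / ((vv T H a c i - vv T H a c j : ℤ) : ℂ) else 1) *
           (if (t:ℤ) ∣ a i + a j then ((vv T H a c i + σ * T + vv T H a c j : ℤ) : ℂ) / ((vv T H a c i + vv T H a c j : ℤ) : ℂ) else 1))) := by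
  have T0 := h.T0
  have TH := h.TH
  have t0 : (0:ℤ) < t := by exact_mod_cast h.t0
  have hTt : T = t * (2 * M) := by rw [h.hT]; push_cast; ring
  have htT : (t:ℤ) ∣ T := ⟨_, hTt⟩
  have htH : (t:ℤ) ∣ H := ⟨_, h.hH⟩
  have hTc : ((t * (2 * M) : ℕ) : ℂ) = ((T:ℤ):ℂ) := by rw [h.hT]; push_cast; ring
  obtain ⟨lo, hi⟩ := Q_bounds h c s hs hm
  have hns : ¬ T ∣ (s:ℤ) := by
    intro h1
    have : T ∣ σ * a i := by have := dvd_sub h1 hd; simpa using this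
    rcases hσ with rfl | rfl
    · exact h.ndvd i (by simpa using this)
    · exact h.ndvd i (by simpa using this)
  have hnsH : ¬ T ∣ (s:ℤ) - H := by
    intro h1
    have h2 : T ∣ H - σ * a i := by have := dvd_sub hd h1; simpa using this
    rcases hσ with rfl | rfl
    · apply h.ndvdH i
      rw [show a i - H = -(H - 1 * a i) by ring]; exact h2.neg_right
    · apply h.ndvdH' i
      rw [show a i + H = (H - -1 * a i) by ring]; exact h2
  have hn2s : ¬ T ∣ (s:ℤ) + s := by
    intro h1
    apply h.ndvd_add i i
    rcases hσ with rfl | rfl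
    · rw [show a i + a i = s + s - ((s - 1 * a i) + (s - 1 * a i)) by ring]
      exact dvd_sub h1 (dvd_add hd hd)
    · rw [show a i + a i = ((s - -1 * a i) + (s - -1 * a i)) - (s + s) by ring]
      exact dvd_sub (dvd_add hd hd) h1
  have hsv : (s:ℤ) = σ * vv T H a c i + H := by
    rw [← hQ]
    unfold vv
    rcases hσ with rfl | rfl
    · rw [Qh_congr (v := a i) c (by simpa using hd), Qh_a h]; ring
    · rw [Qh_congr (v := -a i) c (by simpa using hd), Qh_na h, TH]; ring
  set f : ℤ → ℂ := fun q => ((s - q + T : ℤ) : ℂ) / ((s - q : ℤ) : ℂ) with hf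
  set g : ℤ → ℂ := fun u => if T ∣ u - s then 1 else f (Qh T a c u) with hg
  set G : ℤ → ℂ := fun ρ => if (t:ℤ) ∣ s - ρ then g ρ else 1 with hG
  have hgp : ∀ u v, T ∣ u - v → g u = g v := by
    intro u v huv
    simp only [hg]
    rw [Qh_congr c huv]
    have := dvd_congr' (t := T) (u := u - s) (v := v - s) (by simpa using huv)
    simp only [this]
  have hGp : ∀ u v, T ∣ u - v → G u = G v := by
    intro u v huv
    simp only [hG]
    rw [hgp u v huv]
    have := dvd_congr' (t := (t:ℤ)) (u := s - u) (v := s - v) (by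
      rw [show (s:ℤ) - u - (s - v) = -(u - v) by ring]; exact (htT.trans huv).neg_right)
    simp only [this]
  have hprod : ∏ e ∈ Finset.Ioo 0 (2 * M), (((s - Qh T a c (s + t * e) + (t * (2 * M) : ℕ) : ℤ) : ℂ) / ((s - Qh T a c (s + t * e) : ℤ) : ℂ)) =
      G 0 * G H * ((G (a i) * G (-a i)) * ∏ j ∈ Finset.univ.erase i, (G (a j) * G (-a j))) := by
    rw [Finset.mul_prod_erase Finset.univ (fun j => G (a j) * G (-a j)) (Finset.mem_univ i), ← rs_prod h G hGp,
      ← cyc_prod h s g hgp]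
    have hsplit : Finset.range (2 * M) = insert 0 (Finset.Ioo 0 (2 * M)) := by
      have := h.M0
      ext x; simp only [Finset.mem_range, Finset.mem_insert, Finset.mem_Ioo]; omega
    rw [hsplit, Finset.prod_insert (by simp)]
    have hg0 : g (s + t * (0:ℕ)) = 1 := by simp [hg]
    rw [hg0, one_mul]
    refine Finset.prod_congr rfl fun e he => ?_
    have he := Finset.mem_Ioo.1 he
    simp only [hg]
    rw [if_neg, hf, ← h.hT]
    intro h1
    rw [show (s:ℤ) + t * e - s = t * e by ring, hTt] at h1
    have h2 := Int.dvd_of_mul_dvd_mul_left t0.ne' h1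
    have := Int.le_of_dvd (by omega) h2
    omega
  have htele := tele_all t (2 * M) h.t0 (by have := h.M0; omega) (even_two_mul M) s (Qh T a c)
    (fun u v huv => Qh_congr c (by rw [h.hT]; exact huv)) (fun u => by rw [← h.hT]; exact Qh_dvd c u) lo
    (fun u => by rw [← h.hT]; exact hi u) hQ
  have hsc : ((s:ℤ):ℂ) = (s:ℂ) := by push_cast; rfl
  have hs0 : (s:ℂ) ≠ 0 := by exact_mod_cast hs.ne'
  have hsT : ((s - T : ℤ) : ℂ) ≠ 0 := by
    rw [Int.cast_ne_zero]; intro h1; apply hns; rw [show (s:ℤ) = T by omega]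
  have h2sT : ((s + s - T : ℤ) : ℂ) ≠ 0 := by
    rw [Int.cast_ne_zero]; intro h1; apply hn2s; rw [show (s:ℤ) + s = T by omega]
  have G0 : (if t ∣ s then 1 - 1 * (t:ℂ) * ((2 * M : ℕ) : ℂ) / s else 1) * G 0 = 1 := by
    have h1 : (t ∣ s) ↔ (t:ℤ) ∣ s - 0 := by rw [sub_zero]; norm_cast
    simp only [hG, ← h1]
    split_ifs with h2
    · simp only [hg]
      rw [if_neg (by rw [zero_sub, Int.dvd_neg]; exact hns), hf, Qh_zero h c (dvd_zero T)]
      simp only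
      rw [one_mul, ← Nat.cast_mul, hTc]
      push_cast at hsT ⊢
      field_simp
      ring
    · simp
  have G1 : (if t ∣ 2 * s then 1 - 1 * (t:ℂ) * ((2 * M : ℕ) : ℂ) / ((2 * s : ℕ) : ℂ) else 1) * (G (a i) * G (-a i)) = 1 := by
    have e1 : G (a i) * G (-a i) = G s * G (-s) := by
      rcases hσ with rfl | rfl
      · rw [hGp s (a i) (by simpa using hd), hGp (-s) (-a i) (by
          rw [show -(s:ℤ) - -a i = -(s - 1 * a i) by ring]; exact hd.neg_right)]
      · rw [hGp s (-a i) (by simpa using hd), hGp (-s) (a i) (by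
          rw [show -(s:ℤ) - a i = -(s - -1 * a i) by ring]; exact hd.neg_right), mul_comm]
    have e2 : G s = 1 := by simp [hG, hg]
    rw [e1, e2, one_mul]
    have h1 : (t ∣ 2 * s) ↔ (t:ℤ) ∣ s - -s := by
      rw [show (s:ℤ) - -s = ((2 * s : ℕ) : ℤ) by push_cast; ring]; norm_cast
    simp only [hG, ← h1]
    split_ifs with h2
    · simp only [hg]
      rw [if_neg (by rw [show -(s:ℤ) - s = -(s + s) by ring, Int.dvd_neg]; exact hn2s), hf, Qh_neg h c hns, hQ]
      simp only
      rw [one_mul, ← Nat.cast_mul, hTc]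
      have : ((2 * s : ℕ) : ℂ) ≠ 0 := by exact_mod_cast (by positivity)
      push_cast at h2sT this ⊢
      rw [show (s:ℂ) + s - T = 2 * s - T by ring] at h2sT
      rw [show (s:ℂ) - (T - s) = 2 * s - T by ring]
      field_simp
      ring
    · simp
  have GH : G H = (if (t:ℤ) ∣ a i then ((vv T H a c i + σ * T : ℤ) : ℂ) / ((vv T H a c i : ℤ) : ℂ) else 1) := by
    have h1 : (t:ℤ) ∣ s - H ↔ (t:ℤ) ∣ a i := by
      rcases hσ with rfl | rfl
      · apply dvd_congr'
        rw [show (s:ℤ) - H - a i = (s - 1 * a i) - H by ring]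
        exact dvd_sub (htT.trans hd) htH
      · rw [← Int.dvd_neg (b := a i)]
        apply dvd_congr'
        rw [show (s:ℤ) - H - -a i = (s - -1 * a i) - H by ring]
        exact dvd_sub (htT.trans hd) htH
    simp only [hG]
    apply ite_eq' h1
    intro _
    simp only [hg]
    rw [if_neg (by rw [← Int.dvd_neg, neg_sub]; exact hnsH), hf, Qh_H h c (by simp)]
    simp only
    rw [hsv]
    rcases hσ with rfl | rfl
    · congr 2 <;> ring
    · rw [← neg_div_neg_eq, ← Int.cast_neg, ← Int.cast_neg]
      congr 2 <;> ring
  have GJ : ∀ j ∈ Finset.univ.erase i, G (a j) * G (-a j) =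
      ((if (t:ℤ) ∣ a i - a j then ((vv T H a c i + σ * T - vv T H a c j : ℤ) : ℂ) / ((vv T H a c i - vv T H a c j : ℤ) : ℂ) else 1) *
           (if (t:ℤ) ∣ a i + a j then ((vv T H a c i + σ * T + vv T H a c j : ℤ) : ℂ) / ((vv T H a c i + vv T H a c j : ℤ) : ℂ) else 1)) := by
    intro j hj
    have hj := Finset.ne_of_mem_erase hj
    have hja : Qh T a c (a j) = vv T H a c j + H := by rw [Qh_a h]; unfold vv; ring
    have hjna : Qh T a c (-a j) = H - vv T H a c j := by rw [Qh_na h, TH]; unfold vv; ring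
    rcases hσ with rfl | rfl
    · rw [one_mul] at hd hsv
      congr 1
      · simp only [hG]
        apply ite_eq'
        · apply dvd_congr'
          rw [show (s:ℤ) - a j - (a i - a j) = s - a i by ring]; exact htT.trans hd
        · intro _
          simp only [hg]
          rw [if_neg, hf, hja]
          · simp only; rw [hsv]; congr 2 <;> ring
          · intro h1; apply h.ndvd_sub hj
            have := dvd_add h1 hd
            rwa [show a j - s + (s - a i) = a j - a i by ring] at this
      · simp only [hG]
        apply ite_eq'
        · apply dvd_congr'
          rw [show (s:ℤ) - -a j - (a i + a j) = s - a i by ring]; exact htT.trans hd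
        · intro _
          simp only [hg]
          rw [if_neg, hf, hjna]
          · simp only; rw [hsv]; congr 2 <;> ring
          · intro h1; apply h.ndvd_add j i
            have := (dvd_add h1 hd).neg_right
            rwa [show -(-a j - s + (s - a i)) = a j + a i by ring] at this
    · rw [show (s:ℤ) - -1 * a i = s + a i by ring] at hd
      rw [mul_comm]
      congr 1
      · simp only [hG]
        apply ite_eq'
        · rw [← Int.dvd_neg (b := a i - a j)]
          apply dvd_congr'
          rw [show (s:ℤ) - -a j - -(a i - a j) = s + a i by ring]; exact htT.trans hd
        · intro _
          simp only [hg]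
          rw [if_neg, hf, hjna]
          · simp only; rw [hsv, ← neg_div_neg_eq, ← Int.cast_neg, ← Int.cast_neg]; congr 2 <;> ring
          · intro h1; apply h.ndvd_sub hj.symm
            have := dvd_add h1 hd
            rwa [show -a j - s + (s + a i) = a i - a j by ring] at this
      · simp only [hG]
        apply ite_eq'
        · rw [← Int.dvd_neg (b := a i + a j)]
          apply dvd_congr'
          rw [show (s:ℤ) - a j - -(a i + a j) = s + a i by ring]; exact htT.trans hd
        · intro _
          simp only [hg]
          rw [if_neg, hf, hja]
          · simp only; rw [hsv, ← neg_div_neg_eq, ← Int.cast_neg, ← Int.cast_neg]; congr 2 <;> ring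
          · intro h1; apply h.ndvd_add j i
            have := (dvd_add h1 hd)
            rwa [show a j - s + (s + a i) = a j + a i by ring] at this
  unfold wt
  rw [if_neg hs.ne', hole_prod h c s, htele, hprod, Finset.prod_congr rfl GJ, GH]
  generalize (∏ j ∈ Finset.univ.erase i, _ : ℂ) = P
  generalize (if (t:ℤ) ∣ a i then ((vv T H a c i + σ * T : ℤ) : ℂ) / ((vv T H a c i : ℤ) : ℂ) else 1) = R
  linear_combination (-R * P * ((if t ∣ 2 * s then 1 - 1 * (t:ℂ) * ((2 * M : ℕ) : ℂ) / ((2 * s : ℕ) : ℂ) else 1) * (G (a i) * G (-a i)))) * G0 - R * P * G1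

end


section
variable {t M : ℕ} {T H : ℤ} {ι : Type} [Fintype ι] {a : ι → ℤ}

theorem pair_split [DecidableEq ι] (ha : Function.Injective a) (P : ι → ι → ℂ) (hP : ∀ k l, P k l = P l k) (i : ι) :
    ∏ k, ∏ l, (if a k < a l then P k l else 1) =
      (∏ l ∈ Finset.univ.erase i, P i l) *
        ∏ k ∈ Finset.univ.erase i, ∏ l ∈ Finset.univ.erase i, (if a k < a l then P k l else 1) := by
  rw [← Finset.mul_prod_erase Finset.univ _ (Finset.mem_univ i)]
  have h1 : ∀ k, ∏ l, (if a k < a l then P k l else 1) =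
      (if a k < a i then P k i else 1) * ∏ l ∈ Finset.univ.erase i, (if a k < a l then P k l else 1) := fun k =>
    (Finset.mul_prod_erase Finset.univ _ (Finset.mem_univ i)).symm
  simp only [h1]
  rw [Finset.prod_mul_distrib, if_neg (lt_irrefl _), one_mul, ← mul_assoc, ← Finset.prod_mul_distrib]
  congr 1
  refine Finset.prod_congr rfl fun l hl => ?_
  have hl := Finset.ne_of_mem_erase hl
  rcases lt_or_gt_of_ne (fun e => hl (ha e)) with h2 | h2
  · rw [if_neg (by omega), if_pos h2, one_mul, hP]
  · rw [if_pos h2, if_neg (by omega), mul_one]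

def r1 (t : ℕ) (T H : ℤ) (a c : ι → ℤ) (i : ι) : ℂ :=
  if (t:ℤ) ∣ a i then ((vv T H a c i : ℤ) : ℂ) / ((vv T H a 0 i : ℤ) : ℂ) else 1

def r2 (t : ℕ) (T H : ℤ) (a c : ι → ℤ) (i j : ι) : ℂ :=
  (if (t:ℤ) ∣ a i - a j then ((vv T H a c i - vv T H a c j : ℤ) : ℂ) / ((vv T H a 0 i - vv T H a 0 j : ℤ) : ℂ) else 1) *
  (if (t:ℤ) ∣ a i + a j then ((vv T H a c i + vv T H a c j : ℤ) : ℂ) / ((vv T H a 0 i + vv T H a 0 j : ℤ) : ℂ) else 1)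

def Psi (t : ℕ) (T H : ℤ) (a c : ι → ℤ) : ℂ :=
  (∏ i, r1 t T H a c i) * ∏ k, ∏ l, (if a k < a l then r2 t T H a c k l else 1)

theorem r2_symm (c : ι → ℤ) (i j : ι) : r2 t T H a c i j = r2 t T H a c j i := by
  unfold r2
  congr 1
  · apply ite_eq'
    · rw [← Int.dvd_neg, neg_sub]
    · intro _
      rw [← neg_div_neg_eq, ← Int.cast_neg, ← Int.cast_neg, neg_sub, neg_sub]
  · apply ite_eq'
    · rw [add_comm]
    · intro _
      rw [add_comm, add_comm (vv T H a 0 i)]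

theorem vv_ne (h : RS t M T H a) (c : ι → ℤ) (i : ι) : ((vv T H a c i : ℤ) : ℂ) ≠ 0 := by
  rw [Int.cast_ne_zero]
  intro h1
  apply h.ndvdH i
  unfold vv at h1
  exact ⟨-c i, by linarith⟩

theorem vv_sub_ne (h : RS t M T H a) (c d : ι → ℤ) {i j : ι} (hij : i ≠ j) : ((vv T H a c i - vv T H a d j : ℤ) : ℂ) ≠ 0 := by
  rw [Int.cast_ne_zero]
  intro h1
  apply h.ndvd_sub hij
  unfold vv at h1
  exact ⟨d j - c i, by linarith⟩

theorem vv_add_ne (h : RS t M T H a) (c d : ι → ℤ) (i j : ι) : ((vv T H a c i + vv T H a d j : ℤ) : ℂ) ≠ 0 := by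
  rw [Int.cast_ne_zero]
  intro h1
  apply h.ndvd_add i j
  unfold vv at h1
  exact ⟨1 - d j - c i, by rw [h.TH] at h1 ⊢; linarith⟩

theorem Psi_upd [DecidableEq ι] (h : RS t M T H a) (c : ι → ℤ) (i : ι) (σ : ℤ) :
    Psi t T H a (c + Pi.single i σ) =
      ((if (t:ℤ) ∣ a i then ((vv T H a c i + σ * T : ℤ) : ℂ) / ((vv T H a c i : ℤ) : ℂ) else 1) *
        ∏ j ∈ Finset.univ.erase i,
          ((if (t:ℤ) ∣ a i - a j then ((vv T H a c i + σ * T - vv T H a c j : ℤ) : ℂ) / ((vv T H a c i - vv T H a c j : ℤ) : ℂ) else 1) *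
           (if (t:ℤ) ∣ a i + a j then ((vv T H a c i + σ * T + vv T H a c j : ℤ) : ℂ) / ((vv T H a c i + vv T H a c j : ℤ) : ℂ) else 1))) *
      Psi t T H a c := by
  generalize hc : c + Pi.single i σ = c'
  have hvi : vv T H a c' i = vv T H a c i + σ * T := by
    rw [← hc]; unfold vv; simp; ring
  have hvj : ∀ j, j ≠ i → vv T H a c' j = vv T H a c j := by
    intro j hj; rw [← hc]; unfold vv; simp [Pi.single_eq_of_ne hj]
  unfold Psi
  rw [pair_split h.inj _ (r2_symm _) i, pair_split h.inj (r2 t T H a c) (r2_symm c) i,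
    ← Finset.mul_prod_erase Finset.univ (r1 t T H a c') (Finset.mem_univ i),
    ← Finset.mul_prod_erase Finset.univ (r1 t T H a c) (Finset.mem_univ i)]
  have e1 : r1 t T H a c' i =
      (if (t:ℤ) ∣ a i then ((vv T H a c i + σ * T : ℤ) : ℂ) / ((vv T H a c i : ℤ) : ℂ) else 1) * r1 t T H a c i := by
    unfold r1
    split_ifs
    · rw [hvi]
      have h1 := vv_ne h c i
      have h2 := vv_ne h 0 i
      field_simp
    · simp
  have e2 : ∏ j ∈ Finset.univ.erase i, r1 t T H a c' j = ∏ j ∈ Finset.univ.erase i, r1 t T H a c j := by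
    refine Finset.prod_congr rfl fun j hj => ?_
    unfold r1
    rw [hvj j (Finset.ne_of_mem_erase hj)]
  have e3 : ∏ k ∈ Finset.univ.erase i, ∏ l ∈ Finset.univ.erase i, (if a k < a l then r2 t T H a c' k l else 1) =
      ∏ k ∈ Finset.univ.erase i, ∏ l ∈ Finset.univ.erase i, (if a k < a l then r2 t T H a c k l else 1) := by
    refine Finset.prod_congr rfl fun k hk => Finset.prod_congr rfl fun l hl => ?_
    unfold r2
    rw [hvj k (Finset.ne_of_mem_erase hk), hvj l (Finset.ne_of_mem_erase hl)]
  have e4 : ∏ j ∈ Finset.univ.erase i, r2 t T H a c' i j =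
      (∏ j ∈ Finset.univ.erase i,
          ((if (t:ℤ) ∣ a i - a j then ((vv T H a c i + σ * T - vv T H a c j : ℤ) : ℂ) / ((vv T H a c i - vv T H a c j : ℤ) : ℂ) else 1) *
           (if (t:ℤ) ∣ a i + a j then ((vv T H a c i + σ * T + vv T H a c j : ℤ) : ℂ) / ((vv T H a c i + vv T H a c j : ℤ) : ℂ) else 1))) *
      ∏ j ∈ Finset.univ.erase i, r2 t T H a c i j := by
    rw [← Finset.prod_mul_distrib]
    refine Finset.prod_congr rfl fun j hj => ?_
    have hj := Finset.ne_of_mem_erase hj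
    unfold r2
    rw [hvi, hvj j hj]
    rw [mul_mul_mul_comm]
    congr 1
    · split_ifs
      · rw [mul_comm, div_mul_div_cancel₀ (vv_sub_ne h c c hj.symm)] 
      · simp
    · split_ifs
      · rw [mul_comm, div_mul_div_cancel₀ (vv_add_ne h c c i j)]
      · simp
  rw [e1, e2, e3, e4]
  ring

theorem Psi_zero (h : RS t M T H a) : Psi t T H a 0 = 1 := by
  unfold Psi
  rw [Finset.prod_eq_one, one_mul, Finset.prod_eq_one]
  · intro k _
    apply Finset.prod_eq_one
    intro l _
    split_ifs with hkl
    · unfold r2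
      have hne : k ≠ l := by rintro rfl; exact lt_irrefl _ hkl
      rw [div_self (vv_sub_ne h 0 0 hne), div_self (vv_add_ne h 0 0 k l)]
      simp
    · rfl
  · intro i _
    unfold r1
    rw [div_self (vv_ne h 0 i)]; simp

theorem WW_Psi [DecidableEq ι] (h : RS t M T H a) (c : ι → ℤ) :
    (-1) ^ (Sc T a c).card * WW t 1 ((2 * M : ℕ) : ℂ) (Sc T a c) = Psi t T H a c := by
  refine c_ind h (P := fun c => (-1) ^ (Sc T a c).card * WW t 1 ((2 * M : ℕ) : ℂ) (Sc T a c) = Psi t T H a c) ?_ ?_ c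
  · rw [Sc_zero h, Psi_zero h, WW_empty]; simp
  · intro c i σ s hσ hs hd hQ hm hS ih
    rw [hS, WW_insert _ _ _ _ _ hm, wt_formula h c i σ s hσ hs hd hQ hm, Psi_upd h c i σ, ← ih,
      Finset.card_insert_of_notMem (fun hs => lt_irrefl _ (hm s hs)), pow_succ]
    ring

theorem Sc_sum [DecidableEq ι] (h : RS t M T H a) (c : ι → ℤ) :
    ((∑ s ∈ Sc T a c, s : ℕ) : ℤ) = ∑ i, (T * tri (c i) + a i * c i) := by
  refine c_ind h (P := fun c => ((∑ s ∈ Sc T a c, s : ℕ) : ℤ) = ∑ i, (T * tri (c i) + a i * c i)) ?_ ?_ c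
  · rw [Sc_zero h]; simp [tri]
  · intro c i σ s hσ hs hd hQ hm hS ih
    rw [hS, Finset.sum_insert (fun hs => lt_irrefl _ (hm s hs))]
    push_cast at ih ⊢
    obtain ⟨c', hc'⟩ : ∃ c' : ι → ℤ, c' = c + Pi.single i σ := ⟨_, rfl⟩
    rw [← hc']
    have hci : c' i = c i + σ := by rw [hc']; simp
    rw [ih, ← Finset.add_sum_erase Finset.univ _ (Finset.mem_univ i),
      ← Finset.add_sum_erase Finset.univ (fun j => T * tri (c' j) + a j * c' j) (Finset.mem_univ i)]
    have e1 : ∑ j ∈ Finset.univ.erase i, (T * tri (c' j) + a j * c' j) =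
        ∑ j ∈ Finset.univ.erase i, (T * tri (c j) + a j * c j) := by
      refine Finset.sum_congr rfl fun j hj => ?_
      rw [hc']; simp [Pi.single_eq_of_ne (Finset.ne_of_mem_erase hj)]
    rw [e1, ← hQ, hci]
    rcases hσ with rfl | rfl
    · rw [Qh_congr (v := a i) c (by simpa using hd), Qh_a h, tri_succ]; ring
    · rw [Qh_congr (v := -a i) c (by simpa using hd), Qh_na h, ← sub_eq_add_neg, tri_pred]; ring

/-- t-charge -/
def chiS (t : ℕ) (S : Finset ℕ) (u : ℤ) : ℤ := ∑ m ∈ S, (dv t (u - m) - dv t (u + m))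

theorem Sc_chi [DecidableEq ι] (h : RS t M T H a) (c : ι → ℤ) (u : ℤ) :
    chiS t (Sc T a c) u = ∑ i, c i * (dv t (u - a i) - dv t (u + a i)) := by
  have htT : (t:ℤ) ∣ T := ⟨2 * M, by rw [h.hT]; push_cast; ring⟩
  refine c_ind h (P := fun c => chiS t (Sc T a c) u = ∑ i, c i * (dv t (u - a i) - dv t (u + a i))) ?_ ?_ c
  · rw [Sc_zero h]; simp [chiS]
  · intro c i σ s hσ hs hd hQ hm hS ih
    unfold chiS at ih ⊢
    rw [hS, Finset.sum_insert (fun hs => lt_irrefl _ (hm s hs)), ih]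
    simp only [Pi.add_apply, add_mul, Finset.sum_add_distrib]
    rw [add_comm]
    congr 1
    rw [Finset.sum_eq_single i]
    · simp only [Pi.single_eq_same]
      rcases hσ with rfl | rfl
      · rw [one_mul, dv_congr (u := u - s) (v := u - a i), dv_congr (u := u + s) (v := u + a i)]
        · rw [show u + s - (u + a i) = s - 1 * a i by ring]; exact htT.trans hd
        · rw [show u - s - (u - a i) = -(s - 1 * a i) by ring]; exact (htT.trans hd).neg_right
      · rw [dv_congr (u := u - s) (v := u + a i), dv_congr (u := u + s) (v := u - a i)]
        · ring
        · rw [show u + s - (u - a i) = s - -1 * a i by ring]; exact htT.trans hd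
        · rw [show u - s - (u + a i) = -(s - -1 * a i) by ring]; exact (htT.trans hd).neg_right
    · intro j _ hj; simp [Pi.single_eq_of_ne hj]
    · simp

end


def ee (t s : ℕ) (S : Finset ℕ) : ℕ :=
  (if t ∣ s then 1 else 0) + (if t ∣ 2 * s then 1 else 0) +
    2 * ∑ m ∈ Finset.Ioo 0 s, (if t ∣ (if m ∈ S then s + m else s - m) then 1 else 0)

def yE (t : ℕ) (S : Finset ℕ) : ℕ := ∑ s ∈ S, ee t s S

theorem wt_y (t : ℕ) (y z : ℂ) (s : ℕ) (S : Finset ℕ) : wt t y z s S = y ^ ee t s S * wt t 1 z s S := by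
  have this : ∀ m, Dz t y z (if m ∈ S then s + m else s - m) =
      (y ^ 2) ^ (if t ∣ (if m ∈ S then s + m else s - m) then 1 else 0) * Dz t 1 z (if m ∈ S then s + m else s - m) := by
    intro m
    generalize (if m ∈ S then s + m else s - m) = d
    unfold Dz
    split_ifs
    · ring
    · ring
  unfold wt ee
  by_cases h0 : s = 0
  · rw [if_pos h0, if_pos h0, mul_zero]
  rw [if_neg h0, if_neg h0, pow_add, pow_add, pow_mul, ← Finset.prod_pow_eq_pow_sum,
    Finset.prod_congr rfl (fun m _ => this m), Finset.prod_mul_distrib]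
  generalize (∏ m ∈ Finset.Ioo 0 s, (y ^ 2) ^ (if t ∣ (if m ∈ S then s + m else s - m) then 1 else 0)) = P
  generalize (∏ m ∈ Finset.Ioo 0 s, Dz t 1 z (if m ∈ S then s + m else s - m)) = Q
  split_ifs <;> ring

theorem WW_y (t : ℕ) (y z : ℂ) (S : Finset ℕ) : WW t y z S = y ^ yE t S * WW t 1 z S := by
  unfold WW yE
  simp only [wt_y t y z, Finset.prod_mul_distrib, Finset.prod_pow_eq_pow_sum]

theorem ee_congr (t s : ℕ) (S S' : Finset ℕ) (h : ∀ m, 0 < m → m < s → (m ∈ S ↔ m ∈ S')) : ee t s S = ee t s S' := by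
  unfold ee
  congr 2
  refine Finset.sum_congr rfl fun m hm => ?_
  rw [Finset.mem_Ioo] at hm
  simp only [h m hm.1 hm.2]

theorem yE_insert (t s : ℕ) (S : Finset ℕ) (h : ∀ m ∈ S, m < s) : yE t (insert s S) = ee t s S + yE t S := by
  unfold yE
  rw [Finset.sum_insert (fun hs => lt_irrefl _ (h s hs))]
  congr 1
  · apply ee_congr
    intro m _ hm
    simp [hm.ne]
  · refine Finset.sum_congr rfl fun m hm => ?_
    apply ee_congr
    intro m' _ hm'
    have := h m hm
    simp [(hm'.trans this).ne]

theorem count_dv (t s : ℕ) (hs : 0 < s) : ∑ m ∈ Finset.Ioo 0 s, dv t ((s:ℤ) - m) = (((s - 1) / t : ℕ) : ℤ) := by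
  rw [← Nat.Ioc_filter_dvd_card_eq_div, Finset.card_filter]
  push_cast
  apply Finset.sum_nbij' (fun m => s - m) (fun m => s - m)
  · intro m hm; rw [Finset.mem_Ioo] at hm; rw [Finset.mem_Ioc]; omega
  · intro m hm; rw [Finset.mem_Ioc] at hm; rw [Finset.mem_Ioo]; omega
  · intro m hm; rw [Finset.mem_Ioo] at hm; omega
  · intro m hm; rw [Finset.mem_Ioc] at hm; omega
  · intro m hm
    rw [Finset.mem_Ioo] at hm
    unfold dv
    have : ((t:ℤ) ∣ s - m) ↔ t ∣ s - m := by
      rw [← Nat.cast_sub hm.2.le]; norm_cast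
    simp only [this]

theorem ee_eq (t s : ℕ) (S : Finset ℕ) (hs : 0 < s) (h0 : 0 ∉ S) (h : ∀ m ∈ S, m < s) :
    (ee t s S : ℤ) = dv t s + dv t (2 * s) + 2 * ((((s - 1) / t : ℕ) : ℤ) - chiS t S s) := by
  have e1 : ∀ m ∈ Finset.Ioo 0 s, (((if t ∣ (if m ∈ S then s + m else s - m) then 1 else 0 : ℕ)) : ℤ) =
      dv t ((s:ℤ) - m) + (if m ∈ S then - (dv t ((s:ℤ) - m) - dv t ((s:ℤ) + m)) else 0) := by
    intro m hm
    rw [Finset.mem_Ioo] at hm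
    have h1 : ((t:ℤ) ∣ s - m) ↔ t ∣ s - m := by
      rw [← Nat.cast_sub hm.2.le]; norm_cast
    have h2 : ((t:ℤ) ∣ s + m) ↔ t ∣ s + m := by norm_cast
    unfold dv
    simp only [h1, h2]
    by_cases hm : m ∈ S
    · simp only [if_pos hm]; push_cast; ring
    · simp only [if_neg hm]; push_cast; ring
  have hsub : (Finset.Ioo 0 s).filter (fun m => m ∈ S) = S := by
    ext m
    rw [Finset.mem_filter, Finset.mem_Ioo]
    refine ⟨fun h => h.2, fun hm => ⟨⟨?_, h m hm⟩, hm⟩⟩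
    rcases Nat.eq_zero_or_pos m with rfl | h1
    · exact absurd hm h0
    · exact h1
  unfold ee
  rw [Nat.cast_add, Nat.cast_mul, Nat.cast_sum, Finset.sum_congr rfl e1, Finset.sum_add_distrib, count_dv t s hs,
    ← Finset.sum_filter, hsub, Finset.sum_neg_distrib]
  unfold chiS dv
  have h3 : ((t:ℤ) ∣ 2 * s) ↔ t ∣ 2 * s := by norm_cast
  simp only [h3, Int.natCast_dvd_natCast]
  push_cast
  ring

def coreS (t' : ℕ) (S : Finset ℕ) : ℤ := ∑ r ∈ Finset.Ioo 0 t', ((2 * t' : ℕ) * tri (chiS (2 * t') S r) + r * chiS (2 * t') S r)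

theorem chiS_congr (t : ℕ) (S : Finset ℕ) {u v : ℤ} (h : (t:ℤ) ∣ u - v) : chiS t S u = chiS t S v := by
  unfold chiS
  refine Finset.sum_congr rfl fun m _ => ?_
  rw [dv_congr (u := u - m) (v := v - m) (by simpa using h), dv_congr (u := u + m) (v := v + m) (by simpa using h)]

theorem chiS_neg (t : ℕ) (S : Finset ℕ) (u : ℤ) : chiS t S (-u) = - chiS t S u := by
  unfold chiS
  rw [← Finset.sum_neg_distrib]
  refine Finset.sum_congr rfl fun m _ => ?_
  rw [show -u - m = -(u + m) by ring, show -u + m = -(u - m) by ring, dv_neg, dv_neg]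
  ring

theorem chiS_insert (t s : ℕ) (S : Finset ℕ) (h : ∀ m ∈ S, m < s) (u : ℤ) :
    chiS t (insert s S) u = (dv t (u - s) - dv t (u + s)) + chiS t S u := by
  unfold chiS
  rw [Finset.sum_insert (fun hs => lt_irrefl _ (h s hs))]

theorem dv_small {t u : ℤ} (h1 : u < t) (h2 : -t < u) (h3 : u ≠ 0) : dv t u = 0 := by
  unfold dv
  rw [if_neg]
  intro hd
  apply h3
  exact Int.eq_zero_of_abs_lt_dvd hd (by rw [abs_lt]; omega)

theorem core_thm (t' : ℕ) (ht' : 0 < t') (S : Finset ℕ) (h0 : 0 ∉ S) :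
    ((2 * t' : ℕ) : ℤ) * yE (2 * t') S + 2 * coreS t' S = 2 * ((∑ s ∈ S, s : ℕ) : ℤ) := by
  induction S using Finset.induction_on_max with
  | empty => simp [yE, coreS, chiS, tri]
  | insert s S hS ih =>
    have h0' : 0 ∉ S := fun h => h0 (Finset.mem_insert_of_mem h)
    have hs : 0 < s := Nat.pos_of_ne_zero (by rintro rfl; exact h0 (Finset.mem_insert_self _ _))
    have ih := ih h0'
    rw [yE_insert _ _ _ hS, Finset.sum_insert (fun hs => lt_irrefl _ (hS s hs))]
    push_cast only [Nat.cast_add]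
    rw [ee_eq _ s S hs h0' hS]
    suffices hh : ((2 * t' : ℕ) : ℤ) * (dv (2 * t' : ℕ) s + dv (2 * t' : ℕ) (2 * s) + 2 * ((((s - 1) / (2 * t') : ℕ) : ℤ) - chiS (2 * t') S s))
        + 2 * (coreS t' (insert s S) - coreS t' S) = 2 * s by
      linear_combination hh + ih
    clear ih
    set t := 2 * t' with ht
    have htp : 0 < t := by omega
    have hmod := Nat.div_add_mod s t
    have hlt := Nat.mod_lt s htp
    set q := s / t with hq
    set ρ := s % t with hρ
    have hmodz : (t:ℤ) * q + ρ = s := by exact_mod_cast hmod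
    have htz : (t:ℤ) = 2 * t' := by rw [ht]; push_cast; ring
    have hltz : (ρ:ℤ) < 2 * t' := by rw [← htz]; exact_mod_cast hlt
    have hdiv : ρ ≠ 0 → (s - 1) / t = q := by
      intro h1
      rw [← hmod, Nat.add_sub_assoc (by omega), Nat.mul_add_div htp, Nat.div_eq_of_lt (by omega), add_zero]
    have hχ : chiS t S s = chiS t S ρ := chiS_congr t S ⟨q, by linear_combination -hmodz⟩
    have e1 : ∀ u : ℤ, dv t (u - s) = dv t (u - ρ) := fun u => dv_congr ⟨-q, by linear_combination hmodz⟩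
    have e2 : ∀ u : ℤ, dv t (u + s) = dv t (u + ρ) := fun u => dv_congr ⟨q, by linear_combination -hmodz⟩
    have e3 : dv t s = dv t ρ := by simpa using e2 0
    have e4 : dv t (2 * s) = dv t (2 * ρ) := dv_congr ⟨2 * q, by linear_combination -2 * hmodz⟩
    have hc : coreS t' (insert s S) - coreS t' S = ∑ r ∈ Finset.Ioo 0 t',
        (((t:ℕ) * tri ((dv t (r - ρ) - dv t (r + ρ)) + chiS t S r) + r * ((dv t (r - ρ) - dv t (r + ρ)) + chiS t S r))
          - ((t:ℕ) * tri (chiS t S r) + r * chiS t S r)) := by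
      unfold coreS
      rw [← Finset.sum_sub_distrib, ← ht]
      refine Finset.sum_congr rfl fun r _ => ?_
      rw [chiS_insert t s S hS, e1, e2]
    rw [hc, e3, e4, hχ]
    have hcases : ρ = 0 ∨ ρ = t' ∨ (0 < ρ ∧ ρ < t') ∨ (t' < ρ ∧ ρ < t) := by omega
    have hsum0 : (ρ = 0 ∨ ρ = t') → ∑ r ∈ Finset.Ioo 0 t',
        (((t:ℕ) * tri ((dv t (r - ρ) - dv t (r + ρ)) + chiS t S r) + r * ((dv t (r - ρ) - dv t (r + ρ)) + chiS t S r))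
          - ((t:ℕ) * tri (chiS t S r) + r * chiS t S r)) = 0 := by
      intro h
      refine Finset.sum_eq_zero fun r hr => ?_
      rw [Finset.mem_Ioo] at hr
      rw [dv_small (by omega) (by omega) (by omega), dv_small (t := t) (u := r + ρ) (by omega) (by omega) (by omega)]
      simp
    rcases hcases with h | h | h | h
    · rw [hsum0 (Or.inl h), h]
      have hz : chiS t S ((0:ℕ):ℤ) = 0 := by
        have := chiS_neg t S 0
        simp only [neg_zero] at this
        push_cast
        omega
      have hdd : dv t ((0:ℕ):ℤ) = 1 := by simp [dv]
      have hdd' : dv t (2 * ((0:ℕ):ℤ)) = 1 := by simp [dv]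
      have hqq : ((((s - 1) / t : ℕ)) : ℤ) = q - 1 := by
        have hq1 : 0 < q := by
          rcases Nat.eq_zero_or_pos q with h1 | h1
          · rw [h1, h] at hmod; omega
          · exact h1
        obtain ⟨k, hk⟩ : ∃ k, q = k + 1 := ⟨q - 1, by omega⟩
        have : s - 1 = t * k + (t - 1) := by
          rw [← hmod, h, hk, mul_add, mul_one]; omega
        rw [this, Nat.mul_add_div htp, Nat.div_eq_of_lt (by omega), hk]
        push_cast; ring
      rw [hz, hdd, hdd', hqq]
      rw [h] at hmodz
      push_cast at hmodz
      linear_combination 2 * hmodz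
    · rw [hsum0 (Or.inr h), h, hdiv (by omega)]
      have hz : chiS t S (t':ℤ) = 0 := by
        have h1 := chiS_neg t S t'
        have h2 : chiS t S (-(t':ℤ)) = chiS t S t' := chiS_congr t S ⟨-1, by rw [htz]; ring⟩
        omega
      have hdd : dv t (t':ℤ) = 0 := dv_small (by omega) (by omega) (by omega)
      have hdd' : dv t (2 * (t':ℤ)) = 1 := by unfold dv; rw [if_pos]; rw [htz]
      rw [hz, hdd, hdd']
      rw [h] at hmodz
      linear_combination 2 * hmodz + htz
    · rw [Finset.sum_eq_single ρ, hdiv (by omega)]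
      · have hd0 : dv t ((ρ:ℤ) - ρ) = 1 := by simp [dv]
        have hd1 : dv t ((ρ:ℤ) + ρ) = 0 := dv_small (by omega) (by omega) (by omega)
        have hd2 : dv t ((ρ:ℤ)) = 0 := dv_small (by omega) (by omega) (by omega)
        have hd3 : dv t (2 * (ρ:ℤ)) = 0 := dv_small (by omega) (by omega) (by omega)
        have h2 := two_tri (chiS t S ρ)
        have h3 := two_tri (1 + chiS t S ρ)
        rw [hd0, hd1, hd2, hd3, sub_zero]
        linear_combination 2 * hmodz + (t:ℤ) * h3 - (t:ℤ) * h2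
      · intro r hr hne
        rw [Finset.mem_Ioo] at hr
        rw [dv_small (by omega) (by omega) (by omega), dv_small (t := t) (u := r + ρ) (by omega) (by omega) (by omega)]
        simp
      · intro hh
        exact absurd (Finset.mem_Ioo.2 h) hh
    · rw [Finset.sum_eq_single (t - ρ), hdiv (by omega)]
      · have hcast : ((t - ρ : ℕ) : ℤ) = t - ρ := by rw [Nat.cast_sub hlt.le]
        rw [hcast]
        have hd0 : dv t ((t:ℤ) - ρ - ρ) = 0 := dv_small (by omega) (by omega) (by omega)
        have hd1 : dv t ((t:ℤ) - ρ + ρ) = 1 := by simp [dv]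
        have hd2 : dv t ((ρ:ℤ)) = 0 := dv_small (by omega) (by omega) (by omega)
        have hd3 : dv t (2 * (ρ:ℤ)) = 0 := by
          rw [dv_congr (v := 2 * (ρ:ℤ) - t) ⟨1, by ring⟩]
          exact dv_small (by omega) (by omega) (by omega)
        have hx : chiS t S ((t:ℤ) - ρ) = - chiS t S ρ := by
          rw [← chiS_neg]
          exact chiS_congr t S ⟨1, by ring⟩
        have h2 := two_tri (- chiS t S ρ)
        have h3 := two_tri (0 - 1 + - chiS t S ρ)
        rw [hd0, hd1, hd2, hd3, hx]
        linear_combination 2 * hmodz + (t:ℤ) * h3 - (t:ℤ) * h2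
      · intro r hr hne
        rw [Finset.mem_Ioo] at hr
        rw [dv_small (by omega) (by omega) (by omega), dv_congr (u := (r:ℤ) + ρ) (v := r + ρ - t) ⟨1, by ring⟩,
          dv_small (t := t) (u := r + ρ - t) (by omega) (by omega) (by omega)]
        simp
      · intro hh
        exact absurd (Finset.mem_Ioo.2 ⟨by omega, by omega⟩) hh


abbrev IX (u n : ℕ) := Fin n ⊕ (Fin (n + 1) ⊕ (Fin u × Fin (2 * (n + 1))))

def qIx (u n : ℕ) : IX u n → ℤ
  | Sum.inl i => n + 2 + i
  | Sum.inr (Sum.inl i) => n + 1 + i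
  | Sum.inr (Sum.inr p) => (p.2 : ℕ)

def rIx (u n : ℕ) : IX u n → ℤ
  | Sum.inl i => 0
  | Sum.inr (Sum.inl i) => u + 1
  | Sum.inr (Sum.inr p) => (p.1 : ℕ) + 1

def af (u n : ℕ) (i : IX u n) : ℤ := (2 * (u + 1) : ℕ) * qIx u n i + rIx u n i

abbrev tt (u : ℕ) : ℕ := 2 * (u + 1)
abbrev TT (u n : ℕ) : ℤ := ((tt u * (2 * (n + 1)) : ℕ) : ℤ)
abbrev HH (u n : ℕ) : ℤ := ((tt u * (n + 1) : ℕ) : ℤ)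

theorem rf_bd (u n : ℕ) (i : IX u n) : 0 ≤ rIx u n i ∧ rIx u n i ≤ u + 1 := by
  rcases i with i | i | ⟨r, j⟩
  · simp only [rIx]; omega
  · simp only [rIx]; omega
  · simp only [rIx]; omega

theorem qf_bd (u n : ℕ) (i : IX u n) : 0 ≤ qIx u n i ∧ qIx u n i ≤ 2 * n + 1 ∧ (rIx u n i = 0 → n + 2 ≤ qIx u n i) ∧
    (rIx u n i = u + 1 → n + 1 ≤ qIx u n i) := by
  rcases i with i | i | ⟨r, j⟩
  · simp only [rIx, qIx]; omega
  · simp only [rIx, qIx]; omega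
  · simp only [rIx, qIx]; omega

theorem qr_inj (u n : ℕ) (i j : IX u n) (h1 : rIx u n i = rIx u n j) (h2 : qIx u n i = qIx u n j) : i = j := by
  rcases i with i | i | ⟨r, i⟩ <;> rcases j with j | j | ⟨s, j⟩ <;> simp only [rIx, qIx] at h1 h2
  · congr 1; ext; omega
  · omega
  · omega
  · omega
  · congr 2; ext; omega
  · omega
  · omega
  · omega
  · have : r = s := by ext; omega
    have : i = j := by ext; omega
    subst_vars; rfl

theorem t_dvd (u : ℕ) {q r : ℤ} : ((tt u : ℕ) : ℤ) ∣ (2 * (u + 1) : ℕ) * q + r ↔ ((tt u : ℕ) : ℤ) ∣ r := by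
  rw [dvd_add_right (Dvd.intro _ rfl)]

theorem af_dvd (u n : ℕ) (i : IX u n) : ((tt u : ℕ) : ℤ) ∣ af u n i ↔ rIx u n i = 0 := by
  have := rf_bd u n i
  unfold af
  rw [t_dvd]
  constructor
  · intro h
    exact Int.eq_zero_of_abs_lt_dvd h (by rw [abs_of_nonneg this.1]; push_cast; omega)
  · intro h; rw [h]; exact dvd_zero _

theorem af_dvd_sub (u n : ℕ) (i j : IX u n) : ((tt u : ℕ) : ℤ) ∣ af u n i - af u n j ↔ rIx u n i = rIx u n j := by
  have := rf_bd u n i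
  have := rf_bd u n j
  rw [show af u n i - af u n j = (2 * (u + 1) : ℕ) * (qIx u n i - qIx u n j) + (rIx u n i - rIx u n j) by unfold af; ring, t_dvd]
  constructor
  · intro h
    have := Int.eq_zero_of_abs_lt_dvd h (by rw [abs_lt]; push_cast; omega)
    omega
  · intro h; rw [h, sub_self]; exact dvd_zero _

theorem af_dvd_add (u n : ℕ) (i j : IX u n) : ((tt u : ℕ) : ℤ) ∣ af u n i + af u n j ↔
    (rIx u n i = 0 ∧ rIx u n j = 0) ∨ (rIx u n i = u + 1 ∧ rIx u n j = u + 1) := by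
  have := rf_bd u n i
  have := rf_bd u n j
  rw [show af u n i + af u n j = (2 * (u + 1) : ℕ) * (qIx u n i + qIx u n j) + (rIx u n i + rIx u n j) by unfold af; ring, t_dvd]
  constructor
  · intro h
    by_cases h1 : rIx u n i + rIx u n j < 2 * (u + 1)
    · have := Int.eq_zero_of_abs_lt_dvd h (by rw [abs_lt]; push_cast; omega)
      left; omega
    · right; omega
  · rintro (h | h)
    · rw [h.1, h.2]; simp
    · rw [h.1, h.2]; exact ⟨1, by push_cast; ring⟩

theorem RSf (u n : ℕ) : RS (tt u) (n + 1) (TT u n) (HH u n) (af u n) where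
  t0 := by positivity
  M0 := by positivity
  hT := rfl
  hH := by push_cast; ring
  pos := by
    intro i
    have h1 := rf_bd u n i
    have h2 := qf_bd u n i
    unfold af
    have : (0:ℤ) ≤ (2 * (u + 1) : ℕ) * qIx u n i := mul_nonneg (by positivity) h2.1
    by_cases h3 : rIx u n i = 0
    · have h4 := h2.2.2.1 h3
      have : (0:ℤ) < (2 * (u + 1) : ℕ) * qIx u n i := mul_pos (by positivity) (by omega)
      omega
    · omega
  lt := by
    intro i
    have h1 := rf_bd u n i
    have h2 := qf_bd u n i
    unfold af
    have : ((2 * (u + 1) : ℕ):ℤ) * qIx u n i ≤ (2 * (u + 1) : ℕ) * (2 * n + 1) := mul_le_mul_of_nonneg_left h2.2.1 (by positivity)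
    rw [TT]
    push_cast at *
    nlinarith
  inj := by
    intro i j hij
    have h1 : rIx u n i = rIx u n j := by rw [← af_dvd_sub, hij, sub_self]; exact dvd_zero _
    apply qr_inj u n i j h1
    unfold af at hij
    rw [h1] at hij
    have h3 : ((2 * (u + 1) : ℕ):ℤ) ≠ 0 := by positivity
    exact mul_left_cancel₀ h3 (by linarith)
  sum_ne := by
    intro i j hij
    have hq1 := qf_bd u n i
    have hq2 := qf_bd u n j
    have h1 : ((tt u : ℕ) : ℤ) ∣ af u n i + af u n j := by rw [hij]; exact ⟨2 * (n + 1), by push_cast; ring⟩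
    have h3 : (u + 1 : ℤ) ≠ 0 := by positivity
    rw [af_dvd_add] at h1
    unfold af at hij
    rcases h1 with h | h
    · rw [h.1, h.2] at hij
      have := hq1.2.2.1 h.1
      have := hq2.2.2.1 h.2
      have h4 : (u + 1 : ℤ) * (qIx u n i + qIx u n j) = (u + 1) * (2 * (n + 1)) := by push_cast at hij; linarith
      have := mul_left_cancel₀ h3 h4
      omega
    · rw [h.1, h.2] at hij
      have := hq1.2.2.2 h.1
      have := hq2.2.2.2 h.2
      have h4 : (u + 1 : ℤ) * (qIx u n i + qIx u n j + 1) = (u + 1) * (2 * (n + 1)) := by push_cast at hij; linarith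
      have := mul_left_cancel₀ h3 h4
      omega
  card := by
    simp only [Fintype.card_sum, Fintype.card_prod, Fintype.card_fin]
    push_cast
    ring


def psi0 (n : ℕ) (c : Fin n → ℤ) : ℂ :=
  (∏ i : Fin n, ((i + 1 + (2 * n + 2 : ℕ) * c i : ℤ) : ℂ) / ((i + 1 : ℤ) : ℂ)) *
        ∏ i : Fin n, ∏ j ∈ Finset.Ioi i, ((((j + 1 + (2 * n + 2 : ℕ) * c j) + (i + 1 + (2 * n + 2 : ℕ) * c i) : ℤ) : ℂ) / (((j + 1) + (i + 1) : ℤ) : ℂ)) *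
          ((((j + 1 + (2 * n + 2 : ℕ) * c j) - (i + 1 + (2 * n + 2 : ℕ) * c i) : ℤ) : ℂ) / (((j + 1) - (i + 1) : ℤ) : ℂ))

def psiF (n : ℕ) (c : Fin n → ℤ) : ℂ :=
  ∏ i : Fin n, ∏ j ∈ Finset.Ioi i, ((((2 * (j + 1 + (2 * n : ℕ) * c j) - 1) + (2 * (i + 1 + (2 * n : ℕ) * c i) - 1) : ℤ) : ℂ) / (((2 * (j + 1) - 1) + (2 * (i + 1) - 1) : ℤ) : ℂ)) *
          ((((2 * (j + 1 + (2 * n : ℕ) * c j) - 1) - (2 * (i + 1 + (2 * n : ℕ) * c i) - 1) : ℤ) : ℂ) / (((2 * (j + 1) - 1) - (2 * (i + 1) - 1) : ℤ) : ℂ))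

def psiA (N : ℕ) (c : Fin N → ℤ) : ℂ :=
  ∏ i : Fin N, ∏ j ∈ Finset.Ioi i,
          (((((j + N * c j) - (i + N * c i) : ℤ) : ℂ) / ((j - i : ℤ) : ℂ)))

def pF (u n : ℕ) (c : IX u n → ℤ) (k l : IX u n) : ℂ :=
  if af u n k < af u n l then r2 (tt u) (TT u n) (HH u n) (af u n) c k l else 1

theorem pF_ne (u n : ℕ) (c : IX u n → ℤ) (k l : IX u n) (h : rIx u n k ≠ rIx u n l) : pF u n c k l = 1 := by
  unfold pF r2
  have h2 : ¬ ((rIx u n k = 0 ∧ rIx u n l = 0) ∨ (rIx u n k = u + 1 ∧ rIx u n l = u + 1)) := by omega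
  simp only [af_dvd_sub, af_dvd_add, if_neg h, if_neg h2]
  simp

theorem div_cancel_t (t a b : ℤ) (ht : t ≠ 0) : ((t * a : ℤ) : ℂ) / ((t * b : ℤ) : ℂ) = (a:ℂ) / b := by
  push_cast
  exact mul_div_mul_left _ _ (by exact_mod_cast ht)

theorem af_lt (u n : ℕ) (k l : IX u n) (h : rIx u n k = rIx u n l) : af u n k < af u n l ↔ qIx u n k < qIx u n l := by
  unfold af
  rw [h, add_lt_add_iff_right, mul_lt_mul_iff_right₀ (by positivity)]

theorem pF_00 (u n : ℕ) (c : IX u n → ℤ) (i j : Fin n) : pF u n c (Sum.inl i) (Sum.inl j) =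
    if i < j then ((((j + 1 + (2 * n + 2 : ℕ) * c (Sum.inl j)) + (i + 1 + (2 * n + 2 : ℕ) * c (Sum.inl i)) : ℤ) : ℂ) / (((j + 1) + (i + 1) : ℤ) : ℂ)) *
          ((((j + 1 + (2 * n + 2 : ℕ) * c (Sum.inl j)) - (i + 1 + (2 * n + 2 : ℕ) * c (Sum.inl i)) : ℤ) : ℂ) / (((j + 1) - (i + 1) : ℤ) : ℂ)) else 1 := by
  unfold pF
  have e : af u n (Sum.inl i) < af u n (Sum.inl j) ↔ i < j := by
    rw [af_lt u n (Sum.inl i) (Sum.inl j) rfl]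
    simp only [qIx, Fin.lt_def]; omega
  refine if_congr e ?_ rfl
  unfold r2
  rw [if_pos (by rw [af_dvd_sub]; rfl), if_pos (by rw [af_dvd_add]; exact Or.inl ⟨rfl, rfl⟩), mul_comm]
  have ht : (tt u : ℤ) ≠ 0 := by positivity
  have ht' : -(tt u : ℤ) ≠ 0 := by rwa [neg_ne_zero]
  congr 1
  · refine Eq.trans ?_ (div_cancel_t (tt u) _ _ ht)
    congr 2 <;> simp only [vv, af, qIx, rIx, Pi.zero_apply] <;> push_cast <;> ring
  · refine Eq.trans ?_ (div_cancel_t (-(tt u)) _ _ ht')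
    congr 2 <;> simp only [vv, af, qIx, rIx, Pi.zero_apply] <;> push_cast <;> ring

theorem pF_11 (u n : ℕ) (c : IX u n → ℤ) (i j : Fin (n + 1)) : pF u n c (Sum.inr (Sum.inl i)) (Sum.inr (Sum.inl j)) =
    if i < j then ((((2 * (j + 1 + (2 * (n + 1) : ℕ) * c (Sum.inr (Sum.inl j))) - 1) + (2 * (i + 1 + (2 * (n + 1) : ℕ) * c (Sum.inr (Sum.inl i))) - 1) : ℤ) : ℂ) / (((2 * (j + 1) - 1) + (2 * (i + 1) - 1) : ℤ) : ℂ)) *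
          ((((2 * (j + 1 + (2 * (n + 1) : ℕ) * c (Sum.inr (Sum.inl j))) - 1) - (2 * (i + 1 + (2 * (n + 1) : ℕ) * c (Sum.inr (Sum.inl i))) - 1) : ℤ) : ℂ) / (((2 * (j + 1) - 1) - (2 * (i + 1) - 1) : ℤ) : ℂ)) else 1 := by
  unfold pF
  have e : af u n (Sum.inr (Sum.inl i)) < af u n (Sum.inr (Sum.inl j)) ↔ i < j := by
    rw [af_lt u n (Sum.inr (Sum.inl i)) (Sum.inr (Sum.inl j)) rfl]
    simp only [qIx, Fin.lt_def]; omega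
  refine if_congr e ?_ rfl
  unfold r2
  rw [if_pos (by rw [af_dvd_sub]; rfl), if_pos (by rw [af_dvd_add]; exact Or.inr ⟨rfl, rfl⟩), mul_comm]
  have ht : (u + 1 : ℤ) ≠ 0 := by positivity
  have ht' : -(u + 1 : ℤ) ≠ 0 := by rwa [neg_ne_zero]
  congr 1
  · refine Eq.trans ?_ (div_cancel_t (u + 1) _ _ ht)
    congr 2 <;> simp only [vv, af, qIx, rIx, Pi.zero_apply] <;> push_cast <;> ring
  · refine Eq.trans ?_ (div_cancel_t (-(u + 1)) _ _ ht')
    congr 2 <;> simp only [vv, af, qIx, rIx, Pi.zero_apply] <;> push_cast <;> ring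

theorem pF_22 (u n : ℕ) (c : IX u n → ℤ) (r : Fin u) (i j : Fin (2 * (n + 1))) :
    pF u n c (Sum.inr (Sum.inr (r, i))) (Sum.inr (Sum.inr (r, j))) =
    if i < j then (((((j + (2 * (n + 1) : ℕ) * c (Sum.inr (Sum.inr (r, j)))) - (i + (2 * (n + 1) : ℕ) * c (Sum.inr (Sum.inr (r, i)))) : ℤ) : ℂ) / ((j - i : ℤ) : ℂ))) else 1 := by
  unfold pF
  have e : af u n (Sum.inr (Sum.inr (r, i))) < af u n (Sum.inr (Sum.inr (r, j))) ↔ i < j := by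
    rw [af_lt u n (Sum.inr (Sum.inr (r, i))) (Sum.inr (Sum.inr (r, j))) rfl]
    simp only [qIx, Fin.lt_def]; omega
  refine if_congr e ?_ rfl
  unfold r2
  rw [if_pos (by rw [af_dvd_sub]; rfl), if_neg (by rw [af_dvd_add]; simp only [rIx]; omega), mul_one]
  have ht' : -(tt u : ℤ) ≠ 0 := by rw [neg_ne_zero]; positivity
  refine Eq.trans ?_ (div_cancel_t (-(tt u)) _ _ ht')
  congr 2 <;> simp only [vv, af, qIx, rIx, Pi.zero_apply] <;> push_cast <;> ring

theorem prod_Ioi_ite {m : ℕ} (i : Fin m) (f : Fin m → ℂ) : ∏ j, (if i < j then f j else 1) = ∏ j ∈ Finset.Ioi i, f j := by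
  rw [← Finset.prod_filter]
  congr 1
  ext j; simp

theorem Psi_fac (u n : ℕ) (c : IX u n → ℤ) : Psi (tt u) (TT u n) (HH u n) (af u n) c =
    psi0 n (fun i => c (Sum.inl i)) * psiF (n + 1) (fun i => c (Sum.inr (Sum.inl i))) *
      ∏ r : Fin u, psiA (2 * (n + 1)) (fun j => c (Sum.inr (Sum.inr (r, j)))) := by
  have e0 : ∏ i, r1 (tt u) (TT u n) (HH u n) (af u n) c i =
      ∏ i : Fin n, ((i + 1 + (2 * n + 2 : ℕ) * c (Sum.inl i) : ℤ) : ℂ) / ((i + 1 : ℤ) : ℂ) := by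
    rw [Fintype.prod_sum_type, Finset.prod_congr rfl (g := fun _ => (1:ℂ)) (s₂ := (Finset.univ : Finset (Fin (n+1) ⊕ (Fin u × Fin (2 * (n + 1)))))) , Finset.prod_const_one, mul_one]
    · refine Finset.prod_congr rfl fun i _ => ?_
      have ht : (tt u : ℤ) ≠ 0 := by positivity
      unfold r1
      rw [if_pos (by rw [af_dvd]; rfl)]
      refine Eq.trans ?_ (div_cancel_t (tt u) _ _ ht)
      congr 2 <;> simp only [vv, af, qIx, rIx, Pi.zero_apply] <;> push_cast <;> ring
    · intro x _
      unfold r1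
      rw [if_neg]
      rw [af_dvd]
      rcases x with i | ⟨r, j⟩
      · simp only [rIx]; omega
      · simp only [rIx]; omega
  have e1 : ∏ k, ∏ l, pF u n c k l = (∏ i : Fin n, ∏ j : Fin n, pF u n c (Sum.inl i) (Sum.inl j)) *
     ((∏ i : Fin (n + 1), ∏ j : Fin (n + 1), pF u n c (Sum.inr (Sum.inl i)) (Sum.inr (Sum.inl j))) *
      ∏ r : Fin u, ∏ i : Fin (2 * (n + 1)), ∏ j : Fin (2 * (n + 1)), pF u n c (Sum.inr (Sum.inr (r, i))) (Sum.inr (Sum.inr (r, j)))) := by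
    rw [Fintype.prod_sum_type, Fintype.prod_sum_type, Fintype.prod_prod_type]
    congr 1
    · refine Finset.prod_congr rfl fun i _ => ?_
      rw [Fintype.prod_sum_type, Finset.prod_congr rfl (g := fun _ => (1:ℂ)) (s₂ := (Finset.univ : Finset (Fin (n+1) ⊕ (Fin u × Fin (2 * (n + 1)))))) , Finset.prod_const_one, mul_one]
      intro x _
      apply pF_ne
      rcases x with i | ⟨r, j⟩
      · simp only [rIx]; omega
      · simp only [rIx]; omega
    · congr 1
      · refine Finset.prod_congr rfl fun i _ => ?_
        rw [Fintype.prod_sum_type, Fintype.prod_sum_type, Finset.prod_eq_one, Finset.prod_eq_one (s := (Finset.univ : Finset (Fin u × Fin (2 * (n + 1))))), mul_one, one_mul]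
        · intro x _
          apply pF_ne; simp only [rIx]; omega
        · intro x _
          apply pF_ne; simp only [rIx]; omega
      · refine Finset.prod_congr rfl fun r _ => ?_
        refine Finset.prod_congr rfl fun i _ => ?_
        rw [Fintype.prod_sum_type, Fintype.prod_sum_type, Fintype.prod_prod_type, Finset.prod_eq_one, one_mul, Finset.prod_eq_one (s := (Finset.univ : Finset (Fin (n+1)))), one_mul]
        · rw [Finset.prod_eq_single r]
          · intro s _ hs
            refine Finset.prod_eq_one fun j _ => ?_
            apply pF_ne; simp only [rIx]
            have : (s:ℕ) ≠ r := fun h => hs (Fin.ext h)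
            omega
          · simp
        · intro x _
          apply pF_ne; simp only [rIx]; omega
        · intro x _
          apply pF_ne; simp only [rIx]; omega
  have e2 : Psi (tt u) (TT u n) (HH u n) (af u n) c = (∏ i, r1 (tt u) (TT u n) (HH u n) (af u n) c i) * ∏ k, ∏ l, pF u n c k l := rfl
  rw [e2, e0, e1]
  simp only [pF_00, pF_11, pF_22, prod_Ioi_ite]
  unfold psi0 psiF psiA
  ring


def K0 (n : ℕ) (c : Fin n → ℤ) : ℕ := ∑ i : Fin n, ex (2 * n + 2) (n + 2 + i) (c i)
def K1 (n : ℕ) (c : Fin n → ℤ) : ℕ := ∑ i : Fin n, ex (2 * (2 * n)) (2 * n + 1 + 2 * i) (c i)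
def KA (N : ℕ) (c : Fin N → ℤ) : ℕ := ∑ i : Fin N, ex N i (c i)

abbrev Sf (u n : ℕ) (c : IX u n → ℤ) : Finset ℕ := Sc (TT u n) (af u n) c

abbrev cA {u n : ℕ} (c : IX u n → ℤ) (r : Fin u) : Fin (2 * (n + 1)) → ℤ := fun j => c (Sum.inr (Sum.inr (r, j)))
abbrev c0 {u n : ℕ} (c : IX u n → ℤ) : Fin n → ℤ := fun j => c (Sum.inl j)
abbrev c1 {u n : ℕ} (c : IX u n → ℤ) : Fin (n + 1) → ℤ := fun j => c (Sum.inr (Sum.inl j))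

theorem sum_dec (u n : ℕ) (c : IX u n → ℤ) : ((∑ s ∈ Sf u n c, s : ℕ) : ℤ) =
    tt u * K0 n (c0 c) + (u + 1) * K1 (n + 1) (c1 c) + ∑ r : Fin u, (tt u * (KA (2 * (n + 1)) (cA c r) : ℤ) + (r + 1) * ∑ j, cA c r j) := by
  rw [Sc_sum (RSf u n), Fintype.sum_sum_type, Fintype.sum_sum_type, Fintype.sum_prod_type, add_assoc]
  congr 1
  · unfold K0
    rw [Nat.cast_sum, Finset.mul_sum]
    refine Finset.sum_congr rfl fun i _ => ?_
    rw [ex_cast _ _ (by omega)]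
    simp only [af, qIx, rIx]; push_cast; ring
  congr 1
  · unfold K1
    rw [Nat.cast_sum, Finset.mul_sum]
    refine Finset.sum_congr rfl fun i _ => ?_
    rw [ex_cast _ _ (by omega)]
    simp only [af, qIx, rIx]; push_cast; ring
  · refine Finset.sum_congr rfl fun r _ => ?_
    unfold KA
    rw [Nat.cast_sum, Finset.mul_sum, Finset.mul_sum, ← Finset.sum_add_distrib]
    refine Finset.sum_congr rfl fun i _ => ?_
    rw [ex_cast _ _ (by omega)]
    simp only [af, qIx, rIx]; push_cast; ring

theorem dv_rf (u n : ℕ) (r : Fin u) (i : IX u n) : dv (tt u) ((r:ℤ) + 1 - af u n i) - dv (tt u) ((r:ℤ) + 1 + af u n i) =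
    if rIx u n i = r + 1 then 1 else 0 := by
  have h := rf_bd u n i
  rw [dv_congr (u := (r:ℤ) + 1 - af u n i) (v := r + 1 - rIx u n i) ⟨-qIx u n i, by unfold af; push_cast; ring⟩,
    dv_congr (u := (r:ℤ) + 1 + af u n i) (v := r + 1 + rIx u n i) ⟨qIx u n i, by unfold af; push_cast; ring⟩,
    dv_small (u := (r:ℤ) + 1 + rIx u n i) (by push_cast; omega) (by push_cast; omega) (by omega)]
  split_ifs with h1
  · rw [h1]; simp [dv]
  · rw [dv_small (by push_cast; omega) (by push_cast; omega) (by omega)]; rfl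

theorem chi_dec (u n : ℕ) (c : IX u n → ℤ) (r : Fin u) : chiS (tt u) (Sf u n c) (r + 1) = ∑ j, cA c r j := by
  rw [Sc_chi (RSf u n)]
  simp only [dv_rf]
  rw [Fintype.sum_sum_type, Fintype.sum_sum_type, Fintype.sum_prod_type, Finset.sum_eq_zero, zero_add, Finset.sum_eq_zero, zero_add,
    Finset.sum_eq_single r]
  · refine Finset.sum_congr rfl fun i _ => ?_
    simp [rIx]
  · intro s _ hs
    refine Finset.sum_eq_zero fun j _ => ?_
    have : (s:ℕ) ≠ r := fun h => hs (Fin.ext h)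
    rw [if_neg (by simp only [rIx]; omega), mul_zero]
  · simp
  · intro i _
    rw [if_neg (by simp only [rIx]; omega), mul_zero]
  · intro i _
    rw [if_neg (by simp only [rIx]; omega), mul_zero]

theorem core_dec (u n : ℕ) (c : IX u n → ℤ) : coreS (u + 1) (Sf u n c) =
    ∑ r : Fin u, (tt u * tri (∑ j, cA c r j) + (r + 1) * ∑ j, cA c r j) := by
  unfold coreS
  rw [show Finset.Ioo 0 (u + 1) = Finset.Ico (0 + 1) (u + 1) by ext; simp; omega,
    ← Finset.sum_Ico_add' _ 0 u 1, ← Finset.range_eq_Ico, Finset.sum_range]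
  refine Finset.sum_congr rfl fun r _ => ?_
  rw [← chi_dec u n c r]
  push_cast
  rfl

theorem yE_dec (u n : ℕ) (c : IX u n → ℤ) : (yE (tt u) (Sf u n c) : ℤ) = 2 * K0 n (c0 c) + K1 (n + 1) (c1 c) +
    ∑ r : Fin u, 2 * ((KA (2 * (n + 1)) (cA c r) : ℤ) - tri (∑ j, cA c r j)) := by
  have h1 := core_thm (u + 1) (by omega) (Sf u n c) (by
    intro h; rw [mem_Sc (RSf u n)] at h; exact lt_irrefl _ h.1)
  rw [sum_dec, core_dec] at h1
  have h2 : (2 * (u + 1) : ℤ) ≠ 0 := by positivity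
  apply mul_left_cancel₀ h2
  have h3 : (2 * (u + 1) : ℤ) * ∑ r : Fin u, 2 * ((KA (2 * (n + 1)) (cA c r) : ℤ) - tri (∑ j, cA c r j)) =
     2 * ∑ r : Fin u, (tt u * (KA (2 * (n + 1)) (cA c r) : ℤ) + (r + 1) * ∑ j, cA c r j)
      - 2 * ∑ r : Fin u, (tt u * tri (∑ j, cA c r j) + (r + 1) * ∑ j, cA c r j) := by
    rw [← mul_sub, ← Finset.sum_sub_distrib, Finset.mul_sum, Finset.mul_sum]
    refine Finset.sum_congr rfl fun r _ => ?_
    push_cast; ring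
  rw [mul_add (2 * (u + 1) : ℤ) (2 * _ + _), h3]
  push_cast at h1 ⊢
  linear_combination h1

theorem KA_ge (n : ℕ) (c : Fin (2 * (n + 1)) → ℤ) : tri (∑ j, c j) ≤ KA (2 * (n + 1)) c := by
  have h := yE_dec 1 n (fun i => match i with
    | Sum.inl _ => 0
    | Sum.inr (Sum.inl _) => 0
    | Sum.inr (Sum.inr p) => c p.2)
  have e0 : K0 n (fun _ => 0) = 0 := by simp [K0, ex, tri]
  have e1 : K1 (n + 1) (fun _ => 0) = 0 := by simp [K1, ex, tri]
  have h2 : ((yE (tt 1) _ : ℕ) : ℤ) = 2 * ((K0 n (fun _ => 0) : ℕ) : ℤ) + ((K1 (n + 1) (fun _ => 0) : ℕ):ℤ) + ∑ r : Fin 1, 2 * ((KA (2 * (n + 1)) c : ℤ) - tri (∑ j, c j)) := h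
  rw [e0, e1, Fin.sum_univ_one] at h2
  have h3 := Int.natCast_nonneg (yE (tt 1) (Sf 1 n (fun i => match i with
    | Sum.inl _ => 0
    | Sum.inr (Sum.inl _) => 0
    | Sum.inr (Sum.inr p) => c p.2)))
  rw [h2] at h3
  push_cast at h3
  linarith


def sg (w : ℂ) (b : ℕ) (hb : b ≠ 0) : PS →+* PS := ((expand (R := ℂ) b hb : PS →ₐ[ℂ] PS) : PS →+* PS).comp (rescale w)

theorem sg_coeff (w : ℂ) (b : ℕ) (hb : b ≠ 0) (f : PS) (n : ℕ) :
    coeff n (sg w b hb f) = if b ∣ n then w ^ (n / b) * coeff (n / b) f else 0 := by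
  unfold sg
  rw [RingHom.comp_apply]
  change coeff n (expand b hb (rescale w f)) = _
  rw [coeff_expand, coeff_rescale]

theorem sg_C (w : ℂ) (b : ℕ) (hb : b ≠ 0) (a : ℂ) : sg w b hb (C a) = C a := by
  unfold sg
  rw [RingHom.comp_apply]
  have : rescale w (C a) = C a := by
    ext n
    rw [coeff_rescale, coeff_C]
    split_ifs with h
    · rw [h]; simp
    · simp
  rw [this]
  exact expand_C b hb a

theorem sg_X (w : ℂ) (b : ℕ) (hb : b ≠ 0) : sg w b hb X = C w * X ^ b := by
  unfold sg
  rw [RingHom.comp_apply, rescale_X]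
  change expand b hb (C w * X) = _
  rw [map_mul, expand_C, expand_X]

theorem sg_cont (w : ℂ) (b : ℕ) (hb : b ≠ 0) : Continuous (sg w b hb) := by
  rw [continuous_iff_continuousAt]
  intro f
  unfold ContinuousAt
  rw [ps_tendsto_iff]
  intro n
  simp only [sg_coeff]
  by_cases h : b ∣ n
  · simp only [if_pos h]
    refine Filter.Tendsto.const_mul _ ?_
    exact (ps_tendsto_iff.1 Filter.tendsto_id) (n / b)
  · simp only [if_neg h]
    exact tendsto_const_nhds

theorem sg_tsum {ι : Type*} (w : ℂ) (b : ℕ) (hb : b ≠ 0) {a : ι → PS} (h : FS a) :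
    sg w b hb (∑' i, a i) = ∑' i, sg w b hb (a i) :=
  h.summable.map_tsum (sg w b hb) (sg_cont w b hb)

theorem sg_FS {ι : Type*} (w : ℂ) (b : ℕ) (hb : b ≠ 0) {a : ι → PS} (h : FS a) : FS (fun i => sg w b hb (a i)) := by
  intro n
  refine (h (n / b)).subset ?_
  intro i hi hc
  apply hi
  rw [sg_coeff, hc]
  simp

theorem sg_tprod (w : ℂ) (b : ℕ) (hb : b ≠ 0) {a : ℕ → PS} (h : NP a) :
    sg w b hb (∏' i, a i) = ∏' i, sg w b hb (a i) :=
  h.multipliable.map_tprod (sg w b hb) (sg_cont w b hb)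

theorem sg_EE (w : ℂ) (b : ℕ) (hb : b ≠ 0) (N : ℕ) (hN : 0 < N) :
    sg w b hb (EE N) = ∏' k : ℕ, (1 - C (w ^ (N * (k + 1))) * X ^ (b * (N * (k + 1)))) := by
  unfold EE
  rw [sg_tprod w b hb (np_qf N hN)]
  congr 1
  funext k
  rw [map_sub, map_one, map_pow, sg_X, mul_pow, ← map_pow, ← pow_mul]


theorem laurent (H : Finset ℤ) (a : ℤ → ℂ) (h : ∀ ξ : ℂˣ, ∑ m ∈ H, a m * (ξ:ℂ) ^ m = 0) : ∀ m ∈ H, a m = 0 := by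
  let φ : ℤ → (ℂˣ →* ℂ) := fun m => (Units.coeHom ℂ).comp (zpowGroupHom m)
  have hφ : Function.Injective φ := by
    intro m m' hm
    have h2 := DFunLike.congr_fun hm (Units.mk0 (2:ℂ) two_ne_zero)
    simp only [φ, MonoidHom.comp_apply, zpowGroupHom_apply, Units.coeHom_apply, Units.val_zpow_eq_zpow_val, Units.val_mk0] at h2
    have h3 : (2:ℝ) ^ m = (2:ℝ) ^ m' := by
      have h4 := congrArg (fun x : ℂ => ‖x‖) h2
      simpa [norm_zpow] using h4
    exact zpow_right_injective₀ (by norm_num) (by norm_num) h3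
  have hl := (linearIndependent_monoidHom ℂˣ ℂ).comp φ hφ
  rw [linearIndependent_iff'] at hl
  apply hl H a
  funext ξ
  have := h ξ
  simp only [Finset.sum_apply, Pi.smul_apply, Function.comp_apply, smul_eq_mul, Pi.zero_apply]
  simpa [φ] using this

theorem fin_bd (m : ℕ) (B : ℤ) : {c : Fin m → ℤ | ∀ i, |c i| ≤ B}.Finite := by
  refine (Set.Finite.pi (fun _ : Fin m => Set.finite_Icc (-B) B)).subset ?_
  intro c hc i _
  exact abs_le.1 (hc i)

theorem KA_bd (N : ℕ) (c : Fin N → ℤ) (i : Fin N) : |c i| ≤ KA N c + 1 := by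
  have h := ex_ge N i i.2 (c i)
  have h2 : ex N i (c i) ≤ KA N c := Finset.single_le_sum (f := fun i : Fin N => ex N i (c i)) (fun _ _ => Nat.zero_le _) (Finset.mem_univ i)
  omega

theorem KA_fin (N B : ℕ) : {c | KA N c ≤ B}.Finite := by
  refine (fin_bd N (B + 1)).subset ?_
  intro c hc i
  have := KA_bd N c i
  have h2 : KA N c ≤ B := hc
  omega

theorem KA_FS (N : ℕ) (w : (Fin N → ℤ) → PS) : FS (fun c => w c * X ^ KA N c) :=
  FS.of_exp w (KA N) fun n => (KA_fin N n).subset fun c (hc : KA N c < n) => show KA N c ≤ n from hc.le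

theorem A_coeff (N : ℕ) (hN : 0 < N) (hev : Even N) (k : ℕ) (m : ℤ) :
    ∑ c ∈ (KA_fin N k).toFinset, (if ∑ i, c i = m ∧ KA N c = k then psiA N c else 0) =
      coeff k (EE 1 ^ (N ^ 2 - 1) * (C ((-1) ^ m) * X ^ ex 1 0 m)) := by
  set F := (KA_fin N k).toFinset with hF
  set P := EE 1 ^ (N ^ 2 - 1)
  let b : ℤ → ℂ := fun m => coeff k (P * (C ((-1) ^ m) * X ^ ex 1 0 m))
  let G : Finset ℤ := Finset.Icc (-(k + 1)) (k + 1)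
  have hb : ∀ m, m ∉ G → b m = 0 := by
    intro m hm
    have h1 := ex_ge 1 0 one_pos m
    have h2 : k < ex 1 0 m := by
      by_contra hc
      apply hm
      rw [Finset.mem_Icc, ← abs_le]
      omega
    simp only [b]
    rw [← mul_assoc, coeff_mul_X_pow', if_neg (by omega)]
  let L : ℤ → ℂ := fun m => ∑ c ∈ F, (if ∑ i, c i = m ∧ KA N c = k then psiA N c else 0)
  let H : Finset ℤ := G ∪ F.image (fun c => ∑ i, c i)
  have hL : ∀ m, m ∉ H → L m = 0 := by
    intro m hm
    refine Finset.sum_eq_zero fun c hc => ?_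
    rw [if_neg]
    rintro ⟨h1, -⟩
    exact hm (Finset.mem_union_right _ (Finset.mem_image.2 ⟨c, hc, h1⟩))
  have key : ∀ ξ : ℂˣ, ∑ m ∈ H, (L m - b m) * (ξ:ℂ) ^ m = 0 := by
    intro ξ
    obtain ⟨ζ0, hζ0⟩ := IsAlgClosed.exists_pow_nat_eq (ξ:ℂ) hN
    have hz : ζ0 ≠ 0 := by
      rintro rfl
      rw [zero_pow hN.ne'] at hζ0
      exact ξ.ne_zero hζ0.symm
    have h := congrArg (coeff k) (A_final N hN hev (Units.mk0 ζ0 hz))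
    simp only [Units.val_mk0, hζ0] at h
    have e1 : ∀ c : Fin N → ℤ, ζ0 ^ ((N:ℤ) * ∑ i, c i) = (ξ:ℂ) ^ (∑ i, c i) := by
      intro c; rw [zpow_mul, zpow_natCast, hζ0]
    have hlhs : coeff k (∑' c : Fin N → ℤ, C (((ξ:ℂ) ^ (∑ i, c i)) * psiA N c) * X ^ KA N c) = ∑ m ∈ H, L m * (ξ:ℂ) ^ m := by
      rw [(KA_FS N fun c => C (((ξ:ℂ) ^ (∑ i, c i)) * psiA N c)).coeff_tsum_finset k F]
      · simp only [L, Finset.sum_mul]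
        rw [Finset.sum_comm]
        refine Finset.sum_congr rfl fun c hc => ?_
        rw [Finset.sum_eq_single (∑ i, c i)]
        · rw [coeff_C_mul, coeff_X_pow]
          by_cases hk : KA N c = k
          · rw [if_pos hk.symm, if_pos ⟨rfl, hk⟩]; ring
          · rw [if_neg (Ne.symm hk), if_neg (fun h => hk h.2)]; ring
        · intro m _ hm
          rw [if_neg (fun h => hm h.1.symm), zero_mul]
        · intro hc'
          exact absurd (Finset.mem_union_right _ (Finset.mem_image.2 ⟨c, hc, rfl⟩)) hc'
      · intro c hc
        rw [coeff_C_mul, coeff_X_pow, if_neg, mul_zero]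
        intro hk
        apply hc
        rw [hF, Set.Finite.mem_toFinset]
        exact hk.symm.le
    have hrhs : coeff k (P * th 1 0 (ξ:ℂ)) = ∑ m ∈ H, b m * (ξ:ℂ) ^ m := by
      have hfs : FS (fun j : ℤ => C ((-(ξ:ℂ)) ^ j) * X ^ ex 1 0 j) := ex_fs 1 0 one_pos _
      have e2 : ∀ m : ℤ, coeff k (P * (C ((-(ξ:ℂ)) ^ m) * X ^ ex 1 0 m)) = b m * (ξ:ℂ) ^ m := by
        intro m
        simp only [b]
        rw [show P * (C ((-(ξ:ℂ)) ^ m) * X ^ ex 1 0 m) = C ((ξ:ℂ) ^ m) * (P * (C ((-1) ^ m) * X ^ ex 1 0 m)) by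
          rw [show -(ξ:ℂ) = (-1) * ξ by ring, mul_zpow, map_mul]; ring, coeff_C_mul, mul_comm]
      unfold th
      rw [← hfs.tml, (hfs.mul_left fun _ => P).coeff_tsum_finset k H]
      · exact Finset.sum_congr rfl fun m _ => e2 m
      · intro m hm
        rw [e2, hb m (fun h => hm (Finset.mem_union_left _ h)), zero_mul]
    have hA : coeff k (∑' c : Fin N → ℤ, C (((ξ:ℂ) ^ (∑ i, c i)) * psiA N c) * X ^ KA N c) = coeff k (P * th 1 0 (ξ:ℂ)) := by
      rw [← h]
      congr 2
      funext c
      rw [e1]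
      rfl
    simp only [sub_mul, Finset.sum_sub_distrib]
    rw [← hlhs, ← hrhs, hA, sub_self]
  by_cases hm : m ∈ H
  · exact sub_eq_zero.1 (laurent H _ key m hm)
  · exact (hL m hm).trans (hb m fun h => hm (Finset.mem_union_left _ h)).symm


theorem ex10 (m : ℤ) : (ex 1 0 m : ℤ) = tri m := by
  rw [ex_cast 1 0 one_pos]; simp

theorem ex10_le (n : ℕ) (c : Fin (2 * (n + 1)) → ℤ) : ex 1 0 (∑ i, c i) ≤ KA (2 * (n + 1)) c := by
  have := KA_ge n c
  have h2 := ex10 (∑ i, c i)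
  omega

theorem A_slice_FS (N : ℕ) (m : ℤ) (w : (Fin N → ℤ) → PS) :
    FS (fun c : Fin N → ℤ => if ∑ i, c i = m then w c * X ^ (KA N c - ex 1 0 m) else 0) := by
  apply FS.of_le
  intro k
  refine (KA_fin N (k + ex 1 0 m)).subset ?_
  intro c hc
  by_contra h
  apply hc
  have h2 : ¬ (KA N c ≤ k + ex 1 0 m) := h
  split_ifs
  · exact Dvd.dvd.mul_left (pow_dvd_pow _ (by omega)) _
  · exact dvd_zero _

theorem A_slice (n : ℕ) (m : ℤ) :
    ∑' c : Fin (2 * (n + 1)) → ℤ, (if ∑ i, c i = m then C (psiA (2 * (n + 1)) c) * X ^ (KA (2 * (n + 1)) c - ex 1 0 m) else 0) =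
      C ((-1) ^ m) * EE 1 ^ ((2 * (n + 1)) ^ 2 - 1) := by
  ext k
  have h := A_coeff (2 * (n + 1)) (by omega) (even_two_mul _) (k + ex 1 0 m) m
  rw [(A_slice_FS _ m _).coeff_tsum_finset k ((KA_fin (2 * (n + 1)) (k + ex 1 0 m)).toFinset)]
  · rw [← mul_assoc, coeff_mul_X_pow, mul_comm (EE 1 ^ _)] at h
    rw [← h]
    refine Finset.sum_congr rfl fun c _ => ?_
    by_cases h1 : ∑ i, c i = m
    · have h3 := ex10_le n c
      rw [h1] at h3
      rw [if_pos h1, coeff_C_mul, coeff_X_pow]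
      by_cases h2 : KA (2 * (n + 1)) c = k + ex 1 0 m
      · rw [if_pos (by omega), if_pos ⟨h1, h2⟩, mul_one]
      · rw [if_neg (by omega), if_neg (fun h => h2 h.2), mul_zero]
    · rw [if_neg h1, if_neg (fun h => h1 h.1), map_zero]
  · intro c hc
    split_ifs with h1
    · rw [coeff_C_mul, coeff_X_pow, if_neg, mul_zero]
      intro h2
      apply hc
      rw [Set.Finite.mem_toFinset]
      show KA (2 * (n + 1)) c ≤ k + ex 1 0 m
      omega
    · simp

def FA (n : ℕ) (w : ℂ) (b : ℕ) (t r : ℕ) (c : Fin (2 * (n + 1)) → ℤ) : PS :=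
  C (psiA (2 * (n + 1)) c) * (C w * X ^ b) ^ (KA (2 * (n + 1)) c - ex 1 0 (∑ i, c i)) * X ^ ex t r (∑ i, c i)

theorem FA_pair_FS (n : ℕ) (w : ℂ) (b : ℕ) (hb : b ≠ 0) (t r : ℕ) (hr : r < t) :
    FS (fun p : ℤ × (Fin (2 * (n + 1)) → ℤ) => if ∑ i, p.2 i = p.1 then FA n w b t r p.2 else 0) := by
  apply FS.of_le
  intro k
  refine (((abs_le_fin (k + 1)).prod (KA_fin (2 * (n + 1)) (k + (k + 2) * (k + 2))))).subset ?_
  rintro ⟨m, c⟩ hc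
  simp only [Set.mem_ofPred_eq] at hc
  by_cases hs : ∑ i, c i = m
  · rw [if_pos hs] at hc
    unfold FA at hc
    rw [mul_pow, ← pow_mul, hs] at hc
    have h1 : ex t r m < k := by
      by_contra h
      exact hc (Dvd.dvd.mul_left (pow_dvd_pow _ (by omega)) _)
    have h2 : b * (KA (2 * (n + 1)) c - ex 1 0 m) < k := by
      by_contra h
      exact hc (Dvd.dvd.mul_right (Dvd.dvd.mul_left (Dvd.dvd.mul_left (pow_dvd_pow _ (by omega)) _) _) _)
    have h3 : KA (2 * (n + 1)) c - ex 1 0 m < k := lt_of_le_of_lt (Nat.le_mul_of_pos_left _ (Nat.pos_of_ne_zero hb)) h2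
    have h4 := ex_ge t r hr m
    have h5 : |m| ≤ k + 1 := by omega
    refine ⟨h5, ?_⟩
    show KA (2 * (n + 1)) c ≤ _
    have h6 := ex10 m
    have h7 := two_tri m
    have h8 : ex 1 0 m ≤ (k + 2) * (k + 2) := by
      have : (ex 1 0 m : ℤ) ≤ (k + 2) * (k + 2) := by
        rw [h6]
        have h9 := abs_le.1 h5
        nlinarith
      exact_mod_cast this
    omega
  · rw [if_neg hs] at hc
    exact absurd (dvd_zero _) hc

theorem FA_FS (n : ℕ) (w : ℂ) (b : ℕ) (hb : b ≠ 0) (t r : ℕ) (hr : r < t) : FS (FA n w b t r) := by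
  have h := (FA_pair_FS n w b hb t r hr).comp_inj (f := fun c : Fin (2 * (n + 1)) → ℤ => (∑ i, c i, c))
    (by intro a b hab; exact (Prod.mk.inj hab).2)
  simpa using h

theorem FA_sum (n : ℕ) (w : ℂ) (b : ℕ) (hb : b ≠ 0) (t r : ℕ) (hr : r < t) :
    ∑' c, FA n w b t r c = sg w b hb (EE 1) ^ ((2 * (n + 1)) ^ 2 - 1) * th t r 1 := by
  have hF := FA_pair_FS n w b hb t r hr
  have h1 := hF.tsum_prod.2
  have h2 := (hF.comp_inj (f := Prod.swap) Prod.swap_injective).tsum_prod.2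
  have h3 : ∑' p : (Fin (2 * (n + 1)) → ℤ) × ℤ, ((fun p : ℤ × (Fin (2 * (n + 1)) → ℤ) => if ∑ i, p.2 i = p.1 then FA n w b t r p.2 else 0) (Prod.swap p)) =
    ∑' p : ℤ × (Fin (2 * (n + 1)) → ℤ), ((fun p : ℤ × (Fin (2 * (n + 1)) → ℤ) => if ∑ i, p.2 i = p.1 then FA n w b t r p.2 else 0) p) :=
    (Equiv.prodComm _ _).tsum_eq (fun p : ℤ × (Fin (2 * (n + 1)) → ℤ) => if ∑ i, p.2 i = p.1 then FA n w b t r p.2 else 0)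
  have h4 : ∑' c, FA n w b t r c = ∑' c : Fin (2 * (n + 1)) → ℤ, ∑' m : ℤ, (if ∑ i, c i = m then FA n w b t r c else 0) := by
    congr 1
    funext c
    rw [tsum_eq_single (∑ i, c i)]
    · rw [if_pos rfl]
    · intro m hm; rw [if_neg hm.symm]
  have h5 : ∑' c, FA n w b t r c = ∑' m : ℤ, ∑' c : Fin (2 * (n + 1)) → ℤ, (if ∑ i, c i = m then FA n w b t r c else 0) := by
    rw [h4]
    exact h2.symm.trans (h3.trans h1)
  rw [h5]
  unfold th
  rw [← (ex_fs t r hr _).tml]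
  congr 1
  funext m
  have h6 := congrArg (sg w b hb) (A_slice n m)
  rw [sg_tsum w b hb (A_slice_FS _ m _), map_mul, sg_C, map_pow] at h6
  rw [show sg w b hb (EE 1) ^ ((2 * (n + 1)) ^ 2 - 1) * (C ((-1) ^ m) * X ^ ex t r m) = (C ((-1) ^ m) * sg w b hb (EE 1) ^ ((2 * (n + 1)) ^ 2 - 1)) * X ^ ex t r m by ring,
    ← h6, ← (sg_FS w b hb (A_slice_FS _ m _)).tmr]
  congr 1
  funext c
  split_ifs with h
  · unfold FA
    rw [h, map_mul, sg_C, map_pow, sg_X]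
  · simp


theorem K0_FS (n : ℕ) (w : (Fin n → ℤ) → PS) : FS (fun c => w c * X ^ K0 n c) := by
  refine FS.of_exp w (K0 n) fun B => (fin_bd n (B + 1)).subset ?_
  intro c hc i
  have hc' : K0 n c < B := hc
  have h := ex_ge (2 * n + 2) (n + 2 + i) (by omega) (c i)
  have h2 : ex (2 * n + 2) (n + 2 + i) (c i) ≤ K0 n c := Finset.single_le_sum (f := fun i : Fin n => ex (2 * n + 2) (n + 2 + i) (c i)) (fun _ _ => Nat.zero_le _) (Finset.mem_univ i)
  omega

theorem K1_FS (n : ℕ) (w : (Fin n → ℤ) → PS) : FS (fun c => w c * X ^ K1 n c) := by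
  refine FS.of_exp w (K1 n) fun B => (fin_bd n (B + 1)).subset ?_
  intro c hc i
  have hc' : K1 n c < B := hc
  have h := ex_ge (2 * (2 * n)) (2 * n + 1 + 2 * i) (by omega) (c i)
  have h2 : ex (2 * (2 * n)) (2 * n + 1 + 2 * i) (c i) ≤ K1 n c := Finset.single_le_sum (f := fun i : Fin n => ex (2 * (2 * n)) (2 * n + 1 + 2 * i) (c i)) (fun _ _ => Nat.zero_le _) (Finset.mem_univ i)
  omega

def FC (n : ℕ) (w : ℂ) (b : ℕ) (c : Fin n → ℤ) : PS := C (psi0 n c) * (C w * X ^ b) ^ K0 n c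
def FF (n : ℕ) (w : ℂ) (b : ℕ) (c : Fin n → ℤ) : PS := C (psiF n c) * (C w * X ^ b) ^ K1 n c

theorem FC_sg (n : ℕ) (w : ℂ) (b : ℕ) (hb : b ≠ 0) : FC n w b = fun c => sg w b hb (C (psi0 n c) * X ^ K0 n c) := by
  funext c
  rw [FC, map_mul, sg_C, map_pow, sg_X]

theorem FF_sg (n : ℕ) (w : ℂ) (b : ℕ) (hb : b ≠ 0) : FF n w b = fun c => sg w b hb (C (psiF n c) * X ^ K1 n c) := by
  funext c
  rw [FF, map_mul, sg_C, map_pow, sg_X]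

theorem FC_FS (n : ℕ) (w : ℂ) (b : ℕ) (hb : b ≠ 0) : FS (FC n w b) := by
  rw [FC_sg n w b hb]
  exact sg_FS w b hb (K0_FS n _)

theorem FF_FS (n : ℕ) (w : ℂ) (b : ℕ) (hb : b ≠ 0) : FS (FF n w b) := by
  rw [FF_sg n w b hb]
  exact sg_FS w b hb (K1_FS n _)

theorem FC_sum (n : ℕ) (w : ℂ) (b : ℕ) (hb : b ≠ 0) : ∑' c, FC n w b c = sg w b hb (EE 1) ^ (2 * n ^ 2 + n) := by
  rw [FC_sg n w b hb, ← sg_tsum w b hb (K0_FS n _), ← map_pow, ← C_final n]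
  rfl

theorem FF_sum (n : ℕ) (hn : 0 < n) (w : ℂ) (b : ℕ) (hb : b ≠ 0) : (∑' c, FF n w b c) * sg w b hb (EE 1) ^ (2 * n - 1) =
    sg w b hb (EE 2) ^ (2 * n ^ 2 + n - 1) := by
  rw [FF_sg n w b hb, ← sg_tsum w b hb (K1_FS n _), ← map_pow, ← map_mul, ← map_pow, ← F_final n hn]
  rfl

def TS (t : ℕ) (y z : ℂ) (S : Finset ℕ) : PS := C ((-1) ^ S.card * WW t y z S) * X ^ (∑ s ∈ S, s)

theorem TS_fac (u n : ℕ) (y : ℂ) (c : IX u n → ℤ) : TS (tt u) y ((2 * (n + 1) : ℕ) : ℂ) (Sf u n c) =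
    FC n (y ^ 2) (tt u) (c0 c) * (FF (n + 1) y (u + 1) (c1 c) * ∏ r : Fin u, FA n (y ^ 2) (tt u) (tt u) (r + 1) (cA c r)) := by
  have hP : (-1) ^ (Sf u n c).card * WW (tt u) y ((2 * (n + 1) : ℕ) : ℂ) (Sf u n c) =
      (psi0 n (c0 c) * psiF (n + 1) (c1 c) * ∏ r : Fin u, psiA (2 * (n + 1)) (cA c r)) * y ^ yE (tt u) (Sf u n c) := by
    rw [WW_y, ← Psi_fac, ← WW_Psi (RSf u n)]
    ring
  have hy : yE (tt u) (Sf u n c) = 2 * K0 n (c0 c) + K1 (n + 1) (c1 c) +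
      ∑ r : Fin u, 2 * (KA (2 * (n + 1)) (cA c r) - ex 1 0 (∑ j, cA c r j)) := by
    zify
    rw [yE_dec]
    congr 1
    refine Finset.sum_congr rfl fun r _ => ?_
    rw [Nat.cast_sub (ex10_le n _), ex10]
  have hx : ∑ s ∈ Sf u n c, s = tt u * K0 n (c0 c) + (u + 1) * K1 (n + 1) (c1 c) +
      ∑ r : Fin u, (tt u * (KA (2 * (n + 1)) (cA c r) - ex 1 0 (∑ j, cA c r j)) + ex (tt u) (r + 1) (∑ j, cA c r j)) := by
    zify
    have := sum_dec u n c
    push_cast at this ⊢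
    rw [this]
    congr 1
    refine Finset.sum_congr rfl fun r _ => ?_
    rw [Nat.cast_sub (ex10_le n _), ex10, ex_cast _ _ (by unfold tt; omega)]
    push_cast
    ring
  unfold TS FC FF FA
  rw [hP, hy, hx]
  simp only [mul_pow, pow_add, map_mul, map_pow, map_prod, Finset.prod_mul_distrib, ← Finset.prod_pow_eq_pow_sum, pow_mul]
  ring

def IXe (u n : ℕ) : (IX u n → ℤ) ≃ (Fin n → ℤ) × ((Fin (n + 1) → ℤ) × (Fin u → Fin (2 * (n + 1)) → ℤ)) :=
  (Equiv.sumArrowEquivProdArrow _ _ _).trans ((Equiv.refl _).prodCongr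
    ((Equiv.sumArrowEquivProdArrow _ _ _).trans ((Equiv.refl _).prodCongr (Equiv.curry _ _ _))))

theorem TS_sum (u n : ℕ) (y : ℂ) : ∑' S : Finset ℕ, TS (tt u) y ((2 * (n + 1) : ℕ) : ℂ) S =
    (∑' c, FC n (y ^ 2) (tt u) c) * ((∑' c, FF (n + 1) y (u + 1) c) * ∏ r : Fin u, ∑' c, FA n (y ^ 2) (tt u) (tt u) (r + 1) c) := by
  have hi := Sc_inj (RSf u n)
  rw [← hi.tsum_eq (f := fun S => TS (tt u) y ((2 * (n + 1) : ℕ) : ℂ) S)]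
  · simp only [TS_fac]
    have h0 := FC_FS n (y ^ 2) (tt u) (by unfold tt; omega)
    have h1 := FF_FS (n + 1) y (u + 1) (by omega)
    have h2 : ∀ r : Fin u, FS (FA n (y ^ 2) (tt u) (tt u) (r + 1)) := fun r => FA_FS n (y ^ 2) (tt u) (by unfold tt; omega) (tt u) (r + 1) (by unfold tt; omega)
    have h3 := FS.prod_tsum (a := fun (r : Fin u) c => FA n (y ^ 2) (tt u) (tt u) (r + 1) c) h2
    have h4 := FS.pi (a := fun (r : Fin u) c => FA n (y ^ 2) (tt u) (tt u) (r + 1) c) h2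
    rw [h3, h1.tsum_mul_tsum h4, h0.tsum_mul_tsum (h1.mul h4), ← (IXe u n).tsum_eq]
    rfl
  · intro S hS
    have h1 : WW (tt u) y ((2 * (n + 1) : ℕ) : ℂ) S ≠ 0 := by
      intro h
      apply hS
      simp only [TS, h]
      simp
    rw [WW_y] at h1
    obtain ⟨c, hc⟩ := WW_range (RSf u n) S (right_ne_zero_of_mul h1)
    exact ⟨c, hc.symm⟩


def PMr (N r : ℕ) : PS := ∏' k : ℕ, (1 - X ^ (N * k + r))

theorem np_pmr (N r : ℕ) (hN : 0 < N) (hr : 0 < r) : NP (fun k => (1 - X ^ (N * k + r) : PS)) := by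
  refine NP.one_sub fun k => pow_dvd_pow _ ?_
  nlinarith [Nat.le_mul_of_pos_left k hN]

theorem th_pmr (N i : ℕ) (hi : i < N) (h0 : 0 < i) : th N i 1 = EE N * PMr N i * PMr N (N - i) := by
  rw [jtp N i hi 1 (by norm_num)]
  have h1 : PMr N i = (1 - X ^ i) * ∏' k : ℕ, (1 - X ^ (N * (k + 1) + i)) := by
    unfold PMr
    have hnp := np_pmr N i (by omega) h0
    have hnp' : NP (fun k => (1 - X ^ (N * (k + 1) + i) : PS)) := by
      refine NP.one_sub fun k => pow_dvd_pow _ ?_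
      nlinarith [Nat.le_mul_of_pos_left k (show 0 < N by omega)]
    refine ps_ext_dvd fun n => ?_
    have h2 := hnp.dvd n (n + 1) (by omega)
    have h3 := hnp'.dvd n n (by omega)
    rw [Finset.prod_range_succ'] at h2
    have h4 := Dvd.dvd.mul_left h3 (1 - X ^ i : PS)
    have := dvd_sub h2 h4
    convert this using 1
    simp only [mul_zero, zero_add]
    ring
  have h2 : PMr N (N - i) = ∏' k : ℕ, (1 - X ^ (N * (k + 1) - i)) := by
    unfold PMr
    refine tprod_congr fun k => ?_
    congr 2
    rw [mul_add]; omega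
  rw [h1, h2]
  simp
  ring

theorem ee_pmr (t : ℕ) : EE t = PMr t t := by
  unfold EE PMr
  rfl

theorem th_prod (u : ℕ) : EE (u + 1) * ∏ r : Fin u, th (tt u) (r + 1) 1 = EE 1 * EE (tt u) ^ u := by
  have h1 : EE 1 = ∏ r ∈ Finset.range (tt u), PMr (tt u) (r + 1) := by
    unfold EE
    rw [tprod_split _ (np_qf 1 (by omega)) (tt u) (by unfold tt; omega)]
    refine Finset.prod_congr rfl fun r _ => ?_
    unfold PMr
    refine tprod_congr fun k => ?_
    congr 2
    ring
  have h2 : EE (u + 1) = PMr (tt u) (u + 1) * EE (tt u) := by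
    unfold EE
    rw [tprod_split _ (np_qf (u + 1) (by omega)) 2 (by omega), Finset.prod_range_succ, Finset.prod_range_one]
    congr 1
    · unfold PMr
      refine tprod_congr fun k => ?_
      congr 2
      unfold tt; ring
    · refine tprod_congr fun k => ?_
      congr 2
      unfold tt; ring
  have h3 : ∏ r ∈ Finset.range (tt u), PMr (tt u) (r + 1) =
     (∏ r ∈ Finset.range u, PMr (tt u) (r + 1)) * PMr (tt u) (u + 1) * (∏ r ∈ Finset.range u, PMr (tt u) (tt u - (r + 1))) * EE (tt u) := by
    have e : tt u = (u + 1) + u + 1 := by unfold tt; omega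
    have h4 : ∏ r ∈ Finset.range u, PMr (tt u) (tt u - (r + 1)) = ∏ r ∈ Finset.range u, PMr (tt u) (u + 1 + r + 1) := by
      rw [← Finset.prod_range_reflect]
      refine Finset.prod_congr rfl fun r hr => ?_
      rw [Finset.mem_range] at hr
      congr 1
      unfold tt; omega
    rw [h4, ee_pmr, show Finset.range (tt u) = Finset.range (u + 1 + u + 1) by rw [e],
      Finset.prod_range_succ, Finset.prod_range_add, Finset.prod_range_succ]
    rw [← e]
  rw [Fin.prod_univ_eq_prod_range (fun r => th (tt u) (r + 1) 1) u]
  rw [Finset.prod_congr rfl (fun r hr => th_pmr (tt u) (r + 1) (by rw [Finset.mem_range] at hr; unfold tt; omega) (by omega))]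
  rw [h1, h3, h2, Finset.prod_mul_distrib, Finset.prod_mul_distrib, Finset.prod_const, Finset.card_range]
  ring

/-- closed form -/
theorem TS_closed (u n : ℕ) (y : ℂ) :
    (∑' S : Finset ℕ, TS (tt u) y ((2 * (n + 1) : ℕ) : ℂ) S) * (EE (u + 1) * (∏' k : ℕ, (1 - C (y ^ (k + 1)) * X ^ ((k + 1) * (u + 1)))) ^ (2 * n + 1)) =
    EE 1 * EE (tt u) ^ u * (∏' k : ℕ, (1 - C (y ^ (2 * (k + 1))) * X ^ ((k + 1) * (tt u)))) ^ ((2 * (n + 1) * (u + 1) + u) * (2 * n + 1)) := by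
  have htt : tt u ≠ 0 := by unfold tt; omega
  rw [TS_sum, FC_sum n (y ^ 2) (tt u) htt]
  rw [Finset.prod_congr rfl (fun (r : Fin u) _ => FA_sum n (y ^ 2) (tt u) htt (tt u) (r + 1) (by have := r.2; unfold tt; omega)),
    Finset.prod_mul_distrib, Finset.prod_const, Finset.card_univ, Fintype.card_fin]
  have hF := FF_sum (n + 1) (by omega) y (u + 1) (by omega)
  have e1 : sg (y ^ 2) (tt u) htt (EE 1) = ∏' k : ℕ, (1 - C (y ^ (2 * (k + 1))) * X ^ ((k + 1) * (tt u))) := by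
    rw [sg_EE _ _ _ 1 (by omega)]
    refine tprod_congr fun k => ?_
    rw [one_mul, ← pow_mul, mul_comm (tt u)]
  have e2 : sg y (u + 1) (by omega) (EE 2) = ∏' k : ℕ, (1 - C (y ^ (2 * (k + 1))) * X ^ ((k + 1) * (tt u))) := by
    rw [sg_EE _ _ _ 2 (by omega)]
    refine tprod_congr fun k => ?_
    congr 3
    unfold tt; ring
  have e3 : sg y (u + 1) (by omega) (EE 1) = ∏' k : ℕ, (1 - C (y ^ (k + 1)) * X ^ ((k + 1) * (u + 1))) := by
    rw [sg_EE _ _ _ 1 (by omega)]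
    refine tprod_congr fun k => ?_
    rw [one_mul, mul_comm (u + 1)]
  rw [e2, e3] at hF
  rw [e1]
  set V := ∏' k : ℕ, (1 - C (y ^ (k + 1)) * X ^ ((k + 1) * (u + 1)) : PS)
  set Y := ∏' k : ℕ, (1 - C (y ^ (2 * (k + 1))) * X ^ ((k + 1) * (tt u)) : PS)
  set Fs := ∑' c, FF (n + 1) y (u + 1) c
  rw [show 2 * (n + 1) - 1 = 2 * n + 1 by omega] at hF
  calc _ = Y ^ (2 * n ^ 2 + n) * (Fs * V ^ (2 * n + 1)) * (Y ^ ((2 * (n + 1)) ^ 2 - 1)) ^ u * (EE (u + 1) * ∏ r : Fin u, th (tt u) (r + 1) 1) := by ring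
    _ = _ := by
      rw [hF, th_prod, ← pow_mul]
      have : (2 * (n + 1) * (u + 1) + u) * (2 * n + 1) = (2 * n ^ 2 + n) + (2 * (n + 1) ^ 2 + (n + 1) - 1) + ((2 * (n + 1)) ^ 2 - 1) * u := by
        rw [show 2 * (n + 1) ^ 2 + (n + 1) - 1 = 2 * (n + 1) ^ 2 + n by omega,
          show (2 * (n + 1)) ^ 2 - 1 = 4 * n ^ 2 + 8 * n + 3 by
            rw [show (2 * (n + 1)) ^ 2 = 4 * n ^ 2 + 8 * n + 3 + 1 by ring]; rfl]
        ring
      rw [this, pow_add, pow_add]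
      ring


theorem cpow_FS (f : PS) (hf : X ∣ f - 1) (z : ℂ) : FS (fun k : ℕ => C (cchoose z k) * (f - 1) ^ k) := by
  refine FS.of_le fun n => (Set.finite_lt_nat n).subset fun k hk => ?_
  by_contra h
  apply hk
  have h' : n ≤ k := by
    by_contra h2; exact h (show k < n by omega)
  exact Dvd.dvd.mul_left ((pow_dvd_pow X h').trans (pow_dvd_pow_of_dvd hf k)) _

theorem cpow_coeff (f : PS) (hf : X ∣ f - 1) (z : ℂ) (n : ℕ) :
    coeff n (cpow f z) = ∑ k ∈ Finset.range (n + 1), cchoose z k * coeff n ((f - 1) ^ k) := by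
  unfold cpow
  rw [(cpow_FS f hf z).coeff_tsum_finset n (Finset.range (n + 1))]
  · simp only [coeff_C_mul]
  · intro k hk
    rw [coeff_C_mul, X_pow_dvd_iff.1 (pow_dvd_pow_of_dvd hf k) n (by simpa using hk), mul_zero]

theorem cpow_dvd (f : PS) (m : ℕ) (hm : 0 < m) (hf : X ^ m ∣ f - 1) (z : ℂ) : X ^ m ∣ cpow f z - 1 := by
  rw [X_pow_dvd_iff]
  intro i hi
  have hf' : X ∣ f - 1 := (dvd_pow_self X (by omega)).trans hf
  rw [map_sub, cpow_coeff f hf', Finset.sum_range_succ', Finset.sum_eq_zero]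
  · simp [cchoose]
  · intro k _
    rw [X_pow_dvd_iff.1 (hf.trans (dvd_pow_self _ (by omega : k + 1 ≠ 0))) i hi, mul_zero]

theorem cchoose_nat (m k : ℕ) : cchoose (m : ℂ) k = (m.choose k : ℂ) := by
  have h : ∏ i ∈ Finset.range k, ((m : ℂ) - i) = (m.descFactorial k : ℂ) := by
    induction k with
    | zero => simp
    | succ k ih =>
      rw [Finset.prod_range_succ, ih, Nat.descFactorial_succ]
      by_cases hk : k ≤ m
      · push_cast [hk]; ring
      · rw [Nat.descFactorial_eq_zero_iff_lt.2 (by omega)]; simp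
  unfold cchoose
  rw [h, Nat.descFactorial_eq_factorial_mul_choose, Nat.cast_mul]
  field_simp [Nat.factorial_ne_zero]

theorem cpow_nat (f : PS) (m : ℕ) : cpow f (m : ℂ) = f ^ m := by
  unfold cpow
  rw [tsum_eq_sum (s := Finset.range (m + 1))]
  · conv_rhs => rw [show f = (f - 1) + 1 by ring, add_pow]
    refine Finset.sum_congr rfl fun k _ => ?_
    rw [cchoose_nat, map_natCast]
    ring
  · intro k hk
    rw [cchoose_nat, Nat.choose_eq_zero_of_lt (by simpa using hk)]
    simp

/-- polynomial dependence -/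
def PolyC (f : ℂ → ℂ) : Prop := ∃ p : Polynomial ℂ, ∀ z, f z = p.eval z

theorem PolyC.const (c : ℂ) : PolyC (fun _ => c) := ⟨Polynomial.C c, fun z => by simp⟩
theorem PolyC.id : PolyC (fun z => z) := ⟨Polynomial.X, fun z => by simp⟩
theorem PolyC.add {f g : ℂ → ℂ} (hf : PolyC f) (hg : PolyC g) : PolyC (fun z => f z + g z) := by
  obtain ⟨p, hp⟩ := hf
  obtain ⟨q, hq⟩ := hg
  exact ⟨p + q, fun z => by simp [hp, hq]⟩
theorem PolyC.sub {f g : ℂ → ℂ} (hf : PolyC f) (hg : PolyC g) : PolyC (fun z => f z - g z) := by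
  obtain ⟨p, hp⟩ := hf
  obtain ⟨q, hq⟩ := hg
  exact ⟨p - q, fun z => by simp [hp, hq]⟩
theorem PolyC.mul {f g : ℂ → ℂ} (hf : PolyC f) (hg : PolyC g) : PolyC (fun z => f z * g z) := by
  obtain ⟨p, hp⟩ := hf
  obtain ⟨q, hq⟩ := hg
  exact ⟨p * q, fun z => by simp [hp, hq]⟩
theorem PolyC.div {f : ℂ → ℂ} (hf : PolyC f) (c : ℂ) : PolyC (fun z => f z / c) := by
  simp only [div_eq_mul_inv]
  exact hf.mul (PolyC.const _)
theorem PolyC.sum {ι : Type*} (s : Finset ι) {f : ι → ℂ → ℂ} (hf : ∀ i ∈ s, PolyC (f i)) : PolyC (fun z => ∑ i ∈ s, f i z) := by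
  classical
  induction s using Finset.induction_on with
  | empty => simpa using PolyC.const 0
  | insert a s ha ih =>
    simp only [Finset.sum_insert ha]
    exact (hf a (by simp)).add (ih fun i hi => hf i (by simp [hi]))
theorem PolyC.prod {ι : Type*} (s : Finset ι) {f : ι → ℂ → ℂ} (hf : ∀ i ∈ s, PolyC (f i)) : PolyC (fun z => ∏ i ∈ s, f i z) := by
  classical
  induction s using Finset.induction_on with
  | empty => simpa using PolyC.const 1
  | insert a s ha ih =>
    simp only [Finset.prod_insert ha]
    exact (hf a (by simp)).mul (ih fun i hi => hf i (by simp [hi]))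

theorem PolyC.eq {f g : ℂ → ℂ} (hf : PolyC f) (hg : PolyC g) (h : ∀ n : ℕ, f ((2 * (n + 1) : ℕ) : ℂ) = g ((2 * (n + 1) : ℕ) : ℂ)) (z : ℂ) : f z = g z := by
  obtain ⟨p, hp⟩ := hf
  obtain ⟨q, hq⟩ := hg
  have : p = q := by
    refine Polynomial.eq_of_infinite_eval_eq p q ?_
    refine Set.infinite_of_injective_forall_mem (f := fun n : ℕ => ((2 * (n + 1) : ℕ) : ℂ)) ?_ ?_
    · intro a b hab
      have := Nat.cast_injective (R := ℂ) hab
      omega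
    · intro n
      show _ = _
      rw [← hp, ← hq, h]
  rw [hp, hq, this]

def PolyZ (f : ℂ → PS) : Prop := ∀ n, PolyC (fun z => coeff n (f z))

theorem PolyZ.const (c : PS) : PolyZ (fun _ => c) := fun n => PolyC.const _
theorem PolyZ.mul {f g : ℂ → PS} (hf : PolyZ f) (hg : PolyZ g) : PolyZ (fun z => f z * g z) := by
  intro n
  simp only [coeff_mul]
  exact PolyC.sum _ fun i _ => (hf _).mul (hg _)
theorem PolyZ.sub {f g : ℂ → PS} (hf : PolyZ f) (hg : PolyZ g) : PolyZ (fun z => f z - g z) := by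
  intro n
  simp only [map_sub]
  exact (hf n).sub (hg n)
theorem PolyZ.prod {ι : Type*} (s : Finset ι) {f : ι → ℂ → PS} (hf : ∀ i ∈ s, PolyZ (f i)) : PolyZ (fun z => ∏ i ∈ s, f i z) := by
  classical
  induction s using Finset.induction_on with
  | empty => simpa using PolyZ.const 1
  | insert a s ha ih =>
    simp only [Finset.prod_insert ha]
    exact (hf a (by simp)).mul (ih fun i hi => hf i (by simp [hi]))
theorem PolyZ.pow {f : ℂ → PS} (hf : PolyZ f) (n : ℕ) : PolyZ (fun z => f z ^ n) := by
  have := PolyZ.prod (Finset.range n) (f := fun _ => f) (fun _ _ => hf)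
  simpa using this

theorem PolyZ.cpow {f : ℂ → PS} (hf : PolyZ f) (hd : ∀ z, X ∣ f z - 1) {w : ℂ → ℂ} (hw : PolyC w) : PolyZ (fun z => cpow (f z) (w z)) := by
  intro n
  simp only [fun z => cpow_coeff (f z) (hd z) (w z) n]
  refine PolyC.sum _ fun k _ => PolyC.mul ?_ ?_
  · unfold cchoose
    exact PolyC.div (PolyC.prod _ fun i _ => hw.sub (PolyC.const _)) _
  · exact PolyZ.pow (hf.sub (PolyZ.const 1)) k n

theorem PolyZ.tprod {f : ℕ → ℂ → PS} (h : ∀ z, NP (fun k => f k z)) (hf : ∀ k, PolyZ (f k)) : PolyZ (fun z => ∏' k, f k z) := by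
  intro n
  have : ∀ z, coeff n (∏' k, f k z) = coeff n (∏ k ∈ Finset.range n, f k z) := by
    intro z
    have := (h z).dvd (n + 1) n (by omega)
    have := X_pow_dvd_iff.1 this n (by omega)
    rwa [map_sub, sub_eq_zero] at this
  simp only [this]
  exact PolyZ.prod _ (fun k _ => hf k) n


/-- The factor of the right-hand side. -/
def RHf (t' : ℕ) (y : ℂ) (k : ℕ) (z : ℂ) : PS :=
      ((1 - X ^ (k + 1)) * (1 - X ^ ((k + 1) * (2 * t'))) ^ (t' - 1) *
          (1 - X ^ ((k + 1) * t') : PowerSeries ℂ)⁻¹ *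
        cpow
          (cpow (1 - PowerSeries.C (y ^ (2 * (k + 1))) * X ^ ((k + 1) * (2 * t')))
              (z * (t' : ℂ) - 1 + (t' : ℂ)) *
            (1 - PowerSeries.C (y ^ (k + 1)) * X ^ ((k + 1) * t'))⁻¹)
          (z - 1))

theorem np_mm (a : ℕ → ℂ) (t : ℕ) (ht : 0 < t) : NP (fun k => (1 - C (a k) * X ^ ((k + 1) * t) : PS)) :=
  np_pow (fun k => Nat.le_mul_of_pos_right _ ht) _

theorem np_mm1 (t : ℕ) (ht : 0 < t) : NP (fun k => (1 - X ^ ((k + 1) * t) : PS)) := by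
  simpa using np_mm (fun _ => 1) t ht

theorem np_cpow {f : ℕ → PS} (hf : NP f) (z : ℂ) : NP (fun k => cpow (f k) z) :=
  fun k => cpow_dvd _ _ (by omega) (hf k) z

theorem np_in (t' : ℕ) (ht' : 0 < t') (y z : ℂ) : NP (fun k => cpow (1 - PowerSeries.C (y ^ (2 * (k + 1))) * X ^ ((k + 1) * (2 * t')))
              (z * (t' : ℂ) - 1 + (t' : ℂ)) *
            (1 - PowerSeries.C (y ^ (k + 1)) * X ^ ((k + 1) * t'))⁻¹) :=
  (np_cpow (np_mm (fun k => y ^ (2 * (k + 1))) (2 * t') (by omega)) _).mul (np_mm (fun k => y ^ (k + 1)) t' ht').inv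

theorem np_RHf (t' : ℕ) (ht' : 0 < t') (y z : ℂ) : NP (fun k => RHf t' y k z) := by
  have h1 : NP (fun k => (1 - X ^ (k + 1) : PS)) := by simpa using np_mm1 1 (by omega)
  exact ((h1.mul ((np_mm1 (2 * t') (by omega)).pow (t' - 1))).mul (np_mm1 t' ht').inv).mul (np_cpow (np_in t' ht' y z) _)

theorem NP.X_dvd {f : ℕ → PS} (hf : NP f) (k : ℕ) : X ∣ f k - 1 := (dvd_pow_self X (by omega)).trans (hf k)

theorem poly_RHf (t' : ℕ) (ht' : 0 < t') (y : ℂ) (k : ℕ) : PolyZ (RHf t' y k) := by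
  unfold RHf
  refine (PolyZ.const _).mul ?_
  refine PolyZ.cpow ?_ (fun z => (np_in t' ht' y z).X_dvd k) (PolyC.id.sub (PolyC.const 1))
  refine PolyZ.mul ?_ (PolyZ.const _)
  refine PolyZ.cpow (PolyZ.const _) (fun z => (np_mm (fun k => y ^ (2 * (k + 1))) (2 * t') (by omega)).X_dvd k) ?_
  exact ((PolyC.id.mul (PolyC.const _)).sub (PolyC.const _)).add (PolyC.const _)

theorem poly_RH (t' : ℕ) (ht' : 0 < t') (y : ℂ) : PolyZ (fun z => ∏' k, RHf t' y k z) :=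
  PolyZ.tprod (np_RHf t' ht' y) (poly_RHf t' ht' y)

theorem sum_finite (n : ℕ) (S : Finset ℕ) (h : ∑ s ∈ S, s = n) : S ∈ (Finset.range (n + 1)).powerset := by
  rw [Finset.mem_powerset]
  intro s hs
  have := Finset.single_le_sum (f := fun s : ℕ => s) (fun i _ => Nat.zero_le i) hs
  rw [Finset.mem_range]
  omega

theorem TS_coeff (t : ℕ) (y z : ℂ) (S : Finset ℕ) (n : ℕ) :
    coeff n (TS t y z S) = if ∑ s ∈ S, s = n then (-1) ^ S.card * WW t y z S else 0 := by
  unfold TS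
  rw [coeff_C_mul, coeff_X_pow]
  by_cases h : ∑ s ∈ S, s = n
  · simp [h]
  · rw [if_neg h, if_neg (fun h' => h h'.symm), mul_zero]

theorem TS_FS (t : ℕ) (y z : ℂ) : FS (TS t y z) := by
  intro n
  refine ((Finset.range (n + 1)).powerset.finite_toSet).subset fun S hS => ?_
  have hS' : coeff n (TS t y z S) ≠ 0 := hS
  rw [TS_coeff] at hS'
  by_cases h : ∑ s ∈ S, s = n
  · exact sum_finite n S h
  · exact absurd (if_neg h) hS'

theorem poly_WW (t : ℕ) (y : ℂ) (S : Finset ℕ) : PolyC (fun z => WW t y z S) := by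
  unfold WW
  refine PolyC.prod _ fun s _ => ?_
  unfold wt
  have lin : ∀ c d : ℂ, PolyC (fun z => y - c * z / d) := fun c d => (PolyC.const _).sub (((PolyC.const _).mul PolyC.id).div _)
  split_ifs
  all_goals first | exact PolyC.const _ | skip
  all_goals refine PolyC.mul (PolyC.mul ?_ ?_) (PolyC.prod _ fun m _ => ?_)
  all_goals first | exact PolyC.const _ | exact lin _ _ | skip
  all_goals
    unfold Dz
    split_ifs
    all_goals first | exact PolyC.const _ | exact PolyC.mul (lin _ _) ((PolyC.const _).add (((PolyC.const _).mul PolyC.id).div _))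

theorem poly_TS (t : ℕ) (y : ℂ) : PolyZ (fun z => ∑' S, TS t y z S) := by
  intro n
  have : ∀ z, coeff n (∑' S, TS t y z S) = ∑ S ∈ (Finset.range (n + 1)).powerset, coeff n (TS t y z S) := by
    intro z
    refine (TS_FS t y z).coeff_tsum_finset n _ fun S hS => ?_
    rw [TS_coeff, if_neg fun h => hS (sum_finite n S h)]
  simp only [this]
  refine PolyC.sum _ fun S _ => ?_
  simp only [TS_coeff]
  split_ifs
  · exact (PolyC.const _).mul (poly_WW t y S)
  · exact PolyC.const _

theorem TS_RH_even (u n : ℕ) (y : ℂ) : ∑' S : Finset ℕ, TS (tt u) y ((2 * (n + 1) : ℕ) : ℂ) S = ∏' k, RHf (u + 1) y k ((2 * (n + 1) : ℕ) : ℂ) := by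
  have hc := TS_closed u n y
  have nA := np_mm (fun k => y ^ (2 * (k + 1))) (tt u) (by unfold tt; omega)
  have nB := np_mm (fun k => y ^ (k + 1)) (u + 1) (by omega)
  have nE := np_mm1 (u + 1) (by omega)
  have nT := np_mm1 (tt u) (by unfold tt; omega)
  have n1 : NP (fun k => (1 - X ^ (k + 1) : PS)) := by simpa using np_mm1 1 (by omega)
  have hEE : ∀ t, EE t = ∏' k : ℕ, (1 - X ^ ((k + 1) * t)) := fun t => by
    unfold EE; refine tprod_congr fun k => ?_; rw [mul_comm]
  have hf : ∀ k, RHf (u + 1) y k ((2 * (n + 1) : ℕ) : ℂ) = (1 - X ^ (k + 1)) * (1 - X ^ ((k + 1) * tt u)) ^ u *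
     (1 - X ^ ((k + 1) * (u + 1)))⁻¹ * ((1 - C (y ^ (2 * (k + 1))) * X ^ ((k + 1) * tt u)) ^ ((2 * (n + 1) * (u + 1) + u) * (2 * n + 1)) * ((1 - C (y ^ (k + 1)) * X ^ ((k + 1) * (u + 1)))⁻¹) ^ (2 * n + 1)) := by
    intro k
    unfold RHf
    rw [show ((2 * (n + 1) : ℕ) : ℂ) * ((u + 1 : ℕ) : ℂ) - 1 + ((u + 1 : ℕ) : ℂ) = ((2 * (n + 1) * (u + 1) + u : ℕ) : ℂ) by push_cast; ring,
      show ((2 * (n + 1) : ℕ) : ℂ) - 1 = ((2 * n + 1 : ℕ) : ℂ) by push_cast; ring, cpow_nat, cpow_nat, mul_pow, ← pow_mul]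
    rfl
  rw [tprod_congr hf]
  have s1 := (n1.mul (nT.pow u)).mul nE.inv
  have s2 := (nA.pow ((2 * (n + 1) * (u + 1) + u) * (2 * n + 1))).mul (nB.inv.pow (2 * n + 1))
  rw [s1.tprod_mul s2, (n1.mul (nT.pow u)).tprod_mul nE.inv, n1.tprod_mul (nT.pow u), nT.tprod_pow,
    (nA.pow _).tprod_mul (nB.inv.pow _), nA.tprod_pow, nB.inv.tprod_pow]
  have i1 := nE.tprod_mul_inv
  have i2 := nB.tprod_mul_inv
  rw [hEE, hEE, hEE] at hc
  simp only [mul_one] at hc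
  set A := ∏' k : ℕ, (1 - C (y ^ (2 * (k + 1))) * X ^ ((k + 1) * tt u) : PS)
  set B := ∏' k : ℕ, (1 - C (y ^ (k + 1)) * X ^ ((k + 1) * (u + 1)) : PS)
  set B' := ∏' k : ℕ, (1 - C (y ^ (k + 1)) * X ^ ((k + 1) * (u + 1)) : PS)⁻¹
  set E := ∏' k : ℕ, (1 - X ^ ((k + 1) * (u + 1)) : PS)
  set E' := ∏' k : ℕ, (1 - X ^ ((k + 1) * (u + 1)) : PS)⁻¹
  set L := ∑' S : Finset ℕ, TS (tt u) y ((2 * (n + 1) : ℕ) : ℂ) S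
  calc L = L * ((E * B ^ (2 * n + 1))) * (E' * B' ^ (2 * n + 1)) := by
        rw [show L * ((E * B ^ (2 * n + 1))) * (E' * B' ^ (2 * n + 1)) = L * ((E * E') * (B * B') ^ (2 * n + 1)) by rw [mul_pow]; ring, i1, i2]
        simp
    _ = _ := by rw [hc]; ring

theorem TS_RH (t' : ℕ) (ht' : 0 < t') (y z : ℂ) : ∑' S : Finset ℕ, TS (2 * t') y z S = ∏' k, RHf t' y k z := by
  obtain ⟨u, rfl⟩ : ∃ u, t' = u + 1 := ⟨t' - 1, by omega⟩
  ext n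
  refine PolyC.eq (poly_TS (2 * (u + 1)) y n) (poly_RH (u + 1) ht' y n) (fun m => ?_) z
  exact congrArg (coeff n) (TS_RH_even u m y)


theorem ex_D (μ : YoungDiagram) : ∃ n, (n, n) ∉ μ :=
  ⟨μ.rowLen 0, fun h => by
    have h1 := YoungDiagram.mem_iff_lt_rowLen.1 h
    have h2 := μ.rowLen_anti 0 (μ.rowLen 0) (Nat.zero_le _)
    omega⟩

theorem diag_iff (μ : YoungDiagram) (k : ℕ) : (k, k) ∈ μ ↔ k < durfee μ := by
  classical
  have h0 : ∀ k, (k, k) ∈ μ ↔ k < Nat.find (ex_D μ) := by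
    intro k
    constructor
    · intro h
      by_contra h'
      exact Nat.find_spec (ex_D μ) (μ.up_left_mem (by omega) (by omega) h)
    · intro h
      have := Nat.find_min (ex_D μ) h
      simpa using this
  have h1 : durfee μ = Nat.find (ex_D μ) := by
    unfold durfee
    have : (μ.cells.filter fun c => c.1 = c.2) = (Finset.range (Nat.find (ex_D μ))).image (fun k => (k, k)) := by
      ext ⟨a, b⟩
      simp only [Finset.mem_filter, YoungDiagram.mem_cells, Finset.mem_image, Finset.mem_range, Prod.mk.injEq, ← h0]
      constructor
      · rintro ⟨h, rfl⟩
        exact ⟨a, h, rfl, rfl⟩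
      · rintro ⟨k, h, rfl, rfl⟩
        exact ⟨h, rfl⟩
    rw [this, Finset.card_image_of_injective _ (fun a b h => (Prod.mk.inj h).1), Finset.card_range]
  rw [h0, h1]

/-- Basic data of a doubled distinct diagram. -/
def sd (μ : YoungDiagram) (k : ℕ) : ℕ := μ.colLen k - k
def SD (μ : YoungDiagram) : Finset ℕ := (Finset.range (durfee μ)).image (sd μ)

section
variable {μ : YoungDiagram} (hμ : DDiagram μ)

theorem col_sd {k : ℕ} (hk : k < durfee μ) : μ.colLen k = sd μ k + k ∧ 0 < sd μ k := by
  have := YoungDiagram.mem_iff_lt_colLen.1 ((diag_iff μ k).2 hk)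
  unfold sd; omega

theorem row_sd (hμ : DDiagram μ) {k : ℕ} (hk : k < durfee μ) : μ.rowLen k = sd μ k + k + 1 := by
  rw [hμ k ((diag_iff μ k).2 hk), (col_sd hk).1]

theorem sd_anti {k l : ℕ} (hkl : k < l) (hl : l < durfee μ) : sd μ l < sd μ k := by
  have h1 := (col_sd hl).1
  have h2 := (col_sd (hkl.trans hl)).1
  have := μ.colLen_anti k l hkl.le
  omega

theorem sd_injOn : Set.InjOn (sd μ) (Finset.range (durfee μ)) := by
  intro a ha b hb hab
  simp only [Finset.coe_range, Set.mem_Iio] at ha hb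
  rcases lt_trichotomy a b with h | h | h
  · have := sd_anti h hb; omega
  · exact h
  · have := sd_anti h ha; omega

theorem SD_card : (SD μ).card = durfee μ := by
  unfold SD
  rw [Finset.card_image_of_injOn sd_injOn, Finset.card_range]

theorem sd_lb {k : ℕ} (hk : k < durfee μ) : durfee μ ≤ sd μ k + k := by
  have hD : durfee μ - 1 < durfee μ := by omega
  have h1 := col_sd hD
  have h2 := (col_sd hk).1
  have := μ.colLen_anti k (durfee μ - 1) (by omega)
  omega

theorem not_diag : (durfee μ, durfee μ) ∉ μ := fun h => by
  have := (diag_iff μ _).1 h; omega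

theorem row_le {i : ℕ} (hi : durfee μ ≤ i) : μ.rowLen i ≤ durfee μ := by
  by_contra h
  have : (i, durfee μ) ∈ μ := YoungDiagram.mem_iff_lt_rowLen.2 (by omega)
  exact not_diag (μ.up_left_mem hi le_rfl this)

theorem col_le {j : ℕ} (hj : durfee μ ≤ j) : μ.colLen j ≤ durfee μ := by
  by_contra h
  have : (durfee μ, j) ∈ μ := YoungDiagram.mem_iff_lt_colLen.2 (by omega)
  exact not_diag (μ.up_left_mem le_rfl hj this)

theorem row_col (hμ : DDiagram μ) {i : ℕ} (hi : durfee μ ≤ i) : μ.rowLen i = μ.colLen (i + 1) := by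
  have key : ∀ k < durfee μ, k < μ.rowLen i ↔ k < μ.colLen (i + 1) := by
    intro k hk
    rw [← YoungDiagram.mem_iff_lt_rowLen, ← YoungDiagram.mem_iff_lt_colLen, YoungDiagram.mem_iff_lt_colLen,
      YoungDiagram.mem_iff_lt_rowLen, row_sd hμ hk, (col_sd hk).1]
    omega
  have h1 := row_le hi
  have h2 := col_le (μ := μ) (j := i + 1) (by omega)
  rcases lt_trichotomy (μ.rowLen i) (μ.colLen (i + 1)) with h | h | h
  · have := (key (μ.rowLen i) (by omega)).2 h; omega
  · exact h
  · have := (key (μ.colLen (i + 1)) (by omega)).1 h; omega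

theorem col_D (hμ : DDiagram μ) : μ.colLen (durfee μ) = durfee μ := by
  refine le_antisymm (col_le le_rfl) ?_
  by_contra h
  have h1 : ¬ (μ.colLen (durfee μ), durfee μ) ∈ μ := by
    rw [YoungDiagram.mem_iff_lt_colLen]; omega
  apply h1
  rw [YoungDiagram.mem_iff_lt_rowLen, row_sd hμ (by omega)]
  have := sd_lb (μ := μ) (k := μ.colLen (durfee μ)) (by omega)
  omega

theorem mem_dd (hμ : DDiagram μ) (i j : ℕ) : (i, j) ∈ μ ↔ (i ≤ j ∧ i < durfee μ ∧ j ≤ sd μ i + i) ∨ (j < i ∧ j < durfee μ ∧ i < sd μ j + j) := by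
  constructor
  · intro h
    rcases le_or_gt i j with h' | h'
    · have hi : i < durfee μ := (diag_iff μ i).1 (μ.up_left_mem le_rfl h' h)
      have := YoungDiagram.mem_iff_lt_rowLen.1 h
      rw [row_sd hμ hi] at this
      left; omega
    · have hi : j < durfee μ := (diag_iff μ j).1 (μ.up_left_mem h'.le le_rfl h)
      have := YoungDiagram.mem_iff_lt_colLen.1 h
      rw [(col_sd hi).1] at this
      right; omega
  · rintro (⟨h, hi, hj⟩ | ⟨h, hi, hj⟩)
    · rw [YoungDiagram.mem_iff_lt_rowLen, row_sd hμ hi]; omega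
    · rw [YoungDiagram.mem_iff_lt_colLen, (col_sd hi).1]; omega

/-- splitting a product over the cells -/
theorem cells_prod {M : Type*} [CommMonoid M] (hμ : DDiagram μ) (f : ℕ × ℕ → M) : ∏ c ∈ μ.cells, f c =
    ∏ k ∈ Finset.range (durfee μ), ((∏ j ∈ Finset.Ico k (sd μ k + k + 1), f (k, j)) * ∏ i ∈ Finset.Ioo k (sd μ k + k), f (i, k)) := by
  rw [← Finset.prod_filter_mul_prod_filter_not μ.cells (fun c => c.1 ≤ c.2), Finset.prod_mul_distrib]
  congr 1
  · refine Finset.prod_finset_product _ _ _ ?_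
    rintro ⟨i, j⟩
    simp only [Finset.mem_filter, YoungDiagram.mem_cells, mem_dd hμ, Finset.mem_range, Finset.mem_Ico]
    omega
  · refine Finset.prod_finset_product_right _ _ _ ?_
    rintro ⟨i, j⟩
    simp only [Finset.mem_filter, YoungDiagram.mem_cells, mem_dd hμ, Finset.mem_range, Finset.mem_Ioo]
    omega

theorem card_dd (hμ : DDiagram μ) : μ.card = 2 * ∑ s ∈ SD μ, s := by
  have h := cells_prod (M := Multiplicative ℕ) hμ (fun _ => Multiplicative.ofAdd 1)
  have h' : ∑ c ∈ μ.cells, 1 = ∑ k ∈ Finset.range (durfee μ), ((∑ j ∈ Finset.Ico k (sd μ k + k + 1), 1) + ∑ i ∈ Finset.Ioo k (sd μ k + k), 1) := h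
  unfold SD
  rw [Finset.sum_image sd_injOn, Finset.mul_sum]
  rw [Finset.sum_const, smul_eq_mul, mul_one] at h'
  refine h'.trans (Finset.sum_congr rfl fun k hk => ?_)
  have := (col_sd (Finset.mem_range.1 hk)).2
  simp
  omega

end


section
variable {μ : YoungDiagram}

def mi (μ : YoungDiagram) (i : ℕ) : ℕ := if i < durfee μ then sd μ i else i + 1 - μ.rowLen i
def si (μ : YoungDiagram) (i : ℕ) : ℕ := if i < durfee μ then i else i + 1

theorem mi_notin {i : ℕ} (hi : durfee μ ≤ i) : mi μ i ∉ SD μ := by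
  intro h
  unfold SD at h
  obtain ⟨k, hk, h⟩ := Finset.mem_image.1 h
  rw [Finset.mem_range] at hk
  unfold mi at h
  rw [if_neg (by omega)] at h
  have hr := row_le hi
  have hc := (col_sd hk).1
  have hm : k < μ.rowLen i ↔ i < μ.colLen k := by
    rw [← YoungDiagram.mem_iff_lt_rowLen, ← YoungDiagram.mem_iff_lt_colLen]
  omega

theorem mi_in {i : ℕ} (hi : i < durfee μ) : mi μ i ∈ SD μ := by
  unfold mi SD
  rw [if_pos hi]
  exact Finset.mem_image_of_mem _ (Finset.mem_range.2 hi)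

theorem mi_inj : Function.Injective (mi μ) := by
  have key : ∀ i j, i < j → mi μ i ≠ mi μ j := by
    intro i j hij h
    rcases lt_or_ge j (durfee μ) with hj | hj
    · unfold mi at h
      rw [if_pos hj, if_pos (hij.trans hj)] at h
      have := sd_anti hij hj
      omega
    · rcases lt_or_ge i (durfee μ) with hi | hi
      · have h1 := mi_in hi
        rw [h] at h1
        exact mi_notin hj h1
      · unfold mi at h
        rw [if_neg (by omega), if_neg (by omega)] at h
        have := μ.rowLen_anti i j hij.le
        have := row_le hi
        omega
  intro i j h
  rcases lt_trichotomy i j with h' | h' | h'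
  · exact absurd h (key i j h')
  · exact h'
  · exact absurd h.symm (key j i h')

theorem mi_image {k : ℕ} (hk : k < durfee μ) : (Finset.Ioo k (sd μ k + k)).image (mi μ) = Finset.Ioo 0 (sd μ k) := by
  refine Finset.eq_of_subset_of_card_le ?_ ?_
  · intro m hm
    obtain ⟨i, hi, rfl⟩ := Finset.mem_image.1 hm
    rw [Finset.mem_Ioo] at hi ⊢
    unfold mi
    split_ifs with h
    · exact ⟨(col_sd h).2, sd_anti hi.1 h⟩
    · have hr := row_le (μ := μ) (i := i) (by omega)
      have hc := (col_sd hk).1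
      have hm : k < μ.rowLen i ↔ i < μ.colLen k := by
        rw [← YoungDiagram.mem_iff_lt_rowLen, ← YoungDiagram.mem_iff_lt_colLen]
      omega
  · rw [Finset.card_image_of_injective _ mi_inj]
    simp

theorem hook_low (hμ : DDiagram μ) {k : ℕ} (hk : k < durfee μ) {i : ℕ} (hi : i ∈ Finset.Ioo k (sd μ k + k)) :
    hookLen μ (i, k) = if mi μ i ∈ SD μ then sd μ k + mi μ i else sd μ k - mi μ i := by
  rw [Finset.mem_Ioo] at hi
  have hc := (col_sd hk).1
  by_cases h : i < durfee μ
  · rw [if_pos (mi_in h)]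
    unfold hookLen mi
    rw [if_pos h]
    have := row_sd hμ h
    simp only
    omega
  · rw [if_neg (mi_notin (by omega))]
    unfold hookLen mi
    rw [if_neg h]
    have hr := row_le (μ := μ) (i := i) (by omega)
    simp only
    omega

theorem hook_up (hμ : DDiagram μ) {k : ℕ} (hk : k < durfee μ) {i : ℕ} (hi : i ∈ Finset.Ioo k (sd μ k + k)) :
    hookLen μ (k, si μ i) = hookLen μ (i, k) := by
  rw [Finset.mem_Ioo] at hi
  have hc := (col_sd hk).1
  have hr := row_sd hμ hk
  by_cases h : i < durfee μ
  · unfold hookLen si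
    rw [if_pos h]
    have := row_sd hμ h
    have := (col_sd h).1
    simp only
    omega
  · unfold hookLen si
    rw [if_neg h]
    have := row_col hμ (i := i) (by omega)
    simp only
    omega

theorem hook_D (hμ : DDiagram μ) {k : ℕ} (hk : k < durfee μ) : hookLen μ (k, durfee μ) = sd μ k := by
  have hr := row_sd hμ hk
  have := col_D hμ
  unfold hookLen
  simp only
  omega

theorem hook_diag (hμ : DDiagram μ) {k : ℕ} (hk : k < durfee μ) : hookLen μ (k, k) = 2 * sd μ k := by
  have hr := row_sd hμ hk
  have := (col_sd hk).1
  unfold hookLen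
  simp only
  omega

theorem si_inj : Function.Injective (si μ) := by
  intro i j h
  unfold si at h
  split_ifs at h <;> omega

theorem up_prod {M : Type*} [CommMonoid M] {k : ℕ} (hk : k < durfee μ) (f : ℕ → M) : ∏ j ∈ Finset.Ico k (sd μ k + k + 1), f j =
    f k * (f (durfee μ) * ∏ i ∈ Finset.Ioo k (sd μ k + k), f (si μ i)) := by
  have hD := sd_lb hk
  have : Finset.Ico k (sd μ k + k + 1) = insert k (insert (durfee μ) ((Finset.Ioo k (sd μ k + k)).image (si μ))) := by
    ext j
    simp only [Finset.mem_Ico, Finset.mem_insert, Finset.mem_image, Finset.mem_Ioo]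
    constructor
    · rintro ⟨h1, h2⟩
      rcases lt_trichotomy j (durfee μ) with h | h | h
      · by_cases hj : j = k
        · exact Or.inl hj
        · exact Or.inr (Or.inr ⟨j, by omega, by unfold si; rw [if_pos h]⟩)
      · exact Or.inr (Or.inl h)
      · exact Or.inr (Or.inr ⟨j - 1, by omega, by unfold si; rw [if_neg (by omega)]; omega⟩)
    · rintro (h | h | ⟨i, hi, h⟩)
      · omega
      · omega
      · unfold si at h
        split_ifs at h <;> omega
  rw [this, Finset.prod_insert, Finset.prod_insert, Finset.prod_image (fun a _ b _ h => si_inj h)]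
  · intro h
    obtain ⟨i, hi, h⟩ := Finset.mem_image.1 h
    unfold si at h
    split_ifs at h <;> omega
  · intro h
    rcases Finset.mem_insert.1 h with h | h
    · omega
    · obtain ⟨i, hi, h⟩ := Finset.mem_image.1 h
      rw [Finset.mem_Ioo] at hi
      unfold si at h
      split_ifs at h <;> omega

theorem hook_prod (hμ : DDiagram μ) (t : ℕ) (y z : ℂ) :
    ∏ c ∈ μ.cells.filter (fun c => t ∣ hookLen μ c), (y - y * (t : ℂ) * z / ((hookLen μ c : ℂ) * eps c)) = WW t y z (SD μ) := by
  rw [Finset.prod_filter, cells_prod hμ]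
  unfold WW
  rw [show (∏ s ∈ SD μ, wt t y z s (SD μ)) = ∏ k ∈ Finset.range (durfee μ), wt t y z (sd μ k) (SD μ) from
    Finset.prod_image sd_injOn]
  refine Finset.prod_congr rfl fun k hk => ?_
  rw [Finset.mem_range] at hk
  rw [up_prod hk]
  have h0 := (col_sd hk).2
  unfold wt
  rw [if_neg h0.ne', ← mi_image hk, Finset.prod_image (fun a _ b _ h => mi_inj h)]
  have e1 : eps (k, k) = 1 := by simp [eps]
  have e2 : eps (k, durfee μ) = 1 := by simp [eps]; omega
  rw [hook_diag hμ hk, hook_D hμ hk, e1, e2, mul_one, mul_one]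
  have e3 : (∏ i ∈ Finset.Ioo k (sd μ k + k), if t ∣ hookLen μ (k, si μ i) then y - y * (t : ℂ) * z / ((hookLen μ (k, si μ i) : ℂ) * eps (k, si μ i)) else 1) *
      (∏ i ∈ Finset.Ioo k (sd μ k + k), if t ∣ hookLen μ (i, k) then y - y * (t : ℂ) * z / ((hookLen μ (i, k) : ℂ) * eps (i, k)) else 1) =
      ∏ i ∈ Finset.Ioo k (sd μ k + k), Dz t y z (if mi μ i ∈ SD μ then sd μ k + mi μ i else sd μ k - mi μ i) := by
    rw [← Finset.prod_mul_distrib]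
    refine Finset.prod_congr rfl fun i hi => ?_
    rw [hook_up hμ hk hi, ← hook_low hμ hk hi]
    rw [Finset.mem_Ioo] at hi
    have e4 : eps (i, k) = -1 := by unfold eps; rw [if_pos hi.1]
    have e5 : eps (k, si μ i) = 1 := by
      unfold eps si; rw [if_neg]; simp only; split_ifs <;> omega
    rw [e4, e5]
    unfold Dz
    split_ifs
    · rw [mul_one, mul_neg, mul_one, div_neg, sub_neg_eq_add]
    · rw [mul_one]
  rw [← e3]
  ring

theorem term_eq (hμ : DDiagram μ) (t : ℕ) (y z : ℂ) :
    PowerSeries.C ((-1) ^ durfee μ *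
        ∏ c ∈ μ.cells.filter (fun c => t ∣ hookLen μ c),
          (y - y * (t : ℂ) * z / ((hookLen μ c : ℂ) * eps c))) * X ^ (μ.card / 2) = TS t y z (SD μ) := by
  rw [hook_prod hμ, card_dd hμ, Nat.mul_div_cancel_left _ (by norm_num)]
  unfold TS
  rw [SD_card]

def en (S : Finset ℕ) (k : ℕ) : ℕ := if h : k < S.card then S.orderEmbOfFin rfl ⟨S.card - 1 - k, by omega⟩ else 0

theorem sd_en {k : ℕ} (hk : k < durfee μ) : sd μ k = en (SD μ) k := by
  have hc := SD_card (μ := μ)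
  have h := Finset.orderEmbOfFin_unique (s := SD μ) rfl (f := fun i => sd μ ((SD μ).card - 1 - i)) (by
      intro x
      exact Finset.mem_image_of_mem _ (Finset.mem_range.2 (by have := x.2; omega)))
    (by
      intro a b hab
      have h1 : (a : ℕ) < b := hab
      have := a.2
      have := b.2
      exact sd_anti (by omega) (by omega))
  unfold en
  rw [dif_pos (by omega), ← h]
  simp only
  congr 1
  omega

end

theorem SD_inj : Function.Injective (fun μ : {μ : YoungDiagram // DDiagram μ} => SD μ.1) := by
  rintro ⟨μ, hμ⟩ ⟨ν, hν⟩ h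
  have h : SD μ = SD ν := h
  have hd : durfee μ = durfee ν := by rw [← SD_card, ← SD_card, h]
  have hs : ∀ k < durfee μ, sd μ k = sd ν k := by
    intro k hk
    rw [sd_en hk, sd_en (by omega), h]
  refine Subtype.ext (YoungDiagram.ext ?_)
  ext ⟨i, j⟩
  rw [YoungDiagram.mem_cells, YoungDiagram.mem_cells, mem_dd hμ, mem_dd hν, ← hd]
  have h1 := hs i
  have h2 := hs j
  constructor
  · rintro (⟨a, b, c⟩ | ⟨a, b, c⟩)
    · have := h1 b; left; omega
    · have := h2 b; right; omega
  · rintro (⟨a, b, c⟩ | ⟨a, b, c⟩)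
    · have := h1 b; left; omega
    · have := h2 b; right; omega

theorem SD_surj (S : Finset ℕ) (h0 : 0 ∉ S) : ∃ μ, DDiagram μ ∧ SD μ = S := by
  classical
  set D := S.card with hD
  have hin : ∀ k < D, en S k ∈ S := by
    intro k hk
    unfold en; rw [dif_pos hk]; exact Finset.orderEmbOfFin_mem _ _ _
  have hpos : ∀ k < D, 0 < en S k := by
    intro k hk
    have := hin k hk
    rcases Nat.eq_zero_or_pos (en S k) with h | h
    · rw [h] at this; exact absurd this h0
    · exact h
  have hanti : ∀ k l, k < l → l < D → en S l < en S k := by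
    intro k l hkl hl
    unfold en
    rw [dif_pos hl, dif_pos (hkl.trans hl)]
    refine (S.orderEmbOfFin rfl).strictMono ?_
    exact Fin.mk_lt_mk.2 (by omega)
  have hA : ∀ k l, k ≤ l → l < D → en S l + l ≤ en S k + k := by
    intro k l hkl
    induction l, hkl using Nat.le_induction with
    | base => intro _; exact le_rfl
    | succ l hl ih =>
      intro h
      have := ih (by omega)
      have := hanti l (l + 1) (by omega) h
      omega
  have hB : ∀ k < D, D ≤ en S k + k := by
    intro k hk
    have := hA k (D - 1) (by omega) (by omega)
    have := hpos (D - 1) (by omega)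
    omega
  have himg : (Finset.range D).image (en S) = S := by
    refine Finset.eq_of_subset_of_card_le ?_ ?_
    · intro m hm
      obtain ⟨k, hk, rfl⟩ := Finset.mem_image.1 hm
      exact hin k (Finset.mem_range.1 hk)
    · rw [Finset.card_image_of_injOn, Finset.card_range]
      intro a ha b hb hab
      simp only [Finset.coe_range, Set.mem_Iio] at ha hb
      rcases lt_trichotomy a b with h | h | h
      · have := hanti a b h hb; omega
      · exact h
      · have := hanti b a h ha; omega
  let P : ℕ × ℕ → Prop := fun c => (c.1 ≤ c.2 ∧ c.1 < D ∧ c.2 ≤ en S c.1 + c.1) ∨ (c.2 < c.1 ∧ c.2 < D ∧ c.1 < en S c.2 + c.2)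
  set B := en S 0 + D + 1 with hBdef
  have hbd : ∀ k < D, en S k + k < B := by
    intro k hk
    have := hA 0 k (by omega) hk
    omega
  have hP : ∀ c, P c → c ∈ Finset.range B ×ˢ Finset.range B := by
    rintro ⟨i, j⟩ hc
    rw [Finset.mem_product, Finset.mem_range, Finset.mem_range]
    rcases hc with ⟨a, b, c⟩ | ⟨a, b, c⟩
    · have := hbd i b
      simp only at *
      omega
    · have := hbd j b
      simp only at *
      omega
  let μ : YoungDiagram := 
    { cells := (Finset.range B ×ˢ Finset.range B).filter P
      isLowerSet := by
        rintro ⟨i, j⟩ ⟨i', j'⟩ ⟨h1, h2⟩ h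
        have h := (Finset.mem_filter.1 h).2
        refine Finset.mem_coe.2 (Finset.mem_filter.2 ⟨hP _ ?_, ?_⟩) <;>
        · simp only [P] at h h1 h2 ⊢
          have a1 := hB i'
          have a2 := hB j'
          have a3 := hA i' i h1
          have a4 := hA j' j h2
          omega }
  have hmem : ∀ i j, (i, j) ∈ μ ↔ P (i, j) := by
    intro i j
    rw [← YoungDiagram.mem_cells]
    exact ⟨fun h => (Finset.mem_filter.1 h).2, fun h => Finset.mem_filter.2 ⟨hP _ h, h⟩⟩
  have hrow : ∀ i < D, μ.rowLen i = en S i + i + 1 := by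
    intro i hi
    have key : ∀ j, j < μ.rowLen i ↔ j < en S i + i + 1 := by
      intro j
      rw [← YoungDiagram.mem_iff_lt_rowLen, hmem]
      simp only [P]
      have := hB j
      omega
    have k1 := key (μ.rowLen i)
    have k2 := key (en S i + i + 1)
    omega
  have hcol : ∀ j < D, μ.colLen j = en S j + j := by
    intro j hj
    have key : ∀ i, i < μ.colLen j ↔ i < en S j + j := by
      intro i
      rw [← YoungDiagram.mem_iff_lt_colLen, hmem]
      simp only [P]
      have := hB i
      have := hpos j hj
      omega
    have k1 := key (μ.colLen j)
    have k2 := key (en S j + j)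
    omega
  have hdiag : ∀ k, (k, k) ∈ μ ↔ k < D := by
    intro k
    rw [hmem]
    simp only [P]
    omega
  have hdur : durfee μ = D := by
    have k1 := hdiag (durfee μ)
    have k2 := hdiag D
    rw [diag_iff] at k1 k2
    omega
  refine ⟨μ, ?_, ?_⟩
  · intro i hi
    have hi := (hdiag i).1 hi
    rw [hrow i hi, hcol i hi]
  · unfold SD
    rw [hdur]
    refine Eq.trans (Finset.image_congr ?_) himg
    intro k hk
    simp only [Finset.coe_range, Set.mem_Iio] at hk
    unfold sd
    rw [hcol k hk]
    omega

theorem LHS_TS (t : ℕ) (y z : ℂ) : ∑' μ : {μ : YoungDiagram // DDiagram μ},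
      PowerSeries.C ((-1) ^ durfee μ.1 *
        ∏ c ∈ μ.1.cells.filter (fun c => t ∣ hookLen μ.1 c),
          (y - y * (t : ℂ) * z / ((hookLen μ.1 c : ℂ) * eps c))) * X ^ (μ.1.card / 2) = ∑' S, TS t y z S := by
  rw [← SD_inj.tsum_eq (f := fun S => TS t y z S)]
  · exact tsum_congr fun μ => term_eq μ.2 t y z
  · intro S hS
    have h0 : 0 ∉ S := by
      intro h
      apply hS
      simp only [TS]
      have : WW t y z S = 0 := Finset.prod_eq_zero h (by simp [wt])
      rw [this]
      simp
    obtain ⟨μ, h1, h2⟩ := SD_surj S h0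
    exact ⟨⟨μ, h1⟩, h2⟩

theorem generalisation_DD_t_even (t' : ℕ) (ht' : 0 < t') (y z : ℂ) :
    ∑' μ : {μ : YoungDiagram // DDiagram μ},
      PowerSeries.C ((-1) ^ durfee μ.1 *
        ∏ c ∈ μ.1.cells.filter (fun c => (2 * t') ∣ hookLen μ.1 c),
          (y - y * (2 * t' : ℕ) * z / ((hookLen μ.1 c : ℂ) * eps c))) * X ^ (μ.1.card / 2)
      =
    ∏' k : ℕ,
      ((1 - X ^ (k + 1)) * (1 - X ^ ((k + 1) * (2 * t'))) ^ (t' - 1) *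
          (1 - X ^ ((k + 1) * t') : PowerSeries ℂ)⁻¹ *
        cpow
          (cpow (1 - PowerSeries.C (y ^ (2 * (k + 1))) * X ^ ((k + 1) * (2 * t')))
              (z * (t' : ℂ) - 1 + (t' : ℂ)) *
            (1 - PowerSeries.C (y ^ (k + 1)) * X ^ ((k + 1) * t'))⁻¹)
          (z - 1)) := by
  rw [LHS_TS, TS_RH t' ht']
  rfl
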